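/- For every integer q ≥ 2 and every β > 0: d_cond(q,β) = inf{ d > 0 : limsup_{n→∞} E⟨ ‖ρ_{σ_1,σ_2} − ρ̄‖_TV ⟩_{𝔾(n,d/n),q,β} > 0 }. That is, the condensation threshold of the Potts antiferromagnet coincides exactly with the threshold for overlap concentration: below d_cond(q,β) the expected total variation distance of the overlap of two independent Gibbs samples from the uniform distribution tends to 0, while beyond but arbitrarily close to d_cond(q,β) it is bounded away from 0 along a subsequence. -/

import Mathlib

open MeasureTheory Finset

/-- `Λ(x) = x ln x`. -/
noncomputable def LamFn (x : ℝ) : ℝ := x * Real.log x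

/-- Membership in `P²_*(Ω)`: a (probability) measure on `ℝ^Ω` concentrated on the simplex
`P(Ω)` whose barycenter is the uniform distribution. -/
def memP2star (q : ℕ) (π : ProbabilityMeasure (Fin q → ℝ)) : Prop :=
  (∀ᵐ μ ∂(π : Measure (Fin q → ℝ)), μ ∈ stdSimplex ℝ (Fin q)) ∧
    ∀ s : Fin q, (∫ μ, μ s ∂(π : Measure (Fin q → ℝ))) = (q : ℝ)⁻¹

/-- The Bethe functional `B_Potts(q,β,d,π)`: with `γ ~ Poisson(d)` and `ρ_1, ρ_2, …`
i.i.d. samples from `π`, independent of `γ`, this is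
`E[Λ(Σ_σ Π_{i≤γ}(1-(1-e^{-β})ρ_i(σ)))/(q(1-(1-e^{-β})/q)^γ)
  - (d/2)·Λ(1-(1-e^{-β})Σ_τ ρ_1(τ)ρ_2(τ))/(1-(1-e^{-β})/q)]`. -/
noncomputable def BPotts (q : ℕ) (β d : ℝ) (π : ProbabilityMeasure (Fin q → ℝ)) : ℝ :=
  (∑' γ : ℕ, (Real.exp (-d) * d ^ γ / γ.factorial) *
      ∫ ρ : Fin γ → Fin q → ℝ,
        LamFn (∑ σ : Fin q, ∏ i, (1 - (1 - Real.exp (-β)) * ρ i σ)) /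
          ((q : ℝ) * (1 - (1 - Real.exp (-β)) / q) ^ γ)
        ∂(Measure.pi fun _ : Fin γ => (π : Measure (Fin q → ℝ)))) -
    d / 2 *
      ∫ ρ : Fin 2 → Fin q → ℝ,
        LamFn (1 - (1 - Real.exp (-β)) * ∑ τ : Fin q, ρ 0 τ * ρ 1 τ) /
          (1 - (1 - Real.exp (-β)) / q)
        ∂(Measure.pi fun _ : Fin 2 => (π : Measure (Fin q → ℝ)))

/-- The condensation threshold
`d_cond(q,β) = inf{d > 0 : sup_{π ∈ P²_*(Ω)} B_Potts(q,β,d,π) > ln q + (d/2)ln(1-(1-e^{-β})/q)}`. -/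
noncomputable def dcond (q : ℕ) (β : ℝ) : ℝ :=
  sInf {d : ℝ | 0 < d ∧ ∃ π : ProbabilityMeasure (Fin q → ℝ), memP2star q π ∧
    BPotts q β d π >
      Real.log q + d / 2 * Real.log (1 - (1 - Real.exp (-β)) / q)}

/-- The index set of potential edges of a graph on `{x_1,…,x_n}`: unordered pairs,
represented by ordered pairs `(v,w)` with `v < w`. -/
abbrev EdgeIdx (n : ℕ) := {e : Fin n × Fin n // e.1 < e.2}

/-- A graph on `{x_1,…,x_n}`, given by the indicator of its edge set. -/
abbrev GraphCfg (n : ℕ) := EdgeIdx n → Bool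

/-- The probability of the graph `g` under the Erdős–Rényi model `𝔾(n, pr)`: each edge is
present independently with probability `pr`. -/
noncomputable def erProb (n : ℕ) (pr : ℝ) (g : GraphCfg n) : ℝ :=
  ∏ e : EdgeIdx n, if g e then pr else 1 - pr

/-- The Potts Boltzmann weight `Π_{{v,w}∈E(g)} exp(-β·1{σ(v)=σ(w)})` of a coloring. -/
noncomputable def pottsWeight (q n : ℕ) (β : ℝ) (g : GraphCfg n) (σ : Fin n → Fin q) : ℝ :=
  ∏ e : EdgeIdx n,
    if g e then Real.exp (-(β * if σ e.1.1 = σ e.1.2 then 1 else 0)) else 1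

/-- The Potts partition function `Z_{q,β}(g)`. -/
noncomputable def pottsZ (q n : ℕ) (β : ℝ) (g : GraphCfg n) : ℝ :=
  ∑ σ : Fin n → Fin q, pottsWeight q n β g σ

/-- The total variation distance `‖ρ_{σ,τ} - ρ̄‖_TV` between the overlap of two colorings
and the uniform distribution on `Ω × Ω`. -/
noncomputable def overlapTV (q n : ℕ) (σ τ : Fin n → Fin q) : ℝ :=
  (1 / 2 : ℝ) * ∑ s : Fin q, ∑ t : Fin q,
    |((Finset.univ.filter fun v => σ v = s ∧ τ v = t).card : ℝ) / n - ((q : ℝ) ^ 2)⁻¹|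

/-- `E⟨‖ρ_{σ_1,σ_2} - ρ̄‖_TV⟩_{𝔾(n,d/n),q,β}`: the annealed average over the Erdős–Rényi
graph `𝔾(n,d/n)` of the Gibbs average of the overlap distance of two independent samples. -/
noncomputable def expOverlap (q : ℕ) (β d : ℝ) (n : ℕ) : ℝ :=
  ∑ g : GraphCfg n, erProb n (d / n) g *
    ∑ σ₁ : Fin n → Fin q, ∑ σ₂ : Fin n → Fin q,
      pottsWeight q n β g σ₁ / pottsZ q n β g * (pottsWeight q n β g σ₂ / pottsZ q n β g) *
        overlapTV q n σ₁ σ₂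

set_option linter.unusedSectionVars false

noncomputable section PoissonCalculus

variable {E : Type*} [NormedAddCommGroup E]

lemma hasSum_exp (x : ℝ) : HasSum (fun m : ℕ => x ^ m / m.factorial) (Real.exp x) := by
  rw [Real.exp_eq_exp_ℝ]
  exact NormedSpace.expSeries_div_hasSum_exp x

/-- Translation of functions by `y`. -/
def shiftOp (y : E) : Module.End ℝ (E → ℝ) := LinearMap.funLeft ℝ ℝ (fun H => H + y)

/-- The jump operator `F ↦ ∑ ν(y) F(· + y)` of a finitely supported rate measure. -/
def jumpOp (ν : E →₀ ℝ) : Module.End ℝ (E → ℝ) := Finsupp.linearCombination ℝ shiftOp ν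

/-- The total rate. -/
def rateTot (ν : E →₀ ℝ) : ℝ := ν.sum fun _ r => r

/-- Exponential moment of the total variation of a rate measure. -/
def rateNorm (a : ℝ) (ν : E →₀ ℝ) : ℝ := ν.sum fun y r => |r| * Real.exp (a * ‖y‖)

/-- `|F H| ≤ C exp(a‖H‖)` for all `H`. -/
def GrowthBy (C a : ℝ) (F : E → ℝ) : Prop := ∀ H, |F H| ≤ C * Real.exp (a * ‖H‖)

/-- At most exponential growth. -/
def ExpGrowth (F : E → ℝ) : Prop := ∃ C a, 0 ≤ C ∧ 0 ≤ a ∧ GrowthBy C a F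

/-- Expectation of `F` at `H` plus a compound Poisson variable with rate measure `ν`. -/
def Pois (ν : E →₀ ℝ) (F : E → ℝ) (H : E) : ℝ :=
  Real.exp (-rateTot ν) * ∑' m : ℕ, ((jumpOp ν ^ m) F H) / m.factorial

lemma jumpOp_apply (ν : E →₀ ℝ) (F : E → ℝ) (H : E) :
    jumpOp ν F H = ν.sum fun y r => r * F (H + y) := by
  simp [jumpOp, Finsupp.linearCombination_apply, Finsupp.sum, shiftOp, LinearMap.funLeft_apply,
    LinearMap.sum_apply, Finset.sum_apply]

lemma jumpOp_single (y : E) (r : ℝ) (F : E → ℝ) (H : E) :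
    jumpOp (Finsupp.single y r) F H = r * F (H + y) := by
  simp [jumpOp_apply]

lemma jumpOp_add (ν ν' : E →₀ ℝ) : jumpOp (ν + ν') = jumpOp ν + jumpOp ν' := by
  simp [jumpOp]

lemma jumpOp_smul (t : ℝ) (ν : E →₀ ℝ) : jumpOp (t • ν) = t • jumpOp ν := by
  simp [jumpOp]

lemma jumpOp_zero : jumpOp (0 : E →₀ ℝ) = 0 := by
  simp [jumpOp]

lemma rateTot_eq (ν : E →₀ ℝ) : rateTot ν = Finsupp.linearCombination ℝ (fun _ : E => (1 : ℝ)) ν := by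
  simp [rateTot, Finsupp.linearCombination_apply]

@[simp] lemma rateTot_add (ν ν' : E →₀ ℝ) : rateTot (ν + ν') = rateTot ν + rateTot ν' := by
  simp [rateTot_eq]

@[simp] lemma rateTot_smul (t : ℝ) (ν : E →₀ ℝ) : rateTot (t • ν) = t * rateTot ν := by
  simp [rateTot_eq]

@[simp] lemma rateTot_zero : rateTot (0 : E →₀ ℝ) = 0 := by
  simp [rateTot_eq]

@[simp] lemma rateTot_single (y : E) (r : ℝ) : rateTot (Finsupp.single y r) = r := by
  simp [rateTot_eq]

lemma rateTot_sum {X : Type*} (s : Finset X) (f : X → E →₀ ℝ) :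
    rateTot (∑ x ∈ s, f x) = ∑ x ∈ s, rateTot (f x) := by
  simp [rateTot_eq]

lemma rateNorm_nonneg (a : ℝ) (ν : E →₀ ℝ) : 0 ≤ rateNorm a ν :=
  Finset.sum_nonneg fun _ _ => by positivity

lemma rateTot_nonneg {ν : E →₀ ℝ} (h : 0 ≤ ν) : 0 ≤ rateTot ν :=
  Finset.sum_nonneg fun y _ => h y

lemma jumpOp_comm (ν ν' : E →₀ ℝ) : Commute (jumpOp ν) (jumpOp ν') := by
  refine LinearMap.ext fun F => funext fun H => ?_
  simp only [Module.End.mul_apply, jumpOp_apply, Finsupp.sum, Finset.mul_sum]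
  rw [Finset.sum_comm]
  refine Finset.sum_congr rfl fun y _ => Finset.sum_congr rfl fun z _ => ?_
  rw [add_right_comm]; ring

lemma GrowthBy.jump {C a : ℝ} {F : E → ℝ} (ha : 0 ≤ a) (hF : GrowthBy C a F) (ν : E →₀ ℝ) :
    GrowthBy (C * rateNorm a ν) a (jumpOp ν F) := by
  intro H
  have hC : 0 ≤ C := by
    have := (abs_nonneg _).trans (hF 0)
    simpa using this
  rw [jumpOp_apply]
  refine (Finset.abs_sum_le_sum_abs _ _).trans ?_
  rw [rateNorm, Finsupp.sum, Finset.mul_sum, Finset.sum_mul]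
  refine Finset.sum_le_sum fun y _ => ?_
  rw [abs_mul]
  have h1 : |F (H + y)| ≤ C * (Real.exp (a * ‖y‖) * Real.exp (a * ‖H‖)) := by
    refine (hF _).trans ?_
    rw [← Real.exp_add]
    have := norm_add_le H y
    gcongr
    nlinarith
  calc |ν y| * |F (H + y)| ≤ |ν y| * (C * (Real.exp (a * ‖y‖) * Real.exp (a * ‖H‖))) := by gcongr
    _ = _ := by ring

lemma GrowthBy.jump_pow {C a : ℝ} {F : E → ℝ} (ha : 0 ≤ a) (hF : GrowthBy C a F) (ν : E →₀ ℝ)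
    (m : ℕ) : GrowthBy (C * rateNorm a ν ^ m) a ((jumpOp ν ^ m) F) := by
  induction m with
  | zero => simpa using hF
  | succ k ih =>
    rw [pow_succ' (jumpOp ν), pow_succ (rateNorm a ν), ← mul_assoc]
    exact ih.jump ha ν

lemma GrowthBy.abs_pois_term {C a : ℝ} {F : E → ℝ} (ha : 0 ≤ a) (hF : GrowthBy C a F) (ν : E →₀ ℝ)
    (H : E) (m : ℕ) : |(jumpOp ν ^ m) F H / m.factorial| ≤
      C * Real.exp (a * ‖H‖) * (rateNorm a ν ^ m / m.factorial) := by
  rw [abs_div, Nat.abs_cast]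
  have := hF.jump_pow ha ν m H
  calc _ ≤ C * rateNorm a ν ^ m * Real.exp (a * ‖H‖) / m.factorial := by gcongr
    _ = _ := by ring

lemma ExpGrowth.summable {F : E → ℝ} (hF : ExpGrowth F) (ν : E →₀ ℝ) (H : E) :
    Summable fun m : ℕ => (jumpOp ν ^ m) F H / m.factorial := by
  obtain ⟨C, a, hC, ha, h⟩ := hF
  refine Summable.of_norm_bounded (g := fun m : ℕ => C * Real.exp (a * ‖H‖) *
    (rateNorm a ν ^ m / m.factorial)) ((Real.summable_pow_div_factorial _).mul_left _) fun m => ?_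
  exact h.abs_pois_term ha ν H m

lemma GrowthBy.mono {C a C' a' : ℝ} {F : E → ℝ} (hF : GrowthBy C a F) (hC' : C ≤ C')
    (h0 : 0 ≤ C) (ha : a ≤ a') : GrowthBy C' a' F := fun H => (hF H).trans (by gcongr; exact h0.trans hC')

lemma ExpGrowth.add {F G : E → ℝ} (hF : ExpGrowth F) (hG : ExpGrowth G) :
    ExpGrowth fun H => F H + G H := by
  obtain ⟨C, a, hC, ha, h⟩ := hF
  obtain ⟨C', a', hC', ha', h'⟩ := hG
  refine ⟨C + C', max a a', by positivity, by positivity, fun H => ?_⟩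
  have h1 := (h.mono le_rfl hC (le_max_left a a')) H
  have h2 := (h'.mono le_rfl hC' (le_max_right a a')) H
  calc |F H + G H| ≤ |F H| + |G H| := abs_add_le _ _
    _ ≤ _ := by linarith

lemma ExpGrowth.mul {F G : E → ℝ} (hF : ExpGrowth F) (hG : ExpGrowth G) :
    ExpGrowth fun H => F H * G H := by
  obtain ⟨C, a, hC, ha, h⟩ := hF
  obtain ⟨C', a', hC', ha', h'⟩ := hG
  refine ⟨C * C', a + a', by positivity, by positivity, fun H => ?_⟩
  rw [abs_mul, add_mul, Real.exp_add]
  calc |F H| * |G H| ≤ (C * Real.exp (a * ‖H‖)) * (C' * Real.exp (a' * ‖H‖)) :=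
        mul_le_mul (h H) (h' H) (abs_nonneg _) (by positivity)
    _ = _ := by ring

lemma ExpGrowth.const (c : ℝ) : ExpGrowth fun _ : E => c :=
  ⟨|c|, 0, abs_nonneg _, le_rfl, fun H => by simp⟩

lemma ExpGrowth.const_mul {F : E → ℝ} (hF : ExpGrowth F) (c : ℝ) : ExpGrowth fun H => c * F H :=
  (ExpGrowth.const c).mul hF

lemma ExpGrowth.neg {F : E → ℝ} (hF : ExpGrowth F) : ExpGrowth fun H => - F H := by
  simpa using hF.const_mul (-1)

lemma ExpGrowth.sub {F G : E → ℝ} (hF : ExpGrowth F) (hG : ExpGrowth G) :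
    ExpGrowth fun H => F H - G H := by
  simpa [sub_eq_add_neg] using hF.add hG.neg

lemma ExpGrowth.sum {X : Type*} {s : Finset X} {F : X → E → ℝ} (hF : ∀ x ∈ s, ExpGrowth (F x)) :
    ExpGrowth fun H => ∑ x ∈ s, F x H := by
  classical
  induction s using Finset.induction_on with
  | empty => simpa using ExpGrowth.const 0
  | insert a s ha ih =>
    simp only [Finset.sum_insert ha]
    exact (hF a (by simp)).add (ih fun x hx => hF x (by simp [hx]))

lemma ExpGrowth.of_abs_le {F G : E → ℝ} (hG : ExpGrowth G) (h : ∀ H, |F H| ≤ G H) :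
    ExpGrowth F := by
  obtain ⟨C, a, hC, ha, h'⟩ := hG
  exact ⟨C, a, hC, ha, fun H => (h H).trans ((le_abs_self _).trans (h' H))⟩

lemma ExpGrowth.add_right {F : E → ℝ} (hF : ExpGrowth F) (y : E) : ExpGrowth fun H => F (H + y) := by
  obtain ⟨C, a, hC, ha, h⟩ := hF
  refine ⟨C * Real.exp (a * ‖y‖), a, by positivity, ha, fun H => (h _).trans ?_⟩
  rw [mul_assoc, ← Real.exp_add]
  have := norm_add_le H y
  gcongr
  nlinarith

lemma ExpGrowth.jump {F : E → ℝ} (hF : ExpGrowth F) (ν : E →₀ ℝ) : ExpGrowth (jumpOp ν F) := by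
  obtain ⟨C, a, hC, ha, h⟩ := hF
  exact ⟨_, a, mul_nonneg hC (rateNorm_nonneg _ _), ha, h.jump ha ν⟩

lemma ExpGrowth.pois {F : E → ℝ} (hF : ExpGrowth F) (ν : E →₀ ℝ) : ExpGrowth (Pois ν F) := by
  obtain ⟨C, a, hC, ha, h⟩ := hF
  refine ⟨C * (Real.exp (-rateTot ν) * Real.exp (rateNorm a ν)), a, by positivity, ha, fun H => ?_⟩
  rw [Pois, abs_mul, abs_of_pos (Real.exp_pos _)]
  have hs : Summable fun m : ℕ => C * Real.exp (a * ‖H‖) * (rateNorm a ν ^ m / m.factorial) :=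
    (Real.summable_pow_div_factorial _).mul_left _
  have h1 : |∑' m : ℕ, ((jumpOp ν ^ m) F H) / m.factorial| ≤
      ∑' m : ℕ, C * Real.exp (a * ‖H‖) * (rateNorm a ν ^ m / m.factorial) := by
    rw [← Real.norm_eq_abs]
    exact tsum_of_norm_bounded hs.hasSum fun m => h.abs_pois_term ha ν H m
  rw [tsum_mul_left, (hasSum_exp _).tsum_eq] at h1
  calc _ ≤ Real.exp (-rateTot ν) * (C * Real.exp (a * ‖H‖) * Real.exp (rateNorm a ν)) := by gcongr
    _ = _ := by ring

lemma jump_pow_const (ν : E →₀ ℝ) (c : ℝ) (m : ℕ) (H : E) :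
    (jumpOp ν ^ m) (fun _ => c) H = rateTot ν ^ m * c := by
  induction m generalizing H with
  | zero => simp
  | succ k ih =>
    rw [pow_succ', Module.End.mul_apply, jumpOp_apply]
    simp only [ih]
    rw [pow_succ', Finsupp.sum, ← Finset.sum_mul, rateTot, Finsupp.sum, mul_assoc]

@[simp] lemma pois_const (ν : E →₀ ℝ) (c : ℝ) (H : E) : Pois ν (fun _ => c) H = c := by
  have : ∀ m : ℕ, (jumpOp ν ^ m) (fun _ => c) H / m.factorial =
      rateTot ν ^ m / m.factorial * c := fun m => by rw [jump_pow_const]; ring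
  simp only [Pois, this]
  rw [tsum_mul_right, (hasSum_exp _).tsum_eq, ← mul_assoc, ← Real.exp_add]
  simp

@[simp] lemma pois_zero (F : E → ℝ) (H : E) : Pois 0 F H = F H := by
  rw [Pois, tsum_eq_single 0]
  · simp
  · intro m hm
    simp [jumpOp_zero, hm]

lemma pois_add {F G : E → ℝ} (hF : ExpGrowth F) (hG : ExpGrowth G) (ν : E →₀ ℝ) (H : E) :
    Pois ν (fun H => F H + G H) H = Pois ν F H + Pois ν G H := by
  rw [Pois, Pois, Pois, ← mul_add, ← (hF.summable ν H).tsum_add (hG.summable ν H)]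
  congr 2; funext m
  rw [← add_div, show (fun H => F H + G H) = F + G from rfl, map_add]; rfl

lemma pois_const_mul (c : ℝ) (F : E → ℝ) (ν : E →₀ ℝ) (H : E) :
    Pois ν (fun H => c * F H) H = c * Pois ν F H := by
  rw [Pois, Pois, mul_left_comm, ← tsum_mul_left (a := c)]
  congr 2; funext m
  rw [show (fun H => c * F H) = c • F from rfl, map_smul, Pi.smul_apply, smul_eq_mul, mul_div_assoc]

lemma pois_neg (F : E → ℝ) (ν : E →₀ ℝ) (H : E) :
    Pois ν (fun H => - F H) H = - Pois ν F H := by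
  simpa using pois_const_mul (-1) F ν H

lemma pois_sub {F G : E → ℝ} (hF : ExpGrowth F) (hG : ExpGrowth G) (ν : E →₀ ℝ) (H : E) :
    Pois ν (fun H => F H - G H) H = Pois ν F H - Pois ν G H := by
  simp only [sub_eq_add_neg]
  rw [pois_add hF hG.neg, pois_neg]

lemma pois_sum {X : Type*} {s : Finset X} {F : X → E → ℝ} (hF : ∀ x ∈ s, ExpGrowth (F x))
    (ν : E →₀ ℝ) (H : E) :
    Pois ν (fun H => ∑ x ∈ s, F x H) H = ∑ x ∈ s, Pois ν (F x) H := by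
  classical
  induction s using Finset.induction_on with
  | empty => simp
  | insert a s ha ih =>
    simp only [Finset.sum_insert ha]
    rw [pois_add (hF a (by simp)) (ExpGrowth.sum fun x hx => hF x (by simp [hx])),
      ih fun x hx => hF x (by simp [hx])]

lemma jumpOp_mono {ν : E →₀ ℝ} (hν : 0 ≤ ν) {F G : E → ℝ} (h : ∀ H, F H ≤ G H) (H : E) :
    jumpOp ν F H ≤ jumpOp ν G H := by
  rw [jumpOp_apply, jumpOp_apply]
  exact Finset.sum_le_sum fun y _ => mul_le_mul_of_nonneg_left (h _) (hν y)

lemma jumpOp_pow_mono {ν : E →₀ ℝ} (hν : 0 ≤ ν) {F G : E → ℝ} (h : ∀ H, F H ≤ G H) (m : ℕ) (H : E) :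
    (jumpOp ν ^ m) F H ≤ (jumpOp ν ^ m) G H := by
  induction m generalizing H with
  | zero => simpa using h H
  | succ k ih =>
    rw [pow_succ']
    exact jumpOp_mono hν ih H

lemma pois_mono {ν : E →₀ ℝ} (hν : 0 ≤ ν) {F G : E → ℝ} (hF : ExpGrowth F) (hG : ExpGrowth G)
    (h : ∀ H, F H ≤ G H) (H : E) : Pois ν F H ≤ Pois ν G H := by
  refine mul_le_mul_of_nonneg_left ?_ (Real.exp_pos _).le
  refine (hF.summable ν H).tsum_le_tsum (fun m => ?_) (hG.summable ν H)
  gcongr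
  exact jumpOp_pow_mono hν h m H

lemma pois_nonneg {ν : E →₀ ℝ} (hν : 0 ≤ ν) {F : E → ℝ} (hF : ExpGrowth F)
    (h : ∀ H, 0 ≤ F H) (H : E) : 0 ≤ Pois ν F H := by
  simpa using pois_mono hν (ExpGrowth.const 0) hF h H

lemma abs_pois_le {ν : E →₀ ℝ} (hν : 0 ≤ ν) {F G : E → ℝ} (hF : ExpGrowth F) (hG : ExpGrowth G)
    (h : ∀ H, |F H| ≤ G H) (H : E) : |Pois ν F H| ≤ Pois ν G H := by
  rw [abs_le, ← pois_neg]
  exact ⟨pois_mono hν hG.neg hF (fun H => (abs_le.1 (h H)).1) H,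
    pois_mono hν hF hG (fun H => (abs_le.1 (h H)).2) H⟩

lemma jumpOp_pow_tsum {f : ℕ → E → ℝ} (hf : ∀ H, Summable fun j => f j H) (ν : E →₀ ℝ) (m : ℕ)
    (H : E) : (Summable fun j => (jumpOp ν ^ m) (f j) H) ∧
      (jumpOp ν ^ m) (fun H => ∑' j, f j H) H = ∑' j, (jumpOp ν ^ m) (f j) H := by
  induction m generalizing H with
  | zero => simpa using hf H
  | succ k ih =>
    rw [pow_succ']
    simp only [Module.End.mul_apply, jumpOp_apply, Finsupp.sum]
    have hs : ∀ y ∈ ν.support, Summable fun j => ν y * (jumpOp ν ^ k) (f j) (H + y) :=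
      fun y _ => (ih (H + y)).1.mul_left _
    refine ⟨summable_sum hs, ?_⟩
    rw [Summable.tsum_finsetSum hs]
    refine Finset.sum_congr rfl fun y _ => ?_
    rw [(ih (H + y)).2, tsum_mul_left]

lemma pois_eq_fun (ν : E →₀ ℝ) (F : E → ℝ) :
    Pois ν F = Real.exp (-rateTot ν) • fun H => ∑' m : ℕ, ((jumpOp ν ^ m) F H) / m.factorial := rfl

lemma jumpOp_pow_pois {F : E → ℝ} (hF : ExpGrowth F) (δ ν : E →₀ ℝ) (m : ℕ) (H : E) :
    (jumpOp δ ^ m) (Pois ν F) H = Pois ν ((jumpOp δ ^ m) F) H := by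
  rw [pois_eq_fun, map_smul, Pi.smul_apply, (jumpOp_pow_tsum (hF.summable ν) δ m H).2, smul_eq_mul,
    Pois]
  congr 2; funext j
  have h : (fun H => (jumpOp ν ^ j) F H / j.factorial) =
      (j.factorial : ℝ)⁻¹ • (jumpOp ν ^ j) F := by
    funext H; simp [div_eq_inv_mul]
  rw [h, map_smul, Pi.smul_apply, smul_eq_mul, ← Module.End.mul_apply,
    ((jumpOp_comm δ ν).pow_pow m j).eq, Module.End.mul_apply, div_eq_inv_mul]

lemma jumpOp_pois {F : E → ℝ} (hF : ExpGrowth F) (δ ν : E →₀ ℝ) (H : E) :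
    jumpOp δ (Pois ν F) H = Pois ν (jumpOp δ F) H := by
  simpa using jumpOp_pow_pois hF δ ν 1 H

lemma pois_shift {F : E → ℝ} (hF : ExpGrowth F) (ν : E →₀ ℝ) (H y : E) :
    Pois ν F (H + y) = Pois ν (fun H => F (H + y)) H := by
  have := jumpOp_pois hF (Finsupp.single y 1) ν H
  rw [jumpOp_single, one_mul] at this
  rw [this]; congr 1; funext H; rw [jumpOp_single, one_mul]

/-- The semigroup property: independent compound Poisson variables add. -/
lemma pois_add_rate {F : E → ℝ} (hF : ExpGrowth F) (ν ν' : E →₀ ℝ) (H : E) :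
    Pois (ν + ν') F H = Pois ν (Pois ν' F) H := by
  set f : ℕ × ℕ → ℝ := fun p => (jumpOp ν ^ p.1) ((jumpOp ν' ^ p.2) F) H /
    (p.1.factorial * p.2.factorial) with hf
  have hsum : Summable f := by
    obtain ⟨C, a, hC, ha, h⟩ := hF
    refine Summable.of_norm_bounded (g := fun p : ℕ × ℕ => C * Real.exp (a * ‖H‖) *
      ((rateNorm a ν ^ p.1 / p.1.factorial) * (rateNorm a ν' ^ p.2 / p.2.factorial)))
      (((Real.summable_pow_div_factorial _).mul_of_nonneg (Real.summable_pow_div_factorial _)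
        (fun _ => div_nonneg (pow_nonneg (rateNorm_nonneg _ _) _) (by positivity))
        (fun _ => div_nonneg (pow_nonneg (rateNorm_nonneg _ _) _) (by positivity))).mul_left _)
      fun p => ?_
    have := ((h.jump_pow ha ν' p.2).jump_pow ha ν p.1) H
    rw [Real.norm_eq_abs, hf, abs_div, abs_of_nonneg (by positivity : (0:ℝ) ≤ (p.1.factorial * p.2.factorial))]
    calc _ ≤ C * rateNorm a ν' ^ p.2 * rateNorm a ν ^ p.1 * Real.exp (a * ‖H‖) /
          (p.1.factorial * p.2.factorial) := by gcongr
      _ = _ := by field_simp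
  have h1 : ∀ m : ℕ, (jumpOp (ν + ν') ^ m) F H / m.factorial =
      ∑ p ∈ antidiagonal m, f p := by
    intro m
    rw [jumpOp_add, (jumpOp_comm ν ν').add_pow', LinearMap.sum_apply, Finset.sum_apply,
      Finset.sum_div]
    refine Finset.sum_congr rfl fun p hp => ?_
    rw [HasAntidiagonal.mem_antidiagonal] at hp
    subst hp
    rw [LinearMap.smul_apply, Pi.smul_apply, Module.End.mul_apply, nsmul_eq_mul,
      Nat.cast_add_choose]
    have := Nat.factorial_ne_zero (p.1 + p.2)
    simp only [hf]
    field_simp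
  have h2 : ∑' m : ℕ, (jumpOp (ν + ν') ^ m) F H / m.factorial = ∑' i, ∑' j, f (i, j) := by
    simp only [h1]
    rw [← hsum.tsum_prod, ← Finset.HasAntidiagonal.sigmaAntidiagonalEquivProd.tsum_eq f,
      Summable.tsum_sigma']
    · refine tsum_congr fun m => ?_
      rw [tsum_fintype, ← Finset.sum_coe_sort]
      rfl
    · intro m; exact (hasSum_fintype _).summable
    · exact (Finset.HasAntidiagonal.sigmaAntidiagonalEquivProd.summable_iff).2 hsum
  rw [Pois, h2, rateTot_add, neg_add, Real.exp_add, mul_assoc, ← tsum_mul_left, Pois]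
  congr 2; funext i
  rw [jumpOp_pow_pois hF, Pois, mul_div_assoc, ← tsum_div_const]
  congr 2; funext j
  have h3 := ((jumpOp_comm ν ν').pow_pow i j).eq
  simp only [hf]
  rw [← Module.End.mul_apply, h3, Module.End.mul_apply, div_div, mul_comm (i.factorial : ℝ)]

end PoissonCalculus

noncomputable section PoissonTilting

variable {E : Type*} [NormedAddCommGroup E]

lemma hasDerivAt_tsum_pow_div_factorial {a : ℕ → ℝ} {C K : ℝ}
    (ha : ∀ m, |a m| ≤ C * K ^ m) :
    HasDerivAt (fun t : ℝ => ∑' m : ℕ, t ^ m * a m / m.factorial) (a 1) 0 := by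
  have hC : 0 ≤ C := by have := (abs_nonneg _).trans (ha 0); simpa using this
  have hu : Summable fun m : ℕ => C * (m * K ^ m / m.factorial) := by
    refine Summable.mul_left _ ((summable_nat_add_iff 1).1 ?_)
    refine ((Real.summable_pow_div_factorial K).mul_left K).congr fun m => ?_
    rw [Nat.factorial_succ]; push_cast
    have : (m : ℝ) + 1 ≠ 0 := by positivity
    field_simp; ring
  have h := hasDerivAt_tsum_of_isPreconnected (u := fun m : ℕ => C * (m * K ^ m / m.factorial))
    (g := fun (m : ℕ) (t : ℝ) => t ^ m * a m / m.factorial)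
    (g' := fun (m : ℕ) (t : ℝ) => m * t ^ (m - 1) * a m / m.factorial)
    (t := Metric.ball (0 : ℝ) 1) (y₀ := 0) (y := 0) hu Metric.isOpen_ball
    (convex_ball (0 : ℝ) 1).isPreconnected
    (fun m y _ => ((hasDerivAt_pow m y).mul_const _).div_const _)
    (fun m y hy => ?_) (by simp) ?_ (by simp)
  · refine h.congr_deriv ?_
    rw [tsum_eq_single 1]
    · simp
    · intro m hm
      rcases Nat.eq_zero_or_pos m with rfl | h0
      · simp
      · rw [zero_pow (by omega)]; simp
  · have hy' : |y| ≤ 1 := by simpa using (mem_ball_zero_iff.1 hy).le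
    have h1 : |y| ^ (m - 1) ≤ 1 := pow_le_one₀ (abs_nonneg _) hy'
    rw [Real.norm_eq_abs, abs_div, abs_mul, abs_mul, Nat.abs_cast, Nat.abs_cast, abs_pow,
      ← mul_div_assoc]
    refine div_le_div_of_nonneg_right ?_ (by positivity)
    calc (m : ℝ) * |y| ^ (m - 1) * |a m| ≤ m * 1 * (C * K ^ m) := by
          gcongr; exact ha m
      _ = C * (m * K ^ m) := by ring
  · refine summable_of_ne_finset_zero (s := {0}) fun m hm => ?_
    simp only [Finset.mem_singleton] at hm
    simp [hm]

lemma hasDerivAt_pois_smul_zero {G : E → ℝ} (hG : ExpGrowth G) (δ : E →₀ ℝ) (H : E) :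
    HasDerivAt (fun t : ℝ => Pois (t • δ) G H) (jumpOp δ G H - rateTot δ * G H) 0 := by
  have hfun : (fun t : ℝ => Pois (t • δ) G H) = fun t : ℝ => Real.exp (-(t * rateTot δ)) *
      ∑' m : ℕ, t ^ m * (jumpOp δ ^ m) G H / m.factorial := by
    funext t
    rw [Pois, rateTot_smul]
    congr 2; funext m
    rw [jumpOp_smul, smul_pow]; rfl
  rw [hfun]
  obtain ⟨C, a, hC, ha, h⟩ := hG
  have h1 := hasDerivAt_tsum_pow_div_factorial (a := fun m => (jumpOp δ ^ m) G H)
    (C := C * Real.exp (a * ‖H‖)) (K := rateNorm a δ) (fun m => by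
      have := h.jump_pow ha δ m H
      calc _ ≤ _ := this
        _ = _ := by ring)
  have h2 : HasDerivAt (fun t : ℝ => Real.exp (-(t * rateTot δ))) (-rateTot δ) 0 := by
    have := (((hasDerivAt_id (0 : ℝ)).mul_const (rateTot δ)).neg).exp
    simpa using this
  have h3 := h2.mul h1
  refine h3.congr_deriv ?_
  rw [tsum_eq_single 0 (by intro m hm; simp [hm])]
  simp; ring

lemma hasDerivAt_pois {F : E → ℝ} (hF : ExpGrowth F) (ν δ : E →₀ ℝ) (H : E) (t : ℝ) :
    HasDerivAt (fun t : ℝ => Pois (ν + t • δ) F H)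
      (Pois (ν + t • δ) (fun H => jumpOp δ F H - rateTot δ * F H) H) t := by
  have h := hasDerivAt_pois_smul_zero (hF.pois (ν + t • δ)) δ H
  have h' := HasDerivAt.comp_sub_const t t ((sub_self t).symm ▸ h)
  have h2 : (fun s : ℝ => Pois ((s - t) • δ) (Pois (ν + t • δ) F) H) =
      fun s : ℝ => Pois (ν + s • δ) F H := by
    funext s
    rw [← pois_add_rate hF]
    congr 1
    rw [sub_smul]; abel
  rw [h2] at h'
  refine h'.congr_deriv ?_
  rw [pois_sub (hF.jump δ) (hF.const_mul _), jumpOp_pois hF, pois_const_mul]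

/-- Exponential tilting of a rate measure. -/
def tilt (ℓ : E →+ ℝ) (ν : E →₀ ℝ) : E →₀ ℝ :=
  Finsupp.linearCombination ℝ (fun y => Finsupp.single y (Real.exp (ℓ y))) ν

lemma jumpOp_tilt (ℓ : E →+ ℝ) (ν : E →₀ ℝ) (F : E → ℝ) (H : E) :
    jumpOp (tilt ℓ ν) F H = ν.sum fun y r => r * (Real.exp (ℓ y) * F (H + y)) := by
  rw [tilt, jumpOp, Finsupp.apply_linearCombination, Finsupp.linearCombination_apply, Finsupp.sum,
    LinearMap.sum_apply, Finset.sum_apply]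
  refine Finset.sum_congr rfl fun y _ => ?_
  simp [shiftOp, LinearMap.funLeft_apply]

lemma rateTot_tilt (ℓ : E →+ ℝ) (ν : E →₀ ℝ) :
    rateTot (tilt ℓ ν) = ν.sum fun y r => r * Real.exp (ℓ y) := by
  have := jumpOp_tilt ℓ ν (fun _ => 1) 0
  rw [show jumpOp (tilt ℓ ν) (fun _ => 1) 0 = rateTot (tilt ℓ ν) by
    simpa using jump_pow_const (tilt ℓ ν) 1 1 0] at this
  simpa using this

/-- The exponential change of measure for compound Poisson variables. -/
lemma pois_exp_mul (ℓ : E →+ ℝ) (ν : E →₀ ℝ) (g : E → ℝ) (H : E) :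
    Pois ν (fun H => Real.exp (ℓ H) * g H) H =
      Real.exp (ℓ H) * Real.exp (ν.sum fun y r => r * (Real.exp (ℓ y) - 1)) * Pois (tilt ℓ ν) g H := by
  have h : ∀ (m : ℕ) (H : E), (jumpOp ν ^ m) (fun H => Real.exp (ℓ H) * g H) H =
      Real.exp (ℓ H) * (jumpOp (tilt ℓ ν) ^ m) g H := by
    intro m
    induction m with
    | zero => intro H; simp
    | succ k ih =>
      intro H
      rw [pow_succ', pow_succ', Module.End.mul_apply, Module.End.mul_apply, jumpOp_apply,
        jumpOp_tilt, Finsupp.sum, Finsupp.sum, Finset.mul_sum]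
      refine Finset.sum_congr rfl fun y _ => ?_
      rw [ih, map_add, Real.exp_add]; ring
  simp only [Pois, h, mul_div_assoc]
  rw [tsum_mul_left, rateTot_tilt]
  have h2 : (ν.sum fun y r => r * (Real.exp (ℓ y) - 1)) =
      (ν.sum fun y r => r * Real.exp (ℓ y)) - rateTot ν := by
    simp only [rateTot, Finsupp.sum, mul_sub, Finset.sum_sub_distrib, mul_one]
  rw [h2, sub_eq_add_neg, Real.exp_add, Real.exp_neg (ν.sum fun y r => r * Real.exp (ℓ y))]
  have := (Real.exp_pos (ν.sum fun y r => r * Real.exp (ℓ y))).ne'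
  field_simp

lemma pois_exp (ℓ : E →+ ℝ) (ν : E →₀ ℝ) (H : E) :
    Pois ν (fun H => Real.exp (ℓ H)) H =
      Real.exp (ℓ H) * Real.exp (ν.sum fun y r => r * (Real.exp (ℓ y) - 1)) := by
  simpa using pois_exp_mul ℓ ν (fun _ => 1) H

lemma pois_mapDomain {E' : Type*} [NormedAddCommGroup E'] (ι : E →+ E') (ν : E →₀ ℝ)
    (F : E' → ℝ) (c : E') (H : E) :
    Pois (ν.mapDomain ι) F (c + ι H) = Pois ν (fun H => F (c + ι H)) H := by
  have h : ∀ (m : ℕ) (H : E), (jumpOp (ν.mapDomain ι) ^ m) F (c + ι H) =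
      (jumpOp ν ^ m) (fun H => F (c + ι H)) H := by
    intro m
    induction m with
    | zero => intro H; simp
    | succ k ih =>
      intro H
      rw [pow_succ', pow_succ', Module.End.mul_apply, Module.End.mul_apply, jumpOp_apply,
        jumpOp_apply, Finsupp.sum_mapDomain_index (by simp) (by intros; ring)]
      refine Finset.sum_congr rfl fun y _ => ?_
      dsimp only
      rw [add_assoc, ← map_add, ih]
  have h2 : rateTot (ν.mapDomain ι) = rateTot ν := by
    rw [rateTot, Finsupp.sum_mapDomain_index (by simp) (by simp)]; rfl
  simp only [Pois, h, h2]

/-- The rate measure with an atom of mass `r x` at `ψ x` for each `x`. -/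
def rateOf {X : Type*} [Fintype X] (ψ : X → E) (r : X → ℝ) : E →₀ ℝ :=
  ∑ x, Finsupp.single (ψ x) (r x)

lemma jumpOp_rateOf {X : Type*} [Fintype X] (ψ : X → E) (r : X → ℝ) (F : E → ℝ) (H : E) :
    jumpOp (rateOf ψ r) F H = ∑ x, r x * F (H + ψ x) := by
  rw [rateOf, jumpOp, map_sum, LinearMap.sum_apply, Finset.sum_apply]
  exact Finset.sum_congr rfl fun x _ => jumpOp_single _ _ _ _

lemma rateTot_rateOf {X : Type*} [Fintype X] (ψ : X → E) (r : X → ℝ) :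
    rateTot (rateOf ψ r) = ∑ x, r x := by
  simp [rateOf, rateTot_sum]

lemma rateOf_nonneg {X : Type*} [Fintype X] (ψ : X → E) {r : X → ℝ} (h : ∀ x, 0 ≤ r x) :
    0 ≤ rateOf ψ r :=
  Finset.sum_nonneg fun x _ => Finsupp.single_nonneg.2 (h x)

lemma rateOf_add {X : Type*} [Fintype X] (ψ : X → E) (r r' : X → ℝ) :
    rateOf ψ (fun x => r x + r' x) = rateOf ψ r + rateOf ψ r' := by
  simp [rateOf, Finset.sum_add_distrib]

lemma rateOf_smul {X : Type*} [Fintype X] (ψ : X → E) (t : ℝ) (r : X → ℝ) :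
    rateOf ψ (fun x => t * r x) = t • rateOf ψ r := by
  simp [rateOf, Finset.smul_sum]

lemma mapDomain_rateOf {E' : Type*} [NormedAddCommGroup E'] {X : Type*} [Fintype X] (ψ : X → E)
    (r : X → ℝ) (ι : E →+ E') :
    (rateOf ψ r).mapDomain ι = rateOf (fun x => ι (ψ x)) r := by
  simp [rateOf, Finsupp.mapDomain_finsetSum]

lemma sum_rateOf {X M : Type*} [Fintype X] [AddCommMonoid M] (ψ : X → E) (r : X → ℝ)
    (f : E → ℝ → M) (h0 : ∀ y, f y 0 = 0) (hadd : ∀ y a b, f y (a + b) = f y a + f y b) :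
    (rateOf ψ r).sum f = ∑ x, f (ψ x) (r x) := by
  rw [rateOf, ← Finsupp.sum_finsetSum_index (by simpa using h0) (by simpa using hadd)]
  exact Finset.sum_congr rfl fun x _ => by rw [Finsupp.sum_single_index (h0 _)]

lemma jumpOp_pow_rateOf {X : Type*} [Fintype X] (ψ : X → E) (r : X → ℝ) (F : E → ℝ) (m : ℕ)
    (H : E) : (jumpOp (rateOf ψ r) ^ m) F H =
      ∑ l : Fin m → X, (∏ i, r (l i)) * F (H + ∑ i, ψ (l i)) := by
  induction m generalizing H with
  | zero => simp
  | succ k ih =>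
    rw [pow_succ', Module.End.mul_apply, jumpOp_rateOf, ← (Fin.consEquiv fun _ => X).sum_comp,
      Fintype.sum_prod_type]
    refine Finset.sum_congr rfl fun x _ => ?_
    rw [ih, Finset.mul_sum]
    refine Finset.sum_congr rfl fun l _ => ?_
    simp [Fin.consEquiv, Fin.prod_univ_succ, Fin.sum_univ_succ, add_assoc, mul_assoc]

end PoissonTilting

noncomputable section PoissonConcentration

variable {E : Type*} [NormedAddCommGroup E]

/-- `F` is `1`-Lipschitz. -/
def LipOne (F : E → ℝ) : Prop := ∀ H y, |F (H + y) - F H| ≤ ‖y‖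

lemma LipOne.abs_le {F : E → ℝ} (hF : LipOne F) (H : E) : |F H| ≤ |F 0| + ‖H‖ := by
  have := hF 0 H
  rw [zero_add] at this
  calc |F H| = |F 0 + (F H - F 0)| := by ring_nf
    _ ≤ _ := (abs_add_le _ _).trans (by linarith)

lemma LipOne.expGrowth_exp {F : E → ℝ} (hF : LipOne F) (lam : ℝ) :
    ExpGrowth fun H => Real.exp (lam * F H) := by
  refine ⟨Real.exp (|lam| * |F 0|), |lam|, (Real.exp_pos _).le, abs_nonneg _, fun H => ?_⟩
  rw [abs_of_pos (Real.exp_pos _), ← Real.exp_add, Real.exp_le_exp]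
  calc lam * F H ≤ |lam| * |F H| := (le_abs_self _).trans (abs_mul _ _).le
    _ ≤ |lam| * (|F 0| + ‖H‖) := by gcongr; exact hF.abs_le H
    _ = _ := by ring

lemma LipOne.expGrowth {F : E → ℝ} (hF : LipOne F) : ExpGrowth F := by
  refine ((hF.expGrowth_exp 1).add (hF.expGrowth_exp (-1))).of_abs_le fun H => ?_
  have h1 := Real.add_one_le_exp (1 * F H)
  have h2 := Real.add_one_le_exp (-1 * F H)
  have h3 := Real.exp_pos (1 * F H)
  have h4 := Real.exp_pos (-1 * F H)
  rw [_root_.abs_le]; constructor <;> linarith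

lemma LipOne.pois {F : E → ℝ} (hF : LipOne F) {ν : E →₀ ℝ} (hν : 0 ≤ ν) : LipOne (Pois ν F) := by
  intro H y
  rw [pois_shift hF.expGrowth, ← pois_sub (hF.expGrowth.add_right y) hF.expGrowth]
  have := abs_pois_le hν ((hF.expGrowth.add_right y).sub hF.expGrowth) (ExpGrowth.const ‖y‖)
    (fun H => hF H y) H
  rwa [pois_const] at this

lemma jumpOp_pow_le_of_norm {ν : E →₀ ℝ} (hν : 0 ≤ ν) {y₀ : ℝ} 
    (hsupp : ∀ y ∈ ν.support, ‖y‖ ≤ y₀) {f : E → ℝ} {φ : ℝ → ℝ} (hφ : MonotoneOn φ (Set.Ici 0))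
    (hy₀ : 0 ≤ y₀) (H : E) (hf : ∀ H', f H' ≤ φ ‖H' - H‖) (m : ℕ) (H' : E) :
    (jumpOp ν ^ m) f H' ≤ rateTot ν ^ m * φ (‖H' - H‖ + m * y₀) := by
  induction m generalizing H' with
  | zero => simpa using hf H'
  | succ k ih =>
    rw [pow_succ', Module.End.mul_apply, jumpOp_apply, pow_succ', mul_assoc, rateTot, Finsupp.sum,
      Finsupp.sum, Finset.sum_mul]
    refine Finset.sum_le_sum fun y hy => mul_le_mul_of_nonneg_left ?_ (hν y)
    refine (ih (H' + y)).trans (mul_le_mul_of_nonneg_left ?_ (pow_nonneg (rateTot_nonneg hν) _))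
    refine hφ (Set.mem_Ici.2 (by positivity)) (Set.mem_Ici.2 (by positivity)) ?_
    have h1 : ‖H' + y - H‖ ≤ ‖H' - H‖ + ‖y‖ := by
      rw [add_sub_right_comm]; exact norm_add_le _ _
    have := hsupp y hy
    push_cast; linarith

lemma exp_sub_one_sub_le_sq (x : ℝ) : Real.exp x - 1 - x ≤ (Real.exp |x| - 1) ^ 2 := by
  have key : ∀ x : ℝ, 0 ≤ x → Real.exp x - 1 - x ≤ (Real.exp x - 1) ^ 2 := by
    intro x hx
    have h1 := Real.add_one_le_exp x
    have h2 := Real.one_sub_inv_le_log_of_pos (Real.exp_pos x)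
    rw [Real.log_exp] at h2
    have h3 : (0:ℝ) < Real.exp x := Real.exp_pos x
    have h4 : 1 - x ≤ (Real.exp x)⁻¹ := by linarith
    have h5 : 1 ≤ Real.exp x := by linarith
    have h6 : (Real.exp x)⁻¹ * Real.exp x = 1 := inv_mul_cancel₀ h3.ne'
    nlinarith [mul_nonneg (sub_nonneg.2 h4) h3.le, mul_nonneg (sub_nonneg.2 h5) (sub_nonneg.2 h5)]
  rcases le_total 0 x with h | h
  · rw [abs_of_nonneg h]; exact key x h
  · rw [abs_of_nonpos h]
    have h1 := Real.add_one_le_exp (-x)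
    have h2 : Real.exp x * Real.exp (-x) = 1 := by rw [← Real.exp_add]; simp
    have h3 := Real.exp_pos x
    have h4 : Real.exp x * (1 - x) ≤ 1 := by nlinarith
    have h5 : Real.exp x - 1 - x ≤ x ^ 2 := by nlinarith [pow_two_nonneg x, mul_nonneg (neg_nonneg.2 h) (pow_two_nonneg x)]
    have h6 : (-x) ^ 2 ≤ (Real.exp (-x) - 1) ^ 2 := by
      have : 0 ≤ -x := by linarith
      gcongr; linarith
    linarith [neg_sq x]

lemma abs_pois_sub_pois_le {ν ν' : E →₀ ℝ} (hν : 0 ≤ ν) (hν' : 0 ≤ ν') {F : E → ℝ}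
    (hF : ExpGrowth F) {B : ℝ}
    (hB : ∀ H, |jumpOp (ν' - ν) F H - rateTot (ν' - ν) * F H| ≤ B) (H : E) :
    |Pois ν' F H - Pois ν F H| ≤ B := by
  have h := norm_image_sub_le_of_norm_deriv_le_segment_01' (C := B)
    (f := fun t : ℝ => Pois (ν + t • (ν' - ν)) F H)
    (f' := fun t => Pois (ν + t • (ν' - ν)) (fun H => jumpOp (ν' - ν) F H - rateTot (ν' - ν) * F H) H)
    (fun t _ => (hasDerivAt_pois hF ν (ν' - ν) H t).hasDerivWithinAt) (fun t ht => ?_)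
  · simpa using h
  · have hpos : 0 ≤ ν + t • (ν' - ν) := fun y => by
      have h1 := hν y
      have h2 := hν' y
      simp only [Finsupp.coe_zero, Pi.zero_apply, Finsupp.coe_add, Pi.add_apply, Finsupp.coe_smul,
        Pi.smul_apply, Finsupp.coe_sub, Pi.sub_apply, smul_eq_mul] at *
      nlinarith [ht.1, ht.2]
    have := abs_pois_le hpos ((hF.jump _).sub (hF.const_mul _)) (ExpGrowth.const B) hB H
    rwa [pois_const] at this

lemma LipOne.abs_jumpOp_sub_le {F : E → ℝ} (hF : LipOne F) (δ : E →₀ ℝ) (H : E) :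
    |jumpOp δ F H - rateTot δ * F H| ≤ δ.sum fun y r => |r| * ‖y‖ := by
  rw [jumpOp_apply, rateTot, Finsupp.sum, Finsupp.sum, Finset.sum_mul, ← Finset.sum_sub_distrib]
  refine (Finset.abs_sum_le_sum_abs _ _).trans (Finset.sum_le_sum fun y _ => ?_)
  rw [← mul_sub, abs_mul]
  exact mul_le_mul_of_nonneg_left (hF H y) (abs_nonneg _)

lemma LipOne.abs_pois_sub_le {F : E → ℝ} (hF : LipOne F) {ν : E →₀ ℝ} (hν : 0 ≤ ν) {y₀ : ℝ}
    (hsupp : ∀ y ∈ ν.support, ‖y‖ ≤ y₀) (H : E) : |Pois ν F H - F H| ≤ rateTot ν * y₀ := by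
  have h := abs_pois_sub_pois_le le_rfl hν hF.expGrowth (B := rateTot ν * y₀) (fun H => by
    rw [sub_zero]
    refine (hF.abs_jumpOp_sub_le ν H).trans ?_
    rw [rateTot, Finsupp.sum, Finsupp.sum, Finset.sum_mul]
    refine Finset.sum_le_sum fun y hy => ?_
    rw [abs_of_nonneg (hν y)]
    exact mul_le_mul_of_nonneg_left (hsupp y hy) (hν y)) H
  simpa using h

lemma pois_exp_sq_le {ν : E →₀ ℝ} (hν : 0 ≤ ν) {y₀ x : ℝ} (hx : 0 ≤ x) (hy₀ : 0 ≤ y₀)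
    (hsupp : ∀ y ∈ ν.support, ‖y‖ ≤ y₀) {f : E → ℝ} (hfg : ExpGrowth f) (H : E)
    (hf : ∀ H', f H' ≤ (Real.exp (x * ‖H' - H‖) - 1) ^ 2) :
    Pois ν f H ≤ Real.exp (rateTot ν * (Real.exp (2 * (x * y₀)) - 1)) -
      2 * Real.exp (rateTot ν * (Real.exp (x * y₀) - 1)) + 1 := by
  set T := rateTot ν
  have hmono : MonotoneOn (fun r : ℝ => (Real.exp (x * r) - 1) ^ 2) (Set.Ici 0) := by
    intro a ha b hb hab
    have h0 : 1 ≤ Real.exp (x * a) := Real.one_le_exp (mul_nonneg hx ha)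
    dsimp only
    gcongr
  have hs := ((hasSum_exp (T * Real.exp (2 * (x * y₀)))).sub
    ((hasSum_exp (T * Real.exp (x * y₀))).mul_left 2)).add (hasSum_exp T)
  have h1 : ∑' m : ℕ, (jumpOp ν ^ m) f H / m.factorial ≤
      Real.exp (T * Real.exp (2 * (x * y₀))) - 2 * Real.exp (T * Real.exp (x * y₀)) + Real.exp T := by
    refine hasSum_le (fun m => ?_) (hfg.summable ν H).hasSum hs
    have := jumpOp_pow_le_of_norm hν hsupp hmono hy₀ H hf m H
    rw [sub_self, norm_zero, zero_add] at this
    calc _ ≤ T ^ m * (Real.exp (x * (m * y₀)) - 1) ^ 2 / m.factorial := by gcongr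
      _ = _ := by
        rw [mul_pow, mul_pow, ← Real.exp_nat_mul, ← Real.exp_nat_mul,
          show x * (m * y₀) = m * (x * y₀) by ring, show (m : ℝ) * (2 * (x * y₀)) = m * (x * y₀) + m * (x * y₀) by ring,
          Real.exp_add]
        ring
  calc Pois ν f H ≤ Real.exp (-T) * (Real.exp (T * Real.exp (2 * (x * y₀))) -
        2 * Real.exp (T * Real.exp (x * y₀)) + Real.exp T) :=
        mul_le_mul_of_nonneg_left h1 (Real.exp_pos _).le
    _ = _ := by
      simp only [sub_eq_add_neg, Real.exp_add, mul_add, mul_one, mul_neg, Real.exp_neg]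
      field_simp

lemma pois_exp_step {ν : E →₀ ℝ} (hν : 0 ≤ ν) {y₀ lam : ℝ} (hy₀ : 0 ≤ y₀) (hsmall : |lam| * y₀ ≤ 1)
    (hT : 64 * rateTot ν ≤ 1) (hsupp : ∀ y ∈ ν.support, ‖y‖ ≤ y₀) {F : E → ℝ} (hF : LipOne F) (H : E) :
    Pois ν (fun H => Real.exp (lam * F H)) H ≤
      Real.exp (lam * Pois ν F H + 10 * rateTot ν * (|lam| * y₀) ^ 2) := by
  set T := rateTot ν with hTdef
  set y := |lam| * y₀ with hy
  have hT0 : 0 ≤ T := rateTot_nonneg hν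
  have hy0 : 0 ≤ y := by positivity
  set X : E → ℝ := fun H' => lam * (F H' - F H) with hX
  have hXg : ExpGrowth X := (hF.expGrowth.sub (ExpGrowth.const _)).const_mul _
  have heg : ExpGrowth fun H' => Real.exp (X H') := by
    have := (hF.expGrowth_exp lam).const_mul (Real.exp (-(lam * F H)))
    refine this.of_abs_le fun H' => ?_
    rw [abs_of_pos (Real.exp_pos _), ← Real.exp_add]
    apply le_of_eq; congr 1; simp only [hX]; ring
  have h1 := pois_exp_sq_le hν (abs_nonneg lam) hy₀ hsupp (f := fun H' => Real.exp (X H') - 1 - X H')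
    ((heg.sub (ExpGrowth.const 1)).sub hXg) H (fun H' => by
      refine (exp_sub_one_sub_le_sq _).trans ?_
      have h2 : |X H'| ≤ |lam| * ‖H' - H‖ := by
        rw [hX, abs_mul]
        have := hF H (H' - H)
        rw [add_sub_cancel] at this
        gcongr
      have h3 : 1 ≤ Real.exp |X H'| := Real.one_le_exp (abs_nonneg _)
      gcongr)
  rw [pois_sub (heg.sub (ExpGrowth.const 1)) hXg, pois_sub heg (ExpGrowth.const 1), pois_const,
    ← hTdef, ← hy] at h1
  have h4 : Pois ν (fun H' => Real.exp (X H')) H =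
      Real.exp (-(lam * F H)) * Pois ν (fun H => Real.exp (lam * F H)) H := by
    rw [← pois_const_mul]; congr 1; funext H'
    rw [← Real.exp_add]; congr 1; simp only [hX]; ring
  have h5 : Pois ν X H = lam * Pois ν F H - lam * F H := by
    simp only [hX]
    rw [pois_const_mul, pois_sub hF.expGrowth (ExpGrowth.const _), pois_const]; ring
  have ha1 : Real.exp y - 1 ≤ 2 * y := by
    have := Real.abs_exp_sub_one_sub_id_le (x := y) (by rw [abs_of_nonneg hy0]; exact hsmall)
    have := (abs_le.1 this).2
    nlinarith
  have ha0 : 0 ≤ Real.exp y - 1 := by linarith [Real.add_one_le_exp y]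
  set a := Real.exp y - 1 with ha
  have h2y : Real.exp (2 * y) - 1 = 2 * a + a ^ 2 := by
    rw [show 2 * y = y + y by ring, Real.exp_add, ha]; ring
  have hu : T * (2 * a + a ^ 2) ≤ 8 * T * y := by nlinarith [mul_nonneg hT0 ha0, mul_nonneg (mul_nonneg hT0 ha0) ha0, mul_nonneg hT0 (sub_nonneg.2 ha1)]
  have hu0 : 0 ≤ T * (2 * a + a ^ 2) := by positivity
  have hTy : T * y ≤ T := by nlinarith
  have hb1 : Real.exp (T * (2 * a + a ^ 2)) ≤ 1 + T * (2 * a + a ^ 2) + (T * (2 * a + a ^ 2)) ^ 2 := by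
    have := Real.abs_exp_sub_one_sub_id_le (x := T * (2 * a + a ^ 2))
      (by rw [abs_of_nonneg hu0]; nlinarith)
    have := (abs_le.1 this).2
    linarith
  have hb2 : 1 + T * a ≤ Real.exp (T * a) := by linarith [Real.add_one_le_exp (T * a)]
  have hb3 : (T * (2 * a + a ^ 2)) ^ 2 ≤ T * y ^ 2 := by
    calc (T * (2 * a + a ^ 2)) ^ 2 ≤ (8 * T * y) ^ 2 := by gcongr
      _ = (64 * T) * (T * y ^ 2) := by ring
      _ ≤ 1 * (T * y ^ 2) := by gcongr
      _ = _ := one_mul _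
  have hb4 : T * a ^ 2 ≤ 4 * (T * y ^ 2) := by
    calc T * a ^ 2 ≤ T * (2 * y) ^ 2 := by gcongr
      _ = _ := by ring
  rw [h2y] at h1
  have h6 : Pois ν (fun H' => Real.exp (X H')) H ≤ 1 + Pois ν X H + 5 * (T * y ^ 2) := by
    linarith
  have hPX : -(T * y) ≤ Pois ν X H := by
    rw [h5]
    have h9 := hF.abs_pois_sub_le hν hsupp H
    have : |lam * (Pois ν F H - F H)| ≤ |lam| * (T * y₀) := by
      rw [abs_mul]; gcongr
    have := (abs_le.1 this).1
    rw [hy]; linarith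
  have h7 : 1 + Pois ν X H + 5 * (T * y ^ 2) ≤ Real.exp (Pois ν X H + 10 * T * y ^ 2) := by
    rw [Real.exp_add]
    have e1 := Real.add_one_le_exp (Pois ν X H)
    have e2 := Real.add_one_le_exp (10 * T * y ^ 2)
    have e3 : 1 / 2 ≤ Real.exp (Pois ν X H) := by linarith
    have e4 : 0 ≤ T * y ^ 2 := by positivity
    nlinarith [mul_nonneg (Real.exp_pos (Pois ν X H)).le (sub_nonneg.2 e2)]
  rw [h4] at h6
  have h8 := h6.trans h7
  calc _ = Real.exp (lam * F H) * (Real.exp (-(lam * F H)) * Pois ν (fun H => Real.exp (lam * F H)) H) := by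
        rw [← mul_assoc, ← Real.exp_add]; simp
    _ ≤ Real.exp (lam * F H) * Real.exp (Pois ν X H + 10 * T * y ^ 2) := by gcongr
    _ = _ := by rw [← Real.exp_add, h5]; congr 1; ring

/-- Sub-Gaussian moment generating function of Lipschitz functions of compound Poisson variables. -/
lemma pois_exp_le {ν : E →₀ ℝ} (hν : 0 ≤ ν) {y₀ lam : ℝ} (hy₀ : 0 ≤ y₀) (hsmall : |lam| * y₀ ≤ 1)
    (hsupp : ∀ y ∈ ν.support, ‖y‖ ≤ y₀) {F : E → ℝ} (hF : LipOne F) (H : E) :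
    Pois ν (fun H => Real.exp (lam * F H)) H ≤
      Real.exp (lam * Pois ν F H + 10 * rateTot ν * (|lam| * y₀) ^ 2) := by
  obtain ⟨n, hn⟩ := exists_nat_ge (64 * rateTot ν + 1)
  have hT0 : 0 ≤ rateTot ν := rateTot_nonneg hν
  have hn0 : (0 : ℝ) < n := by linarith
  set μ : E →₀ ℝ := (n : ℝ)⁻¹ • ν with hμ
  have hμ0 : 0 ≤ μ := fun y => by
    simpa [hμ] using mul_nonneg (inv_nonneg.2 hn0.le) (hν y)
  have hμT : rateTot μ = (n : ℝ)⁻¹ * rateTot ν := by simp [hμ]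
  have key : ∀ (k : ℕ) (H : E), Pois ((k : ℝ) • μ) (fun H => Real.exp (lam * F H)) H ≤
      Real.exp (lam * Pois ((k : ℝ) • μ) F H + k * (10 * rateTot μ * (|lam| * y₀) ^ 2)) := by
    intro k
    induction k with
    | zero => intro H; simp
    | succ k ih =>
      intro H
      have hk0 : 0 ≤ (k : ℝ) • μ := fun y => by
        simpa using mul_nonneg (Nat.cast_nonneg k) (hμ0 y)
      have hadd : ((k + 1 : ℕ) : ℝ) • μ = μ + (k : ℝ) • μ := by
        push_cast; rw [add_smul, one_smul, add_comm]
      have hFk := hF.pois hk0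
      rw [hadd, pois_add_rate (hF.expGrowth_exp lam), pois_add_rate hF.expGrowth]
      set R := (10 * rateTot μ * (|lam| * y₀) ^ 2) with hR
      calc _ ≤ Pois μ (fun H => Real.exp (k * R) * Real.exp (lam * Pois ((k : ℝ) • μ) F H)) H := by
            refine pois_mono hμ0 ((hF.expGrowth_exp lam).pois _) ((hFk.expGrowth_exp lam).const_mul _)
              (fun H => (ih H).trans (le_of_eq ?_)) H
            rw [← Real.exp_add, add_comm]
        _ = Real.exp (k * R) * Pois μ (fun H => Real.exp (lam * Pois ((k : ℝ) • μ) F H)) H :=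
            pois_const_mul _ _ _ _
        _ ≤ Real.exp (k * R) * Real.exp (lam * Pois μ (Pois ((k : ℝ) • μ) F) H + R) := by
            refine mul_le_mul_of_nonneg_left ?_ (Real.exp_pos _).le
            refine pois_exp_step hμ0 hy₀ hsmall ?_ (fun y hy => hsupp y ?_) hFk H
            · rw [hμT, ← mul_assoc, mul_comm 64, mul_assoc, inv_mul_le_iff₀ hn0]; linarith
            · exact Finsupp.support_smul hy
        _ = _ := by rw [← Real.exp_add]; congr 1; push_cast; ring
  have := key n H
  rw [hμT, show (n : ℝ) • μ = ν by rw [hμ, smul_smul, mul_inv_cancel₀ hn0.ne', one_smul]] at this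
  refine this.trans (le_of_eq ?_)
  congr 2
  field_simp

end PoissonConcentration

noncomputable section Planted

variable {S : Type*} [Fintype S] [Nonempty S]

/-- The partition function of log-weights `H`. -/
def partZ (H : S → ℝ) : ℝ := ∑ σ, Real.exp (H σ)

/-- `x ln x - x + 1`. -/
def lamZ (x : ℝ) : ℝ := LamFn x - x + 1

lemma lamZ_nonneg {x : ℝ} (hx : 0 ≤ x) : 0 ≤ lamZ x := by
  rcases hx.eq_or_lt with rfl | h
  · simp [lamZ, LamFn]
  · have h1 := Real.one_sub_inv_le_log_of_pos h
    have h2 : x * (1 - x⁻¹) ≤ x * Real.log x := by gcongr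
    rw [mul_sub, mul_inv_cancel₀ h.ne'] at h2
    unfold lamZ LamFn; linarith

lemma lamZ_le_sq {x : ℝ} (hx : 0 < x) : lamZ x ≤ (x - 1) ^ 2 := by
  have h1 := Real.log_le_sub_one_of_pos hx
  unfold lamZ LamFn; nlinarith

lemma lamZ_tangent {x y : ℝ} (hx : 0 < x) (hy : 0 < y) :
    lamZ y + Real.log y * (x - y) ≤ lamZ x := by
  have h1 := Real.one_sub_inv_le_log_of_pos (div_pos hx hy)
  rw [Real.log_div hx.ne' hy.ne', inv_div] at h1
  have h2 : x * (1 - y / x) ≤ x * (Real.log x - Real.log y) := by gcongr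
  rw [mul_sub, mul_div_cancel₀ _ hx.ne'] at h2
  unfold lamZ LamFn; nlinarith

lemma partZ_pos (H : S → ℝ) : 0 < partZ H :=
  Finset.sum_pos (fun _ _ => Real.exp_pos _) Finset.univ_nonempty

lemma partZ_zero : partZ (0 : S → ℝ) = Fintype.card S := by simp [partZ]

lemma partZ_add_le (H y : S → ℝ) : partZ (H + y) ≤ Real.exp ‖y‖ * partZ H := by
  rw [partZ, partZ, Finset.mul_sum]
  refine Finset.sum_le_sum fun σ _ => ?_
  rw [Pi.add_apply, Real.exp_add, mul_comm]
  gcongr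
  exact (le_abs_self _).trans (norm_le_pi_norm y σ)

lemma le_partZ_add (H y : S → ℝ) : Real.exp (-‖y‖) * partZ H ≤ partZ (H + y) := by
  have := partZ_add_le (H + y) (-y)
  rw [add_neg_cancel_right, norm_neg] at this
  rw [Real.exp_neg, inv_mul_le_iff₀ (Real.exp_pos _)]
  exact this

lemma lipOne_log_partZ : LipOne fun H : S → ℝ => Real.log (partZ H) := by
  intro H y
  have h1 := Real.log_le_log (partZ_pos _) (partZ_add_le H y)
  have h2 := Real.log_le_log (by have := partZ_pos H; positivity) (le_partZ_add H y)
  rw [Real.log_mul (Real.exp_pos _).ne' (partZ_pos _).ne', Real.log_exp] at h1 h2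
  rw [abs_le]; constructor <;> linarith

lemma expGrowth_exp_norm (a : ℝ) (ha : 0 ≤ a) : ExpGrowth fun H : S → ℝ => Real.exp (a * ‖H‖) :=
  ⟨1, a, zero_le_one, ha, fun H => by rw [abs_of_pos (Real.exp_pos _), one_mul]⟩

lemma expGrowth_exp_eval (σ : S) : ExpGrowth fun H : S → ℝ => Real.exp (H σ) := by
  refine (expGrowth_exp_norm 1 zero_le_one).of_abs_le fun H => ?_
  rw [abs_of_pos (Real.exp_pos _), Real.exp_le_exp, one_mul]
  exact (le_abs_self _).trans (norm_le_pi_norm H σ)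

lemma expGrowth_partZ : ExpGrowth fun H : S → ℝ => partZ H :=
  ExpGrowth.sum fun σ _ => expGrowth_exp_eval σ

lemma expGrowth_log_partZ : ExpGrowth fun H : S → ℝ => Real.log (partZ H) :=
  lipOne_log_partZ.expGrowth

lemma expGrowth_lam_partZ : ExpGrowth fun H : S → ℝ => LamFn (partZ H) :=
  expGrowth_partZ.mul expGrowth_log_partZ

/-- The ratio `Z(H+y)/Z(H)`, i.e. the Gibbs average of `exp y`. -/
def zRatio (H y : S → ℝ) : ℝ := partZ (H + y) / partZ H

lemma zRatio_pos (H y : S → ℝ) : 0 < zRatio H y := div_pos (partZ_pos _) (partZ_pos _)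

lemma zRatio_le (H y : S → ℝ) : zRatio H y ≤ Real.exp ‖y‖ := by
  rw [zRatio, div_le_iff₀ (partZ_pos _)]; exact partZ_add_le H y

lemma le_zRatio (H y : S → ℝ) : Real.exp (-‖y‖) ≤ zRatio H y := by
  rw [zRatio, le_div_iff₀ (partZ_pos _)]; exact le_partZ_add H y

lemma zRatio_mul (H y z : S → ℝ) : zRatio H y * zRatio (H + y) z = zRatio H (y + z) := by
  have h1 := (partZ_pos H).ne'
  have h2 := (partZ_pos (H + y)).ne'
  rw [zRatio, zRatio, zRatio, add_assoc]; field_simp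

/-- The compensating drift of a rate measure. -/
def drift (ν : (S → ℝ) →₀ ℝ) : S → ℝ :=
  fun σ => -(ν.sum fun y r => r * (Real.exp (y σ) - 1))

lemma drift_eq (ν : (S → ℝ) →₀ ℝ) :
    drift ν = Finsupp.linearCombination ℝ (fun (y : S → ℝ) σ => 1 - Real.exp (y σ)) ν := by
  funext σ
  rw [drift, Finsupp.linearCombination_apply, Finsupp.sum, Finsupp.sum, Finset.sum_apply,
    ← Finset.sum_neg_distrib]
  exact Finset.sum_congr rfl fun y _ => by simp; ring

@[simp] lemma drift_add (ν ν' : (S → ℝ) →₀ ℝ) : drift (ν + ν') = drift ν + drift ν' := by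
  simp [drift_eq]

@[simp] lemma drift_smul (t : ℝ) (ν : (S → ℝ) →₀ ℝ) : drift (t • ν) = t • drift ν := by
  simp [drift_eq]

@[simp] lemma drift_zero : drift (0 : (S → ℝ) →₀ ℝ) = 0 := by simp [drift_eq]

lemma drift_rateOf {X : Type*} [Fintype X] (ψ : X → S → ℝ) (r : X → ℝ) (σ : S) :
    drift (rateOf ψ r) σ = -∑ x, r x * (Real.exp (ψ x σ) - 1) := by
  rw [drift, sum_rateOf _ _ _ (by simp) (by intros; ring)]

/-- The compensated Poisson semigroup, which preserves Boltzmann weights on average. -/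
def plantedK (ν : (S → ℝ) →₀ ℝ) (F : (S → ℝ) → ℝ) (H : S → ℝ) : ℝ := Pois ν F (H + drift ν)

lemma plantedK_add_rate (ν ν' : (S → ℝ) →₀ ℝ) {F : (S → ℝ) → ℝ} (hF : ExpGrowth F) (H : S → ℝ) :
    plantedK (ν + ν') F H = plantedK ν (plantedK ν' F) H := by
  have h : plantedK ν' F = fun H => Pois ν' F (H + drift ν') := rfl
  rw [plantedK, plantedK, h, ← pois_shift (hF.pois ν'), pois_add_rate hF, drift_add, add_assoc]

lemma ExpGrowth.plantedK {F : (S → ℝ) → ℝ} (hF : ExpGrowth F) (ν : (S → ℝ) →₀ ℝ) :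
    ExpGrowth (plantedK ν F) := (hF.pois ν).add_right (drift ν)

lemma plantedK_exp_eval (ν : (S → ℝ) →₀ ℝ) (σ : S) (H : S → ℝ) :
    plantedK ν (fun H => Real.exp (H σ)) H = Real.exp (H σ) := by
  have := pois_exp (Pi.evalAddMonoidHom (fun _ : S => ℝ) σ) ν (H + drift ν)
  simp only [Pi.evalAddMonoidHom_apply] at this
  rw [plantedK, this, ← Real.exp_add]
  congr 1
  simp [drift]

lemma plantedK_weighted (ν : (S → ℝ) →₀ ℝ) (f : S → ℝ) (H : S → ℝ) :
    plantedK ν (fun H => ∑ σ, f σ * Real.exp (H σ)) H = ∑ σ, f σ * Real.exp (H σ) := by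
  rw [plantedK, pois_sum fun σ _ => (expGrowth_exp_eval σ).const_mul _]
  refine Finset.sum_congr rfl fun σ _ => ?_
  rw [pois_const_mul]; congr 1
  exact plantedK_exp_eval ν σ H

lemma plantedK_partZ (ν : (S → ℝ) →₀ ℝ) (H : S → ℝ) : plantedK ν (fun H => partZ H) H = partZ H := by
  simpa [partZ] using plantedK_weighted ν (fun _ => 1) H

lemma plantedK_partZ_add (ν : (S → ℝ) →₀ ℝ) (H y : S → ℝ) :
    plantedK ν (fun H => partZ (H + y)) H = partZ (H + y) := by
  have := plantedK_weighted ν (fun σ => Real.exp (y σ)) H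
  simpa [partZ, Real.exp_add, mul_comm] using this

/-- The planted free energy. -/
def plantedFE (ν : (S → ℝ) →₀ ℝ) : ℝ :=
  (Fintype.card S : ℝ)⁻¹ * plantedK ν (fun H => LamFn (partZ H)) 0

/-- Expectation in the planted model. -/
def plantedE (ν : (S → ℝ) →₀ ℝ) (g : (S → ℝ) → ℝ) : ℝ :=
  (Fintype.card S : ℝ)⁻¹ * plantedK ν (fun H => partZ H * g H) 0

lemma plantedE_mono {ν : (S → ℝ) →₀ ℝ} (hν : 0 ≤ ν) {g g' : (S → ℝ) → ℝ} (hg : ExpGrowth g)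
    (hg' : ExpGrowth g') (h : ∀ H, g H ≤ g' H) : plantedE ν g ≤ plantedE ν g' := by
  refine mul_le_mul_of_nonneg_left ?_ (by positivity)
  exact pois_mono hν (expGrowth_partZ.mul hg) (expGrowth_partZ.mul hg')
    (fun H => mul_le_mul_of_nonneg_left (h H) (partZ_pos H).le) _

@[simp] lemma plantedE_const (ν : (S → ℝ) →₀ ℝ) (c : ℝ) : plantedE ν (fun _ => c) = c := by
  have h : (fun H : S → ℝ => partZ H * c) = fun H => c * partZ H := by funext H; ring
  rw [plantedE, plantedK, h, pois_const_mul]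
  have := plantedK_partZ ν (0 : S → ℝ)
  rw [plantedK, partZ_zero] at this
  rw [this]; field_simp

lemma plantedE_add (ν : (S → ℝ) →₀ ℝ) {g g' : (S → ℝ) → ℝ} (hg : ExpGrowth g)
    (hg' : ExpGrowth g') : plantedE ν (fun H => g H + g' H) = plantedE ν g + plantedE ν g' := by
  simp only [plantedE, mul_add, plantedK]
  rw [pois_add (expGrowth_partZ.mul hg) (expGrowth_partZ.mul hg'), mul_add]

lemma plantedE_const_mul (ν : (S → ℝ) →₀ ℝ) (c : ℝ) (g : (S → ℝ) → ℝ) :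
    plantedE ν (fun H => c * g H) = c * plantedE ν g := by
  simp only [plantedE, plantedK, mul_left_comm _ c]
  rw [pois_const_mul, mul_left_comm]

lemma plantedE_sub (ν : (S → ℝ) →₀ ℝ) {g g' : (S → ℝ) → ℝ} (hg : ExpGrowth g)
    (hg' : ExpGrowth g') : plantedE ν (fun H => g H - g' H) = plantedE ν g - plantedE ν g' := by
  simp only [plantedE, mul_sub, plantedK]
  rw [pois_sub (expGrowth_partZ.mul hg) (expGrowth_partZ.mul hg'), mul_sub]

lemma plantedE_sum {X : Type*} {s : Finset X} (ν : (S → ℝ) →₀ ℝ) {g : X → (S → ℝ) → ℝ}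
    (hg : ∀ x ∈ s, ExpGrowth (g x)) :
    plantedE ν (fun H => ∑ x ∈ s, g x H) = ∑ x ∈ s, plantedE ν (g x) := by
  simp only [plantedE, plantedK, Finset.mul_sum]
  rw [pois_sum fun x hx => expGrowth_partZ.mul (hg x hx), Finset.mul_sum]

lemma plantedE_nonneg {ν : (S → ℝ) →₀ ℝ} (hν : 0 ≤ ν) {g : (S → ℝ) → ℝ} (hg : ExpGrowth g)
    (h : ∀ H, 0 ≤ g H) : 0 ≤ plantedE ν g := by
  simpa using plantedE_mono hν (ExpGrowth.const 0) hg h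

/-- The Gibbs average. -/
def gibbs (H f : S → ℝ) : ℝ := (∑ σ, f σ * Real.exp (H σ)) / partZ H

lemma plantedE_gibbs (ν : (S → ℝ) →₀ ℝ) (f : S → ℝ) :
    plantedE ν (fun H => gibbs H f) = (Fintype.card S : ℝ)⁻¹ * ∑ σ, f σ := by
  rw [plantedE]
  congr 1
  have h : (fun H : S → ℝ => partZ H * gibbs H f) = fun H => ∑ σ, f σ * Real.exp (H σ) := by
    funext H; rw [gibbs, mul_div_cancel₀ _ (partZ_pos H).ne']
  rw [h, plantedK_weighted]; simp

/-- The planted expectation as an average over ground truths. -/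
lemma plantedE_eq_avg (ν : (S → ℝ) →₀ ℝ) {g : (S → ℝ) → ℝ} (hg : ExpGrowth g) :
    plantedE ν g = (Fintype.card S : ℝ)⁻¹ *
      ∑ σ, Pois (tilt (Pi.evalAddMonoidHom (fun _ : S => ℝ) σ) ν) g (drift ν) := by
  rw [plantedE, plantedK]
  congr 1
  simp only [partZ, Finset.sum_mul]
  rw [pois_sum fun σ _ => (expGrowth_exp_eval σ).mul hg]
  refine Finset.sum_congr rfl fun σ _ => ?_
  have := pois_exp_mul (Pi.evalAddMonoidHom (fun _ : S => ℝ) σ) ν g (0 + drift ν)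
  simp only [Pi.evalAddMonoidHom_apply] at this
  rw [this, ← Real.exp_add, zero_add]
  simp [drift]

lemma lamZ_div_partZ_nonneg (H H' : S → ℝ) : 0 ≤ lamZ (partZ H' / partZ H) :=
  lamZ_nonneg (div_pos (partZ_pos _) (partZ_pos _)).le

lemma lamZ_zRatio_le (H y : S → ℝ) : lamZ (zRatio H y) ≤ Real.exp (2 * ‖y‖) + 1 := by
  have h1 := zRatio_pos H y
  have h2 := lamZ_le_sq h1
  have h3 := zRatio_le H y
  have h4 : Real.exp (2 * ‖y‖) = Real.exp ‖y‖ ^ 2 := by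
    rw [two_mul, Real.exp_add]; ring
  rw [h4]; nlinarith

lemma lamZ_div_partZ_le (H H' : S → ℝ) :
    lamZ (partZ H' / partZ H) ≤ Real.exp (2 * ‖H' - H‖) + 1 := by
  have := lamZ_zRatio_le H (H' - H)
  rwa [zRatio, add_sub_cancel] at this

lemma expGrowth_exp_norm_sub (H : S → ℝ) : ExpGrowth fun H' : S → ℝ => Real.exp (2 * ‖H' - H‖) + 1 := by
  have := ((expGrowth_exp_norm 2 zero_le_two).add_right (-H)).add (ExpGrowth.const 1)
  simpa [sub_eq_add_neg] using this

lemma expGrowth_lamZ_div (H : S → ℝ) : ExpGrowth fun H' : S → ℝ => lamZ (partZ H' / partZ H) :=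
  (expGrowth_exp_norm_sub H).of_abs_le fun H' => by
    rw [abs_of_nonneg (lamZ_div_partZ_nonneg H H')]; exact lamZ_div_partZ_le _ _

/-- The expected entropy gain at state `H` when `δ` is added. -/
def kGain (δ : (S → ℝ) →₀ ℝ) (H : S → ℝ) : ℝ :=
  plantedK δ (fun H' => lamZ (partZ H' / partZ H)) H

lemma kGain_nonneg {δ : (S → ℝ) →₀ ℝ} (hδ : 0 ≤ δ) (H : S → ℝ) : 0 ≤ kGain δ H :=
  pois_nonneg hδ (expGrowth_lamZ_div H) (lamZ_div_partZ_nonneg H) _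

lemma kGain_le {δ : (S → ℝ) →₀ ℝ} (hδ : 0 ≤ δ) (H : S → ℝ) :
    kGain δ H ≤ Pois δ (fun H' => Real.exp (2 * ‖H'‖) + 1) (drift δ) := by
  have h1 := pois_mono hδ (expGrowth_lamZ_div H) (expGrowth_exp_norm_sub H) (lamZ_div_partZ_le H)
    (H + drift δ)
  refine h1.trans (le_of_eq ?_)
  rw [add_comm, pois_shift (expGrowth_exp_norm_sub H)]
  simp

lemma expGrowth_kGain {δ : (S → ℝ) →₀ ℝ} (hδ : 0 ≤ δ) : ExpGrowth (kGain δ) :=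
  (ExpGrowth.const _).of_abs_le fun H => by
    rw [abs_of_nonneg (kGain_nonneg hδ H)]; exact kGain_le hδ H

lemma plantedK_lam_partZ (δ : (S → ℝ) →₀ ℝ) (H : S → ℝ) :
    plantedK δ (fun H => LamFn (partZ H)) H = LamFn (partZ H) + partZ H * kGain δ H := by
  have h0 := (partZ_pos H).ne'
  have h : (fun H' : S → ℝ => LamFn (partZ H')) = fun H' =>
      partZ H * lamZ (partZ H' / partZ H) + ((Real.log (partZ H) + 1) * partZ H' + -partZ H) := by
    funext H'
    have h1 := (partZ_pos H').ne'
    simp only [lamZ, LamFn, Real.log_div h1 h0]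
    field_simp; ring
  have hK := plantedK_partZ δ H
  simp only [plantedK] at hK
  rw [kGain, plantedK, plantedK, h, pois_add ((expGrowth_lamZ_div H).const_mul _)
    ((expGrowth_partZ.const_mul _).add (ExpGrowth.const _)), pois_const_mul,
    pois_add (expGrowth_partZ.const_mul _) (ExpGrowth.const _), pois_const_mul, hK, pois_const]
  rw [LamFn]; ring

/-- Entropy gain when `δ` is added. -/
lemma plantedFE_add (ν : (S → ℝ) →₀ ℝ) {δ : (S → ℝ) →₀ ℝ} (hδ : 0 ≤ δ) :
    plantedFE (ν + δ) = plantedFE ν + plantedE ν (kGain δ) := by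
  rw [plantedFE, plantedK_add_rate _ _ expGrowth_lam_partZ, plantedFE, plantedE, ← mul_add]
  congr 1
  rw [plantedK, plantedK, plantedK, ← pois_add expGrowth_lam_partZ
    (expGrowth_partZ.mul (expGrowth_kGain hδ))]
  congr 1
  funext H
  exact plantedK_lam_partZ δ H

/-- First-order entropy gain. -/
def entGain (δ : (S → ℝ) →₀ ℝ) (H : S → ℝ) : ℝ := δ.sum fun y r => r * lamZ (zRatio H y)

lemma entGain_rateOf {X : Type*} [Fintype X] (ψ : X → S → ℝ) (r : X → ℝ) (H : S → ℝ) :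
    entGain (rateOf ψ r) H = ∑ x, r x * lamZ (zRatio H (ψ x)) :=
  sum_rateOf _ _ _ (by simp) (by intros; ring)

lemma entGain_nonneg {δ : (S → ℝ) →₀ ℝ} (hδ : 0 ≤ δ) (H : S → ℝ) : 0 ≤ entGain δ H :=
  Finset.sum_nonneg fun y _ => mul_nonneg (hδ y) (lamZ_nonneg (zRatio_pos H y).le)

lemma entGain_le {δ : (S → ℝ) →₀ ℝ} (hδ : 0 ≤ δ) (H : S → ℝ) :
    entGain δ H ≤ δ.sum fun y r => r * (Real.exp (2 * ‖y‖) + 1) :=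
  Finset.sum_le_sum fun y _ => mul_le_mul_of_nonneg_left (lamZ_zRatio_le H y) (hδ y)

lemma expGrowth_lamZ_zRatio (y : S → ℝ) : ExpGrowth fun H => lamZ (zRatio H y) :=
  (ExpGrowth.const (Real.exp (2 * ‖y‖) + 1)).of_abs_le fun H => by
    rw [abs_of_nonneg (lamZ_nonneg (zRatio_pos H y).le)]; exact lamZ_zRatio_le H y

lemma expGrowth_entGain (δ : (S → ℝ) →₀ ℝ) : ExpGrowth (entGain δ) :=
  ExpGrowth.sum fun y _ => (expGrowth_lamZ_zRatio y).const_mul _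

lemma jumpOp_lamZ_div (δ : (S → ℝ) →₀ ℝ) (H z : S → ℝ) :
    jumpOp δ (fun H' => lamZ (partZ H' / partZ H)) (H + z) =
      δ.sum fun y r => r * lamZ (zRatio H (y + z)) := by
  rw [jumpOp_apply]
  refine Finset.sum_congr rfl fun y _ => ?_
  simp only [zRatio]
  rw [add_assoc, add_comm z y]

lemma lamZ_zRatio_add_ge (H y b : S → ℝ) {s : ℝ} (hs0 : 0 ≤ s) (hs1 : s ≤ 1) :
    lamZ (zRatio H y) - s * (‖y‖ * Real.exp ‖y‖ * (‖b‖ * Real.exp ‖b‖)) ≤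
      lamZ (zRatio H (y + s • b)) := by
  have hr := zRatio_pos H y
  have h1 := lamZ_tangent (zRatio_pos H (y + s • b)) hr
  have hlog : |Real.log (zRatio H y)| ≤ ‖y‖ := by
    have e1 := Real.log_le_log hr (zRatio_le H y)
    have e2 := Real.log_le_log (Real.exp_pos _) (le_zRatio H y)
    rw [Real.log_exp] at e1 e2
    rw [abs_le]; constructor <;> linarith
  have hsb : ‖s • b‖ = s * ‖b‖ := by rw [norm_smul, Real.norm_of_nonneg hs0]
  have hdiff : |zRatio H (y + s • b) - zRatio H y| ≤ Real.exp ‖y‖ * (s * (‖b‖ * Real.exp ‖b‖)) := by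
    rw [← zRatio_mul, ← mul_sub_one, abs_mul, abs_of_pos hr]
    refine mul_le_mul (zRatio_le H y) ?_ (abs_nonneg _) (Real.exp_pos _).le
    have e1 := zRatio_le (H + y) (s • b)
    have e2 := le_zRatio (H + y) (s • b)
    rw [hsb] at e1 e2
    have e3 := Real.add_one_le_exp (-(s * ‖b‖))
    have e4 : 1 ≤ Real.exp ‖b‖ := Real.one_le_exp (norm_nonneg _)
    have e5 : Real.exp (s * ‖b‖) - 1 ≤ s * ‖b‖ * Real.exp ‖b‖ := by
      have f1 : Real.exp (s * ‖b‖) * Real.exp (-(s * ‖b‖)) = 1 := by rw [← Real.exp_add]; simp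
      have f2 : Real.exp (s * ‖b‖) ≤ Real.exp ‖b‖ :=
        Real.exp_le_exp.2 (by nlinarith [norm_nonneg b])
      have f3 := Real.exp_pos (s * ‖b‖)
      have f4 : 0 ≤ s * ‖b‖ := by positivity
      nlinarith
    have e6 : 0 ≤ s * ‖b‖ := by positivity
    rw [abs_le]; constructor <;> nlinarith
  have h2 : |Real.log (zRatio H y) * (zRatio H (y + s • b) - zRatio H y)| ≤
      ‖y‖ * (Real.exp ‖y‖ * (s * (‖b‖ * Real.exp ‖b‖))) := by
    rw [abs_mul]; gcongr
  have h3 := (abs_le.1 h2).1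
  linarith

lemma kGain_smul_ge {δ : (S → ℝ) →₀ ℝ} (hδ : 0 ≤ δ) :
    ∃ C, ∀ (H : S → ℝ) (s : ℝ), 0 ≤ s → s ≤ 1 → s * entGain δ H - C * s ^ 2 ≤ kGain (s • δ) H := by
  set M := δ.sum fun y r => r * (Real.exp (2 * ‖y‖) + 1) with hM
  set b := drift δ with hb
  set D := δ.sum fun y r => r * (‖y‖ * Real.exp ‖y‖ * (‖b‖ * Real.exp ‖b‖)) with hD
  have hT := rateTot_nonneg hδ
  have hD0 : 0 ≤ D := Finset.sum_nonneg fun y _ => mul_nonneg (hδ y) (by positivity)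
  refine ⟨rateTot δ * M + D, fun H s hs0 hs1 => ?_⟩
  have hsδ : 0 ≤ s • δ := fun y => by simpa using mul_nonneg hs0 (hδ y)
  have h1 : Real.exp (-(s * rateTot δ)) * (s * (δ.sum fun y r => r * lamZ (zRatio H (y + s • b)))) ≤
      kGain (s • δ) H := by
    rw [kGain, plantedK, Pois, rateTot_smul]
    refine mul_le_mul_of_nonneg_left ?_ (Real.exp_pos _).le
    have := ((expGrowth_lamZ_div H).summable (s • δ) (H + drift (s • δ))).le_tsum 1 (fun m _ => by
      refine div_nonneg ?_ (by positivity)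
      have := jumpOp_pow_mono hsδ (lamZ_div_partZ_nonneg H) m (H + drift (s • δ))
      rw [jump_pow_const] at this
      simpa using this)
    refine le_trans (le_of_eq ?_) this
    rw [pow_one, jumpOp_smul, LinearMap.smul_apply, Pi.smul_apply, jumpOp_lamZ_div, drift_smul]
    simp [hb]
  have h2 : entGain δ H - s * D ≤ δ.sum fun y r => r * lamZ (zRatio H (y + s • b)) := by
    rw [entGain, hD, Finsupp.sum, Finsupp.sum, Finsupp.sum, Finset.mul_sum, ← Finset.sum_sub_distrib]
    refine Finset.sum_le_sum fun y _ => ?_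
    have := mul_le_mul_of_nonneg_left (lamZ_zRatio_add_ge H y b hs0 hs1) (hδ y)
    linarith
  have h2' : 0 ≤ δ.sum fun y r => r * lamZ (zRatio H (y + s • b)) :=
    Finset.sum_nonneg fun y _ => mul_nonneg (hδ y) (lamZ_nonneg (zRatio_pos H _).le)
  have h3 := Real.add_one_le_exp (-(s * rateTot δ))
  have h4 : Real.exp (-(s * rateTot δ)) ≤ 1 := Real.exp_le_one_iff.2 (by nlinarith [mul_nonneg hs0 hT])
  have h5 := entGain_le hδ H
  have h6 := entGain_nonneg hδ H
  refine le_trans ?_ h1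
  have h7 : Real.exp (-(s * rateTot δ)) * (s * (entGain δ H - s * D)) ≤
      Real.exp (-(s * rateTot δ)) * (s * (δ.sum fun y r => r * lamZ (zRatio H (y + s • b)))) := by
    gcongr
  refine le_trans ?_ h7
  have h8 : s * entGain δ H * (1 - s * rateTot δ) ≤ s * entGain δ H * Real.exp (-(s * rateTot δ)) :=
    mul_le_mul_of_nonneg_left (by linarith) (by positivity)
  have h9 : Real.exp (-(s * rateTot δ)) * (s ^ 2 * D) ≤ 1 * (s ^ 2 * D) := by gcongr
  have h10 : s ^ 2 * rateTot δ * entGain δ H ≤ s ^ 2 * rateTot δ * M := by gcongr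
  nlinarith

lemma kGain_smul_le {δ : (S → ℝ) →₀ ℝ} (hδ : 0 ≤ δ) (hb : drift δ = 0) :
    ∃ C, ∀ (H : S → ℝ) (s : ℝ), 0 ≤ s → s ≤ 1 → kGain (s • δ) H ≤ s * entGain δ H + C * s ^ 2 := by
  refine ⟨Real.exp (rateTot δ) * Pois δ (fun H' => Real.exp (2 * ‖H'‖) + 1) (drift δ),
    fun H s hs0 hs1 => ?_⟩
  set G := fun H' : S → ℝ => lamZ (partZ H' / partZ H) with hG
  have hGg : ExpGrowth G := expGrowth_lamZ_div H
  have hT := rateTot_nonneg hδ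
  have hpos : ∀ m : ℕ, 0 ≤ (jumpOp δ ^ m) G H := fun m => by
    have := jumpOp_pow_mono hδ (lamZ_div_partZ_nonneg H) m H
    rw [jump_pow_const] at this
    simpa using this
  have h1 : kGain (s • δ) H = Real.exp (-(s * rateTot δ)) *
      ∑' m : ℕ, s ^ m * (jumpOp δ ^ m) G H / m.factorial := by
    rw [kGain, plantedK, drift_smul, hb, smul_zero, add_zero, Pois, rateTot_smul]
    congr 2; funext m
    rw [jumpOp_smul, smul_pow]; rfl
  have hs := (hGg.summable δ H)
  have h2 : ∑' m : ℕ, s ^ m * (jumpOp δ ^ m) G H / m.factorial ≤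
      s * entGain δ H + s ^ 2 * ∑' m : ℕ, (jumpOp δ ^ m) G H / m.factorial := by
    have hsum : Summable fun m : ℕ => s ^ m * (jumpOp δ ^ m) G H / m.factorial := by
      refine hs.of_nonneg_of_le (fun m => div_nonneg (mul_nonneg (pow_nonneg hs0 _) (hpos m)) (by positivity)) fun m => ?_
      have := pow_le_one₀ hs0 hs1 (n := m)
      have := hpos m
      gcongr
      nlinarith
    have hj : jumpOp δ G H = entGain δ H := by
      have := jumpOp_lamZ_div δ H 0
      simpa [entGain] using this
    have h0 : G H = 0 := by
      simp [hG, lamZ, LamFn, div_self (partZ_pos H).ne']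
    have hsp := hasSum_single (f := fun m : ℕ => if m = 1 then s * entGain δ H else 0) 1
      (fun m hm => if_neg hm)
    simp only [if_true] at hsp
    refine hasSum_le (fun m => ?_) hsum.hasSum (hsp.add (hs.hasSum.mul_left (s ^ 2)))
    match m with
    | 0 => simp [h0]
    | 1 =>
      have := entGain_nonneg hδ H
      simp [hj]; positivity
    | m + 2 =>
      have := hpos (m + 2)
      have e : s ^ (m + 2) ≤ s ^ 2 := pow_le_pow_of_le_one hs0 hs1 (by omega)
      simp only [show m + 2 ≠ 1 by omega, if_false, zero_add, ← mul_div_assoc]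
      gcongr
  have h3 : ∑' m : ℕ, (jumpOp δ ^ m) G H / m.factorial = Real.exp (rateTot δ) * kGain δ H := by
    rw [kGain, plantedK, hb, add_zero, Pois, ← mul_assoc, ← Real.exp_add]; simp [hG]
  have h4 := kGain_le hδ H
  have h5 : Real.exp (-(s * rateTot δ)) ≤ 1 := Real.exp_le_one_iff.2 (by nlinarith [mul_nonneg hs0 hT])
  have h6 := entGain_nonneg hδ H
  have h7 := kGain_nonneg hδ H
  rw [h1]
  rw [h3] at h2
  calc _ ≤ Real.exp (-(s * rateTot δ)) * (s * entGain δ H + s ^ 2 * (Real.exp (rateTot δ) * kGain δ H)) := by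
        gcongr
    _ ≤ 1 * (s * entGain δ H + s ^ 2 * (Real.exp (rateTot δ) * kGain δ H)) := by gcongr
    _ ≤ s * entGain δ H + s ^ 2 * (Real.exp (rateTot δ) * Pois δ (fun H' => Real.exp (2 * ‖H'‖) + 1) (drift δ)) := by
        rw [one_mul]; gcongr
    _ = _ := by ring

lemma plantedFE_smul_ge {δ : (S → ℝ) →₀ ℝ} (hδ : 0 ≤ δ) :
    ∃ C, ∀ ν : (S → ℝ) →₀ ℝ, 0 ≤ ν → ∀ s : ℝ, 0 ≤ s → s ≤ 1 →
      plantedFE ν + s * plantedE ν (entGain δ) - C * s ^ 2 ≤ plantedFE (ν + s • δ) := by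
  obtain ⟨C, hC⟩ := kGain_smul_ge hδ
  refine ⟨C, fun ν hν s hs0 hs1 => ?_⟩
  have hsδ : 0 ≤ s • δ := fun y => by simpa using mul_nonneg hs0 (hδ y)
  have := plantedE_mono hν (((expGrowth_entGain δ).const_mul s).sub (ExpGrowth.const (C * s ^ 2)))
    (expGrowth_kGain hsδ) (fun H => hC H s hs0 hs1)
  rw [plantedE_sub _ ((expGrowth_entGain δ).const_mul s) (ExpGrowth.const _), plantedE_const,
    plantedE_const_mul] at this
  rw [plantedFE_add ν hsδ]; linarith

lemma plantedFE_smul_le {δ : (S → ℝ) →₀ ℝ} (hδ : 0 ≤ δ) (hb : drift δ = 0) :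
    ∃ C, ∀ ν : (S → ℝ) →₀ ℝ, 0 ≤ ν → ∀ s : ℝ, 0 ≤ s → s ≤ 1 →
      plantedFE (ν + s • δ) ≤ plantedFE ν + s * plantedE ν (entGain δ) + C * s ^ 2 := by
  obtain ⟨C, hC⟩ := kGain_smul_le hδ hb
  refine ⟨C, fun ν hν s hs0 hs1 => ?_⟩
  have hsδ : 0 ≤ s • δ := fun y => by simpa using mul_nonneg hs0 (hδ y)
  have := plantedE_mono hν (expGrowth_kGain hsδ)
    (((expGrowth_entGain δ).const_mul s).add (ExpGrowth.const (C * s ^ 2)))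
    (fun H => hC H s hs0 hs1)
  rw [plantedE_add _ ((expGrowth_entGain δ).const_mul s) (ExpGrowth.const _), plantedE_const,
    plantedE_const_mul] at this
  rw [plantedFE_add ν hsδ]; linarith

/-- A function with increments at least `s L - C s²` grows by at least `L` over the unit interval. -/
lemma le_sub_of_increments {f : ℝ → ℝ} {L C : ℝ}
    (h : ∀ t s : ℝ, 0 ≤ t → 0 ≤ s → t + s ≤ 1 → f t + s * L - C * s ^ 2 ≤ f (t + s)) :
    f 0 + L ≤ f 1 := by
  have key : ∀ N : ℕ, 0 < N → f 0 + L - C / N ≤ f 1 := by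
    intro N hN
    have hN' : (0 : ℝ) < N := by exact_mod_cast hN
    have : ∀ k : ℕ, k ≤ N → f 0 + k * (L / N - C / N ^ 2) ≤ f (k / N) := by
      intro k
      induction k with
      | zero => intro _; simp
      | succ k ih =>
        intro hk
        have h1 := ih (by omega)
        have hkN : ((k : ℝ) + 1) ≤ N := by exact_mod_cast hk
        have h2 := h (k / N) (1 / N) (by positivity) (by positivity)
          (by rw [← add_div, div_le_one hN']; exact hkN)
        rw [← add_div] at h2
        push_cast
        calc f 0 + (k + 1) * (L / N - C / N ^ 2) = (f 0 + k * (L / N - C / N ^ 2)) + 1 / N * L - C * (1 / N) ^ 2 := by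
              field_simp; ring
          _ ≤ _ := by linarith
    have h1 := this N le_rfl
    rw [div_self hN'.ne'] at h1
    refine le_trans (le_of_eq ?_) h1
    field_simp; ring
  have hlim : Filter.Tendsto (fun N : ℕ => f 0 + L - C / N) Filter.atTop (nhds (f 0 + L - 0)) :=
    tendsto_const_nhds.sub (tendsto_const_div_atTop_nhds_zero_nat C)
  rw [sub_zero] at hlim
  exact le_of_tendsto hlim (Filter.eventually_atTop.2 ⟨1, fun N hN => key N hN⟩)

lemma lamZ_zRatio_le_plantedK (ν : (S → ℝ) →₀ ℝ) (hν : 0 ≤ ν) (y H : S → ℝ) :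
    partZ H * lamZ (zRatio H y) ≤ plantedK ν (fun H => partZ H * lamZ (zRatio H y)) H := by
  set r := zRatio H y with hr
  have hrp : 0 < r := zRatio_pos H y
  have hg : ExpGrowth fun H' : S → ℝ => partZ (H' + y) := expGrowth_partZ.add_right y
  have h1 := pois_mono hν (F := fun H' => (lamZ r - Real.log r * r) * partZ H' + Real.log r * partZ (H' + y))
    (G := fun H => partZ H * lamZ (zRatio H y)) ((expGrowth_partZ.const_mul _).add (hg.const_mul _))
    (expGrowth_partZ.mul (expGrowth_lamZ_zRatio y)) (fun H' => by
      have h2 := mul_le_mul_of_nonneg_left (lamZ_tangent (zRatio_pos H' y) hrp) (partZ_pos H').le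
      have h3 : partZ H' * zRatio H' y = partZ (H' + y) := by
        rw [zRatio, mul_div_cancel₀ _ (partZ_pos H').ne']
      refine le_trans (le_of_eq ?_) h2
      rw [← h3]; ring) (H + drift ν)
  rw [pois_add (expGrowth_partZ.const_mul _) (hg.const_mul _), pois_const_mul, pois_const_mul] at h1
  have e1 := plantedK_partZ ν H
  have e2 := plantedK_partZ_add ν H y
  simp only [plantedK] at e1 e2
  rw [e1, e2] at h1
  refine le_trans (le_of_eq ?_) h1
  have h3 : partZ H * r = partZ (H + y) := by
    rw [hr, zRatio, mul_div_cancel₀ _ (partZ_pos H).ne']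
  rw [← h3]; ring

lemma plantedE_lamZ_zRatio_mono {ν ν' : (S → ℝ) →₀ ℝ} (hν : 0 ≤ ν) (hν' : 0 ≤ ν') (y : S → ℝ) :
    plantedE ν (fun H => lamZ (zRatio H y)) ≤ plantedE (ν + ν') fun H => lamZ (zRatio H y) := by
  refine mul_le_mul_of_nonneg_left ?_ (by positivity)
  have hg : ExpGrowth fun H : S → ℝ => partZ H * lamZ (zRatio H y) :=
    expGrowth_partZ.mul (expGrowth_lamZ_zRatio y)
  rw [plantedK_add_rate _ _ hg]
  exact pois_mono hν hg (hg.plantedK ν') (lamZ_zRatio_le_plantedK ν' hν' y) _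

lemma plantedE_entGain (ν δ : (S → ℝ) →₀ ℝ) :
    plantedE ν (entGain δ) = δ.sum fun y r => r * plantedE ν (fun H => lamZ (zRatio H y)) := by
  have h : entGain δ = fun H : S → ℝ => ∑ y ∈ δ.support, δ y * lamZ (zRatio H y) := rfl
  rw [h, plantedE_sum _ fun y _ => (expGrowth_lamZ_zRatio y).const_mul _]
  exact Finset.sum_congr rfl fun y _ => plantedE_const_mul _ _ _

lemma plantedE_entGain_mono {ν ν' δ : (S → ℝ) →₀ ℝ} (hν : 0 ≤ ν) (hν' : 0 ≤ ν') (hδ : 0 ≤ δ) :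
    plantedE ν (entGain δ) ≤ plantedE (ν + ν') (entGain δ) := by
  rw [plantedE_entGain, plantedE_entGain]
  exact Finset.sum_le_sum fun y _ =>
    mul_le_mul_of_nonneg_left (plantedE_lamZ_zRatio_mono hν hν' y) (hδ y)

/-- The planted free energy increases at least by the first-order entropy gain. -/
lemma plantedFE_add_ge {ν δ : (S → ℝ) →₀ ℝ} (hν : 0 ≤ ν) (hδ : 0 ≤ δ) :
    plantedFE ν + plantedE ν (entGain δ) ≤ plantedFE (ν + δ) := by
  obtain ⟨C, hC⟩ := plantedFE_smul_ge hδ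
  have hs : ∀ t : ℝ, 0 ≤ t → 0 ≤ t • δ := fun t ht y => by simpa using mul_nonneg ht (hδ y)
  have := le_sub_of_increments (f := fun t => plantedFE (ν + t • δ)) (L := plantedE ν (entGain δ))
    (C := C) (fun t s ht hs0 hts => by
      have h1 := hC (ν + t • δ) (add_nonneg hν (hs t ht)) s hs0 (by linarith)
      have h2 := plantedE_entGain_mono hν (hs t ht) hδ
      rw [add_assoc, ← add_smul] at h1
      have := mul_le_mul_of_nonneg_left h2 hs0
      linarith)
  simpa using this

lemma plantedFE_mono {ν δ : (S → ℝ) →₀ ℝ} (hν : 0 ≤ ν) (hδ : 0 ≤ δ) :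
    plantedFE ν ≤ plantedFE (ν + δ) := by
  have := plantedE_nonneg hν (expGrowth_entGain δ) (entGain_nonneg hδ)
  linarith [plantedFE_add_ge hν hδ]

end Planted

noncomputable section AddSpin

variable {S S' : Type*} [Fintype S] [Nonempty S] [Fintype S'] [Nonempty S']

lemma zRatio_eq_gibbs (H y : S → ℝ) : zRatio H y = gibbs H fun σ => Real.exp (y σ) := by
  simp [zRatio, gibbs, partZ, Real.exp_add, mul_comm]

lemma gibbs_add (H f g : S → ℝ) : gibbs H (fun σ => f σ + g σ) = gibbs H f + gibbs H g := by
  simp [gibbs, add_mul, Finset.sum_add_distrib, add_div]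

lemma gibbs_const_mul (H : S → ℝ) (c : ℝ) (f : S → ℝ) :
    gibbs H (fun σ => c * f σ) = c * gibbs H f := by
  simp [gibbs, mul_assoc, ← Finset.mul_sum, mul_div_assoc]

lemma gibbs_const (H : S → ℝ) (c : ℝ) : gibbs H (fun _ => c) = c := by
  rw [gibbs, ← Finset.mul_sum, ← partZ, mul_div_assoc, div_self (partZ_pos H).ne', mul_one]

lemma gibbs_sub (H f g : S → ℝ) : gibbs H (fun σ => f σ - g σ) = gibbs H f - gibbs H g := by
  simp [gibbs, sub_mul, Finset.sum_sub_distrib, sub_div]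

lemma gibbs_sum {X : Type*} (s : Finset X) (H : S → ℝ) (f : X → S → ℝ) :
    gibbs H (fun σ => ∑ x ∈ s, f x σ) = ∑ x ∈ s, gibbs H (f x) := by
  simp only [gibbs, Finset.sum_mul, Finset.sum_div]
  rw [Finset.sum_comm]

lemma gibbs_mono (H : S → ℝ) {f g : S → ℝ} (h : ∀ σ, f σ ≤ g σ) : gibbs H f ≤ gibbs H g :=
  div_le_div_of_nonneg_right (Finset.sum_le_sum fun σ _ =>
    mul_le_mul_of_nonneg_right (h σ) (Real.exp_pos _).le) (partZ_pos H).le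

lemma gibbs_nonneg (H : S → ℝ) {f : S → ℝ} (h : ∀ σ, 0 ≤ f σ) : 0 ≤ gibbs H f := by
  simpa [gibbs_const] using gibbs_mono H h

lemma gibbs_mem_Icc (H : S → ℝ) {f : S → ℝ} {a b : ℝ} (h : ∀ σ, f σ ∈ Set.Icc a b) :
    gibbs H f ∈ Set.Icc a b :=
  ⟨by simpa [gibbs_const] using gibbs_mono H fun σ => (h σ).1,
    by simpa [gibbs_const] using gibbs_mono H fun σ => (h σ).2⟩

lemma abs_gibbs_le (H : S → ℝ) {f : S → ℝ} {b : ℝ} (h : ∀ σ, |f σ| ≤ b) : |gibbs H f| ≤ b :=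
  abs_le.2 (gibbs_mem_Icc H fun σ => abs_le.1 (h σ))

/-- Pulling log-weights back along `r : S' → S`. -/
def pullPot (r : S' → S) : (S → ℝ) →+ (S' → ℝ) where
  toFun H := fun σ => H (r σ)
  map_zero' := rfl
  map_add' _ _ := rfl

@[simp] lemma pullPot_apply (r : S' → S) (H : S → ℝ) (σ : S') : pullPot r H σ = H (r σ) := rfl

lemma drift_mapDomain (r : S' → S) (ν : (S → ℝ) →₀ ℝ) :
    drift (ν.mapDomain (pullPot r)) = pullPot r (drift ν) := by
  rw [drift_eq, drift_eq, Finsupp.linearCombination_mapDomain]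
  ext σ
  simp [Finsupp.linearCombination_apply, Finsupp.sum, Finset.sum_apply]

/-- The expected value of `Λ` of the partition function ratio when the factors `δ` are added
after pulling back along `r`. -/
def vertexGain (r : S' → S) (δ : (S' → ℝ) →₀ ℝ) (H : S → ℝ) : ℝ :=
  plantedK δ (fun H' => LamFn (partZ H' / partZ H)) (pullPot r H)

lemma LamFn_le_of_le {x b : ℝ} (hx : 0 < x) (hb : x ≤ Real.exp b) (hb0 : -b ≤ Real.log x) :
    |LamFn x| ≤ Real.exp b * b := by
  rw [LamFn, abs_mul, abs_of_pos hx]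
  have : |Real.log x| ≤ b := abs_le.2 ⟨hb0, by
    rw [Real.log_le_iff_le_exp hx]; exact hb⟩
  exact mul_le_mul hb this (abs_nonneg _) (Real.exp_pos _).le

lemma LamFn_mul {x y : ℝ} (hx : 0 < x) (hy : 0 < y) :
    LamFn (x * y) = x * LamFn y + x * y * Real.log x := by
  rw [LamFn, LamFn, Real.log_mul hx.ne' hy.ne']; ring

lemma expGrowth_LamFn_div (a : ℝ) (ha : 0 < a) :
    ExpGrowth fun H : S → ℝ => LamFn (partZ H / a) := by
  have : (fun H : S → ℝ => LamFn (partZ H / a)) =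
      fun H => a⁻¹ * LamFn (partZ H) + (a⁻¹ * Real.log a⁻¹) * partZ H := by
    ext H
    rw [div_eq_mul_inv, mul_comm, LamFn_mul (inv_pos.2 ha) (partZ_pos H)]; ring
  rw [this]
  exact (expGrowth_lam_partZ.const_mul _).add (expGrowth_partZ.const_mul _)

lemma partZ_mul_vertexGain (r : S' → S) (δ : (S' → ℝ) →₀ ℝ) (H : S → ℝ) :
    partZ H * vertexGain r δ H = plantedK δ (fun H' => LamFn (partZ H')) (pullPot r H) -
      partZ (pullPot r H) * Real.log (partZ H) := by
  have h1 := plantedK_partZ δ (pullPot r H)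
  rw [vertexGain, plantedK] at *
  rw [← pois_const_mul]
  have : (fun H' : S' → ℝ => partZ H * LamFn (partZ H' / partZ H)) =
      fun H' => LamFn (partZ H') - Real.log (partZ H) * partZ H' := by
    ext H'
    have := LamFn_mul (partZ_pos H) (div_pos (partZ_pos H') (partZ_pos H))
    have h2 : partZ H * (partZ H' / partZ H) = partZ H' := mul_div_cancel₀ _ (partZ_pos H).ne'
    rw [h2] at this
    linarith
  rw [this, pois_sub expGrowth_lam_partZ (expGrowth_partZ.const_mul _), pois_const_mul, h1, plantedK]
  ring

lemma ExpGrowth.comp_pullPot {F : (S' → ℝ) → ℝ} (hF : ExpGrowth F) (r : S' → S) :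
    ExpGrowth fun H => F (pullPot r H) := by
  obtain ⟨C, a, hC, ha, h⟩ := hF
  refine ⟨C, a, hC, ha, fun H => (h _).trans ?_⟩
  gcongr
  exact (pi_norm_le_iff_of_nonneg (norm_nonneg _)).2 fun σ => norm_le_pi_norm H (r σ)

lemma plantedFE_mapDomain_add (r : S' → S) {m : ℝ} (hm : 0 < m)
    (hr : ∀ H : S → ℝ, partZ (pullPot r H) = m * partZ H) (ν : (S → ℝ) →₀ ℝ)
    (δ : (S' → ℝ) →₀ ℝ) :
    plantedFE (ν.mapDomain (pullPot r) + δ) =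
      plantedFE ν + m⁻¹ * plantedE ν (vertexGain r δ) := by
  have hcard : (Fintype.card S' : ℝ) = m * Fintype.card S := by
    have := hr 0
    rwa [map_zero, partZ_zero, partZ_zero] at this
  have hS : (Fintype.card S : ℝ) ≠ 0 := Nat.cast_ne_zero.2 Fintype.card_ne_zero
  rw [plantedFE, plantedFE, plantedE, plantedK_add_rate _ _ expGrowth_lam_partZ, plantedK, zero_add,
    drift_mapDomain, ← zero_add (pullPot r (drift ν)), pois_mapDomain]
  simp only [zero_add]
  have : ∀ H : S → ℝ, plantedK δ (fun H' => LamFn (partZ H')) (pullPot r H) =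
      partZ H * vertexGain r δ H + m * LamFn (partZ H) := fun H => by
    rw [partZ_mul_vertexGain, hr, LamFn]; ring
  have hg : ExpGrowth fun H : S → ℝ => partZ H * vertexGain r δ H := by
    have : (fun H : S → ℝ => partZ H * vertexGain r δ H) = fun H =>
        plantedK δ (fun H' => LamFn (partZ H')) (pullPot r H) - m * LamFn (partZ H) := by
      ext H; rw [this]; ring
    rw [this]
    exact ((expGrowth_lam_partZ.plantedK δ).comp_pullPot r).sub (expGrowth_lam_partZ.const_mul _)
  simp only [this]
  rw [pois_add hg (expGrowth_lam_partZ.const_mul _), pois_const_mul, plantedK, plantedK, hcard]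
  simp only [zero_add]
  field_simp
  ring

end AddSpin

noncomputable section PottsFactors

/-- `1 - e^{-β}`. -/
def cP (β : ℝ) : ℝ := 1 - Real.exp (-β)

/-- `1 - (1 - e^{-β}) / q`. -/
def xiP (q : ℕ) (β : ℝ) : ℝ := 1 - cP β / q

/-- The normalised weight of a factor whose endpoints agree with probability `x`. -/
def fWt (q : ℕ) (β x : ℝ) : ℝ := (1 - cP β * x) / xiP q β

/-- The logarithm of the normalised weight. -/
def fPot (q : ℕ) (β x : ℝ) : ℝ := Real.log (fWt q β x)

variable {q : ℕ} [NeZero q] {β : ℝ}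

lemma cP_pos (hβ : 0 < β) : 0 < cP β := sub_pos.2 (by simpa using hβ)

lemma cP_lt_one : cP β < 1 := sub_lt_self _ (Real.exp_pos _)

lemma one_le_q : (1 : ℝ) ≤ q := by exact_mod_cast Nat.one_le_iff_ne_zero.2 (NeZero.ne q)

lemma q_pos : (0 : ℝ) < q := lt_of_lt_of_le one_pos one_le_q

lemma exp_neg_le_xiP (hβ : 0 < β) : Real.exp (-β) ≤ xiP q β := by
  have h : cP β / q ≤ cP β := div_le_self (cP_pos hβ).le one_le_q
  rw [xiP]; rw [cP] at *; linarith

lemma xiP_pos (hβ : 0 < β) : 0 < xiP q β := (Real.exp_pos _).trans_le (exp_neg_le_xiP hβ)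

lemma xiP_le_one (hβ : 0 < β) : xiP q β ≤ 1 :=
  sub_le_self _ (div_nonneg (cP_pos hβ).le q_pos.le)

lemma half_lt_xiP (hq : 2 ≤ q) : 1 / 2 < xiP q β := by
  have h2 : (2 : ℝ) ≤ q := by exact_mod_cast hq
  have : cP β / q < 1 / 2 := by
    rw [div_lt_div_iff₀ q_pos two_pos]; nlinarith [cP_lt_one (β := β)]
  rw [xiP]; linarith

lemma fWt_eq (hβ : 0 < β) (x : ℝ) : fWt q β x = 1 - cP β / xiP q β * (x - (q : ℝ)⁻¹) := by
  have := (xiP_pos (q := q) hβ).ne'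
  have h : xiP q β = 1 - cP β * (q : ℝ)⁻¹ := rfl
  rw [fWt]; field_simp; rw [h]; ring

lemma exp_neg_le_fWt (hβ : 0 < β) {x : ℝ} (hx : x ≤ 1) : Real.exp (-β) ≤ fWt q β x := by
  rw [fWt, le_div_iff₀ (xiP_pos hβ)]
  have h1 := xiP_le_one (q := q) hβ
  have h2 := cP_pos hβ
  have h3 : Real.exp (-β) = 1 - cP β := by rw [cP]; ring
  nlinarith [Real.exp_pos (-β)]

lemma fWt_le_exp (hβ : 0 < β) {x : ℝ} (hx : 0 ≤ x) : fWt q β x ≤ Real.exp β := by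
  rw [fWt, div_le_iff₀ (xiP_pos hβ)]
  have h1 := exp_neg_le_xiP (q := q) hβ
  have h3 : Real.exp β * Real.exp (-β) = 1 := by rw [← Real.exp_add]; simp
  nlinarith [mul_le_mul_of_nonneg_left h1 (Real.exp_pos β).le, mul_nonneg (cP_pos hβ).le hx]

lemma fWt_pos (hβ : 0 < β) {x : ℝ} (hx : x ≤ 1) : 0 < fWt q β x :=
  (Real.exp_pos _).trans_le (exp_neg_le_fWt hβ hx)

lemma exp_fPot (hβ : 0 < β) {x : ℝ} (hx : x ≤ 1) : Real.exp (fPot q β x) = fWt q β x :=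
  Real.exp_log (fWt_pos hβ hx)

lemma abs_fPot_le (hβ : 0 < β) {x : ℝ} (h0 : 0 ≤ x) (h1 : x ≤ 1) : |fPot q β x| ≤ β := by
  rw [abs_le]
  constructor
  · rw [fPot, Real.le_log_iff_exp_le (fWt_pos hβ h1)]; exact exp_neg_le_fWt hβ h1
  · rw [fPot, Real.log_le_iff_le_exp (fWt_pos hβ h1)]; exact fWt_le_exp hβ h0

lemma gibbs_fWt {S : Type*} [Fintype S] [Nonempty S] (hβ : 0 < β) (H f : S → ℝ) :
    gibbs H (fun σ => fWt q β (f σ)) = fWt q β (gibbs H f) := by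
  simp only [fWt_eq hβ]
  rw [gibbs_sub, gibbs_const, gibbs_const_mul, gibbs_sub, gibbs_const]

lemma zRatio_fPot {S : Type*} [Fintype S] [Nonempty S] (hβ : 0 < β) (H : S → ℝ) {f : S → ℝ}
    (hf : ∀ σ, f σ ≤ 1) : zRatio H (fun σ => fPot q β (f σ)) = fWt q β (gibbs H f) := by
  rw [zRatio_eq_gibbs, ← gibbs_fWt hβ]
  simp only [exp_fPot hβ (hf _)]

lemma norm_fPot_le {S : Type*} [Fintype S] [Nonempty S] (hβ : 0 < β) {f : S → ℝ}
    (hf : ∀ σ, f σ ∈ Set.Icc 0 1) : ‖fun σ => fPot q β (f σ)‖ ≤ β :=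
  (pi_norm_le_iff_of_nonneg hβ.le).2 fun σ => abs_fPot_le hβ (hf σ).1 (hf σ).2

lemma sum_edgeIdx {n : ℕ} {M : Type*} [AddCommMonoid M] (f : Fin n → Fin n → M) :
    ∑ e : EdgeIdx n, f e.1.1 e.1.2 = ∑ v, ∑ w, if v < w then f v w else 0 := by
  rw [← Fintype.sum_prod_type' (f := fun v w => if v < w then f v w else 0)]
  rw [← Finset.sum_filter]
  exact Finset.sum_subtype (Finset.univ.filter fun e : Fin n × Fin n => e.1 < e.2)
    (p := fun e : Fin n × Fin n => e.1 < e.2) (by simp) (fun e => f e.1 e.2) |>.symm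

lemma two_mul_sum_edgeIdx {n : ℕ} (f : Fin n → Fin n → ℝ) (hf : ∀ v w, f v w = f w v) :
    2 * ∑ e : EdgeIdx n, f e.1.1 e.1.2 = (∑ v, ∑ w, f v w) - ∑ v, f v v := by
  have h1 : ∑ v, ∑ w, f v w = (∑ v, ∑ w, if v < w then f v w else 0) +
      (∑ v, ∑ w, if w < v then f v w else 0) + ∑ v, ∑ w, if v = w then f v w else 0 := by
    rw [← Finset.sum_add_distrib, ← Finset.sum_add_distrib]
    refine Finset.sum_congr rfl fun v _ => ?_
    rw [← Finset.sum_add_distrib, ← Finset.sum_add_distrib]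
    refine Finset.sum_congr rfl fun w _ => ?_
    rcases lt_trichotomy v w with h | h | h
    · simp [h, h.not_gt, h.ne]
    · simp [h]
    · simp [h, h.not_gt, h.ne']
  have h2 : (∑ v, ∑ w, if w < v then f v w else 0) = ∑ v, ∑ w, if v < w then f v w else 0 := by
    rw [Finset.sum_comm]
    refine Finset.sum_congr rfl fun v _ => Finset.sum_congr rfl fun w _ => ?_
    rw [hf]
  rw [sum_edgeIdx, h1, h2]
  simp
  ring

/-- Indicator of agreement. -/
def agree {n : ℕ} (v w : Fin n) (σ : Fin n → Fin q) : ℝ := if σ v = σ w then 1 else 0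

lemma agree_mem {n : ℕ} (v w : Fin n) (σ : Fin n → Fin q) : agree v w σ ∈ Set.Icc (0 : ℝ) 1 := by
  rw [agree]; split_ifs <;> simp

lemma agree_comm {n : ℕ} (v w : Fin n) (σ : Fin n → Fin q) : agree v w σ = agree w v σ := by
  simp [agree, eq_comm]

/-- The log-weight of an edge. -/
def edgePot (q : ℕ) (β : ℝ) {n : ℕ} (v w : Fin n) : (Fin n → Fin q) → ℝ :=
  fun σ => fPot q β (agree v w σ)

/-- The log-weight of a half-edge at `v` with message `ρ`. -/
def halfPot (q : ℕ) (β : ℝ) {n : ℕ} (v : Fin n) (ρ : Fin q → ℝ) : (Fin n → Fin q) → ℝ :=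
  fun σ => fPot q β (ρ (σ v))

/-- Poisson rates of edges. -/
def edgeRate (q : ℕ) (β : ℝ) (n : ℕ) (lam : ℝ) : ((Fin n → Fin q) → ℝ) →₀ ℝ :=
  rateOf (fun e : EdgeIdx n => edgePot q β e.1.1 e.1.2) fun _ => lam

/-- A finitely supported law on the simplex. -/
structure FinLaw (q : ℕ) (J : Type) [Fintype J] where
  /-- the weights -/
  p : J → ℝ
  /-- the atoms -/
  ρ : J → Fin q → ℝ
  p_nonneg : ∀ j, 0 ≤ p j
  p_sum : ∑ j, p j = 1
  ρ_mem : ∀ j, ρ j ∈ stdSimplex ℝ (Fin q)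

variable {J : Type} [Fintype J]

/-- The barycenter. -/
def FinLaw.bary (P : FinLaw q J) (s : Fin q) : ℝ := ∑ j, P.p j * P.ρ j s

/-- The barycenter is uniform. -/
def FinLaw.Balanced (P : FinLaw q J) : Prop := ∀ s, P.bary s = (q : ℝ)⁻¹

lemma FinLaw.ρ_mem_Icc (P : FinLaw q J) (j : J) (s : Fin q) : P.ρ j s ∈ Set.Icc (0 : ℝ) 1 :=
  ⟨(P.ρ_mem j).1 s, by
    rw [← (P.ρ_mem j).2]
    exact Finset.single_le_sum (fun t _ => (P.ρ_mem j).1 t) (Finset.mem_univ s)⟩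

/-- Poisson rates of half-edges. -/
def halfRate (β : ℝ) (n : ℕ) (d : ℝ) (P : FinLaw q J) : ((Fin n → Fin q) → ℝ) →₀ ℝ :=
  rateOf (fun x : Fin n × J => halfPot q β x.1 (P.ρ x.2)) fun x => d * P.p x.2

/-- Vertex part of the Bethe functional. -/
def betheV (β d : ℝ) (P : FinLaw q J) : ℝ :=
  (q : ℝ)⁻¹ * Pois (rateOf (fun j s => fPot q β (P.ρ j s)) fun j => d * P.p j)
    (fun h => LamFn (partZ h)) 0

/-- Edge part of the Bethe functional. -/
def betheE (β d : ℝ) (P : FinLaw q J) : ℝ :=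
  d / 2 * ∑ i, ∑ j, P.p i * P.p j * lamZ (fWt q β (∑ s, P.ρ i s * P.ρ j s))

lemma FinLaw.Balanced.sum_fWt {P : FinLaw q J} (hP : P.Balanced) (hβ : 0 < β) (s : Fin q) :
    ∑ j, P.p j * fWt q β (P.ρ j s) = 1 := by
  have := hP s
  rw [FinLaw.bary] at this
  simp only [fWt_eq hβ, mul_sub, mul_one, Finset.sum_sub_distrib, P.p_sum]
  have h2 : ∑ j, P.p j * (cP β / xiP q β * P.ρ j s) = cP β / xiP q β * (q : ℝ)⁻¹ := by
    rw [← this, Finset.mul_sum]; exact Finset.sum_congr rfl fun j _ => by ring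
  rw [h2, ← Finset.sum_mul, P.p_sum]
  ring

lemma drift_halfRate {P : FinLaw q J} (hP : P.Balanced) (hβ : 0 < β) (n : ℕ) (d : ℝ) :
    drift (halfRate β n d P) = 0 := by
  ext σ
  rw [halfRate, drift_rateOf, Fintype.sum_prod_type]
  have : ∀ v : Fin n, ∑ j, d * P.p j * (Real.exp (halfPot q β v (P.ρ j) σ) - 1) = 0 := fun v => by
    have h := hP.sum_fWt hβ (σ v)
    simp only [halfPot, exp_fPot hβ (P.ρ_mem_Icc _ _).2, mul_sub, mul_one, Finset.sum_sub_distrib,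
      mul_assoc, ← Finset.mul_sum, h, P.p_sum, sub_self]
  simp [this]

end PottsFactors

noncomputable section Interpolation

variable {q : ℕ} [NeZero q] {β : ℝ} {J : Type} [Fintype J]

lemma sum_fin_cons {n : ℕ} {M : Type*} [AddCommMonoid M] (f : (Fin (n + 1) → Fin q) → M) :
    ∑ σ, f σ = ∑ s : Fin q, ∑ τ : Fin n → Fin q, f (Fin.cons s τ : Fin (n + 1) → Fin q) := by
  rw [← Fintype.sum_prod_type' (f := fun s τ => f (Fin.cons s τ : Fin (n + 1) → Fin q))]
  exact (Fintype.sum_equiv (Fin.consEquiv fun _ : Fin (n + 1) => Fin q) _ _ fun x => rfl).symm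

/-- Restriction of a configuration on `n + 1` vertices. -/
def restr (n : ℕ) (σ : Fin (n + 1) → Fin q) : Fin n → Fin q := Fin.tail σ

lemma partZ_pull_add (n : ℕ) (H : (Fin n → Fin q) → ℝ) (G : Fin q → (Fin n → Fin q) → ℝ) :
    partZ (pullPot (restr n) H + fun σ => G (σ 0) (restr n σ)) = ∑ s, partZ (H + G s) := by
  rw [partZ, sum_fin_cons]
  simp [partZ, restr]

lemma partZ_pull (n : ℕ) (H : (Fin n → Fin q) → ℝ) :
    partZ (pullPot (restr n) H) = q * partZ H := by
  have := partZ_pull_add n H 0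
  simpa [← Pi.zero_def] using this

lemma partZ_pull_head (n : ℕ) (H : (Fin n → Fin q) → ℝ) (h : Fin q → ℝ) :
    partZ (pullPot (restr n) H + pullPot (fun σ : Fin (n + 1) → Fin q => σ 0) h) =
      partZ h * partZ H := by
  have := partZ_pull_add n H fun s _ => h s
  refine Eq.trans (by rfl) (this.trans ?_)
  simp [partZ, Real.exp_add, ← Finset.sum_mul, mul_comm]

/-- Poisson rates of half-edges at the root. -/
def rootRate (β : ℝ) (n : ℕ) (d : ℝ) (P : FinLaw q J) : ((Fin (n + 1) → Fin q) → ℝ) →₀ ℝ :=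
  rateOf (fun j => halfPot q β 0 (P.ρ j)) fun j => d * P.p j

lemma halfRate_succ (n : ℕ) (d : ℝ) (P : FinLaw q J) :
    halfRate β (n + 1) d P =
      (halfRate β n d P).mapDomain (pullPot (restr n)) + rootRate β n d P := by
  rw [halfRate, halfRate, mapDomain_rateOf, rateOf, rateOf, Fintype.sum_prod_type, Fin.sum_univ_succ,
    Fintype.sum_prod_type]
  exact add_comm _ _

lemma rootRate_eq (n : ℕ) (d : ℝ) (P : FinLaw q J) :
    rootRate β n d P = (rateOf (fun j s => fPot q β (P.ρ j s)) fun j => d * P.p j).mapDomain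
      (pullPot fun σ : Fin (n + 1) → Fin q => σ 0) := by
  rw [mapDomain_rateOf]; rfl

lemma drift_rootRate {P : FinLaw q J} (hP : P.Balanced) (hβ : 0 < β) (n : ℕ) (d : ℝ) :
    drift (rootRate β n d P) = 0 := by
  ext σ
  rw [rootRate, drift_rateOf]
  have h := hP.sum_fWt hβ (σ 0)
  simp only [halfPot, exp_fPot hβ (P.ρ_mem_Icc _ _).2, mul_sub, mul_one, Finset.sum_sub_distrib,
    mul_assoc, ← Finset.mul_sum, h, P.p_sum, sub_self, neg_zero, Pi.zero_apply]

lemma plantedFE_halfRate {P : FinLaw q J} (hP : P.Balanced) (hβ : 0 < β) (n : ℕ) (d : ℝ) :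
    plantedFE (halfRate β n d P) = n * betheV β d P := by
  induction n with
  | zero =>
    have : halfRate β 0 d P = 0 := by
      rw [halfRate, rateOf]; simp
    rw [this, plantedFE, plantedK]
    have hz := pois_zero (fun H : (Fin 0 → Fin q) → ℝ => LamFn (partZ H)) (0 + drift 0)
    rw [hz]
    simp [drift_zero, partZ_zero, LamFn]
  | succ n ih =>
    rw [halfRate_succ, plantedFE_mapDomain_add (restr n) q_pos (partZ_pull n), ih]
    have : vertexGain (restr n) (rootRate β n d P) = fun _ => (q : ℝ) * betheV β d P := by
      ext H
      rw [vertexGain, plantedK, drift_rootRate hP hβ, rootRate_eq, add_zero]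
      have h := pois_mapDomain (pullPot fun σ : Fin (n + 1) → Fin q => σ 0)
        (rateOf (fun j s => fPot q β (P.ρ j s)) fun j => d * P.p j)
        (fun H' => LamFn (partZ H' / partZ H)) (pullPot (restr n) H) 0
      rw [map_zero, add_zero] at h
      rw [h, betheV, mul_inv_cancel_left₀ q_pos.ne']
      congr 1
      ext h
      rw [partZ_pull_head, mul_div_cancel_right₀ _ (partZ_pos H).ne']
    rw [this, plantedE_const]
    have := (q_pos (q := q)).ne'
    push_cast; field_simp

lemma hasSum_lamZ {z : ℝ} (hz : |z| < 1) :
    HasSum (fun k : ℕ => z ^ (k + 2) * (1 / ((k : ℝ) + 1) - 1 / ((k : ℝ) + 2))) (lamZ (1 - z)) := by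
  have h := Real.hasSum_pow_div_log_of_abs_lt_one hz
  have h1 := h.mul_left z
  have h2 := (hasSum_nat_add_iff' 1).2 h
  have h3 := h1.sub h2
  have e1 : (fun k : ℕ => z ^ (k + 2) * (1 / ((k : ℝ) + 1) - 1 / ((k : ℝ) + 2))) =
      fun k : ℕ => z * (z ^ (k + 1) / ((k : ℝ) + 1)) -
        z ^ (k + 1 + 1) / (((k + 1 : ℕ) : ℝ) + 1) := by
    ext k
    have h4 : ((k : ℝ) + 1) ≠ 0 := by positivity
    have h5 : ((k : ℝ) + 2) ≠ 0 := by positivity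
    have h6 : ((k : ℝ) + 1 + 1) ≠ 0 := by positivity
    push_cast
    field_simp
    ring
  have e2 : lamZ (1 - z) = z * -Real.log (1 - z) -
      (-Real.log (1 - z) - ∑ i ∈ Finset.range 1, z ^ (i + 1) / ((i : ℝ) + 1)) := by
    simp [lamZ, LamFn]; ring
  rw [e1, e2]
  exact h3

lemma sum_mul_pow_nonneg {I T : Type*} [Fintype I] [Fintype T] (α : I → ℝ) (g : T → ℝ)
    (hg : ∀ t, 0 ≤ g t) (a : I → T → ℝ) (k : ℕ) :
    0 ≤ ∑ i, ∑ j, α i * α j * (∑ t, g t * a i t * a j t) ^ k := by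
  classical
  have : ∑ i, ∑ j, α i * α j * (∑ t, g t * a i t * a j t) ^ k =
      ∑ f : Fin k → T, (∏ l, g (f l)) * (∑ i, α i * ∏ l, a i (f l)) ^ 2 := by
    have e1 : ∀ i j, α i * α j * (∑ t, g t * a i t * a j t) ^ k =
        ∑ f : Fin k → T, (∏ l, g (f l)) * ((α i * ∏ l, a i (f l)) * (α j * ∏ l, a j (f l))) := by
      intro i j
      rw [← Fin.prod_const, Finset.prod_univ_sum, Finset.mul_sum, Fintype.piFinset_univ]
      refine Finset.sum_congr rfl fun f _ => ?_
      simp only [Finset.prod_mul_distrib]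
      ring
    simp only [e1]
    rw [Finset.sum_congr rfl fun i _ => Finset.sum_comm, Finset.sum_comm]
    refine Finset.sum_congr rfl fun f _ => ?_
    rw [sq, Finset.sum_mul_sum]
    simp only [Finset.mul_sum]
  rw [this]
  exact Finset.sum_nonneg fun f _ => mul_nonneg (Finset.prod_nonneg fun _ _ => hg _) (sq_nonneg _)

lemma sum_mul_lamZ_nonneg {I T : Type*} [Fintype I] [Fintype T] (α : I → ℝ) (g : T → ℝ)
    (hg : ∀ t, 0 ≤ g t) (a : I → T → ℝ) (h1 : ∀ i j, |∑ t, g t * a i t * a j t| < 1) :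
    0 ≤ ∑ i, ∑ j, α i * α j * lamZ (1 - ∑ t, g t * a i t * a j t) := by
  have h := hasSum_sum (s := Finset.univ) fun i _ => hasSum_sum (s := Finset.univ) fun j _ =>
    (hasSum_lamZ (h1 i j)).mul_left (α i * α j)
  refine h.nonneg fun k => ?_
  have hk : (0 : ℝ) ≤ 1 / ((k : ℝ) + 1) - 1 / ((k : ℝ) + 2) := by
    rw [sub_nonneg]; apply one_div_le_one_div_of_le <;> linarith [(Nat.cast_nonneg k : (0:ℝ) ≤ k)]
  have := mul_nonneg (sum_mul_pow_nonneg α g hg a (k + 2)) hk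
  simpa only [Finset.sum_mul, mul_assoc] using this

end Interpolation

noncomputable section BetheLowerBound

variable {q : ℕ} [NeZero q] {β : ℝ} {J : Type} [Fintype J]

lemma abs_fWt_sub_one_lt (hq : 2 ≤ q) (hβ : 0 < β) {x : ℝ} (h0 : 0 ≤ x) (h1 : x ≤ 1) :
    |1 - fWt q β x| < 1 := by
  have h2 : fWt q β x < 2 := by
    rw [fWt, div_lt_iff₀ (xiP_pos hβ)]
    nlinarith [half_lt_xiP (β := β) hq, mul_nonneg (cP_pos hβ).le h0]
  rw [abs_lt]
  constructor <;> linarith [fWt_pos (q := q) hβ h1]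

lemma sum_mul_mem_Icc {x y : Fin q → ℝ} (hx : x ∈ stdSimplex ℝ (Fin q))
    (hy : y ∈ stdSimplex ℝ (Fin q)) : ∑ s, x s * y s ∈ Set.Icc (0 : ℝ) 1 := by
  refine ⟨Finset.sum_nonneg fun s _ => mul_nonneg (hx.1 s) (hy.1 s), ?_⟩
  rw [← hx.2]
  refine Finset.sum_le_sum fun s _ => mul_le_of_le_one_right (hx.1 s) ?_
  rw [← hy.2]
  exact Finset.single_le_sum (fun t _ => hy.1 t) (Finset.mem_univ s)

lemma sum_mul_lamZ_fWt_nonneg {I S : Type*} [Fintype I] [Fintype S] [Nonempty S] (hq : 2 ≤ q)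
    (hβ : 0 < β) (α : I → ℝ) (H : S → ℝ) (D : I → S → Fin q → ℝ)
    (hD : ∀ i σ, D i σ ∈ stdSimplex ℝ (Fin q)) :
    0 ≤ ∑ i, ∑ j, α i * α j * lamZ (fWt q β (gibbs H fun σ => ∑ s, D i σ s * D j σ s)) := by
  have key : ∀ i j, (1 : ℝ) - ∑ t : S × Fin q, (cP β / xiP q β * (Real.exp (H t.1) / partZ H)) *
      (D i t.1 t.2 - (q : ℝ)⁻¹) * (D j t.1 t.2 - (q : ℝ)⁻¹) =
      fWt q β (gibbs H fun σ => ∑ s, D i σ s * D j σ s) := by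
    intro i j
    rw [fWt_eq hβ]
    congr 1
    have h1 : ∀ σ, ∑ s, (D i σ s - (q : ℝ)⁻¹) * (D j σ s - (q : ℝ)⁻¹) =
        (∑ s, D i σ s * D j σ s) - (q : ℝ)⁻¹ := fun σ => by
      have hi := (hD i σ).2
      have hj := (hD j σ).2
      simp only [sub_mul, mul_sub, Finset.sum_sub_distrib, ← Finset.mul_sum, ← Finset.sum_mul, hi, hj]
      have := (q_pos (q := q)).ne'
      simp
    rw [← gibbs_const H (q : ℝ)⁻¹, ← gibbs_sub]
    simp only [gibbs_const, ← h1]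
    rw [gibbs, Fintype.sum_prod_type, Finset.sum_div, Finset.mul_sum]
    refine Finset.sum_congr rfl fun σ _ => ?_
    rw [mul_div_assoc, Finset.sum_mul, Finset.mul_sum]
    refine Finset.sum_congr rfl fun s _ => ?_
    ring
  have := sum_mul_lamZ_nonneg α
    (fun t : S × Fin q => cP β / xiP q β * (Real.exp (H t.1) / partZ H))
    (fun t => mul_nonneg (div_nonneg (cP_pos hβ).le (xiP_pos hβ).le)
      (div_nonneg (Real.exp_pos _).le (partZ_pos H).le))
    (fun i t => D i t.1 t.2 - (q : ℝ)⁻¹) (fun i j => by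
      have h := gibbs_mem_Icc H (f := fun σ => ∑ s, D i σ s * D j σ s)
        fun σ => sum_mul_mem_Icc (hD i σ) (hD j σ)
      have := abs_fWt_sub_one_lt hq hβ h.1 h.2
      rw [← key] at this
      simpa using this)
  simpa only [key] using this

lemma ite_mem_stdSimplex (t : Fin q) :
    (fun s => if t = s then (1 : ℝ) else 0) ∈ stdSimplex ℝ (Fin q) :=
  ⟨fun s => by dsimp only; split_ifs <;> simp, by simp⟩

lemma entGain_edgeRate (hβ : 0 < β) (n : ℕ) (lam : ℝ) (H : (Fin n → Fin q) → ℝ) :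
    entGain (edgeRate q β n lam) H = lam / 2 * ((∑ v, ∑ w, lamZ (fWt q β (gibbs H (agree v w)))) -
      n * lamZ (fWt q β 1)) := by
  rw [edgeRate, entGain_rateOf, ← Finset.mul_sum]
  have h := two_mul_sum_edgeIdx (fun v w : Fin n => lamZ (fWt q β (gibbs H (agree v w))))
    fun v w => by
      have : (agree v w : (Fin n → Fin q) → ℝ) = agree w v := funext fun σ => agree_comm v w σ
      rw [this]
  have h2 : ∀ e : EdgeIdx n, zRatio H (edgePot q β e.1.1 e.1.2) = fWt q β (gibbs H (agree e.1.1 e.1.2)) :=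
    fun e => zRatio_fPot hβ H fun σ => (agree_mem _ _ σ).2
  have h3 : ∀ v : Fin n, gibbs H (agree v v) = 1 := fun v => by
    have : (agree v v : (Fin n → Fin q) → ℝ) = fun _ => 1 := by ext; simp [agree]
    rw [this, gibbs_const]
  simp only [h2]
  simp only [h3, Finset.sum_const, Finset.card_univ, Fintype.card_fin, nsmul_eq_mul] at h
  rw [← h]; ring

lemma entGain_halfRate (hβ : 0 < β) (n : ℕ) (d : ℝ) (P : FinLaw q J) (H : (Fin n → Fin q) → ℝ) :
    entGain (halfRate β n d P) H =
      d * ∑ v, ∑ j, P.p j * lamZ (fWt q β (gibbs H fun σ => P.ρ j (σ v))) := by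
  rw [halfRate, entGain_rateOf, Fintype.sum_prod_type, Finset.mul_sum]
  refine Finset.sum_congr rfl fun v _ => ?_
  rw [Finset.mul_sum]
  refine Finset.sum_congr rfl fun j _ => ?_
  rw [mul_assoc]
  congr 3
  exact zRatio_fPot hβ H fun σ => (P.ρ_mem_Icc j (σ v)).2

lemma entGain_interpolate (hq : 2 ≤ q) (hβ : 0 < β) {n : ℕ} (hn : 0 < n) {d : ℝ} (hd : 0 ≤ d)
    (P : FinLaw q J) (H : (Fin n → Fin q) → ℝ) :
    -(n * betheE β d P + d / 2 * lamZ (fWt q β 1)) ≤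
      entGain (edgeRate q β n (d / n)) H - entGain (halfRate β n d P) H := by
  have hn' : (0 : ℝ) < n := by exact_mod_cast hn
  have h := sum_mul_lamZ_fWt_nonneg hq hβ (I := Fin n ⊕ J)
    (Sum.elim (fun _ => 1) fun j => -(n * P.p j)) H
    (Sum.elim (fun v σ s => if σ v = s then 1 else 0) fun j _ => P.ρ j) (by
      rintro (v | j) σ
      · exact ite_mem_stdSimplex _
      · exact P.ρ_mem j)
  simp only [Fintype.sum_sum_type, Sum.elim_inl, Sum.elim_inr, Finset.sum_add_distrib, ite_mul,
    one_mul, zero_mul, mul_ite, mul_one, mul_zero, Finset.sum_ite_eq, Finset.mem_univ, if_true,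
    gibbs_const] at h
  rw [entGain_edgeRate hβ, entGain_halfRate hβ, betheE]
  set A := ∑ v, ∑ w, lamZ (fWt q β (gibbs H (agree v w)))
  set B := ∑ v, ∑ j, P.p j * lamZ (fWt q β (gibbs H fun σ => P.ρ j (σ v))) with hB
  set D := ∑ i, ∑ j, P.p i * P.p j * lamZ (fWt q β (∑ s, P.ρ i s * P.ρ j s)) with hD
  have e1 : (∑ v : Fin n, ∑ w : Fin n, lamZ (fWt q β (gibbs H fun σ => if σ v = σ w then 1 else 0)))
      = A := rfl
  have e2 : (∑ v : Fin n, ∑ j, -(n * P.p j) * lamZ (fWt q β (gibbs H fun σ => P.ρ j (σ v)))) =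
      -(n * B) := by
    rw [hB, Finset.mul_sum, ← Finset.sum_neg_distrib]
    refine Finset.sum_congr rfl fun v _ => ?_
    rw [Finset.mul_sum, ← Finset.sum_neg_distrib]
    exact Finset.sum_congr rfl fun j _ => by ring
  have e3 : (∑ j, ∑ v : Fin n, -(n * P.p j) * lamZ (fWt q β (gibbs H fun σ => P.ρ j (σ v)))) =
      -(n * B) := by rw [← e2, Finset.sum_comm]
  have e4 : (∑ i, ∑ j, -(n * P.p i) * -(n * P.p j) * lamZ (fWt q β (∑ s, P.ρ i s * P.ρ j s))) =
      n ^ 2 * D := by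
    rw [hD, Finset.mul_sum]
    refine Finset.sum_congr rfl fun v _ => ?_
    rw [Finset.mul_sum]
    exact Finset.sum_congr rfl fun j _ => by ring
  have h5 : 0 ≤ A - 2 * (n * B) + n ^ 2 * D := by
    rw [e1, e2, e3, e4] at h
    linarith
  have h6 := mul_nonneg (div_nonneg hd (by positivity : (0:ℝ) ≤ 2 * n)) h5
  have h7 : d / (2 * n) * (A - 2 * (n * B) + n ^ 2 * D) =
      d / n / 2 * (A - n * lamZ (fWt q β 1)) - d * B + (n * (d / 2 * D) + d / 2 * lamZ (fWt q β 1)) := by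
    field_simp; ring
  rw [h7] at h6
  linarith

lemma edgeRate_nonneg (n : ℕ) {lam : ℝ} (h : 0 ≤ lam) : 0 ≤ edgeRate q β n lam :=
  rateOf_nonneg _ fun _ => h

lemma halfRate_nonneg (n : ℕ) {d : ℝ} (h : 0 ≤ d) (P : FinLaw q J) : 0 ≤ halfRate β n d P :=
  rateOf_nonneg _ fun _ => mul_nonneg h (P.p_nonneg _)

theorem bethe_le_plantedFE (hq : 2 ≤ q) (hβ : 0 < β) {d : ℝ} (hd : 0 ≤ d) {P : FinLaw q J}
    (hP : P.Balanced) {n : ℕ} (hn : 0 < n) :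
    n * (betheV β d P - betheE β d P) - d / 2 * lamZ (fWt q β 1) ≤
      plantedFE (edgeRate q β n (d / n)) := by
  set e := edgeRate q β n (d / n) with he
  set h := halfRate β n d P with hh
  have he0 : 0 ≤ e := edgeRate_nonneg n (div_nonneg hd (Nat.cast_nonneg n))
  have hh0 : 0 ≤ h := halfRate_nonneg n hd P
  obtain ⟨C₁, hC₁⟩ := plantedFE_smul_ge he0
  obtain ⟨C₂, hC₂⟩ := plantedFE_smul_le hh0 (drift_halfRate hP hβ n d)
  have key := le_sub_of_increments (f := fun t => plantedFE (t • e + (1 - t) • h))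
    (L := -(n * betheE β d P + d / 2 * lamZ (fWt q β 1))) (C := C₁ + C₂) (fun t s ht hs hts => by
      set ω := t • e + (1 - t - s) • h with hω
      have hω0 : 0 ≤ ω := add_nonneg (fun y => by simpa using mul_nonneg ht (he0 y))
        (fun y => by simpa using mul_nonneg (by linarith) (hh0 y))
      have h1 := hC₁ ω hω0 s hs (by linarith)
      have h2 := hC₂ ω hω0 s hs (by linarith)
      have e1 : ω + s • e = (t + s) • e + (1 - (t + s)) • h := by rw [hω]; module
      have e2 : ω + s • h = t • e + (1 - t) • h := by rw [hω]; module
      rw [e1] at h1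
      rw [e2] at h2
      have h3 : -(n * betheE β d P + d / 2 * lamZ (fWt q β 1)) ≤
          plantedE ω (entGain e) - plantedE ω (entGain h) := by
        rw [← plantedE_sub ω (expGrowth_entGain e) (expGrowth_entGain h),
          ← plantedE_const ω (-(n * betheE β d P + d / 2 * lamZ (fWt q β 1)))]
        exact plantedE_mono hω0 (.const _) ((expGrowth_entGain e).sub (expGrowth_entGain h))
          fun H => entGain_interpolate hq hβ hn hd P H
      have h4 := mul_le_mul_of_nonneg_left h3 hs
      linarith)
  simp only [zero_smul, sub_zero, one_smul, zero_add, sub_self, add_zero] at key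
  rw [hh, plantedFE_halfRate hP hβ] at key
  linarith

end BetheLowerBound

noncomputable section PoisCompare

variable {E E' : Type*} [NormedAddCommGroup E] [NormedAddCommGroup E']

lemma abs_pois_sub_le_of_pow {ν : E →₀ ℝ} {ν' : E' →₀ ℝ} {F : E → ℝ} {F' : E' → ℝ}
    (hF : ExpGrowth F) (hF' : ExpGrowth F') (hT : rateTot ν = rateTot ν') {H : E} {H' : E'} {C x : ℝ}
    (h : ∀ m, |(jumpOp ν ^ m) F H - (jumpOp ν' ^ m) F' H'| ≤ C * x ^ m) :
    |Pois ν F H - Pois ν' F' H'| ≤ Real.exp (-rateTot ν) * (C * Real.exp x) := by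
  have h1 := ((hF.summable ν H).hasSum.sub (hF'.summable ν' H').hasSum).norm_le_of_bounded
    ((hasSum_exp x).mul_left C) fun m => by
      rw [← sub_div, Real.norm_eq_abs, abs_div, Nat.abs_cast, mul_div_assoc']
      exact div_le_div_of_nonneg_right (h m) (Nat.cast_nonneg _)
  rw [Pois, Pois, ← hT, ← mul_sub, abs_mul, abs_of_pos (Real.exp_pos _)]
  exact mul_le_mul_of_nonneg_left h1 (Real.exp_pos _).le

variable {X : Type*} [Fintype X]

lemma support_rateOf (ψ : X → E) (r : X → ℝ) {y : E} (hy : y ∈ (rateOf ψ r).support) :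
    ∃ x, ψ x = y := by
  classical
  rw [rateOf] at hy
  obtain ⟨x, -, hx⟩ := Finset.mem_biUnion.1 (Finsupp.support_finsetSum hy)
  exact ⟨x, (Finset.mem_singleton.1 (Finsupp.support_single_subset hx)).symm⟩

lemma norm_sum_fin_le (ψ : X → E) {y₀ : ℝ} (hψ : ∀ x, ‖ψ x‖ ≤ y₀) {m : ℕ} (l : Fin m → X) :
    ‖∑ i, ψ (l i)‖ ≤ m * y₀ := by
  refine (norm_sum_le _ _).trans ((Finset.sum_le_sum fun i _ => hψ (l i)).trans ?_)
  simp

lemma sum_prod_eq_pow {m : ℕ} (r : X → ℝ) : ∑ l : Fin m → X, ∏ i, r (l i) = (∑ x, r x) ^ m := by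
  classical
  rw [← Fin.prod_const, Finset.prod_univ_sum, Fintype.piFinset_univ]

lemma abs_jumpOp_pow_rateOf_le (ψ : X → E) {r : X → ℝ} (hr : ∀ x, 0 ≤ r x) {y₀ C a : ℝ}
    (hψ : ∀ x, ‖ψ x‖ ≤ y₀) (hC : 0 ≤ C) (ha : 0 ≤ a) {F : E → ℝ} (hF : GrowthBy C a F) (m : ℕ) (H : E) :
    |(jumpOp (rateOf ψ r) ^ m) F H| ≤
      C * Real.exp (a * ‖H‖) * ((∑ x, r x) * Real.exp (a * y₀)) ^ m := by
  rw [jumpOp_pow_rateOf]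
  refine (Finset.abs_sum_le_sum_abs _ _).trans ?_
  have h1 : ∀ l : Fin m → X, |(∏ i, r (l i)) * F (H + ∑ i, ψ (l i))| ≤
      (∏ i, r (l i)) * (C * Real.exp (a * ‖H‖) * Real.exp (a * y₀) ^ m) := fun l => by
    have hp : 0 ≤ ∏ i, r (l i) := Finset.prod_nonneg fun i _ => hr _
    rw [abs_mul, abs_of_nonneg hp]
    refine mul_le_mul_of_nonneg_left ((hF _).trans ?_) hp
    rw [← Real.exp_nat_mul, mul_assoc, ← Real.exp_add]
    gcongr
    have := norm_add_le H (∑ i, ψ (l i))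
    have h2 := norm_sum_fin_le ψ hψ l
    nlinarith
  refine (Finset.sum_le_sum fun l _ => h1 l).trans (le_of_eq ?_)
  rw [← Finset.sum_mul, sum_prod_eq_pow, mul_pow]; ring

lemma GrowthBy.abs_pois_rateOf_le (ψ : X → E) {r : X → ℝ} (hr : ∀ x, 0 ≤ r x) {y₀ C a : ℝ}
    (hψ : ∀ x, ‖ψ x‖ ≤ y₀) (hC : 0 ≤ C) (ha : 0 ≤ a) {F : E → ℝ} (hF : GrowthBy C a F) (H : E) :
    |Pois (rateOf ψ r) F H| ≤ Real.exp (-∑ x, r x) *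
      (C * Real.exp (a * ‖H‖) * Real.exp ((∑ x, r x) * Real.exp (a * y₀))) := by
  have := abs_pois_sub_le_of_pow (ν := rateOf ψ r) (ν' := rateOf ψ r) (F := F) (F' := fun _ => 0)
    (H := H) (H' := H) ⟨C, a, hC, ha, hF⟩ (.const 0) rfl (C := C * Real.exp (a * ‖H‖))
    (x := (∑ x, r x) * Real.exp (a * y₀)) fun m => by
      rw [jump_pow_const, mul_zero, sub_zero]
      exact abs_jumpOp_pow_rateOf_le ψ hr hψ hC ha hF m H
  rwa [pois_const, sub_zero, rateTot_rateOf] at this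

lemma GrowthBy.abs_pois_rateOf_sub_le (ψ : X → E) {r r' : X → ℝ} (hr : ∀ x, 0 ≤ r x)
    (hr' : ∀ x, 0 ≤ r' x) {d : ℝ} (hd : ∑ x, r x = d) (hd' : ∑ x, r' x = d) {y₀ C a : ℝ}
    (hψ : ∀ x, ‖ψ x‖ ≤ y₀) (hC : 0 ≤ C) (ha : 0 ≤ a) {F : E → ℝ} (hF : GrowthBy C a F) (H : E) :
    |Pois (rateOf ψ r') F H - Pois (rateOf ψ r) F H| ≤ (∑ x, |r' x - r x|) *
      (Real.exp (-d) * (C * (Real.exp (a * y₀) + 1) * Real.exp (a * ‖H‖) *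
        Real.exp (d * Real.exp (a * y₀)))) := by
  set D := ∑ x, |r' x - r x| with hD
  have hD0 : 0 ≤ D := Finset.sum_nonneg fun _ _ => abs_nonneg _
  have hEF : ExpGrowth F := ⟨C, a, hC, ha, hF⟩
  set δ := rateOf ψ fun x => r' x - r x with hδ
  have hpath : ∀ t : ℝ, rateOf ψ r + t • δ = rateOf ψ fun x => r x + t * (r' x - r x) := fun t => by
    rw [hδ, ← rateOf_smul, ← rateOf_add]
  have hg : GrowthBy (D * (C * (Real.exp (a * y₀) + 1))) a
      fun H => jumpOp δ F H - rateTot δ * F H := fun H => by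
    dsimp only
    rw [hδ, jumpOp_rateOf, rateTot_rateOf, Finset.sum_mul, ← Finset.sum_sub_distrib]
    refine (Finset.abs_sum_le_sum_abs _ _).trans ?_
    rw [hD, Finset.sum_mul, Finset.sum_mul]
    refine Finset.sum_le_sum fun x _ => ?_
    rw [← mul_sub, abs_mul, mul_assoc]
    refine mul_le_mul_of_nonneg_left ?_ (abs_nonneg _)
    have h1 : |F (H + ψ x)| ≤ C * (Real.exp (a * ‖H‖) * Real.exp (a * y₀)) := by
      refine (hF _).trans ?_
      rw [← Real.exp_add]
      gcongr
      have := norm_add_le H (ψ x)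
      have := hψ x
      nlinarith
    have h2 := hF H
    have h3 := abs_sub (F (H + ψ x)) (F H)
    linarith
  have h := norm_image_sub_le_of_norm_deriv_le_segment_01'
    (C := D * (Real.exp (-d) * (C * (Real.exp (a * y₀) + 1) * Real.exp (a * ‖H‖) *
        Real.exp (d * Real.exp (a * y₀)))))
    (f := fun t : ℝ => Pois (rateOf ψ r + t • δ) F H)
    (f' := fun t => Pois (rateOf ψ r + t • δ) (fun H => jumpOp δ F H - rateTot δ * F H) H)
    (fun t _ => (hasDerivAt_pois hEF _ δ H t).hasDerivWithinAt) (fun t ht => ?_)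
  · rw [hpath 1] at h
    simpa using h
  · rw [hpath]
    refine (hg.abs_pois_rateOf_le ψ (fun x => ?_) hψ (by positivity) ha H).trans (le_of_eq ?_)
    · nlinarith [hr x, hr' x, ht.1, ht.2]
    · have : ∑ x, (r x + t * (r' x - r x)) = d := by
        rw [Finset.sum_add_distrib, ← Finset.mul_sum, Finset.sum_sub_distrib, hd, hd']; ring
      rw [this]; ring

end PoisCompare

noncomputable section Balance

variable {q : ℕ} [NeZero q] {β : ℝ} {J : Type} [Fintype J]

lemma FinLaw.bary_mem (P : FinLaw q J) : P.bary ∈ stdSimplex ℝ (Fin q) := by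
  refine ⟨fun s => Finset.sum_nonneg fun j _ => mul_nonneg (P.p_nonneg j) ((P.ρ_mem j).1 s), ?_⟩
  simp only [FinLaw.bary]
  rw [Finset.sum_comm]
  simp only [← Finset.mul_sum, (P.ρ_mem _).2, mul_one, P.p_sum]

/-- The distance of the barycenter from uniform. -/
def FinLaw.imbalance (P : FinLaw q J) : ℝ := ∑ s, |P.bary s - (q : ℝ)⁻¹|

lemma FinLaw.imbalance_nonneg (P : FinLaw q J) : 0 ≤ P.imbalance :=
  Finset.sum_nonneg fun _ _ => abs_nonneg _

/-- The mixture `(1 - t) P + t δ_r`. -/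
def FinLaw.mix (P : FinLaw q J) (t : ℝ) (ht : t ∈ Set.Icc (0 : ℝ) 1) (r : Fin q → ℝ)
    (hr : r ∈ stdSimplex ℝ (Fin q)) : FinLaw q (Option J) where
  p o := o.elim t fun j => (1 - t) * P.p j
  ρ o := o.elim r P.ρ
  p_nonneg o := by
    cases o
    · exact ht.1
    · exact mul_nonneg (by linarith [ht.2]) (P.p_nonneg _)
  p_sum := by
    rw [Fintype.sum_option]
    simp [← Finset.mul_sum, P.p_sum]
  ρ_mem o := by
    cases o
    · exact hr
    · exact P.ρ_mem _

lemma FinLaw.exists_mix_balanced (P : FinLaw q J) : ∃ t ht r hr,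
    (P.mix t ht r hr).Balanced ∧ t ≤ q * P.imbalance := by
  have hq := q_pos (q := q)
  by_cases h0 : P.imbalance = 0
  · refine ⟨0, ⟨le_rfl, zero_le_one⟩, P.bary, P.bary_mem, fun s => ?_, by rw [h0, mul_zero]⟩
    have := (Finset.sum_eq_zero_iff_of_nonneg fun _ _ => abs_nonneg _).1 h0 s (Finset.mem_univ s)
    rw [FinLaw.bary, Fintype.sum_option]
    simp only [FinLaw.mix, Option.elim_none, Option.elim_some, zero_mul, sub_zero, one_mul, zero_add]
    rw [← FinLaw.bary]
    exact sub_eq_zero.1 (abs_eq_zero.1 this)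
  · set D := P.imbalance with hD
    have hDpos : 0 < D := lt_of_le_of_ne P.imbalance_nonneg (Ne.symm h0)
    have h1 : 0 < 1 + q * D := by positivity
    refine ⟨q * D / (1 + q * D), ⟨by positivity, by rw [div_le_one h1]; linarith⟩,
      fun s => ((1 + q * D) * (q : ℝ)⁻¹ - P.bary s) / (q * D), ⟨fun s => ?_, ?_⟩, fun s => ?_, ?_⟩
    · refine div_nonneg ?_ (by positivity)
      have h2 : |P.bary s - (q : ℝ)⁻¹| ≤ D :=
        Finset.single_le_sum (f := fun s => |P.bary s - (q : ℝ)⁻¹|) (fun _ _ => abs_nonneg _)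
          (Finset.mem_univ s)
      have h3 := (abs_le.1 h2).2
      have : (1 + q * D) * (q : ℝ)⁻¹ = (q : ℝ)⁻¹ + D := by field_simp
      linarith
    · rw [← Finset.sum_div, Finset.sum_sub_distrib, P.bary_mem.2]
      simp
      field_simp
      ring
    · rw [FinLaw.bary, Fintype.sum_option]
      simp only [FinLaw.mix, Option.elim_none, Option.elim_some, mul_assoc]
      rw [← Finset.mul_sum, ← FinLaw.bary]
      field_simp
      ring
    · exact div_le_self (by positivity) (by nlinarith)

lemma lamZ_fWt_le (hβ : 0 < β) {x : ℝ} (h0 : 0 ≤ x) (h1 : x ≤ 1) :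
    lamZ (fWt q β x) ≤ Real.exp (2 * β) := by
  have h2 := lamZ_le_sq (fWt_pos (q := q) hβ h1)
  have h3 := fWt_le_exp (q := q) hβ h0
  have h4 := fWt_pos (q := q) hβ h1
  have h5 : Real.exp (2 * β) = Real.exp β * Real.exp β := by rw [two_mul, Real.exp_add]
  have h6 : 1 ≤ Real.exp β := Real.one_le_exp hβ.le
  rw [h5]
  nlinarith

lemma betheV_mix_zero (P : FinLaw q J) {d : ℝ} (r : Fin q → ℝ)
    (hr : r ∈ stdSimplex ℝ (Fin q)) :
    betheV β d (P.mix 0 ⟨le_rfl, zero_le_one⟩ r hr) = betheV β d P := by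
  rw [betheV, betheV]
  congr 2
  rw [rateOf, rateOf, Fintype.sum_option]
  simp [FinLaw.mix]

lemma exists_betheV_mix_le (q : ℕ) [NeZero q] (hβ : 0 < β) {d : ℝ} (hd : 0 ≤ d) :
    ∃ C, 0 ≤ C ∧ ∀ (J : Type) [Fintype J] (P : FinLaw q J) t ht r hr,
      |betheV β d (P.mix t ht r hr) - betheV β d P| ≤ C * t := by
  obtain ⟨C, a, hC, ha, hF⟩ := expGrowth_lam_partZ (S := Fin q)
  refine ⟨(q : ℝ)⁻¹ * (2 * d * (Real.exp (-d) * (C * (Real.exp (a * β) + 1) *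
    Real.exp (a * ‖(0 : Fin q → ℝ)‖) * Real.exp (d * Real.exp (a * β))))), ?_, ?_⟩
  · have := q_pos (q := q); positivity
  intro J _ P t ht r hr
  rw [← betheV_mix_zero P r hr, betheV, betheV, ← mul_sub, abs_mul,
    abs_of_pos (inv_pos.2 q_pos), mul_assoc]
  refine mul_le_mul_of_nonneg_left ?_ (inv_pos.2 q_pos).le
  have hQ := fun o => (P.mix t ht r hr).p_nonneg o
  have hQ0 := fun o => (P.mix 0 ⟨le_rfl, zero_le_one⟩ r hr).p_nonneg o
  have h := hF.abs_pois_rateOf_sub_le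
    (fun (o : Option J) s => fPot q β ((P.mix t ht r hr).ρ o s))
    (r := fun o => d * (P.mix 0 ⟨le_rfl, zero_le_one⟩ r hr).p o)
    (r' := fun o => d * (P.mix t ht r hr).p o)
    (fun o => mul_nonneg hd (hQ0 o)) (fun o => mul_nonneg hd (hQ o)) (d := d)
    (by rw [← Finset.mul_sum, FinLaw.p_sum, mul_one]) (by rw [← Finset.mul_sum, FinLaw.p_sum, mul_one])
    (y₀ := β) (fun o => norm_fPot_le hβ fun s => (P.mix t ht r hr).ρ_mem_Icc o s) hC ha 0
  refine h.trans ?_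
  have h2 : ∑ o, |d * (P.mix t ht r hr).p o - d * (P.mix 0 ⟨le_rfl, zero_le_one⟩ r hr).p o| =
      2 * d * t := by
    rw [Fintype.sum_option]
    simp only [FinLaw.mix, Option.elim_none, Option.elim_some]
    have : ∀ j, |d * ((1 - t) * P.p j) - d * ((1 - 0) * P.p j)| = d * t * P.p j := fun j => by
      rw [show d * ((1 - t) * P.p j) - d * ((1 - 0) * P.p j) = -(d * t * P.p j) by ring, abs_neg,
        abs_of_nonneg (mul_nonneg (mul_nonneg hd ht.1) (P.p_nonneg j))]
    simp only [this]
    rw [← Finset.mul_sum, P.p_sum, mul_zero, sub_zero, abs_of_nonneg (mul_nonneg hd ht.1)]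
    ring
  rw [h2]
  exact le_of_eq (by ring)

lemma abs_betheE_mix_le (hβ : 0 < β) {d : ℝ} (hd : 0 ≤ d) (P : FinLaw q J) (t ht r hr) :
    |betheE β d (P.mix t ht r hr) - betheE β d P| ≤ 3 * d * Real.exp (2 * β) * t := by
  set M := Real.exp (2 * β)
  set f : Option J → Option J → ℝ := fun i j =>
    lamZ (fWt q β (∑ s, (P.mix t ht r hr).ρ i s * (P.mix t ht r hr).ρ j s)) with hf
  have hf0 : ∀ i j, 0 ≤ f i j := fun i j => lamZ_nonneg (fWt_pos hβ
    (sum_mul_mem_Icc ((P.mix t ht r hr).ρ_mem i) ((P.mix t ht r hr).ρ_mem j)).2).le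
  have hfM : ∀ i j, f i j ≤ M := fun i j => by
    have := sum_mul_mem_Icc ((P.mix t ht r hr).ρ_mem i) ((P.mix t ht r hr).ρ_mem j)
    exact lamZ_fWt_le hβ this.1 this.2
  have e0 : betheE β d P = d / 2 * ∑ i, ∑ j, P.p i * P.p j * f (some i) (some j) := rfl
  set A := ∑ i, ∑ j, P.p i * P.p j * f (some i) (some j) with hA
  set B := ∑ i, P.p i * f (some i) none with hB
  set B' := ∑ i, P.p i * f none (some i) with hB'
  have e1 : betheE β d (P.mix t ht r hr) = d / 2 *
      (t * t * f none none + t * (1 - t) * B + (t * (1 - t) * B' + (1 - t) ^ 2 * A)) := by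
    rw [betheE]
    congr 1
    simp only [Fintype.sum_option, Finset.sum_add_distrib]
    rw [hA, hB, hB']
    simp only [Finset.mul_sum]
    congr 1
    · congr 1
      refine Finset.sum_congr rfl fun i _ => ?_
      simp only [hf, FinLaw.mix, Option.elim_none, Option.elim_some]; ring
    · congr 1
      · refine Finset.sum_congr rfl fun i _ => ?_
        simp only [hf, FinLaw.mix, Option.elim_none, Option.elim_some]; ring
      · refine Finset.sum_congr rfl fun i _ => Finset.sum_congr rfl fun j _ => ?_
        simp only [hf, FinLaw.mix, Option.elim_some]; ring
  have hB0 : 0 ≤ B := Finset.sum_nonneg fun i _ => mul_nonneg (P.p_nonneg i) (hf0 _ _)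
  have hB0' : 0 ≤ B' := Finset.sum_nonneg fun i _ => mul_nonneg (P.p_nonneg i) (hf0 _ _)
  have hBM : B ≤ M := by
    calc B ≤ ∑ i, P.p i * M := Finset.sum_le_sum fun i _ =>
          mul_le_mul_of_nonneg_left (hfM _ _) (P.p_nonneg i)
      _ = M := by rw [← Finset.sum_mul, P.p_sum, one_mul]
  have hBM' : B' ≤ M := by
    calc B' ≤ ∑ i, P.p i * M := Finset.sum_le_sum fun i _ =>
          mul_le_mul_of_nonneg_left (hfM _ _) (P.p_nonneg i)
      _ = M := by rw [← Finset.sum_mul, P.p_sum, one_mul]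
  have hA0 : 0 ≤ A := Finset.sum_nonneg fun i _ => Finset.sum_nonneg fun j _ =>
    mul_nonneg (mul_nonneg (P.p_nonneg i) (P.p_nonneg j)) (hf0 _ _)
  have hAM : A ≤ M := by
    calc A ≤ ∑ i, ∑ j, P.p i * P.p j * M := Finset.sum_le_sum fun i _ => Finset.sum_le_sum fun j _ =>
          mul_le_mul_of_nonneg_left (hfM _ _) (mul_nonneg (P.p_nonneg i) (P.p_nonneg j))
      _ = M := by simp only [← Finset.sum_mul, ← Finset.mul_sum, P.p_sum, one_mul, mul_one]
  have hN0 := hf0 none none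
  have hNM := hfM none none
  have ht0 := ht.1
  have ht1 := ht.2
  have hM : 0 < M := Real.exp_pos _
  rw [e0, e1, ← mul_sub, abs_mul, abs_of_nonneg (by positivity : 0 ≤ d / 2)]
  have : |t * t * f none none + t * (1 - t) * B + (t * (1 - t) * B' + (1 - t) ^ 2 * A) - A| ≤ 6 * M * t := by
    have h1 : t * t * f none none ≤ t * M := by nlinarith [mul_nonneg ht0 hN0, mul_nonneg ht0 (sub_nonneg.2 ht1)]
    have h2 : t * (1 - t) * B' ≤ t * M := by nlinarith [mul_nonneg ht0 hB0', mul_nonneg ht0 (sub_nonneg.2 ht1)]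
    have h3 : t * (1 - t) * B ≤ t * M := by nlinarith [mul_nonneg ht0 hB0, mul_nonneg ht0 (sub_nonneg.2 ht1)]
    have h4 : A - (1 - t) ^ 2 * A ≤ 2 * (t * M) := by
      nlinarith [mul_nonneg ht0 hA0, mul_nonneg ht0 (sub_nonneg.2 hAM), mul_nonneg (mul_nonneg ht0 ht0) hA0]
    have h4' : (1 - t) ^ 2 * A ≤ A := by nlinarith [mul_nonneg ht0 hA0, mul_nonneg (mul_nonneg ht0 hA0) (sub_nonneg.2 ht1)]
    have h5 : 0 ≤ t * t * f none none := by positivity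
    have h6 : 0 ≤ t * (1 - t) * B' := mul_nonneg (mul_nonneg ht0 (sub_nonneg.2 ht1)) hB0'
    have h7 : 0 ≤ t * (1 - t) * B := mul_nonneg (mul_nonneg ht0 (sub_nonneg.2 ht1)) hB0
    have h8 := mul_nonneg ht0 hM.le
    rw [abs_le]; constructor <;> linarith
  calc _ ≤ d / 2 * (6 * M * t) := mul_le_mul_of_nonneg_left this (by positivity)
    _ = _ := by ring

/-- Every finite law can be balanced at a cost controlled by its imbalance. -/
lemma exists_balanced_bethe_ge (q : ℕ) [NeZero q] (hβ : 0 < β) {d : ℝ} (hd : 0 ≤ d) :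
    ∃ C, 0 ≤ C ∧ ∀ (J : Type) [Fintype J] (P : FinLaw q J), ∃ P' : FinLaw q (Option J),
      P'.Balanced ∧ betheV β d P - betheE β d P - C * P.imbalance ≤ betheV β d P' - betheE β d P' := by
  obtain ⟨C, hC, h⟩ := exists_betheV_mix_le q hβ hd
  refine ⟨(C + 3 * d * Real.exp (2 * β)) * q, by positivity, fun J _ P => ?_⟩
  obtain ⟨t, ht, r, hr, hb, hle⟩ := P.exists_mix_balanced
  refine ⟨P.mix t ht r hr, hb, ?_⟩
  have h1 := (abs_le.1 (h J P t ht r hr)).1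
  have h2 := (abs_le.1 (abs_betheE_mix_le hβ hd P t ht r hr)).2
  have h3 := mul_le_mul_of_nonneg_left hle (by positivity : 0 ≤ C + 3 * d * Real.exp (2 * β))
  linarith

end Balance

noncomputable section Decorrelation

variable {S V : Type*} [Fintype S] [Nonempty S] [Fintype V]

/-- The covariance under the Gibbs measure. -/
def gCov (H f g : S → ℝ) : ℝ := gibbs H (fun σ => f σ * g σ) - gibbs H f * gibbs H g

lemma gCov_comm (H f g : S → ℝ) : gCov H f g = gCov H g f := by
  simp only [gCov, mul_comm]

lemma gCov_eq (H f g : S → ℝ) : gCov H f g = gibbs H fun σ => (f σ - gibbs H f) * g σ := by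
  simp only [sub_mul, gibbs_sub, gibbs_const_mul, gCov]

lemma gCov_sum_left (H : S → ℝ) (c : V → ℝ) (f : V → S → ℝ) (g : S → ℝ) :
    gCov H (fun σ => ∑ v, c v * f v σ) g = ∑ v, c v * gCov H (f v) g := by
  simp only [gCov, Finset.sum_mul, gibbs_sum, gibbs_const_mul, mul_sub, Finset.sum_sub_distrib, mul_assoc]

lemma gCov_affine_left (H : S → ℝ) (a c : ℝ) (f g : S → ℝ) :
    gCov H (fun σ => a + c * f σ) g = c * gCov H f g := by
  simp only [gCov, add_mul, gibbs_add, gibbs_const_mul, gibbs_const, mul_assoc]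
  ring

lemma gCov_self (H f : S → ℝ) : gCov H f f = gibbs H fun σ => (f σ - gibbs H f) ^ 2 := by
  have h1 : gCov H f f = gibbs H fun σ => (f σ - gibbs H f) * f σ := gCov_eq H f f
  have h2 : (gibbs H fun σ => (f σ - gibbs H f) * gibbs H f) = 0 := by
    have : (fun σ => (f σ - gibbs H f) * gibbs H f) = fun σ => gibbs H f * (f σ - gibbs H f) := by
      funext σ; ring
    rw [this, gibbs_const_mul, gibbs_sub, gibbs_const, sub_self, mul_zero]
  have : (fun σ => (f σ - gibbs H f) ^ 2) =
      fun σ => (f σ - gibbs H f) * f σ - (f σ - gibbs H f) * gibbs H f := by funext σ; ring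
  rw [this, gibbs_sub, h2, sub_zero, h1]

lemma abs_le_add_sq_div {x η : ℝ} (hη : 0 < η) : |x| ≤ η + x ^ 2 / η := by
  rw [← sub_le_iff_le_add', le_div_iff₀ hη, ← sq_abs]
  nlinarith [sq_nonneg (|x| - η), abs_nonneg x, sq_nonneg (|x| + η)]

/-- A family with small average squared covariances is nearly uncorrelated with every
bounded observable. -/
lemma sum_abs_gCov_le (H : S → ℝ) (c : ℝ) (hcV : c * Fintype.card V = 1) (f : V → S → ℝ)
    {b : ℝ} (hb : 0 ≤ b) {G : S → ℝ} (hG : ∀ σ, |G σ| ≤ b) {η : ℝ} (hη : 0 < η) :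
    c * ∑ v, |gCov H (f v) G| ≤
      b * (2 * η + (c ^ 2 * ∑ v, ∑ w, gCov H (f v) (f w) ^ 2) / η ^ 3) := by
  set e : V → ℝ := fun v => SignType.sign (gCov H (f v) G) with he
  have he1 : ∀ v, |e v| ≤ 1 := fun v => by
    rw [he]; dsimp only
    rcases SignType.sign (gCov H (f v) G) with _ | _ | _ <;> simp
  set F : S → ℝ := fun σ => ∑ v, (c * e v) * f v σ with hF
  have h1 : c * ∑ v, |gCov H (f v) G| = gCov H F G := by
    rw [hF, gCov_sum_left, Finset.mul_sum]
    refine Finset.sum_congr rfl fun v _ => ?_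
    rw [mul_assoc, he, sign_mul_self]
  have hV : gCov H F F ≤ c ^ 2 * ∑ v, ∑ w, |gCov H (f v) (f w)| := by
    rw [hF, gCov_sum_left, Finset.mul_sum]
    refine Finset.sum_le_sum fun v _ => ?_
    rw [gCov_comm, gCov_sum_left, Finset.mul_sum, Finset.mul_sum]
    refine Finset.sum_le_sum fun w _ => ?_
    rw [gCov_comm H (f w)]
    refine (le_abs_self _).trans ?_
    rw [show c * e v * (c * e w * gCov H (f v) (f w)) =
      c ^ 2 * (e v * e w * gCov H (f v) (f w)) by ring, abs_mul, abs_of_nonneg (sq_nonneg c), abs_mul,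
      abs_mul]
    refine mul_le_mul_of_nonneg_left ?_ (sq_nonneg c)
    have := mul_le_one₀ (he1 v) (abs_nonneg _) (he1 w)
    exact mul_le_of_le_one_left (abs_nonneg _) this
  have hV2 : c ^ 2 * ∑ v, ∑ w, |gCov H (f v) (f w)| ≤
      η ^ 2 + (c ^ 2 * ∑ v, ∑ w, gCov H (f v) (f w) ^ 2) / η ^ 2 := by
    calc _ ≤ c ^ 2 * ∑ v : V, ∑ w : V, (η ^ 2 + gCov H (f v) (f w) ^ 2 / η ^ 2) := by
          gcongr with v _ w _
          exact abs_le_add_sq_div (by positivity)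
      _ = _ := by
          simp only [Finset.sum_add_distrib, Finset.sum_const, Finset.card_univ, nsmul_eq_mul,
            ← Finset.sum_div]
          have : c ^ 2 * (Fintype.card V * (Fintype.card V * η ^ 2)) =
            (c * Fintype.card V) ^ 2 * η ^ 2 := by ring
          rw [mul_add, this, hcV, one_pow, one_mul, mul_div_assoc]
  rw [h1, gCov_eq]
  calc _ ≤ gibbs H (fun σ => b * (η + (F σ - gibbs H F) ^ 2 / η)) := by
        refine gibbs_mono H fun σ => ?_
        refine (le_abs_self _).trans ?_
        rw [abs_mul, mul_comm]
        exact mul_le_mul (hG σ) (abs_le_add_sq_div hη) (abs_nonneg _) hb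
    _ = b * (η + η⁻¹ * gCov H F F) := by
        rw [gibbs_const_mul, gibbs_add, gibbs_const, gCov_self, ← gibbs_const_mul]
        simp only [div_eq_inv_mul]
    _ ≤ b * (η + η⁻¹ * (η ^ 2 + (c ^ 2 * ∑ v, ∑ w, gCov H (f v) (f w) ^ 2) / η ^ 2)) := by
        gcongr
        exact hV.trans hV2
    _ = _ := by field_simp; ring

/-- Products along random lists nearly factorize. -/
lemma sum_abs_gibbs_prod_sub_le (H : S → ℝ) {c : ℝ} (hc : 0 ≤ c) (hcV : c * Fintype.card V = 1)
    (f : V → S → ℝ) {b κ : ℝ} (hb : 1 ≤ b) (hf : ∀ v σ, |f v σ| ≤ b) (hκ0 : 0 ≤ κ)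
    (hκ : ∀ (B : ℝ) (G : S → ℝ), 0 ≤ B → (∀ σ, |G σ| ≤ B) → c * ∑ v, |gCov H (f v) G| ≤ B * κ) (m : ℕ) :
    c ^ m * ∑ l : Fin m → V, |gibbs H (fun σ => ∏ i, f (l i) σ) - ∏ i, gibbs H (f (l i))| ≤
      m * b ^ m * κ := by
  have hb0 : 0 ≤ b := by linarith
  induction m with
  | zero => simp [gibbs_const]
  | succ m ih =>
    have hG : ∀ (l : Fin m → V) σ, |∏ i, f (l i) σ| ≤ b ^ m := fun l σ => by
      rw [Finset.abs_prod]
      refine (Finset.prod_le_prod (fun i _ => abs_nonneg _) fun i _ => hf (l i) σ).trans ?_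
      simp
    rw [← (Fin.consEquiv fun _ : Fin (m + 1) => V).sum_comp, Fintype.sum_prod_type]
    have hstep : ∀ v (l : Fin m → V),
        |gibbs H (fun σ => ∏ i, f ((Fin.cons v l : Fin (m + 1) → V) i) σ) -
          ∏ i, gibbs H (f ((Fin.cons v l : Fin (m + 1) → V) i))| ≤
        |gCov H (f v) fun σ => ∏ i, f (l i) σ| +
          b * |gibbs H (fun σ => ∏ i, f (l i) σ) - ∏ i, gibbs H (f (l i))| := fun v l => by
      simp only [Fin.prod_univ_succ, Fin.cons_zero, Fin.cons_succ]
      have : gibbs H (fun σ => f v σ * ∏ i, f (l i) σ) - gibbs H (f v) * ∏ i, gibbs H (f (l i)) =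
          gCov H (f v) (fun σ => ∏ i, f (l i) σ) +
            gibbs H (f v) * (gibbs H (fun σ => ∏ i, f (l i) σ) - ∏ i, gibbs H (f (l i))) := by
        rw [gCov]; ring
      rw [this]
      refine (abs_add_le _ _).trans (add_le_add_right ?_ _)
      rw [abs_mul]
      exact mul_le_mul_of_nonneg_right (abs_gibbs_le H (hf v)) (abs_nonneg _)
    have h1 : ∑ v : V, ∑ l : Fin m → V, |gibbs H (fun σ => ∏ i, f ((Fin.cons v l : Fin (m + 1) → V) i) σ) -
          ∏ i, gibbs H (f ((Fin.cons v l : Fin (m + 1) → V) i))| ≤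
        (∑ l : Fin m → V, ∑ v : V, |gCov H (f v) fun σ => ∏ i, f (l i) σ|) + (Fintype.card V : ℝ) *
          (b * ∑ l : Fin m → V, |gibbs H (fun σ => ∏ i, f (l i) σ) - ∏ i, gibbs H (f (l i))|) := by
      refine (Finset.sum_le_sum fun v _ => Finset.sum_le_sum fun l _ => hstep v l).trans (le_of_eq ?_)
      simp only [Finset.sum_add_distrib, ← Finset.mul_sum, Finset.sum_const, Finset.card_univ, nsmul_eq_mul]
      rw [Finset.sum_comm]
      ring
    have h2 : c ^ (m + 1) * (∑ l : Fin m → V, ∑ v : V, |gCov H (f v) fun σ => ∏ i, f (l i) σ|) ≤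
        b ^ m * κ := by
      calc _ = c ^ m * ∑ l : Fin m → V, (c * ∑ v : V, |gCov H (f v) fun σ => ∏ i, f (l i) σ|) := by
            rw [← Finset.mul_sum, pow_succ]; ring
        _ ≤ c ^ m * ∑ l : Fin m → V, (b ^ m * κ) := by
            refine mul_le_mul_of_nonneg_left (Finset.sum_le_sum fun l _ => ?_) (by positivity)
            exact hκ _ _ (by positivity) (hG l)
        _ = (c * Fintype.card V) ^ m * (b ^ m * κ) := by
            simp [mul_pow]; ring
        _ = _ := by rw [hcV]; simp
    calc _ ≤ c ^ (m + 1) * _ := mul_le_mul_of_nonneg_left h1 (by positivity)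
      _ ≤ b ^ m * κ + b * (m * b ^ m * κ) := by
          rw [mul_add]
          refine add_le_add h2 ?_
          calc _ = (c * Fintype.card V) * (b * (c ^ m * ∑ l : Fin m → V,
                |gibbs H (fun σ => ∏ i, f (l i) σ) - ∏ i, gibbs H (f (l i))|)) := by ring
            _ ≤ _ := by rw [hcV, one_mul]; gcongr
      _ ≤ b * (b ^ m * κ) + b * (m * b ^ m * κ) := by
          exact add_le_add_left (le_mul_of_one_le_left (by positivity) hb) _
      _ = _ := by push_cast; ring

lemma abs_LamFn_sub_le {x y r : ℝ} (hx : |Real.log x| ≤ r) (hy : |Real.log y| ≤ r) (hx0 : 0 < x)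
    (hy0 : 0 < y) : |LamFn x - LamFn y| ≤ Real.exp r * |x - y| := by
  have key : ∀ x y : ℝ, |Real.log x| ≤ r → |Real.log y| ≤ r → 0 < x → 0 < y →
      LamFn x - LamFn y ≤ Real.exp r * |x - y| := fun x y hx hy hx0 hy0 => by
    have h := lamZ_tangent hy0 hx0
    have h1 : LamFn x - LamFn y ≤ (Real.log x + 1) * (x - y) := by
      simp only [lamZ] at h; linarith
    refine h1.trans ((le_abs_self _).trans ?_)
    rw [abs_mul]
    refine mul_le_mul_of_nonneg_right ?_ (abs_nonneg _)
    have := Real.add_one_le_exp r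
    exact (abs_add_le _ _).trans (by rw [abs_one]; linarith)
  rw [abs_le]
  have h1 := key x y hx hy hx0 hy0
  have h2 := key y x hy hx hy0 hx0
  rw [abs_sub_comm] at h2
  constructor <;> linarith

lemma abs_lamZ_sub_le {x y r : ℝ} (hx : |Real.log x| ≤ r) (hy : |Real.log y| ≤ r) (hx0 : 0 < x)
    (hy0 : 0 < y) : |lamZ x - lamZ y| ≤ r * |x - y| := by
  have key : ∀ x y : ℝ, |Real.log x| ≤ r → |Real.log y| ≤ r → 0 < x → 0 < y →
      lamZ x - lamZ y ≤ r * |x - y| := fun x y hx hy hx0 hy0 => by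
    have h := lamZ_tangent hy0 hx0
    have h1 : lamZ x - lamZ y ≤ Real.log x * (x - y) := by linarith
    refine h1.trans ((le_abs_self _).trans ?_)
    rw [abs_mul]
    exact mul_le_mul_of_nonneg_right hx (abs_nonneg _)
  rw [abs_le]
  have h1 := key x y hx hy hx0 hy0
  have h2 := key y x hy hx hy0 hx0
  rw [abs_sub_comm] at h2
  constructor <;> linarith

end Decorrelation

noncomputable section VertexCompare

variable {q : ℕ} [NeZero q] {β : ℝ} {n : ℕ}

/-- The indicator that `v` has colour `s`. -/
def colInd (v : Fin n) (s : Fin q) (σ : Fin n → Fin q) : ℝ := if σ v = s then 1 else 0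

lemma colInd_mem (v : Fin n) (s : Fin q) (σ : Fin n → Fin q) : colInd v s σ ∈ Set.Icc (0 : ℝ) 1 := by
  rw [colInd]; split_ifs <;> simp

lemma sum_colInd (v : Fin n) (σ : Fin n → Fin q) : ∑ s, colInd v s σ = 1 := by
  simp [colInd]

lemma agree_eq_sum_colInd (v w : Fin n) (σ : Fin n → Fin q) :
    agree v w σ = ∑ s, colInd v s σ * colInd w s σ := by
  simp only [colInd, agree, mul_ite, mul_one, mul_zero, Finset.sum_ite_eq, Finset.mem_univ, if_true]

/-- The deviation of the fraction of vertices of colour `s` from uniform. -/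
def colDev (s : Fin q) (σ : Fin n → Fin q) : ℝ := (n : ℝ)⁻¹ * ∑ v, colInd v s σ - (q : ℝ)⁻¹

/-- The total deviation of the colour frequencies from uniform. -/
def colUnbal (σ : Fin n → Fin q) : ℝ := ∑ s, |colDev s σ|

/-- The average squared colour covariance. -/
def corrEnergy (H : (Fin n → Fin q) → ℝ) : ℝ :=
  ∑ s : Fin q, ((n : ℝ)⁻¹ ^ 2 * ∑ v : Fin n, ∑ w : Fin n, gCov H (colInd v s) (colInd w s) ^ 2)

lemma corrEnergy_nonneg (H : (Fin n → Fin q) → ℝ) : 0 ≤ corrEnergy H :=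
  Finset.sum_nonneg fun _ _ => by positivity

/-- The empirical law of the Gibbs marginals. -/
def margLaw (hn : 0 < n) (H : (Fin n → Fin q) → ℝ) : FinLaw q (Fin n) where
  p _ := (n : ℝ)⁻¹
  ρ v s := gibbs H (colInd v s)
  p_nonneg _ := by positivity
  p_sum := by
    have : (n : ℝ) ≠ 0 := by positivity
    simp [this]
  ρ_mem v := ⟨fun s => gibbs_nonneg H fun σ => (colInd_mem v s σ).1, by
    rw [← gibbs_sum]; simp only [sum_colInd, gibbs_const]⟩

lemma imbalance_margLaw_le (hn : 0 < n) (H : (Fin n → Fin q) → ℝ) :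
    (margLaw hn H).imbalance ≤ gibbs H colUnbal := by
  have : gibbs H colUnbal = ∑ s, gibbs H (fun σ => |colDev s σ|) := gibbs_sum _ _ _
  rw [this]
  refine Finset.sum_le_sum fun s _ => ?_
  have h1 : (margLaw hn H).bary s - (q : ℝ)⁻¹ = gibbs H (colDev s) := by
    have : colDev (q := q) (n := n) s = fun σ => (n : ℝ)⁻¹ * ∑ v, colInd v s σ - (q : ℝ)⁻¹ := rfl
    rw [this, gibbs_sub, gibbs_const_mul, gibbs_sum, gibbs_const, FinLaw.bary, Finset.mul_sum]
    rfl
  rw [h1, abs_le]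
  constructor
  · have h2 := gibbs_mono H fun σ => neg_abs_le (colDev s σ)
    have h3 : gibbs H (fun σ => -|colDev s σ|) = - gibbs H (fun σ => |colDev s σ|) := by
      have := gibbs_const_mul H (-1) fun σ => |colDev s σ|
      simpa using this
    rw [← h3]; exact h2
  · exact gibbs_mono H fun σ => le_abs_self (colDev s σ)

/-- The rates of the edges joining a new vertex to the old ones. -/
def newEdgeRate (q : ℕ) (β : ℝ) (n : ℕ) (lam : ℝ) : ((Fin (n + 1) → Fin q) → ℝ) →₀ ℝ :=
  rateOf (fun w : Fin n => edgePot q β 0 w.succ) fun _ => lam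

lemma edgeRate_succ (n : ℕ) (lam : ℝ) : edgeRate q β (n + 1) lam =
    (edgeRate q β n lam).mapDomain (pullPot (restr n)) + newEdgeRate q β n lam := by
  rw [edgeRate, edgeRate, newEdgeRate, mapDomain_rateOf, rateOf, rateOf, rateOf,
    sum_edgeIdx (fun v w : Fin (n + 1) => Finsupp.single (edgePot q β v w) lam),
    sum_edgeIdx (fun v w : Fin n => Finsupp.single (pullPot (restr n) (edgePot q β v w)) lam),
    Fin.sum_univ_succ]
  refine (add_comm _ _).trans ?_
  congr 1
  · refine Finset.sum_congr rfl fun v _ => ?_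
    rw [Fin.sum_univ_succ]
    simp only [Fin.not_lt_zero, if_false, zero_add, Fin.succ_lt_succ_iff]
    rfl
  · rw [Fin.sum_univ_succ]
    simp [Fin.succ_pos]

lemma agree_zero_succ (σ : Fin (n + 1) → Fin q) (w : Fin n) :
    agree 0 w.succ σ = colInd w (σ 0) (restr n σ) := by
  rw [agree, colInd]; exact if_congr eq_comm rfl rfl

lemma drift_newEdgeRate (hβ : 0 < β) (hn : 0 < n) (d : ℝ) :
    drift (newEdgeRate q β n (d / n)) =
      fun σ => d * (cP β / xiP q β) * colDev (σ 0) (restr n σ) := by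
  funext σ
  rw [newEdgeRate, drift_rateOf]
  have h1 : ∀ w : Fin n, Real.exp (edgePot q β 0 w.succ σ) - 1 =
      -(cP β / xiP q β) * (colInd w (σ 0) (restr n σ) - (q : ℝ)⁻¹) := fun w => by
    rw [edgePot, exp_fPot hβ (agree_mem _ _ _).2, fWt_eq hβ]
    rw [agree_zero_succ]; ring
  simp only [h1, colDev]
  have : (n : ℝ) ≠ 0 := by positivity
  rw [← Finset.mul_sum, ← Finset.mul_sum, Finset.sum_sub_distrib]
  simp
  field_simp

lemma cP_div_xiP_le (hβ : 0 < β) : cP β / xiP q β ≤ Real.exp β := by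
  have h1 := exp_neg_le_xiP (q := q) hβ
  rw [div_le_iff₀ (xiP_pos hβ)]
  have h2 : Real.exp β * Real.exp (-β) = 1 := by rw [← Real.exp_add]; simp
  have := cP_lt_one (β := β)
  nlinarith [Real.exp_pos β]

lemma abs_colDev_le (hn : 0 < n) (s : Fin q) (σ : Fin n → Fin q) : |colDev s σ| ≤ 1 := by
  have hn' : (0 : ℝ) < n := by positivity
  have h1 : 0 ≤ (n : ℝ)⁻¹ * ∑ v, colInd v s σ := 
    mul_nonneg (by positivity) (Finset.sum_nonneg fun v _ => (colInd_mem v s σ).1)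
  have h2 : (n : ℝ)⁻¹ * ∑ v, colInd v s σ ≤ 1 := by
    rw [inv_mul_le_iff₀ hn', mul_one]
    refine (Finset.sum_le_sum fun v _ => (colInd_mem v s σ).2).trans ?_
    simp
  have h3 : (q : ℝ)⁻¹ ≤ 1 := inv_le_one_of_one_le₀ one_le_q
  have h4 : 0 < (q : ℝ)⁻¹ := inv_pos.2 q_pos
  rw [colDev, abs_le]; constructor <;> linarith

lemma abs_exp_sub_one_le (x : ℝ) : |Real.exp x - 1| ≤ |x| * Real.exp |x| := by
  have h := Real.add_one_le_exp x
  have h2 := Real.add_one_le_exp (-x)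
  have h3 : Real.exp x * Real.exp (-x) = 1 := by rw [← Real.exp_add]; simp
  rcases le_total 0 x with hx | hx
  · rw [abs_of_nonneg hx, abs_of_nonneg (by linarith)]
    nlinarith [Real.exp_pos x]
  · rw [abs_of_nonpos hx, abs_of_nonpos (by linarith [Real.exp_le_one_iff.2 hx])]
    have : 1 ≤ Real.exp (-x) := Real.one_le_exp (by linarith)
    nlinarith

/-- The ratio of partition functions upon attaching a vertex along the list `l`. -/
lemma partZ_attach (hβ : 0 < β) (hn : 0 < n) (d : ℝ) (H : (Fin n → Fin q) → ℝ) {m : ℕ}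
    (l : Fin m → Fin n) :
    partZ (pullPot (restr n) H + drift (newEdgeRate q β n (d / n)) +
        ∑ i, edgePot q β 0 (l i).succ) / partZ H =
      ∑ s, gibbs H fun τ => Real.exp (d * (cP β / xiP q β) * colDev s τ) *
        ∏ i, fWt q β (colInd (l i) s τ) := by
  have h1 : pullPot (restr n) H + drift (newEdgeRate q β n (d / n)) + ∑ i, edgePot q β 0 (l i).succ =
      pullPot (restr n) H + fun σ => (fun s τ => d * (cP β / xiP q β) * colDev s τ +
        ∑ i, fPot q β (colInd (l i) s τ)) (σ 0) (restr n σ) := by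
    rw [drift_newEdgeRate hβ hn, add_assoc]
    congr 1
    funext σ
    simp only [Pi.add_apply, Finset.sum_apply]
    congr 1
    refine Finset.sum_congr rfl fun i _ => ?_
    rw [edgePot, agree_zero_succ]
  rw [h1, partZ_pull_add n H fun s τ => d * (cP β / xiP q β) * colDev s τ +
    ∑ i, fPot q β (colInd (l i) s τ), Finset.sum_div]
  refine Finset.sum_congr rfl fun s _ => ?_
  rw [← zRatio, zRatio_eq_gibbs]
  congr 1
  funext τ
  rw [Real.exp_add, Real.exp_sum]
  congr 1
  exact Finset.prod_congr rfl fun i _ => exp_fPot hβ (colInd_mem _ _ _).2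

lemma partZ_bethe (hβ : 0 < β) (H : (Fin n → Fin q) → ℝ) {m : ℕ} (l : Fin m → Fin n) :
    partZ (0 + ∑ i, fun s => fPot q β (gibbs H (colInd (l i) s))) =
      ∑ s, ∏ i, gibbs H fun τ => fWt q β (colInd (l i) s τ) := by
  rw [partZ]
  refine Finset.sum_congr rfl fun s _ => ?_
  simp only [zero_add, Finset.sum_apply]
  rw [Real.exp_sum]
  refine Finset.prod_congr rfl fun i _ => ?_
  rw [exp_fPot hβ (gibbs_mem_Icc H fun σ => colInd_mem _ _ σ).2, gibbs_fWt hβ]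

lemma prod_mem_Icc_exp {m : ℕ} {f : Fin m → ℝ} (hf : ∀ i, f i ∈ Set.Icc (Real.exp (-β)) (Real.exp β)) :
    ∏ i, f i ∈ Set.Icc (Real.exp (-(m * β))) (Real.exp (m * β)) := by
  constructor
  · calc Real.exp (-(m * β)) = ∏ _i : Fin m, Real.exp (-β) := by
          rw [Finset.prod_const, Finset.card_univ, Fintype.card_fin, ← Real.exp_nat_mul]; ring_nf
      _ ≤ _ := Finset.prod_le_prod (fun _ _ => (Real.exp_pos _).le) fun i _ => (hf i).1
  · calc _ ≤ ∏ _i : Fin m, Real.exp β :=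
          Finset.prod_le_prod (fun i _ => (Real.exp_pos _).le.trans (hf i).1) fun i _ => (hf i).2
      _ = _ := by
          rw [Finset.prod_const, Finset.card_univ, Fintype.card_fin, ← Real.exp_nat_mul]

lemma abs_log_sum_le {f : Fin q → ℝ} {r : ℝ} (hf : ∀ s, f s ∈ Set.Icc (Real.exp (-r)) (Real.exp r)) :
    0 < ∑ s, f s ∧ |Real.log (∑ s, f s)| ≤ q + r := by
  have hpos : 0 < ∑ s, f s := Finset.sum_pos (fun s _ => (Real.exp_pos _).trans_le (hf s).1)
    Finset.univ_nonempty
  refine ⟨hpos, abs_le.2 ⟨?_, ?_⟩⟩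
  · rw [Real.le_log_iff_exp_le hpos]
    calc Real.exp (-(q + r)) ≤ Real.exp (-r) := Real.exp_le_exp.2 (by linarith [q_pos (q := q)])
      _ ≤ f 0 := (hf 0).1
      _ ≤ _ := Finset.single_le_sum (fun s _ => (Real.exp_pos _).le.trans (hf s).1) (Finset.mem_univ 0)
  · rw [Real.log_le_iff_le_exp hpos, Real.exp_add]
    calc _ ≤ ∑ _s : Fin q, Real.exp r := Finset.sum_le_sum fun s _ => (hf s).2
      _ = q * Real.exp r := by simp
      _ ≤ _ := by
        gcongr
        linarith [Real.add_one_le_exp (q : ℝ)]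

set_option maxHeartbeats 1000000 in
/-- Attaching a vertex gains the vertex part of the Bethe functional of the marginals, up to
correlations. -/
lemma exists_abs_vertexGain_sub_le (q : ℕ) [NeZero q] (hβ : 0 < β) {d : ℝ} (hd : 0 ≤ d) :
    ∃ C, 0 ≤ C ∧ ∀ (n : ℕ) (hn : 0 < n) (H : (Fin n → Fin q) → ℝ) (η : ℝ), 0 < η →
      |vertexGain (restr n) (newEdgeRate q β n (d / n)) H - q * betheV β d (margLaw hn H)| ≤
        C * (gibbs H colUnbal + (2 * q * η + corrEnergy H / η ^ 3)) := by
  set D := d * Real.exp β with hD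
  have hD0 : 0 ≤ D := by positivity
  set C₀ := Real.exp (q + D) * (D * Real.exp D + Real.exp β) with hC₀
  refine ⟨Real.exp (-d) * (C₀ * Real.exp (2 * d * Real.exp β ^ 2)), by positivity, ?_⟩
  intro n hn H η hη
  have hn' : (0 : ℝ) < n := by positivity
  have hcV : (n : ℝ)⁻¹ * Fintype.card (Fin n) = 1 := by
    rw [Fintype.card_fin, inv_mul_cancel₀ hn'.ne']
  have hξ := xiP_pos (q := q) hβ
  have hcξ0 : 0 ≤ cP β / xiP q β := div_nonneg (cP_pos hβ).le hξ.le
  have hcξ := cP_div_xiP_le (q := q) hβ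
  have hw : ∀ v s (σ : Fin n → Fin q), fWt q β (colInd v s σ) ∈ Set.Icc (Real.exp (-β)) (Real.exp β) :=
    fun v s σ => ⟨exp_neg_le_fWt hβ (colInd_mem v s σ).2, fWt_le_exp hβ (colInd_mem v s σ).1⟩
  set M := gibbs H colUnbal with hM
  have hM0 : 0 ≤ M := gibbs_nonneg H fun σ => Finset.sum_nonneg fun _ _ => abs_nonneg _
  set κ : Fin q → ℝ := fun s => 2 * η + ((n : ℝ)⁻¹ ^ 2 * ∑ v : Fin n, ∑ w : Fin n,
    gCov H (colInd v s) (colInd w s) ^ 2) / η ^ 3 with hκ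
  have hκ0 : ∀ s, 0 ≤ κ s := fun s => by rw [hκ]; positivity
  have hκsum : ∑ s, κ s = 2 * q * η + corrEnergy H / η ^ 3 := by
    simp only [hκ, Finset.sum_add_distrib, corrEnergy, ← Finset.sum_div]
    simp; ring
  rw [← hκsum]
  set K := M + ∑ s, κ s with hK
  have hK0 : 0 ≤ K := add_nonneg hM0 (Finset.sum_nonneg fun s _ => hκ0 s)
  have hfac : ∀ (m : ℕ) (s : Fin q), (n : ℝ)⁻¹ ^ m * ∑ l : Fin m → Fin n,
      |gibbs H (fun σ => ∏ i, fWt q β (colInd (l i) s σ)) -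
        ∏ i, gibbs H (fun σ => fWt q β (colInd (l i) s σ))| ≤
      m * Real.exp β ^ m * (Real.exp β * κ s) := fun m s => by
    refine sum_abs_gibbs_prod_sub_le H (by positivity) hcV
      (fun v σ => fWt q β (colInd v s σ)) (Real.one_le_exp hβ.le)
      (fun v σ => by rw [abs_of_pos (fWt_pos hβ (colInd_mem v s σ).2)]; exact (hw v s σ).2)
      (mul_nonneg (Real.exp_pos _).le (hκ0 s)) (fun B G hB hG => ?_) m
    have h1 : ∀ v : Fin n, gCov H (fun σ => fWt q β (colInd v s σ)) G =
        -(cP β / xiP q β) * gCov H (colInd v s) G := fun v => by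
      rw [← gCov_affine_left H (1 + cP β / xiP q β * (q : ℝ)⁻¹)]
      congr 1; funext σ; rw [fWt_eq hβ]; ring
    simp only [h1, abs_mul, abs_neg, abs_of_nonneg hcξ0]
    rw [← Finset.mul_sum]
    have h2 := sum_abs_gCov_le H (n : ℝ)⁻¹ hcV (fun v => colInd v s) hB hG hη
    calc _ = cP β / xiP q β * ((n : ℝ)⁻¹ * ∑ v, |gCov H (colInd v s) G|) := by ring
      _ ≤ Real.exp β * (B * κ s) := by
        refine mul_le_mul hcξ h2 ?_ (Real.exp_pos _).le
        exact mul_nonneg (by positivity) (Finset.sum_nonneg fun _ _ => abs_nonneg _)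
      _ = _ := by ring
  have hdrift : ∀ s (τ : Fin n → Fin q), |d * (cP β / xiP q β) * colDev s τ| ≤ D := fun s τ => by
    rw [abs_mul, abs_of_nonneg (mul_nonneg hd hcξ0)]
    have := abs_colDev_le hn s τ
    calc _ ≤ d * Real.exp β * 1 := by gcongr
      _ = D := by rw [mul_one]
  have hθ : ∀ s (τ : Fin n → Fin q), |Real.exp (d * (cP β / xiP q β) * colDev s τ) - 1| ≤
      D * Real.exp D * |colDev s τ| := fun s τ => by
    refine (abs_exp_sub_one_le _).trans ?_
    have h1 : |d * (cP β / xiP q β) * colDev s τ| ≤ D * |colDev s τ| := by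
      rw [abs_mul, abs_of_nonneg (mul_nonneg hd hcξ0)]
      exact mul_le_mul_of_nonneg_right (mul_le_mul_of_nonneg_left hcξ hd) (abs_nonneg _)
    calc _ ≤ D * |colDev s τ| * Real.exp D := by gcongr; exact hdrift s τ
      _ = _ := by ring
  have hterm : ∀ (m : ℕ) (l : Fin m → Fin n),
      |LamFn (partZ (pullPot (restr n) H + drift (newEdgeRate q β n (d / n)) +
        ∑ i, edgePot q β 0 (l i).succ) / partZ H) -
        LamFn (partZ (0 + ∑ i, fun s => fPot q β (gibbs H (colInd (l i) s))))| ≤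
      Real.exp (q + D) * Real.exp β ^ m * (Real.exp β ^ m * (D * Real.exp D) * M +
        ∑ s, |gibbs H (fun σ => ∏ i, fWt q β (colInd (l i) s σ)) -
          ∏ i, gibbs H (fun σ => fWt q β (colInd (l i) s σ))|) := fun m l => by
    rw [partZ_attach hβ hn, partZ_bethe hβ]
    have hprod : ∀ s τ, ∏ i, fWt q β (colInd (l i) s τ) ∈
        Set.Icc (Real.exp (-(m * β))) (Real.exp (m * β)) := fun s τ => prod_mem_Icc_exp fun i => hw _ _ _
    have hA := abs_log_sum_le (q := q) (r := m * β + D)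
      (f := fun s => gibbs H fun τ => Real.exp (d * (cP β / xiP q β) * colDev s τ) *
        ∏ i, fWt q β (colInd (l i) s τ)) fun s => gibbs_mem_Icc H fun τ => by
      have h1 := hprod s τ
      have h2 := abs_le.1 (hdrift s τ)
      constructor
      · rw [show -(m * β + D) = -D + -(m * β) by ring, Real.exp_add]
        exact mul_le_mul (Real.exp_le_exp.2 h2.1) h1.1 (Real.exp_pos _).le (Real.exp_pos _).le
      · rw [add_comm, Real.exp_add]
        exact mul_le_mul (Real.exp_le_exp.2 h2.2) h1.2 ((Real.exp_pos _).le.trans h1.1) (Real.exp_pos _).le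
    have hB := abs_log_sum_le (q := q) (r := m * β + D)
      (f := fun s => ∏ i, gibbs H fun τ => fWt q β (colInd (l i) s τ)) fun s => by
      have := prod_mem_Icc_exp (β := β) fun i => gibbs_mem_Icc H fun τ => hw (l i) s τ
      exact ⟨(Real.exp_le_exp.2 (by linarith)).trans this.1, this.2.trans (Real.exp_le_exp.2 (by linarith))⟩
    refine (abs_LamFn_sub_le hA.2 hB.2 hA.1 hB.1).trans ?_
    rw [show (q : ℝ) + (m * β + D) = (q + D) + m * β by ring, Real.exp_add, Real.exp_nat_mul]
    refine mul_le_mul_of_nonneg_left ?_ (by positivity)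
    rw [← Finset.sum_sub_distrib]
    refine (Finset.abs_sum_le_sum_abs _ _).trans ?_
    have hMsum : M = ∑ s, gibbs H (fun σ => |colDev s σ|) := gibbs_sum _ _ _
    rw [hMsum, Finset.mul_sum, ← Finset.sum_add_distrib]
    refine Finset.sum_le_sum fun s _ => ?_
    refine (abs_sub_le _ (gibbs H (fun σ => ∏ i, fWt q β (colInd (l i) s σ))) _).trans
      (add_le_add_left ?_ _)
    rw [← gibbs_sub, ← gibbs_const_mul]
    have h3 : ∀ τ, |Real.exp (d * (cP β / xiP q β) * colDev s τ) * ∏ i, fWt q β (colInd (l i) s τ) -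
        ∏ i, fWt q β (colInd (l i) s τ)| ≤ Real.exp β ^ m * (D * Real.exp D) * |colDev s τ| := fun τ => by
      rw [← sub_one_mul, abs_mul, abs_of_pos ((Real.exp_pos _).trans_le (hprod s τ).1), ← Real.exp_nat_mul]
      calc _ ≤ (D * Real.exp D * |colDev s τ|) * Real.exp (m * β) :=
            mul_le_mul (hθ s τ) (hprod s τ).2 ((Real.exp_pos _).le.trans (hprod s τ).1) (by positivity)
        _ = _ := by ring
    rw [abs_le]
    constructor
    · have h4 := gibbs_mono H fun τ => (abs_le.1 (h3 τ)).1
      have h5 := gibbs_const_mul H (-1) fun τ => Real.exp β ^ m * (D * Real.exp D) * |colDev s τ|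
      simp only [neg_mul, one_mul] at h5 h4
      rw [← h5]; exact h4
    · exact gibbs_mono H fun τ => (abs_le.1 (h3 τ)).2
  have hvg : vertexGain (restr n) (newEdgeRate q β n (d / n)) H =
    Pois (newEdgeRate q β n (d / n)) (fun H' => LamFn (partZ H' / partZ H))
      (pullPot (restr n) H + drift (newEdgeRate q β n (d / n))) := rfl
  have hbv : q * betheV β d (margLaw hn H) = Pois (rateOf (fun v s => fPot q β (gibbs H (colInd v s)))
      fun _ : Fin n => d * (n : ℝ)⁻¹) (fun h => LamFn (partZ h)) 0 := by
    rw [betheV, mul_inv_cancel_left₀ q_pos.ne']; rfl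
  have hTot : rateTot (newEdgeRate q β n (d / n)) = d := by
    rw [newEdgeRate, rateTot_rateOf]; simp; field_simp
  have hmain := abs_pois_sub_le_of_pow (ν := newEdgeRate q β n (d / n))
    (ν' := rateOf (fun v s => fPot q β (gibbs H (colInd v s))) fun _ : Fin n => d * (n : ℝ)⁻¹)
    (F := fun H' => LamFn (partZ H' / partZ H)) (F' := fun h => LamFn (partZ h))
    (expGrowth_LamFn_div _ (partZ_pos H)) expGrowth_lam_partZ
    (by rw [hTot, rateTot_rateOf]; simp; field_simp)
    (H := pullPot (restr n) H + drift (newEdgeRate q β n (d / n))) (H' := 0)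
    (C := C₀ * K) (x := 2 * d * Real.exp β ^ 2) fun m => by
      rw [jumpOp_pow_rateOf]
      conv_lhs => enter [1, 1]; rw [newEdgeRate, jumpOp_pow_rateOf]
      rw [← Finset.sum_sub_distrib]
      refine (Finset.abs_sum_le_sum_abs _ _).trans ?_
      simp only [Finset.prod_const, Finset.card_univ, Fintype.card_fin]
      have e1 : d / n = d * (n : ℝ)⁻¹ := div_eq_mul_inv _ _
      calc _ ≤ ∑ l : Fin m → Fin n, (d * (n : ℝ)⁻¹) ^ m *
            (Real.exp (q + D) * Real.exp β ^ m * (Real.exp β ^ m * (D * Real.exp D) * M +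
            ∑ s, |gibbs H (fun σ => ∏ i, fWt q β (colInd (l i) s σ)) -
              ∏ i, gibbs H (fun σ => fWt q β (colInd (l i) s σ))|)) := by
            refine Finset.sum_le_sum fun l _ => ?_
            rw [← e1, ← mul_sub, abs_mul, abs_of_nonneg (by positivity : 0 ≤ (d / n) ^ m)]
            refine mul_le_mul_of_nonneg_left ?_ (by positivity)
            have := hterm m l
            rw [newEdgeRate] at this
            exact this
        _ = d ^ m * Real.exp (q + D) * Real.exp β ^ m * (Real.exp β ^ m * (D * Real.exp D) * M +
            ∑ s, ((n : ℝ)⁻¹ ^ m * ∑ l : Fin m → Fin n,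
              |gibbs H (fun σ => ∏ i, fWt q β (colInd (l i) s σ)) -
              ∏ i, gibbs H (fun σ => fWt q β (colInd (l i) s σ))|)) := by
            rw [← Finset.mul_sum, ← Finset.mul_sum, Finset.sum_add_distrib, Finset.sum_comm,
              ← Finset.mul_sum, Finset.sum_const, Finset.card_univ, Fintype.card_fun,
              Fintype.card_fin, Fintype.card_fin, nsmul_eq_mul, mul_pow]
            have : (n : ℝ)⁻¹ ^ m * ((n ^ m : ℕ) : ℝ) = 1 := by
              push_cast; rw [← mul_pow, inv_mul_cancel₀ hn'.ne', one_pow]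
            rw [← Finset.mul_sum]
            linear_combination d ^ m * Real.exp (q + D) * Real.exp β ^ m *
              (Real.exp β ^ m * (D * Real.exp D) * M) * this
        _ ≤ d ^ m * Real.exp (q + D) * Real.exp β ^ m * (Real.exp β ^ m * (D * Real.exp D) * M +
            ∑ s, m * Real.exp β ^ m * (Real.exp β * κ s)) := by
            exact mul_le_mul_of_nonneg_left (add_le_add_right
              (Finset.sum_le_sum fun s _ => hfac m s) _) (by positivity)
        _ = d ^ m * Real.exp (q + D) * (Real.exp β ^ 2) ^ m * (1 * (D * Real.exp D * M) +
            m * (Real.exp β * ∑ s, κ s)) := by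
            rw [← Finset.mul_sum, ← Finset.mul_sum]; ring
        _ ≤ d ^ m * Real.exp (q + D) * (Real.exp β ^ 2) ^ m * (2 ^ m * (D * Real.exp D * M) +
            2 ^ m * (Real.exp β * ∑ s, κ s)) := by
            have h2 : (m : ℝ) ≤ 2 ^ m := by exact_mod_cast (Nat.lt_two_pow_self).le
            have h3 : (1 : ℝ) ≤ 2 ^ m := one_le_pow₀ (by norm_num)
            have h4 : 0 ≤ ∑ s, κ s := Finset.sum_nonneg fun s _ => hκ0 s
            exact mul_le_mul_of_nonneg_left (add_le_add
              (mul_le_mul_of_nonneg_right h3 (by positivity))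
              (mul_le_mul_of_nonneg_right h2 (by positivity))) (by positivity)
        _ ≤ C₀ * K * (2 * d * Real.exp β ^ 2) ^ m := by
            have h4 : 0 ≤ ∑ s, κ s := Finset.sum_nonneg fun s _ => hκ0 s
            rw [hC₀, hK, mul_pow, mul_pow]
            have h5 : 0 ≤ d ^ m * Real.exp (q + D) * (Real.exp β ^ 2) ^ m * 2 ^ m := by positivity
            have h6 : D * Real.exp D * M + Real.exp β * ∑ s, κ s ≤
                (D * Real.exp D + Real.exp β) * (M + ∑ s, κ s) := by
              have := mul_nonneg (Real.exp_pos β).le hM0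
              have : 0 ≤ D * Real.exp D * ∑ s, κ s := by positivity
              linarith
            have := mul_le_mul_of_nonneg_left h6 h5
            linarith
  rw [hvg, hbv]
  refine hmain.trans (le_of_eq ?_)
  rw [hTot]; ring

end VertexCompare

noncomputable section VertexStep

variable {q : ℕ} [NeZero q] {β : ℝ} {n : ℕ}

lemma fWt_sub_le (hβ : 0 < β) (x y : ℝ) :
    |fWt q β x - fWt q β y| ≤ Real.exp β * |x - y| := by
  have h : fWt q β x - fWt q β y = -(cP β / xiP q β) * (x - y) := by
    rw [fWt_eq hβ, fWt_eq hβ]; ring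
  rw [h, abs_mul, abs_neg, abs_of_nonneg (div_nonneg (cP_pos hβ).le (xiP_pos hβ).le)]
  exact mul_le_mul_of_nonneg_right (cP_div_xiP_le hβ) (abs_nonneg _)

lemma abs_lamZ_fWt_sub_le (hβ : 0 < β) {x y : ℝ} (hx : x ∈ Set.Icc (0 : ℝ) 1)
    (hy : y ∈ Set.Icc (0 : ℝ) 1) :
    |lamZ (fWt q β x) - lamZ (fWt q β y)| ≤ β * Real.exp β * |x - y| := by
  refine (abs_lamZ_sub_le (abs_fPot_le hβ hx.1 hx.2) (abs_fPot_le hβ hy.1 hy.2)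
    (fWt_pos hβ hx.2) (fWt_pos hβ hy.2)).trans ?_
  rw [mul_assoc]
  exact mul_le_mul_of_nonneg_left (fWt_sub_le hβ x y) hβ.le

lemma gibbs_agree_sub (H : (Fin n → Fin q) → ℝ) (v w : Fin n) :
    gibbs H (agree v w) - ∑ s, gibbs H (colInd v s) * gibbs H (colInd w s) =
      ∑ s, gCov H (colInd v s) (colInd w s) := by
  have : gibbs H (agree v w) = ∑ s, gibbs H fun σ => colInd v s σ * colInd w s σ := by
    rw [← gibbs_sum]
    congr 1
    funext σ
    exact agree_eq_sum_colInd v w σ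
  rw [this, ← Finset.sum_sub_distrib]
  rfl

/-- The average entropy gain of adding a uniformly random edge. -/
def pairGain (β : ℝ) (H : (Fin n → Fin q) → ℝ) : ℝ :=
  (n : ℝ)⁻¹ ^ 2 * ∑ v, ∑ w, lamZ (fWt q β (gibbs H (agree v w)))

lemma pairGain_mem (hβ : 0 < β) (hn : 0 < n) (H : (Fin n → Fin q) → ℝ) :
    pairGain β H ∈ Set.Icc 0 (Real.exp (2 * β)) := by
  have hm : ∀ v w : Fin n, gibbs H (agree v w) ∈ Set.Icc (0 : ℝ) 1 := fun v w =>
    gibbs_mem_Icc H (agree_mem v w)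
  have hn' : (0 : ℝ) < n := by exact_mod_cast hn
  constructor
  · exact mul_nonneg (by positivity) (Finset.sum_nonneg fun v _ => Finset.sum_nonneg fun w _ =>
      lamZ_nonneg (fWt_pos hβ (hm v w).2).le)
  · have : ∑ v : Fin n, ∑ w : Fin n, lamZ (fWt q β (gibbs H (agree v w))) ≤
        ∑ _v : Fin n, ∑ _w : Fin n, Real.exp (2 * β) :=
      Finset.sum_le_sum fun v _ => Finset.sum_le_sum fun w _ =>
        lamZ_fWt_le hβ (hm v w).1 (hm v w).2
    refine (mul_le_mul_of_nonneg_left this (by positivity)).trans (le_of_eq ?_)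
    simp
    field_simp

lemma abs_betheE_margLaw_sub_le (hβ : 0 < β) {d : ℝ} (hd : 0 ≤ d) (hn : 0 < n)
    (H : (Fin n → Fin q) → ℝ) {η : ℝ} (hη : 0 < η) :
    |betheE β d (margLaw hn H) - d / 2 * pairGain β H| ≤
      d / 2 * (β * Real.exp β * (q * η + corrEnergy H / η)) := by
  have hn' : (0 : ℝ) < n := by exact_mod_cast hn
  have hrw : betheE β d (margLaw hn H) - d / 2 * pairGain β H =
      d / 2 * ((n : ℝ)⁻¹ ^ 2 * ∑ v, ∑ w,
        (lamZ (fWt q β (∑ s, gibbs H (colInd v s) * gibbs H (colInd w s))) -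
          lamZ (fWt q β (gibbs H (agree v w))))) := by
    simp only [betheE, pairGain, margLaw, Finset.mul_sum, ← Finset.sum_sub_distrib]
    refine Finset.sum_congr rfl fun v _ => Finset.sum_congr rfl fun w _ => ?_
    ring
  have hpt : ∀ v w : Fin n, |lamZ (fWt q β (∑ s, gibbs H (colInd v s) * gibbs H (colInd w s))) -
      lamZ (fWt q β (gibbs H (agree v w)))| ≤
      β * Real.exp β * ∑ s, (η + gCov H (colInd v s) (colInd w s) ^ 2 / η) := by
    intro v w
    refine (abs_lamZ_fWt_sub_le hβ (sum_mul_mem_Icc ((margLaw hn H).ρ_mem v)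
      ((margLaw hn H).ρ_mem w)) (gibbs_mem_Icc H (agree_mem v w))).trans ?_
    refine mul_le_mul_of_nonneg_left ?_ (mul_nonneg hβ.le (Real.exp_pos _).le)
    rw [abs_sub_comm]
    refine (le_of_eq (congrArg _ (gibbs_agree_sub H v w))).trans ?_
    exact (Finset.abs_sum_le_sum_abs _ _).trans (Finset.sum_le_sum fun s _ => abs_le_add_sq_div hη)
  rw [hrw, abs_mul, abs_of_nonneg (by positivity : 0 ≤ d / 2)]
  refine mul_le_mul_of_nonneg_left ?_ (by positivity)
  rw [abs_mul, abs_of_nonneg (by positivity : (0 : ℝ) ≤ (n : ℝ)⁻¹ ^ 2)]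
  have h1 : |∑ v : Fin n, ∑ w : Fin n,
        (lamZ (fWt q β (∑ s, gibbs H (colInd v s) * gibbs H (colInd w s))) -
          lamZ (fWt q β (gibbs H (agree v w))))| ≤ ∑ v : Fin n, ∑ w : Fin n,
      β * Real.exp β * ∑ s, (η + gCov H (colInd v s) (colInd w s) ^ 2 / η) :=
    (Finset.abs_sum_le_sum_abs _ _).trans (Finset.sum_le_sum fun v _ =>
      (Finset.abs_sum_le_sum_abs _ _).trans (Finset.sum_le_sum fun w _ => hpt v w))
  refine (mul_le_mul_of_nonneg_left h1 (by positivity)).trans (le_of_eq ?_)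
  have h2 : ∑ v : Fin n, ∑ w : Fin n, ∑ s : Fin q, gCov H (colInd v s) (colInd w s) ^ 2 =
      ∑ s : Fin q, ∑ v : Fin n, ∑ w : Fin n, gCov H (colInd v s) (colInd w s) ^ 2 := by
    rw [Finset.sum_comm' (t' := univ) (s' := fun _ => univ) (by simp)]
    rw [Finset.sum_congr rfl fun w _ => Finset.sum_comm]
    rw [Finset.sum_comm]
    exact Finset.sum_congr rfl fun s _ => Finset.sum_comm
  simp only [← Finset.mul_sum, Finset.sum_add_distrib, ← Finset.sum_div, h2, corrEnergy]
  simp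
  field_simp

lemma exists_vertex_step_le (q : ℕ) [NeZero q] (hβ : 0 < β) {d : ℝ} (hd : 0 ≤ d) {b : ℝ}
    (hb : ∀ (J : Type) [Fintype J] (P : FinLaw q J), P.Balanced →
      betheV β d P - betheE β d P ≤ b) :
    ∃ C, 0 ≤ C ∧ ∀ (n : ℕ) (_hn : 0 < n) (H : (Fin n → Fin q) → ℝ) (η : ℝ), 0 < η → η ≤ 1 →
      (q : ℝ)⁻¹ * vertexGain (restr n) (newEdgeRate q β n (d / n)) H ≤
        d / 2 * pairGain β H + b + C * (gibbs H colUnbal + (η + corrEnergy H / η ^ 3)) := by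
  obtain ⟨C₁, hC₁, h₁⟩ := exists_abs_vertexGain_sub_le q hβ hd
  obtain ⟨C₂, hC₂, h₂⟩ := exists_balanced_bethe_ge q hβ hd
  have hq1 : (1 : ℝ) ≤ q := one_le_q
  have hq0 : (0 : ℝ) < q := q_pos
  refine ⟨C₁ * (2 * q) + C₂ + d / 2 * (β * Real.exp β * q), by positivity, ?_⟩
  intro n hn H η hη hη1
  have a₁ := (abs_le.1 (h₁ n hn H η hη)).2
  obtain ⟨P', hP', a₂⟩ := h₂ (Fin n) (margLaw hn H)
  have a₃ := hb _ P' hP'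
  have a₄ := (abs_le.1 (abs_betheE_margLaw_sub_le hβ hd hn H hη)).2
  have a₅ := imbalance_margLaw_le hn H
  have hE := corrEnergy_nonneg H
  have hU : 0 ≤ gibbs H colUnbal := gibbs_nonneg H fun σ => Finset.sum_nonneg fun s _ => abs_nonneg _
  set E := corrEnergy H with hEdef
  set U := gibbs H (colUnbal (q := q) (n := n)) with hUdef
  have hE3 : E / η ≤ E / η ^ 3 :=
    div_le_div_of_nonneg_left hE (by positivity) (by
      calc η ^ 3 ≤ η ^ 1 := pow_le_pow_of_le_one hη.le hη1 (by norm_num)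
        _ = η := pow_one η)
  have hE30 : 0 ≤ E / η ^ 3 := by positivity
  have b₁ : (q : ℝ)⁻¹ * vertexGain (restr n) (newEdgeRate q β n (d / n)) H ≤
      betheV β d (margLaw hn H) + C₁ * (U + (2 * q * η + E / η ^ 3)) := by
    have : vertexGain (restr n) (newEdgeRate q β n (d / n)) H ≤
        q * betheV β d (margLaw hn H) + C₁ * (U + (2 * q * η + E / η ^ 3)) := by linarith
    have h3 : 0 ≤ C₁ * (U + (2 * q * η + E / η ^ 3)) := by positivity
    calc _ ≤ (q : ℝ)⁻¹ * (q * betheV β d (margLaw hn H) + C₁ * (U + (2 * q * η + E / η ^ 3))) :=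
          mul_le_mul_of_nonneg_left this (by positivity)
      _ = betheV β d (margLaw hn H) + (q : ℝ)⁻¹ * (C₁ * (U + (2 * q * η + E / η ^ 3))) := by
          field_simp
      _ ≤ _ := by
          have := mul_le_of_le_one_left h3 (inv_le_one_of_one_le₀ hq1)
          linarith
  have b₂ : C₂ * (margLaw hn H).imbalance ≤ C₂ * U := mul_le_mul_of_nonneg_left a₅ hC₂
  have hU' : U + (2 * q * η + E / η ^ 3) ≤ 2 * q * (U + (η + E / η ^ 3)) := by
    nlinarith
  have b₃ := mul_le_mul_of_nonneg_left hU' hC₁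
  have b₄ : d / 2 * (β * Real.exp β * (q * η + E / η)) ≤
      d / 2 * (β * Real.exp β * q) * (U + (η + E / η ^ 3)) := by
    have : q * η + E / η ≤ q * (U + (η + E / η ^ 3)) := by nlinarith
    calc _ ≤ d / 2 * (β * Real.exp β * (q * (U + (η + E / η ^ 3)))) := by gcongr
      _ = _ := by ring
  have b₅ : C₂ * U ≤ C₂ * (U + (η + E / η ^ 3)) :=
    mul_le_mul_of_nonneg_left (by linarith) hC₂
  nlinarith

/-- Adding centred potentials with uniformly bounded entropy gain. -/
lemma plantedFE_add_le {S : Type*} [Fintype S] [Nonempty S] {ν δ : (S → ℝ) →₀ ℝ} (hν : 0 ≤ ν)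
    (hδ : 0 ≤ δ) (hb : drift δ = 0) {D : ℝ} (hD : ∀ H, entGain δ H ≤ D) :
    plantedFE (ν + δ) ≤ plantedFE ν + D := by
  obtain ⟨C, hC⟩ := plantedFE_smul_le hδ hb
  have h := le_sub_of_increments (f := fun t => -plantedFE (ν + t • δ)) (L := -D) (C := C) ?_
  · simp only [zero_smul, add_zero, one_smul] at h
    linarith
  · intro t s ht hs hts
    have hνt : 0 ≤ ν + t • δ := add_nonneg hν (fun y => by simpa using mul_nonneg ht (hδ y))
    have h1 := hC (ν + t • δ) hνt s hs (by linarith)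
    have h2 : plantedE (ν + t • δ) (entGain δ) ≤ D := by
      have := plantedE_mono hνt (expGrowth_entGain δ) (ExpGrowth.const D) hD
      rwa [plantedE_const] at this
    have h3 : ν + (t + s) • δ = ν + t • δ + s • δ := by module
    rw [h3]
    nlinarith [mul_le_mul_of_nonneg_left h2 hs]

lemma sum_sq_sum (f : Fin q → ℝ) (hf : ∑ s, f s = 0) (n : ℕ) :
    ∑ σ : Fin n → Fin q, (∑ v, f (σ v)) ^ 2 = n * (q : ℝ) ^ n * ((q : ℝ)⁻¹ * ∑ s, f s ^ 2) := by
  have hq0 : (q : ℝ) ≠ 0 := q_pos.ne'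
  induction n with
  | zero => simp
  | succ n ih =>
    rw [sum_fin_cons]
    have h : ∀ (s : Fin q) (τ : Fin n → Fin q),
        (∑ v : Fin (n + 1), f ((Fin.cons s τ : Fin (n + 1) → Fin q) v)) ^ 2 =
          f s ^ 2 + f s * (2 * ∑ v, f (τ v)) + (∑ v, f (τ v)) ^ 2 := by
      intro s τ
      rw [Fin.sum_univ_succ]
      simp only [Fin.cons_zero, Fin.cons_succ]
      ring
    simp only [h, Finset.sum_add_distrib, ← Finset.mul_sum, ← Finset.sum_mul, hf, ih]
    simp only [Finset.sum_const, Finset.card_univ, Fintype.card_pi, Fintype.card_fin,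
      Finset.prod_const, nsmul_eq_mul, ← Finset.mul_sum, zero_mul]
    push_cast
    field_simp
    ring

lemma avg_colDev_sq (hn : 0 < n) (s : Fin q) :
    (Fintype.card (Fin n → Fin q) : ℝ)⁻¹ * ∑ σ : Fin n → Fin q, colDev s σ ^ 2 ≤ (n : ℝ)⁻¹ := by
  have hq0 : (0 : ℝ) < q := q_pos
  have hn' : (0 : ℝ) < n := by exact_mod_cast hn
  have h1 : ∀ σ : Fin n → Fin q, colDev s σ ^ 2 =
      (n : ℝ)⁻¹ ^ 2 * (∑ v, ((if σ v = s then (1 : ℝ) else 0) - (q : ℝ)⁻¹)) ^ 2 := by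
    intro σ
    rw [← mul_pow]
    simp only [colDev, colInd, Finset.sum_sub_distrib]
    simp
    field_simp
  have h2 : ∑ t : Fin q, ((if t = s then (1 : ℝ) else 0) - (q : ℝ)⁻¹) = 0 := by
    simp [hq0.ne']
  simp only [h1, ← Finset.mul_sum]
  rw [sum_sq_sum (fun t => (if t = s then (1 : ℝ) else 0) - (q : ℝ)⁻¹) h2]
  have h3 : ∑ t : Fin q, ((if t = s then (1 : ℝ) else 0) - (q : ℝ)⁻¹) ^ 2 ≤ q := by
    calc _ ≤ ∑ _t : Fin q, (1 : ℝ) := Finset.sum_le_sum fun t _ => by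
          have : (q : ℝ)⁻¹ ≤ 1 := inv_le_one_of_one_le₀ one_le_q
          have h0 : 0 < (q : ℝ)⁻¹ := by positivity
          split_ifs <;> nlinarith
      _ = q := by simp
  have hc : (Fintype.card (Fin n → Fin q) : ℝ) = (q : ℝ) ^ n := by simp
  rw [hc]
  calc _ = (n : ℝ)⁻¹ * ((q : ℝ)⁻¹ * ∑ t : Fin q, ((if t = s then (1 : ℝ) else 0) - (q : ℝ)⁻¹) ^ 2) := by
        field_simp
    _ ≤ (n : ℝ)⁻¹ * ((q : ℝ)⁻¹ * q) := by gcongr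
    _ = _ := by field_simp

lemma avg_colUnbal_le (hn : 0 < n) {η : ℝ} (hη : 0 < η) :
    (Fintype.card (Fin n → Fin q) : ℝ)⁻¹ * ∑ σ : Fin n → Fin q, colUnbal σ ≤
      q * (η + (n : ℝ)⁻¹ / η) := by
  have hc : (Fintype.card (Fin n → Fin q) : ℝ) ≠ 0 := by simp [NeZero.ne q]
  have h1 : ∑ σ : Fin n → Fin q, colUnbal σ ≤
      ∑ σ : Fin n → Fin q, ∑ s : Fin q, (η + colDev s σ ^ 2 / η) :=
    Finset.sum_le_sum fun σ _ => Finset.sum_le_sum fun s _ => abs_le_add_sq_div hη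
  refine (mul_le_mul_of_nonneg_left h1 (by positivity)).trans ?_
  rw [Finset.sum_comm, Finset.mul_sum]
  calc _ ≤ ∑ _s : Fin q, (η + (n : ℝ)⁻¹ / η) := Finset.sum_le_sum fun s _ => by
        rw [Finset.sum_add_distrib, ← Finset.sum_div, mul_add]
        refine add_le_add (le_of_eq ?_) ?_
        · rw [Finset.sum_const, Finset.card_univ, nsmul_eq_mul, inv_mul_cancel_left₀ hc]
        · rw [← mul_div_assoc]
          exact div_le_div_of_nonneg_right (avg_colDev_sq hn s) hη.le
    _ = _ := by simp [mul_add]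

/-- The uniform law on point masses. -/
def pinLaw (q : ℕ) [NeZero q] : FinLaw q (Fin q) where
  p _ := (q : ℝ)⁻¹
  ρ t s := if t = s then 1 else 0
  p_nonneg _ := by positivity
  p_sum := by simp [NeZero.ne q]
  ρ_mem t := ite_mem_stdSimplex t

lemma pinLaw_balanced : (pinLaw q).Balanced := fun s => by simp [FinLaw.bary, pinLaw]

lemma rootRate_nonneg {J : Type} [Fintype J] (n : ℕ) {d : ℝ} (h : 0 ≤ d) (P : FinLaw q J) :
    0 ≤ rootRate β n d P := rateOf_nonneg _ fun j => mul_nonneg h (P.p_nonneg j)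

lemma entGain_rootRate_le {J : Type} [Fintype J] (hβ : 0 < β) (n : ℕ) {d : ℝ} (h : 0 ≤ d)
    (P : FinLaw q J) (H : (Fin (n + 1) → Fin q) → ℝ) :
    entGain (rootRate β n d P) H ≤ d * Real.exp (2 * β) := by
  rw [rootRate, entGain_rateOf]
  calc _ ≤ ∑ j, d * P.p j * Real.exp (2 * β) := Finset.sum_le_sum fun j _ => by
        refine mul_le_mul_of_nonneg_left ?_ (mul_nonneg h (P.p_nonneg j))
        have hm : ∀ σ : Fin (n + 1) → Fin q, P.ρ j (σ 0) ∈ Set.Icc (0 : ℝ) 1 := fun σ =>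
          P.ρ_mem_Icc j _
        have := zRatio_fPot hβ (q := q) H (fun σ => (hm σ).2)
        change lamZ (zRatio H fun σ => fPot q β (P.ρ j (σ 0))) ≤ _
        rw [this]
        have hg := gibbs_mem_Icc H hm
        exact lamZ_fWt_le hβ hg.1 hg.2
    _ = _ := by rw [← Finset.sum_mul, ← Finset.mul_sum, P.p_sum, mul_one]

lemma newEdgeRate_nonneg (n : ℕ) {lam : ℝ} (h : 0 ≤ lam) : 0 ≤ newEdgeRate q β n lam :=
  rateOf_nonneg _ fun _ => h

lemma expGrowth_partZ_inv {S : Type*} [Fintype S] [Nonempty S] :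
    ExpGrowth fun H : S → ℝ => (partZ H)⁻¹ := by
  refine ExpGrowth.of_abs_le (expGrowth_exp_norm 1 zero_le_one) fun H => ?_
  rw [abs_of_pos (inv_pos.2 (partZ_pos H)), one_mul]
  obtain ⟨σ⟩ := ‹Nonempty S›
  rw [inv_le_comm₀ (partZ_pos H) (Real.exp_pos _), ← Real.exp_neg]
  refine le_trans (Real.exp_le_exp.2 ?_)
    (Finset.single_le_sum (f := fun σ => Real.exp (H σ)) (fun _ _ => (Real.exp_pos _).le)
      (Finset.mem_univ σ))
  have := norm_le_pi_norm H σ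
  rw [Real.norm_eq_abs] at this
  linarith [neg_abs_le (H σ)]

lemma expGrowth_vertexGain {S S' : Type*} [Fintype S] [Nonempty S] [Fintype S'] [Nonempty S']
    (r : S' → S) (δ : (S' → ℝ) →₀ ℝ) : ExpGrowth (vertexGain r δ) := by
  have h : vertexGain r δ = fun H => (partZ H)⁻¹ *
      (plantedK δ (fun H' => LamFn (partZ H')) (pullPot r H) -
      partZ (pullPot r H) * Real.log (partZ H)) := by
    funext H
    rw [← partZ_mul_vertexGain, inv_mul_cancel_left₀ (partZ_pos H).ne']
  rw [h]
  exact expGrowth_partZ_inv.mul (((expGrowth_lam_partZ.plantedK δ).comp_pullPot r).sub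
    ((expGrowth_partZ.comp_pullPot r).mul expGrowth_log_partZ))

end VertexStep

noncomputable section Pinning

lemma sq_div_le_lamZ {x : ℝ} (hx : 0 < x) : (x - 1) ^ 2 / (2 * (x + 1)) ≤ lamZ x := by
  have hs : 0 < Real.sqrt x := Real.sqrt_pos.2 hx
  have hsq : Real.sqrt x ^ 2 = x := Real.sq_sqrt hx.le
  set r := Real.sqrt x with hr
  have h1 : 1 - r⁻¹ ≤ Real.log r := Real.one_sub_inv_le_log_of_pos hs
  have h2 : Real.log x = 2 * Real.log r := by
    rw [← hsq, Real.log_pow]; norm_num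
  have h3 : (r - 1) ^ 2 ≤ lamZ x := by
    rw [lamZ, LamFn, h2, ← hsq]
    have : r ^ 2 * (2 * (1 - r⁻¹)) ≤ r ^ 2 * (2 * Real.log r) := by gcongr
    have h4 : r ^ 2 * (2 * (1 - r⁻¹)) = 2 * r ^ 2 - 2 * r := by field_simp
    nlinarith
  refine le_trans ?_ h3
  rw [div_le_iff₀ (by positivity), ← hsq]
  nlinarith [sq_nonneg ((r - 1) ^ 2)]

lemma lamZ_strong_tangent {x y M : ℝ} (hx : 0 < x) (hy : 0 < y) (hxM : x ≤ M) (hyM : y ≤ M) :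
    lamZ y + Real.log y * (x - y) + (x - y) ^ 2 / (4 * M) ≤ lamZ x := by
  have h := mul_le_mul_of_nonneg_left (sq_div_le_lamZ (div_pos hx hy)) hy.le
  have h1 : y * lamZ (x / y) = lamZ x - lamZ y - Real.log y * (x - y) := by
    simp only [lamZ, LamFn]
    rw [Real.log_div hx.ne' hy.ne']
    field_simp
    ring
  have h2 : y * ((x / y - 1) ^ 2 / (2 * (x / y + 1))) = (x - y) ^ 2 / (2 * (x + y)) := by
    field_simp
  have h3 : (x - y) ^ 2 / (4 * M) ≤ (x - y) ^ 2 / (2 * (x + y)) :=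
    div_le_div_of_nonneg_left (sq_nonneg _) (by positivity) (by linarith)
  rw [h1, h2] at h
  linarith

variable {S X : Type*} [Fintype S] [Nonempty S] [Fintype X]

/-- The derivative density of the entropy gain along the direction `rateOf ψ r`. -/
def pinGain (ψ : X → S → ℝ) (r : X → ℝ) (H : S → ℝ) : ℝ :=
  ∑ x, r x * (zRatio H (ψ x) * entGain (rateOf ψ r) (H + ψ x) - entGain (rateOf ψ r) H)

lemma partZ_mul_pinGain (ψ : X → S → ℝ) (r : X → ℝ) (H : S → ℝ) :
    partZ H * pinGain ψ r H =
      jumpOp (rateOf ψ r) (fun H => partZ H * entGain (rateOf ψ r) H) H -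
        rateTot (rateOf ψ r) * (partZ H * entGain (rateOf ψ r) H) := by
  rw [jumpOp_rateOf, rateTot_rateOf, pinGain, Finset.mul_sum, Finset.sum_mul,
    ← Finset.sum_sub_distrib]
  refine Finset.sum_congr rfl fun x _ => ?_
  rw [zRatio]
  field_simp [(partZ_pos H).ne']

lemma expGrowth_pinGain (ψ : X → S → ℝ) (r : X → ℝ) : ExpGrowth (pinGain ψ r) := by
  have hg : ExpGrowth fun H => partZ H * entGain (rateOf ψ r) H :=
    expGrowth_partZ.mul (expGrowth_entGain _)
  have h : pinGain ψ r = fun H => (partZ H)⁻¹ *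
      (jumpOp (rateOf ψ r) (fun H => partZ H * entGain (rateOf ψ r) H) H -
        rateTot (rateOf ψ r) * (partZ H * entGain (rateOf ψ r) H)) := by
    funext H
    rw [← partZ_mul_pinGain, inv_mul_cancel_left₀ (partZ_pos H).ne']
  rw [h]
  exact expGrowth_partZ_inv.mul ((hg.jump _).sub (hg.const_mul _))

lemma hasDerivAt_plantedE_entGain (ν : (S → ℝ) →₀ ℝ) (ψ : X → S → ℝ) (r : X → ℝ)
    (hb : drift (rateOf ψ r) = 0) (t : ℝ) :
    HasDerivAt (fun t : ℝ => plantedE (ν + t • rateOf ψ r) (entGain (rateOf ψ r)))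
      (plantedE (ν + t • rateOf ψ r) (pinGain ψ r)) t := by
  have hg : ExpGrowth fun H => partZ H * entGain (rateOf ψ r) H :=
    expGrowth_partZ.mul (expGrowth_entGain _)
  have h := (hasDerivAt_pois hg ν (rateOf ψ r) (0 + drift ν) t).const_mul (Fintype.card S : ℝ)⁻¹
  have hd : ∀ t : ℝ, drift (ν + t • rateOf ψ r) = drift ν := fun t => by simp [hb]
  simp only [plantedE, plantedK, hd, partZ_mul_pinGain]
  exact h

lemma pinGain_ge (ψ : X → S → ℝ) {r : X → ℝ} (hr : ∀ x, 0 ≤ r x)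
    (hb : drift (rateOf ψ r) = 0) {y₀ : ℝ} (hψ : ∀ x, ‖ψ x‖ ≤ y₀) (H : S → ℝ) :
    Real.exp (-(2 * y₀)) / 4 * ∑ x, ∑ y, r x * r y *
      gCov H (fun σ => Real.exp (ψ x σ)) (fun σ => Real.exp (ψ y σ)) ^ 2 ≤ pinGain ψ r H := by
  have hR : ∀ H : S → ℝ, ∑ x, r x * zRatio H (ψ x) = ∑ x, r x := by
    intro H
    have h0 : ∀ σ, ∑ x, r x * Real.exp (ψ x σ) = ∑ x, r x := by
      intro σ
      have := congrFun hb σ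
      rw [drift_rateOf] at this
      simp only [mul_sub, mul_one, Finset.sum_sub_distrib, Pi.zero_apply, neg_eq_zero] at this
      linarith
    simp only [zRatio_eq_gibbs, ← gibbs_const_mul, ← gibbs_sum]
    simp only [h0, gibbs_const]
  have hup : ∀ (H : S → ℝ) x, zRatio H (ψ x) ≤ Real.exp y₀ := fun H x =>
    (zRatio_le H (ψ x)).trans (Real.exp_le_exp.2 (hψ x))
  have hcov : ∀ x y, gCov H (fun σ => Real.exp (ψ x σ)) (fun σ => Real.exp (ψ y σ)) =
      zRatio H (ψ x) * (zRatio (H + ψ x) (ψ y) - zRatio H (ψ y)) := by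
    intro x y
    rw [mul_sub, zRatio_mul, gCov, zRatio_eq_gibbs, zRatio_eq_gibbs, zRatio_eq_gibbs]
    simp only [Pi.add_apply, Real.exp_add]
  have key : ∀ x y, zRatio H (ψ x) * lamZ (zRatio (H + ψ x) (ψ y)) ≥
      zRatio H (ψ x) * lamZ (zRatio H (ψ y)) +
        Real.log (zRatio H (ψ y)) * (zRatio H (ψ x + ψ y) - zRatio H (ψ x) * zRatio H (ψ y)) +
        Real.exp (-(2 * y₀)) / 4 *
          gCov H (fun σ => Real.exp (ψ x σ)) (fun σ => Real.exp (ψ y σ)) ^ 2 := by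
    intro x y
    have hz := zRatio_pos H (ψ x)
    have h1 := mul_le_mul_of_nonneg_left (lamZ_strong_tangent (zRatio_pos (H + ψ x) (ψ y))
      (zRatio_pos H (ψ y)) (hup _ y) (hup _ y)) hz.le
    rw [hcov, ← zRatio_mul]
    have h2 : Real.exp (-(2 * y₀)) / 4 *
        (zRatio H (ψ x) * (zRatio (H + ψ x) (ψ y) - zRatio H (ψ y))) ^ 2 ≤
        zRatio H (ψ x) * ((zRatio (H + ψ x) (ψ y) - zRatio H (ψ y)) ^ 2 / (4 * Real.exp y₀)) := by
      have h3 : Real.exp (-(2 * y₀)) * Real.exp y₀ * zRatio H (ψ x) ≤ 1 := by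
        calc _ ≤ Real.exp (-(2 * y₀)) * Real.exp y₀ * Real.exp y₀ :=
              mul_le_mul_of_nonneg_left (hup H x) (by positivity)
          _ = 1 := by rw [← Real.exp_add, ← Real.exp_add]; ring_nf; exact Real.exp_zero
      have he := Real.exp_pos y₀
      rw [← mul_div_assoc, le_div_iff₀ (by positivity)]
      calc _ = (Real.exp (-(2 * y₀)) * Real.exp y₀ * zRatio H (ψ x)) *
            (zRatio H (ψ x) * (zRatio (H + ψ x) (ψ y) - zRatio H (ψ y)) ^ 2) := by ring
        _ ≤ 1 * (zRatio H (ψ x) * (zRatio (H + ψ x) (ψ y) - zRatio H (ψ y)) ^ 2) := by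
            gcongr
        _ = _ := one_mul _
    nlinarith
  have hexp : pinGain ψ r H = ∑ x, ∑ y, r x * r y *
      (zRatio H (ψ x) * lamZ (zRatio (H + ψ x) (ψ y)) - lamZ (zRatio H (ψ y))) := by
    simp only [pinGain, entGain_rateOf, Finset.mul_sum, ← Finset.sum_sub_distrib]
    refine Finset.sum_congr rfl fun x _ => Finset.sum_congr rfl fun y _ => ?_
    ring
  have hlow : ∑ x, ∑ y, r x * r y * ((zRatio H (ψ x) - 1) * lamZ (zRatio H (ψ y)) +
        Real.log (zRatio H (ψ y)) * (zRatio H (ψ x + ψ y) - zRatio H (ψ x) * zRatio H (ψ y)) +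
        Real.exp (-(2 * y₀)) / 4 *
          gCov H (fun σ => Real.exp (ψ x σ)) (fun σ => Real.exp (ψ y σ)) ^ 2) ≤ pinGain ψ r H := by
    rw [hexp]
    refine Finset.sum_le_sum fun x _ => Finset.sum_le_sum fun y _ =>
      mul_le_mul_of_nonneg_left ?_ (mul_nonneg (hr x) (hr y))
    linarith [key x y]
  refine le_trans (le_of_eq ?_) hlow
  have e1 : ∑ x, ∑ y, r x * r y * ((zRatio H (ψ x) - 1) * lamZ (zRatio H (ψ y))) = 0 := by
    have : ∑ x, r x * (zRatio H (ψ x) - 1) = 0 := by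
      simp only [mul_sub, mul_one, Finset.sum_sub_distrib, hR, sub_self]
    calc _ = (∑ x, r x * (zRatio H (ψ x) - 1)) * ∑ y, r y * lamZ (zRatio H (ψ y)) := by
          rw [Finset.sum_mul_sum]
          refine Finset.sum_congr rfl fun x _ => Finset.sum_congr rfl fun y _ => ?_
          ring
      _ = 0 := by rw [this, zero_mul]
  have e2 : ∑ x, ∑ y, r x * r y * (Real.log (zRatio H (ψ y)) *
      (zRatio H (ψ x + ψ y) - zRatio H (ψ x) * zRatio H (ψ y))) = 0 := by
    rw [Finset.sum_comm]
    refine Finset.sum_eq_zero fun y _ => ?_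
    have h1 : ∀ x, r x * r y * (Real.log (zRatio H (ψ y)) *
        (zRatio H (ψ x + ψ y) - zRatio H (ψ x) * zRatio H (ψ y))) =
        r y * Real.log (zRatio H (ψ y)) * zRatio H (ψ y) *
          (r x * zRatio (H + ψ y) (ψ x) - r x * zRatio H (ψ x)) := by
      intro x
      rw [add_comm (ψ x), ← zRatio_mul]
      ring
    simp only [h1, ← Finset.mul_sum, Finset.sum_sub_distrib, hR, sub_self, mul_zero]
  simp only [mul_add, Finset.sum_add_distrib, e1, e2, zero_add, Finset.mul_sum]
  refine Finset.sum_congr rfl fun x _ => Finset.sum_congr rfl fun y _ => ?_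
  ring

end Pinning

noncomputable section PottsPinning

variable {q : ℕ} [NeZero q] {β : ℝ} {n : ℕ}

lemma gCov_fWt (hβ : 0 < β) {S : Type*} [Fintype S] [Nonempty S] (H f g : S → ℝ) :
    gCov H (fun σ => fWt q β (f σ)) (fun σ => fWt q β (g σ)) =
      (cP β / xiP q β) ^ 2 * gCov H f g := by
  have h : ∀ f : S → ℝ, (fun σ => fWt q β (f σ)) =
      fun σ => (1 + cP β / xiP q β * (q : ℝ)⁻¹) + (-(cP β / xiP q β)) * f σ := by
    intro f; funext σ; rw [fWt_eq hβ]; ring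
  rw [h f, h g, gCov_affine_left, gCov_comm, gCov_affine_left, gCov_comm]
  ring

lemma corrEnergy_le (hn : 0 < n) (H : (Fin n → Fin q) → ℝ) : corrEnergy H ≤ q := by
  have hn' : (0 : ℝ) < n := by exact_mod_cast hn
  have h : ∀ (s : Fin q) (v w : Fin n), gCov H (colInd v s) (colInd w s) ^ 2 ≤ 1 := by
    intro s v w
    have h1 := gibbs_mem_Icc H (colInd_mem v s)
    have h2 := gibbs_mem_Icc H (colInd_mem w s)
    have h3 := gibbs_mem_Icc H (f := fun σ => colInd v s σ * colInd w s σ) (a := 0) (b := 1)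
      fun σ => ⟨mul_nonneg (colInd_mem v s σ).1 (colInd_mem w s σ).1,
        mul_le_one₀ (colInd_mem v s σ).2 (colInd_mem w s σ).1 (colInd_mem w s σ).2⟩
    have h4 : gibbs H (colInd v s) * gibbs H (colInd w s) ≤ 1 := mul_le_one₀ h1.2 h2.1 h2.2
    have h5 : 0 ≤ gibbs H (colInd v s) * gibbs H (colInd w s) := mul_nonneg h1.1 h2.1
    rw [sq_le_one_iff_abs_le_one, gCov, abs_le]
    exact ⟨by linarith [h3.1], by linarith [h3.2]⟩
  calc corrEnergy H ≤ ∑ _s : Fin q, ((n : ℝ)⁻¹ ^ 2 * ∑ _v : Fin n, ∑ _w : Fin n, (1 : ℝ)) := by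
        refine Finset.sum_le_sum fun s _ => mul_le_mul_of_nonneg_left ?_ (by positivity)
        exact Finset.sum_le_sum fun v _ => Finset.sum_le_sum fun w _ => h s v w
    _ = q := by simp; field_simp

lemma expGrowth_of_bounded {E : Type*} [NormedAddCommGroup E] {F : E → ℝ} {a b : ℝ}
    (h : ∀ H, F H ∈ Set.Icc a b) : ExpGrowth F :=
  (ExpGrowth.const (max |a| |b|)).of_abs_le fun H => abs_le_max_abs_abs (h H).1 (h H).2

lemma expGrowth_corrEnergy (hn : 0 < n) :
    ExpGrowth fun H : (Fin n → Fin q) → ℝ => corrEnergy H :=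
  expGrowth_of_bounded (a := 0) (b := q) fun H => ⟨corrEnergy_nonneg H, corrEnergy_le hn H⟩

/-- The pinning potentials. -/
def pinPot (q : ℕ) (β : ℝ) (n : ℕ) (x : Fin n × Fin q) : (Fin n → Fin q) → ℝ :=
  halfPot q β x.1 fun s => if x.2 = s then 1 else 0

lemma halfRate_pinLaw (n : ℕ) (ε : ℝ) : halfRate β n ε (pinLaw q) =
    ε • rateOf (pinPot q β n) fun _ => (q : ℝ)⁻¹ := by
  rw [← rateOf_smul]; rfl

lemma drift_pin (hβ : 0 < β) (n : ℕ) :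
    drift (rateOf (pinPot q β n) fun _ => (q : ℝ)⁻¹) = 0 := by
  have := drift_halfRate (pinLaw_balanced (q := q)) hβ n 1
  rwa [halfRate_pinLaw, one_smul] at this

lemma entGain_pin_le (hβ : 0 < β) (n : ℕ) (H : (Fin n → Fin q) → ℝ) :
    entGain (rateOf (pinPot q β n) fun _ => (q : ℝ)⁻¹) H ≤ n * Real.exp (2 * β) := by
  have h := entGain_halfRate hβ n 1 (pinLaw q) H
  rw [halfRate_pinLaw, one_smul, one_mul] at h
  rw [h]
  calc _ ≤ ∑ _v : Fin n, ∑ j : Fin q, (pinLaw q).p j * Real.exp (2 * β) := by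
        refine Finset.sum_le_sum fun v _ => Finset.sum_le_sum fun j _ =>
          mul_le_mul_of_nonneg_left ?_ ((pinLaw q).p_nonneg j)
        have hg := gibbs_mem_Icc H (fun σ => (pinLaw q).ρ_mem_Icc j (σ v))
        exact lamZ_fWt_le hβ hg.1 hg.2
    _ = _ := by simp [← Finset.sum_mul, (pinLaw q).p_sum]

lemma pinGain_pin_ge (hβ : 0 < β) (n : ℕ) (H : (Fin n → Fin q) → ℝ) :
    Real.exp (-(2 * β)) / 4 * ((q : ℝ)⁻¹ ^ 2 * cP β ^ 4) * (n ^ 2 * corrEnergy H) ≤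
      pinGain (pinPot q β n) (fun _ => (q : ℝ)⁻¹) H := by
  have hq0 : (0 : ℝ) < q := q_pos
  refine le_trans ?_ (pinGain_ge (pinPot q β n) (fun _ => by positivity) (drift_pin hβ n)
    (fun x => norm_fPot_le hβ fun σ => (pinLaw q).ρ_mem_Icc x.2 (σ x.1)) H)
  rw [mul_assoc]
  refine mul_le_mul_of_nonneg_left ?_ (by positivity)
  have hexp : ∀ x : Fin n × Fin q, (fun σ => Real.exp (pinPot q β n x σ)) =
      fun σ => fWt q β (colInd x.1 x.2 σ) := by
    intro x; funext σ
    have := exp_fPot (q := q) hβ (colInd_mem x.1 x.2 σ).2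
    rw [← this]
    simp only [pinPot, halfPot, colInd]
    congr 2
    exact if_congr eq_comm rfl rfl
  have hc : cP β ≤ cP β / xiP q β :=
    le_div_self (cP_pos hβ).le (xiP_pos hβ) (xiP_le_one hβ)
  have hc0 := (cP_pos hβ).le
  have hterm : ∀ x y : Fin n × Fin q, (q : ℝ)⁻¹ * (q : ℝ)⁻¹ *
      gCov H (fun σ => Real.exp (pinPot q β n x σ)) (fun σ => Real.exp (pinPot q β n y σ)) ^ 2 ≥
      (q : ℝ)⁻¹ ^ 2 * cP β ^ 4 * gCov H (colInd x.1 x.2) (colInd y.1 y.2) ^ 2 := by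
    intro x y
    rw [hexp, hexp, gCov_fWt hβ]
    have h4 : cP β ^ 4 ≤ (cP β / xiP q β) ^ 4 := pow_le_pow_left₀ hc0 hc 4
    calc _ ≤ (q : ℝ)⁻¹ ^ 2 * (cP β / xiP q β) ^ 4 * gCov H (colInd x.1 x.2) (colInd y.1 y.2) ^ 2 := by
          gcongr
      _ = _ := by ring
  refine le_trans ?_ (Finset.sum_le_sum fun x _ => Finset.sum_le_sum fun y _ => hterm x y)
  simp only [← Finset.mul_sum]
  refine mul_le_mul_of_nonneg_left ?_ (by positivity)
  have hce : (n : ℝ) ^ 2 * corrEnergy H =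
      ∑ s : Fin q, ∑ v : Fin n, ∑ w : Fin n, gCov H (colInd v s) (colInd w s) ^ 2 := by
    rcases Nat.eq_zero_or_pos n with rfl | hn
    · simp
    have hn' : (0 : ℝ) < n := by exact_mod_cast hn
    rw [corrEnergy, Finset.mul_sum]
    refine Finset.sum_congr rfl fun s _ => ?_
    field_simp
  rw [hce, Fintype.sum_prod_type, Finset.sum_comm]
  refine Finset.sum_le_sum fun v _ => Finset.sum_le_sum fun s _ => ?_
  rw [Fintype.sum_prod_type]
  refine Finset.sum_le_sum fun w _ => ?_
  exact Finset.single_le_sum (f := fun t => gCov H (colInd v s) (colInd w t) ^ 2)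
    (fun _ _ => sq_nonneg _) (Finset.mem_univ s)

end PottsPinning

noncomputable section UpperBound

variable {q : ℕ} [NeZero q] {β : ℝ} {n : ℕ}

lemma edgeRate_add (n : ℕ) (a b : ℝ) :
    edgeRate q β n (a + b) = edgeRate q β n a + edgeRate q β n b := rateOf_add _ _ _

/-- Edges with rate `lam` and pins with rate `ε` per vertex. -/
def pinnedRate (q : ℕ) [NeZero q] (β : ℝ) (n : ℕ) (lam ε : ℝ) : ((Fin n → Fin q) → ℝ) →₀ ℝ :=
  edgeRate q β n lam + halfRate β n ε (pinLaw q)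

lemma pinnedRate_nonneg (n : ℕ) {lam ε : ℝ} (hl : 0 ≤ lam) (hε : 0 ≤ ε) :
    0 ≤ pinnedRate q β n lam ε :=
  add_nonneg (edgeRate_nonneg n hl) (halfRate_nonneg n hε _)

lemma plantedE_gibbs_colUnbal_le (hn : 0 < n) (ν : ((Fin n → Fin q) → ℝ) →₀ ℝ) {η : ℝ}
    (hη : 0 < η) : plantedE ν (fun H => gibbs H colUnbal) ≤ q * (η + (n : ℝ)⁻¹ / η) := by
  rw [plantedE_gibbs]
  exact avg_colUnbal_le hn hη

lemma colUnbal_mem (hn : 0 < n) (σ : Fin n → Fin q) : colUnbal σ ∈ Set.Icc (0 : ℝ) q := by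
  refine ⟨Finset.sum_nonneg fun s _ => abs_nonneg _, ?_⟩
  calc colUnbal σ ≤ ∑ _s : Fin q, (1 : ℝ) := Finset.sum_le_sum fun s _ => abs_colDev_le hn s σ
    _ = q := by simp

lemma expGrowth_pairGain (hβ : 0 < β) (hn : 0 < n) :
    ExpGrowth fun H : (Fin n → Fin q) → ℝ => pairGain β H :=
  expGrowth_of_bounded fun H => pairGain_mem hβ hn H

lemma expGrowth_gibbs {S : Type*} [Fintype S] [Nonempty S] {f : S → ℝ} {a b : ℝ}
    (hf : ∀ σ, f σ ∈ Set.Icc a b) : ExpGrowth fun H => gibbs H f :=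
  expGrowth_of_bounded fun H => gibbs_mem_Icc H hf

lemma plantedFE_edge_increment_ge (hβ : 0 < β) {d ε : ℝ} (hd : 0 ≤ d) (hε : 0 ≤ ε)
    (hn : 2 ≤ n) :
    plantedFE (pinnedRate q β n (d / n) ε) +
      (d / 2 * plantedE (pinnedRate q β n (d / n) ε) (fun H => pairGain β H) -
        d / 2 * Real.exp (2 * β) * ((n : ℝ) - 1)⁻¹) ≤
    plantedFE (pinnedRate q β n (d / ((n : ℝ) - 1)) ε) := by
  have hn' : (2 : ℝ) ≤ n := by exact_mod_cast hn
  have hn1 : (0 : ℝ) < (n : ℝ) - 1 := by linarith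
  have hn0 : (0 : ℝ) < n := by linarith
  have hsplit : d / ((n : ℝ) - 1) = d / n + d / (n * ((n : ℝ) - 1)) := by field_simp; ring
  have hrate : pinnedRate q β n (d / ((n : ℝ) - 1)) ε =
      pinnedRate q β n (d / n) ε + edgeRate q β n (d / (n * ((n : ℝ) - 1))) := by
    rw [pinnedRate, hsplit, edgeRate_add, pinnedRate]; abel
  have hν : 0 ≤ pinnedRate q β n (d / n) ε := pinnedRate_nonneg n (by positivity) hε
  rw [hrate]
  refine le_trans ?_ (plantedFE_add_ge hν (edgeRate_nonneg n (by positivity)))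
  refine add_le_add_right ?_ _
  have hpt : ∀ H : (Fin n → Fin q) → ℝ, d / 2 * pairGain β H + -(d / 2 * Real.exp (2 * β) *
      ((n : ℝ) - 1)⁻¹) ≤ entGain (edgeRate q β n (d / (n * ((n : ℝ) - 1)))) H := by
    intro H
    rw [entGain_edgeRate hβ]
    have hp := pairGain_mem hβ (by omega : 0 < n) H
    have hs : ∑ v, ∑ w, lamZ (fWt q β (gibbs H (agree v w))) = n ^ 2 * pairGain β H := by
      rw [pairGain]; field_simp
    have hl : lamZ (fWt q β 1) ≤ Real.exp (2 * β) := lamZ_fWt_le hβ zero_le_one le_rfl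
    rw [hs]
    have e1 : d / (n * ((n : ℝ) - 1)) / 2 * (n ^ 2 * pairGain β H - n * lamZ (fWt q β 1)) =
        d / 2 * pairGain β H + d / 2 * ((n : ℝ) - 1)⁻¹ * (pairGain β H - lamZ (fWt q β 1)) := by
      field_simp; ring
    rw [e1]
    have : d / 2 * ((n : ℝ) - 1)⁻¹ * (-Real.exp (2 * β)) ≤
        d / 2 * ((n : ℝ) - 1)⁻¹ * (pairGain β H - lamZ (fWt q β 1)) :=
      mul_le_mul_of_nonneg_left (by linarith [hp.1]) (by positivity)
    nlinarith
  have hpg := expGrowth_pairGain (q := q) hβ (by omega : 0 < n)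
  have := plantedE_mono hν ((hpg.const_mul (d / 2)).add (ExpGrowth.const _))
    (expGrowth_entGain _) hpt
  rw [plantedE_add _ (hpg.const_mul _) (ExpGrowth.const _), plantedE_const_mul,
    plantedE_const] at this
  linarith

lemma plantedFE_vertex_increment_le (hβ : 0 < β) {d ε : ℝ} (hd : 0 ≤ d) (hε : 0 ≤ ε) (hn : 0 < n) :
    plantedFE (pinnedRate q β (n + 1) (d / n) ε) ≤ plantedFE (pinnedRate q β n (d / n) ε) +
      (q : ℝ)⁻¹ * plantedE (pinnedRate q β n (d / n) ε)
        (vertexGain (restr n) (newEdgeRate q β n (d / n))) + ε * Real.exp (2 * β) := by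
  have hrate : pinnedRate q β (n + 1) (d / n) ε =
      (pinnedRate q β n (d / n) ε).mapDomain (pullPot (restr n)) +
        newEdgeRate q β n (d / n) + rootRate β n ε (pinLaw q) := by
    rw [pinnedRate, edgeRate_succ, halfRate_succ, pinnedRate, Finsupp.mapDomain_add]
    abel
  have hnn : 0 ≤ (pinnedRate q β n (d / n) ε).mapDomain (pullPot (restr n)) +
      newEdgeRate q β n (d / n) := by
    refine add_nonneg ?_ (newEdgeRate_nonneg n (by positivity))
    rw [pinnedRate, Finsupp.mapDomain_add, edgeRate, halfRate, mapDomain_rateOf, mapDomain_rateOf]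
    exact add_nonneg (rateOf_nonneg _ fun _ => by positivity)
      (rateOf_nonneg _ fun x => mul_nonneg hε ((pinLaw q).p_nonneg _))
  rw [hrate, ← plantedFE_mapDomain_add (restr n) q_pos (partZ_pull n)]
  exact plantedFE_add_le hnn (rootRate_nonneg n hε _) (drift_rootRate pinLaw_balanced hβ n ε)
    (entGain_rootRate_le hβ n hε _)

set_option maxHeartbeats 1000000 in
lemma exists_plantedFE_step_le (q : ℕ) [NeZero q] (hβ : 0 < β) {d : ℝ} (hd : 0 ≤ d) {b : ℝ}
    (hb : ∀ (J : Type) [Fintype J] (P : FinLaw q J), P.Balanced →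
      betheV β d P - betheE β d P ≤ b) :
    ∃ C, 0 ≤ C ∧ ∀ (n : ℕ) (_hn : 2 ≤ n) (η ε : ℝ), 0 < η → η ≤ 1 → 0 ≤ ε →
      plantedFE (pinnedRate q β (n + 1) (d / n) ε) ≤
        plantedFE (pinnedRate q β n (d / ((n : ℝ) - 1)) ε) + b +
        C * (ε + η + ((n : ℝ) - 1)⁻¹ / η +
          plantedE (pinnedRate q β n (d / n) ε) (fun H => corrEnergy H) / η ^ 3) := by
  obtain ⟨C, hC, h⟩ := exists_vertex_step_le q hβ hd hb
  have hq1 : (1 : ℝ) ≤ q := one_le_q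
  refine ⟨2 * q * C + (1 + d / 2) * Real.exp (2 * β), by positivity, ?_⟩
  intro n hn η ε hη hη1 hε
  have hn' : (2 : ℝ) ≤ n := by exact_mod_cast hn
  have hn0 : 0 < n := by omega
  have hν : 0 ≤ pinnedRate q β n (d / n) ε := pinnedRate_nonneg n (by positivity) hε
  have h1 := plantedFE_vertex_increment_le (q := q) hβ hd hε hn0
  have h2 := plantedFE_edge_increment_ge (q := q) hβ hd hε hn
  set ν := pinnedRate q β n (d / n) ε with hνdef
  have gp : ExpGrowth fun H : (Fin n → Fin q) → ℝ => pairGain β H := expGrowth_pairGain hβ hn0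
  have gu : ExpGrowth fun H : (Fin n → Fin q) → ℝ => gibbs H colUnbal :=
    expGrowth_gibbs (colUnbal_mem hn0)
  have gc : ExpGrowth fun H : (Fin n → Fin q) → ℝ => corrEnergy H := expGrowth_corrEnergy hn0
  have h3 := plantedE_mono hν ((expGrowth_vertexGain (restr n)
      (newEdgeRate q β n (d / n))).const_mul (q : ℝ)⁻¹)
    ((gp.const_mul (d / 2)).add ((gu.const_mul C).add ((gc.const_mul (C / η ^ 3)).add
      (ExpGrowth.const (b + C * η)))))
    (fun H => (h n hn0 H η hη hη1).trans (le_of_eq (by ring)))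
  rw [plantedE_const_mul, plantedE_add ν (gp.const_mul _) ((gu.const_mul C).add
      ((gc.const_mul (C / η ^ 3)).add (ExpGrowth.const (b + C * η)))),
    plantedE_add ν (gu.const_mul C) ((gc.const_mul (C / η ^ 3)).add (ExpGrowth.const (b + C * η))),
    plantedE_add ν (gc.const_mul (C / η ^ 3)) (ExpGrowth.const (b + C * η)), plantedE_const_mul,
    plantedE_const_mul, plantedE_const_mul, plantedE_const] at h3
  have h4 := mul_le_mul_of_nonneg_left (plantedE_gibbs_colUnbal_le hn0 ν hη) hC
  have hE0 : 0 ≤ plantedE ν (fun H => corrEnergy H) := plantedE_nonneg hν gc corrEnergy_nonneg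
  set E := plantedE ν (fun H => corrEnergy H) with hE
  have hinv : (n : ℝ)⁻¹ ≤ ((n : ℝ) - 1)⁻¹ := inv_anti₀ (by linarith) (by linarith)
  have hm0 : 0 ≤ ((n : ℝ) - 1)⁻¹ := inv_nonneg.2 (by linarith)
  set m := ((n : ℝ) - 1)⁻¹ with hm
  have hmη : m ≤ m / η := le_div_self hm0 hη hη1
  have hnη : (n : ℝ)⁻¹ / η ≤ m / η := div_le_div_of_nonneg_right hinv hη.le
  have hE3 : 0 ≤ E / η ^ 3 := by positivity
  have hX : 0 ≤ Real.exp (2 * β) := (Real.exp_pos _).le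
  have t1 : C / η ^ 3 * E = C * (E / η ^ 3) := by ring
  have t2 : C * (q * (η + (n : ℝ)⁻¹ / η)) ≤ q * C * (η + m / η) := by
    calc _ ≤ C * (q * (η + m / η)) := by gcongr
      _ = _ := by ring
  have t3 : C * (E / η ^ 3) + C * η ≤ q * C * (η + E / η ^ 3) := by
    calc _ = 1 * (C * (η + E / η ^ 3)) := by ring
      _ ≤ q * (C * (η + E / η ^ 3)) := by gcongr
      _ = _ := by ring
  have t4 : ε * Real.exp (2 * β) + d / 2 * Real.exp (2 * β) * m ≤
      (1 + d / 2) * Real.exp (2 * β) * (ε + m / η) := by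
    have a1 : d / 2 * Real.exp (2 * β) * m ≤ (1 + d / 2) * Real.exp (2 * β) * (m / η) := by
      gcongr; linarith
    have a2 : ε * Real.exp (2 * β) ≤ (1 + d / 2) * Real.exp (2 * β) * ε := by
      have : 0 ≤ d / 2 * (Real.exp (2 * β) * ε) := by positivity
      nlinarith
    linarith
  have hη0 : 0 ≤ m / η := by positivity
  have t5 : 0 ≤ q * C * ε := by positivity
  have t6 : 0 ≤ q * C * (m / η) := by positivity
  have t7 : 0 ≤ (1 + d / 2) * Real.exp (2 * β) * (η + E / η ^ 3) := by positivity
  have t8 : 0 ≤ q * C * (E / η ^ 3) := by positivity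
  have t9 : (2 * q * C + (1 + d / 2) * Real.exp (2 * β)) * (ε + η + m / η + E / η ^ 3) =
      q * C * (η + m / η) + q * C * (η + E / η ^ 3) +
      (1 + d / 2) * Real.exp (2 * β) * (ε + m / η) + 2 * (q * C * ε) + q * C * (m / η) +
      (1 + d / 2) * Real.exp (2 * β) * (η + E / η ^ 3) + q * C * (E / η ^ 3) := by ring
  rw [t9]
  rw [t1] at h3
  clear_value E m ν
  clear t9 t1 hE hm hνdef hν gp gu gc h
  generalize plantedE ν (vertexGain (restr n) (newEdgeRate q β n (d / n))) = V at *
  generalize plantedE ν (fun H => gibbs H colUnbal) = U at *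
  generalize plantedE ν (fun H => pairGain β H) = G at *
  linarith

lemma exists_pin_level (hβ : 0 < β) {d ε₀ : ℝ} (hd : 0 ≤ d) (hε₀ : 0 < ε₀) (A : Finset ℕ)
    (hA : ∀ n ∈ A, 0 < n) : ∃ ε ∈ Set.Ioo 0 ε₀,
    (Real.exp (-(2 * β)) / 4 * ((q : ℝ)⁻¹ ^ 2 * cP β ^ 4)) *
      ∑ n ∈ A, plantedE (pinnedRate q β n (d / n) ε) (fun H => corrEnergy H) ≤
        Real.exp (2 * β) / ε₀ * ∑ n ∈ A, (n : ℝ)⁻¹ := by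
  set δ : ∀ n : ℕ, ((Fin n → Fin q) → ℝ) →₀ ℝ :=
    fun n => rateOf (pinPot q β n) fun _ => (q : ℝ)⁻¹ with hδ
  have hq0 : (0 : ℝ) < q := q_pos
  have hδ0 : ∀ n, 0 ≤ δ n := fun n => rateOf_nonneg _ fun _ => by positivity
  have hpin : ∀ n ε, edgeRate q β n (d / n) + ε • δ n = pinnedRate q β n (d / n) ε := by
    intro n ε; rw [pinnedRate, halfRate_pinLaw]
  have hder : ∀ t : ℝ, HasDerivAt (fun t : ℝ => ∑ n ∈ A, ((n : ℝ) ^ 2)⁻¹ *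
      plantedE (edgeRate q β n (d / n) + t • δ n) (entGain (δ n)))
      (∑ n ∈ A, ((n : ℝ) ^ 2)⁻¹ * plantedE (edgeRate q β n (d / n) + t • δ n)
        (pinGain (pinPot q β n) fun _ => (q : ℝ)⁻¹)) t := fun t =>
    HasDerivAt.fun_sum fun n _ =>
      (hasDerivAt_plantedE_entGain _ _ _ (drift_pin hβ n) t).const_mul _
  obtain ⟨ε, hε, hslope⟩ := exists_hasDerivAt_eq_slope _ _ hε₀
    (HasDerivAt.continuousOn fun t _ => hder t) fun t _ => hder t
  refine ⟨ε, hε, ?_⟩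
  have hnn : ∀ (n : ℕ) (t : ℝ), 0 ≤ t → 0 ≤ edgeRate q β n (d / n) + t • δ n := by
    intro n t ht
    rw [hpin]; exact pinnedRate_nonneg n (by positivity) ht
  have hup : ∑ n ∈ A, ((n : ℝ) ^ 2)⁻¹ * plantedE (edgeRate q β n (d / n) + ε₀ • δ n)
      (entGain (δ n)) ≤ Real.exp (2 * β) * ∑ n ∈ A, (n : ℝ)⁻¹ := by
    rw [Finset.mul_sum]
    refine Finset.sum_le_sum fun n hn => ?_
    have hn' : (0 : ℝ) < n := by exact_mod_cast hA n hn
    have h := plantedE_mono (hnn n ε₀ hε₀.le) (expGrowth_entGain (δ n)) (ExpGrowth.const _)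
      (entGain_pin_le hβ n)
    rw [plantedE_const] at h
    calc _ ≤ ((n : ℝ) ^ 2)⁻¹ * (n * Real.exp (2 * β)) :=
          mul_le_mul_of_nonneg_left h (by positivity)
      _ = _ := by field_simp
  have hlo : 0 ≤ ∑ n ∈ A, ((n : ℝ) ^ 2)⁻¹ * plantedE (edgeRate q β n (d / n) + (0 : ℝ) • δ n)
      (entGain (δ n)) :=
    Finset.sum_nonneg fun n _ => mul_nonneg (by positivity)
      (plantedE_nonneg (hnn n 0 le_rfl) (expGrowth_entGain _) (entGain_nonneg (hδ0 n)))
  have hmain : (Real.exp (-(2 * β)) / 4 * ((q : ℝ)⁻¹ ^ 2 * cP β ^ 4)) *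
      ∑ n ∈ A, plantedE (pinnedRate q β n (d / n) ε) (fun H => corrEnergy H) ≤
      ∑ n ∈ A, ((n : ℝ) ^ 2)⁻¹ * plantedE (edgeRate q β n (d / n) + ε • δ n)
        (pinGain (pinPot q β n) fun _ => (q : ℝ)⁻¹) := by
    rw [Finset.mul_sum]
    refine Finset.sum_le_sum fun n hn => ?_
    have hn' : (0 : ℝ) < n := by exact_mod_cast hA n hn
    rw [hpin]
    have gc := expGrowth_corrEnergy (q := q) (hA n hn)
    have h := plantedE_mono (pinnedRate_nonneg (β := β) (q := q) n
        (by positivity : 0 ≤ d / (n : ℝ)) hε.1.le)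
      ((gc.const_mul ((n : ℝ) ^ 2)).const_mul _) (expGrowth_pinGain _ _) (pinGain_pin_ge hβ n)
    rw [plantedE_const_mul, plantedE_const_mul] at h
    calc _ = ((n : ℝ) ^ 2)⁻¹ * (Real.exp (-(2 * β)) / 4 * ((q : ℝ)⁻¹ ^ 2 * cP β ^ 4) *
          (n ^ 2 * plantedE (pinnedRate q β n (d / n) ε) fun H => corrEnergy H)) := by
          field_simp
      _ ≤ _ := mul_le_mul_of_nonneg_left h (by positivity)
  refine hmain.trans ?_
  rw [hslope, sub_zero, div_mul_eq_mul_div]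
  exact div_le_div_of_nonneg_right (by linarith) hε₀.le

/-- If the Bethe functional is bounded by `b` on balanced laws, so is the planted free energy per
vertex, asymptotically. -/
theorem plantedFE_le_of_bethe_le (hβ : 0 < β) {d : ℝ} (hd : 0 ≤ d) {b : ℝ}
    (hb : ∀ (J : Type) [Fintype J] (P : FinLaw q J), P.Balanced →
      betheV β d P - betheE β d P ≤ b) {δ : ℝ} (hδ : 0 < δ) :
    ∀ᶠ N : ℕ in Filter.atTop, plantedFE (edgeRate q β N (d / N)) ≤ N * (b + δ) := by
  obtain ⟨C, hC, hstep⟩ := exists_plantedFE_step_le q hβ hd hb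
  set η : ℝ := min 1 (δ / (8 * (C + 1))) with hη
  have hη0 : 0 < η := lt_min one_pos (by positivity)
  have hη1 : η ≤ 1 := min_le_left _ _
  have hCη : C * η ≤ δ / 8 := by
    have : η ≤ δ / (8 * (C + 1)) := min_le_right _ _
    calc C * η ≤ (C + 1) * (δ / (8 * (C + 1))) := by gcongr; linarith
      _ = δ / 8 := by field_simp
  set κ : ℝ := Real.exp (-(2 * β)) / 4 * ((q : ℝ)⁻¹ ^ 2 * cP β ^ 4) with hκ
  have hκ0 : 0 < κ := by have := cP_pos hβ; have := q_pos (q := q); positivity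
  set K : ℝ := C * (1 / η + Real.exp (2 * β) / η / κ / η ^ 3) with hK
  have hK0 : 0 ≤ K := by positivity
  set F2 : ℝ := plantedFE (pinnedRate q β 2 (d / ((2 : ℕ) - 1 : ℝ)) 1) with hF2
  have hbound : ∀ N : ℕ, 2 ≤ N → plantedFE (edgeRate q β N (d / N)) ≤
      F2 + |2 * b| + N * (b + δ / 4) + K * ∑ i ∈ Finset.range N, 1 / ((i : ℝ) + 1) := by
    intro N hN
    obtain ⟨M, rfl⟩ : ∃ M, N = M + 2 := ⟨N - 2, by omega⟩
    set A : Finset ℕ := (Finset.range M).map (addRightEmbedding 2) with hA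
    have hAsum : ∀ f : ℕ → ℝ, ∑ n ∈ A, f n = ∑ i ∈ Finset.range M, f (i + 2) := fun f => by
      rw [hA, Finset.sum_map]; rfl
    obtain ⟨ε, hε, hpin⟩ := exists_pin_level (q := q) hβ hd hη0 A (by
      intro n hn; simp [hA] at hn; omega)
    rw [hAsum, hAsum] at hpin
    have hharm0 : ∀ i : ℕ, 0 ≤ 1 / ((i : ℝ) + 1) := fun i => by positivity
    have htel : ∀ m : ℕ, plantedFE (pinnedRate q β (m + 2) (d / (((m + 2 : ℕ) : ℝ) - 1)) ε) ≤
        plantedFE (pinnedRate q β 2 (d / ((2 : ℕ) - 1 : ℝ)) ε) + ∑ i ∈ Finset.range m,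
          (b + C * (ε + η + 1 / ((i : ℝ) + 1) / η +
            plantedE (pinnedRate q β (i + 2) (d / ((i + 2 : ℕ) : ℝ)) ε)
              (fun H => corrEnergy H) / η ^ 3)) := by
      intro m
      induction m with
      | zero => simp
      | succ m ih =>
        have h := hstep (m + 2) (by omega) η ε hη0 hη1 hε.1.le
        have e1 : ((m + 1 + 2 : ℕ) : ℝ) - 1 = ((m + 2 : ℕ) : ℝ) := by push_cast; ring
        have e2 : (((m + 2 : ℕ) : ℝ) - 1)⁻¹ = 1 / ((m : ℝ) + 1) := by
          rw [one_div]; congr 1; push_cast; ring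
        rw [Finset.sum_range_succ, e1]
        rw [e2] at h
        linarith
    have hFN : plantedFE (edgeRate q β (M + 2) (d / ((M + 2 : ℕ) : ℝ))) ≤
        plantedFE (pinnedRate q β (M + 2) (d / (((M + 2 : ℕ) : ℝ) - 1)) ε) := by
      have hlt : d / ((M + 2 : ℕ) : ℝ) ≤ d / (((M + 2 : ℕ) : ℝ) - 1) :=
        div_le_div_of_nonneg_left hd (by push_cast; linarith [Nat.cast_nonneg (α := ℝ) M])
          (by linarith)
      have hr : pinnedRate q β (M + 2) (d / (((M + 2 : ℕ) : ℝ) - 1)) ε =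
          edgeRate q β (M + 2) (d / ((M + 2 : ℕ) : ℝ)) +
            pinnedRate q β (M + 2) (d / (((M + 2 : ℕ) : ℝ) - 1) - d / ((M + 2 : ℕ) : ℝ)) ε := by
        rw [pinnedRate, pinnedRate, ← add_assoc, ← edgeRate_add]
        congr 2; ring
      rw [hr]
      exact plantedFE_mono (edgeRate_nonneg _ (by positivity))
        (pinnedRate_nonneg _ (by linarith) hε.1.le)
    have hF2' : plantedFE (pinnedRate q β 2 (d / ((2 : ℕ) - 1 : ℝ)) ε) ≤ F2 := by
      have hr : pinnedRate q β 2 (d / ((2 : ℕ) - 1 : ℝ)) 1 =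
          pinnedRate q β 2 (d / ((2 : ℕ) - 1 : ℝ)) ε + halfRate β 2 (1 - ε) (pinLaw q) := by
        rw [pinnedRate, pinnedRate, halfRate_pinLaw, halfRate_pinLaw, halfRate_pinLaw]
        module
      rw [hF2, hr]
      exact plantedFE_mono (pinnedRate_nonneg _ (by norm_num; exact hd) hε.1.le)
        (halfRate_nonneg _ (by linarith [hε.2]) _)
    have hsum : ∑ i ∈ Finset.range M,
          (b + C * (ε + η + 1 / ((i : ℝ) + 1) / η +
            plantedE (pinnedRate q β (i + 2) (d / ((i + 2 : ℕ) : ℝ)) ε)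
              (fun H => corrEnergy H) / η ^ 3)) =
        M * (b + C * (ε + η)) + C * (1 / η) * ∑ i ∈ Finset.range M, 1 / ((i : ℝ) + 1) +
          C / η ^ 3 * ∑ i ∈ Finset.range M,
            plantedE (pinnedRate q β (i + 2) (d / ((i + 2 : ℕ) : ℝ)) ε) (fun H => corrEnergy H) := by
      rw [Finset.mul_sum, Finset.mul_sum]
      have : (M : ℝ) * (b + C * (ε + η)) = ∑ _i ∈ Finset.range M, (b + C * (ε + η)) := by
        rw [Finset.sum_const, Finset.card_range, nsmul_eq_mul]
      rw [this, ← Finset.sum_add_distrib, ← Finset.sum_add_distrib]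
      refine Finset.sum_congr rfl fun i _ => ?_
      ring
    have hinv : ∑ i ∈ Finset.range M, (((i + 2 : ℕ) : ℝ))⁻¹ ≤
        ∑ i ∈ Finset.range M, 1 / ((i : ℝ) + 1) :=
      Finset.sum_le_sum fun i _ => by
        rw [one_div]
        exact inv_anti₀ (by positivity) (by push_cast; linarith)
    have hmono : ∑ i ∈ Finset.range M, 1 / ((i : ℝ) + 1) ≤
        ∑ i ∈ Finset.range (M + 2), 1 / ((i : ℝ) + 1) :=
      Finset.sum_le_sum_of_subset_of_nonneg (Finset.range_mono (by omega)) fun i _ _ => hharm0 i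
    set h1 := ∑ i ∈ Finset.range M, 1 / ((i : ℝ) + 1) with hh1
    set E := ∑ i ∈ Finset.range M,
      plantedE (pinnedRate q β (i + 2) (d / ((i + 2 : ℕ) : ℝ)) ε) (fun H => corrEnergy H) with hE
    have hE' : E ≤ Real.exp (2 * β) / η / κ * h1 := by
      have : κ * E ≤ Real.exp (2 * β) / η * h1 :=
        hpin.trans (mul_le_mul_of_nonneg_left hinv (by positivity))
      calc E = κ * E / κ := by field_simp
        _ ≤ Real.exp (2 * β) / η * h1 / κ := div_le_div_of_nonneg_right this hκ0.le
        _ = _ := by ring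
    have hC3 : C / η ^ 3 * E ≤ C / η ^ 3 * (Real.exp (2 * β) / η / κ * h1) :=
      mul_le_mul_of_nonneg_left hE' (by positivity)
    have hKh : K * h1 ≤ K * ∑ i ∈ Finset.range (M + 2), 1 / ((i : ℝ) + 1) :=
      mul_le_mul_of_nonneg_left hmono hK0
    have hKe : K * h1 = C * (1 / η) * h1 + C / η ^ 3 * (Real.exp (2 * β) / η / κ * h1) := by
      rw [hK]; ring
    have hεη : C * (ε + η) ≤ δ / 4 := by
      have : C * ε ≤ C * η := mul_le_mul_of_nonneg_left hε.2.le hC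
      nlinarith
    have hMb : (M : ℝ) * (b + C * (ε + η)) ≤ |2 * b| + ((M + 2 : ℕ) : ℝ) * (b + δ / 4) := by
      have := mul_le_mul_of_nonneg_left hεη (Nat.cast_nonneg (α := ℝ) M)
      push_cast
      nlinarith [neg_abs_le (2 * b)]
    have := htel M
    rw [hsum] at this
    linarith
  have hces : Filter.Tendsto (fun N : ℕ => (N : ℝ)⁻¹ * ∑ i ∈ Finset.range N, 1 / ((i : ℝ) + 1))
      Filter.atTop (nhds 0) := by
    simpa using (tendsto_one_div_add_atTop_nhds_zero_nat (𝕜 := ℝ)).cesaro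
  have hδ4 : K * 0 < δ / 4 := by rw [mul_zero]; positivity
  have hδ4' : (F2 + |2 * b|) * 0 < δ / 4 := by rw [mul_zero]; positivity
  have hces' := (hces.const_mul K).eventually (gt_mem_nhds hδ4)
  have hconst := (tendsto_inv_atTop_nhds_zero_nat (𝕜 := ℝ)).const_mul (F2 + |2 * b|)
  have hconst' := hconst.eventually (gt_mem_nhds hδ4')
  filter_upwards [hces', hconst', Filter.eventually_ge_atTop 2] with N h1 h2 hN
  have hN' : (0 : ℝ) < N := by exact_mod_cast (by omega : 0 < N)
  have hb' := hbound N hN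
  have h3 : F2 + |2 * b| ≤ N * (δ / 4) := by
    have := mul_le_mul_of_nonneg_left h2.le hN'.le
    calc _ = N * ((F2 + |2 * b|) * (N : ℝ)⁻¹) := by field_simp
      _ ≤ _ := this
  have h4 : K * ∑ i ∈ Finset.range N, 1 / ((i : ℝ) + 1) ≤ N * (δ / 4) := by
    have := mul_le_mul_of_nonneg_left h1.le hN'.le
    calc _ = N * (K * ((N : ℝ)⁻¹ * ∑ i ∈ Finset.range N, 1 / ((i : ℝ) + 1))) := by field_simp
      _ ≤ _ := this
  nlinarith

end UpperBound

noncomputable section NullModel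

variable {S : Type*} [Fintype S] [Nonempty S]

lemma one_add_mul_exp_le (x m : ℝ) : Real.exp m * (1 + (x - m)) ≤ Real.exp x := by
  have h := Real.add_one_le_exp (x - m)
  calc Real.exp m * (1 + (x - m)) ≤ Real.exp m * Real.exp (x - m) :=
        mul_le_mul_of_nonneg_left (by linarith) (Real.exp_pos m).le
    _ = Real.exp x := by rw [← Real.exp_add]; congr 1; ring

lemma exp_gibbs_le (H y : S → ℝ) : Real.exp (gibbs H y) ≤ zRatio H y := by
  rw [zRatio_eq_gibbs]
  have h := gibbs_mono H (fun σ => one_add_mul_exp_le (y σ) (gibbs H y))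
  rw [gibbs_const_mul, gibbs_add, gibbs_const, gibbs_sub, gibbs_const, sub_self] at h
  simpa using h

lemma gibbs_le_log_partZ_add (H y : S → ℝ) :
    Real.log (partZ H) + gibbs H y ≤ Real.log (partZ (H + y)) := by
  have h := (Real.le_log_iff_exp_le (zRatio_pos H y)).2 (exp_gibbs_le H y)
  rw [zRatio, Real.log_div (partZ_pos _).ne' (partZ_pos _).ne'] at h
  linarith

lemma exp_pois_le {E : Type*} [NormedAddCommGroup E] {ν : E →₀ ℝ} (hν : 0 ≤ ν) {F : E → ℝ}
    (hF : ExpGrowth F) (hF' : ExpGrowth fun H => Real.exp (F H)) (H : E) :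
    Real.exp (Pois ν F H) ≤ Pois ν (fun H => Real.exp (F H)) H := by
  set m := Pois ν F H with hm
  have g := (ExpGrowth.const (E := E) 1).add (hF.sub (ExpGrowth.const m))
  have h := pois_mono hν (g.const_mul (Real.exp m)) hF' (fun H => one_add_mul_exp_le (F H) m) H
  rw [pois_const_mul, pois_add (ExpGrowth.const 1) (hF.sub (ExpGrowth.const m)), pois_const,
    pois_sub hF (ExpGrowth.const m), pois_const, ← hm, sub_self, add_zero, mul_one] at h
  exact h

lemma exp_plantedE_le {ν : (S → ℝ) →₀ ℝ} (hν : 0 ≤ ν) {F : (S → ℝ) → ℝ}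
    (hF : ExpGrowth F) (hF' : ExpGrowth fun H => Real.exp (F H)) :
    Real.exp (plantedE ν F) ≤ plantedE ν (fun H => Real.exp (F H)) := by
  set m := plantedE ν F with hm
  have g := (ExpGrowth.const (E := S → ℝ) 1).add (hF.sub (ExpGrowth.const m))
  have h := plantedE_mono hν (g.const_mul (Real.exp m)) hF' (fun H => one_add_mul_exp_le (F H) m)
  rw [plantedE_const_mul, plantedE_add ν (ExpGrowth.const 1) (hF.sub (ExpGrowth.const m)),
    plantedE_const, plantedE_sub ν hF (ExpGrowth.const m), plantedE_const, ← hm, sub_self,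
    add_zero, mul_one] at h
  exact h

lemma plantedE_log_partZ (ν : (S → ℝ) →₀ ℝ) :
    plantedE ν (fun H => Real.log (partZ H)) = plantedFE ν := rfl

lemma card_mul_plantedE_exp (ν : (S → ℝ) →₀ ℝ) (X : (S → ℝ) → ℝ) :
    (Fintype.card S : ℝ) * plantedE ν (fun H => Real.exp (X H - Real.log (partZ H))) =
      Pois ν (fun H => Real.exp (X H)) (drift ν) := by
  have h : ∀ H : S → ℝ, partZ H * Real.exp (X H - Real.log (partZ H)) = Real.exp (X H) := by
    intro H
    rw [Real.exp_sub, Real.exp_log (partZ_pos H), mul_div_cancel₀ _ (partZ_pos H).ne']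
  simp only [plantedE, plantedK, h, zero_add]
  rw [← mul_assoc, mul_inv_cancel₀ (by simp), one_mul]

/-- A small planted free energy forces a large null free energy. -/
lemma log_card_sub_plantedFE_le {ν : (S → ℝ) →₀ ℝ} (hν : 0 ≤ ν) {y₀ lam : ℝ} (hy₀ : 0 ≤ y₀)
    (hlam : 0 ≤ lam) (hsmall : lam * y₀ ≤ 1) (hsupp : ∀ y ∈ ν.support, ‖y‖ ≤ y₀)
    (hb : ∑ σ, drift ν σ = 0) :
    Real.log (Fintype.card S) - (1 - lam) * plantedFE ν ≤
      lam * Pois ν (fun H => Real.log (partZ H)) 0 + 10 * rateTot ν * (lam * y₀) ^ 2 := by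
  have hc : (0 : ℝ) < Fintype.card S := by exact_mod_cast Fintype.card_pos
  have h1 := pois_exp_le hν hy₀ (by rwa [abs_of_nonneg hlam]) hsupp
    (lipOne_log_partZ (S := S)) 0
  rw [abs_of_nonneg hlam] at h1
  have g0 := (lipOne_log_partZ (S := S)).expGrowth_exp lam
  have gs : ExpGrowth fun H : S → ℝ => Real.exp (lam * Real.log (partZ (H + -drift ν))) :=
    g0.add_right (-drift ν)
  have h2 : Pois ν (fun H => Real.exp (lam * Real.log (partZ (H + -drift ν)))) (drift ν) =
      Pois ν (fun H => Real.exp (lam * Real.log (partZ H))) 0 := by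
    rw [← pois_shift g0 ν (drift ν) (-drift ν), add_neg_cancel]
  have h3 := card_mul_plantedE_exp ν fun H => lam * Real.log (partZ (H + -drift ν))
  set X' : (S → ℝ) → ℝ := fun H => (-(1 - lam)) * Real.log (partZ H) - lam * gibbs H (drift ν)
    with hX'
  have gl := expGrowth_log_partZ (S := S)
  have gg : ExpGrowth fun H : S → ℝ => gibbs H (drift ν) :=
    expGrowth_gibbs (a := -‖drift ν‖) (b := ‖drift ν‖) fun σ =>
      abs_le.1 (norm_le_pi_norm (drift ν) σ)
  have gX : ExpGrowth X' := (gl.const_mul _).sub (gg.const_mul _)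
  have hle : ∀ H, X' H ≤ lam * Real.log (partZ (H + -drift ν)) - Real.log (partZ H) := by
    intro H
    have h := mul_le_mul_of_nonneg_left (gibbs_le_log_partZ_add H (-drift ν)) hlam
    have hn : gibbs H (-drift ν) = -gibbs H (drift ν) := by
      have := gibbs_const_mul H (-1) (drift ν)
      rw [neg_one_mul] at this
      rw [← this]; congr 1; funext σ; simp
    rw [hn] at h
    simp only [hX']
    linarith
  have gE : ExpGrowth fun H : S → ℝ =>
      Real.exp (lam * Real.log (partZ (H + -drift ν)) - Real.log (partZ H)) := by
    refine (gs.mul expGrowth_partZ_inv).of_abs_le fun H => le_of_eq ?_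
    rw [abs_of_pos (Real.exp_pos _), Real.exp_sub, Real.exp_log (partZ_pos H), div_eq_mul_inv]
  have gX' : ExpGrowth fun H => Real.exp (X' H) :=
    gE.of_abs_le fun H => by
      rw [abs_of_pos (Real.exp_pos _)]; exact Real.exp_le_exp.2 (hle H)
  have h4 := (exp_plantedE_le hν gX gX').trans
    (plantedE_mono hν gX' gE fun H => Real.exp_le_exp.2 (hle H))
  have h5 : plantedE ν X' = -(1 - lam) * plantedFE ν := by
    rw [hX', plantedE_sub ν (gl.const_mul _) (gg.const_mul _), plantedE_const_mul,
      plantedE_const_mul, plantedE_log_partZ, plantedE_gibbs, hb]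
    ring
  rw [h5] at h4
  have h6 := mul_le_mul_of_nonneg_left h4 hc.le
  rw [h3, h2] at h6
  have h7 := Real.log_le_log (by positivity) (h6.trans h1)
  rw [Real.log_mul hc.ne' (Real.exp_pos _).ne', Real.log_exp, Real.log_exp] at h7
  linarith

/-- A large null free energy forces a small planted free energy, given exponential concentration
of the planted model. -/
lemma mul_plantedFE_le {ν : (S → ℝ) →₀ ℝ} (hν : 0 ≤ ν) {lam C R : ℝ} (hlam : lam ≤ 1)
    (hC : ∀ σ, -C ≤ drift ν σ)
    (hR : plantedE ν (fun H => Real.exp (-lam * Real.log (partZ H))) ≤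
      Real.exp (-lam * plantedFE ν + R)) :
    lam * plantedFE ν ≤ Real.log (Fintype.card S) -
      (1 - lam) * (Pois ν (fun H => Real.log (partZ H)) 0 - C) + R := by
  have hc : (0 : ℝ) < Fintype.card S := by exact_mod_cast Fintype.card_pos
  have gl := expGrowth_log_partZ (S := S)
  have h1 := card_mul_plantedE_exp ν fun H => (1 - lam) * Real.log (partZ H)
  have e1 : (fun H : S → ℝ => Real.exp ((1 - lam) * Real.log (partZ H) - Real.log (partZ H))) =
      fun H => Real.exp (-lam * Real.log (partZ H)) := by
    funext H; congr 1; ring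
  rw [e1] at h1
  have h2 := exp_pois_le hν (gl.const_mul (1 - lam))
    ((lipOne_log_partZ (S := S)).expGrowth_exp (1 - lam)) (drift ν)
  rw [pois_const_mul, ← h1] at h2
  have h3 : Pois ν (fun H => Real.log (partZ H)) 0 - C ≤
      Pois ν (fun H => Real.log (partZ H)) (drift ν) := by
    have := pois_mono hν (gl.sub (ExpGrowth.const C)) (gl.add_right (drift ν)) (fun H => ?_) 0
    · rwa [pois_sub gl (ExpGrowth.const C), pois_const, ← pois_shift gl, zero_add] at this
    · have hz : Real.exp (-C) * partZ H ≤ partZ (H + drift ν) := by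
        rw [partZ, partZ, Finset.mul_sum]
        refine Finset.sum_le_sum fun σ _ => ?_
        rw [← Real.exp_add, Pi.add_apply]
        exact Real.exp_le_exp.2 (by linarith [hC σ])
      have := Real.log_le_log (mul_pos (Real.exp_pos _) (partZ_pos H)) hz
      rw [Real.log_mul (Real.exp_pos _).ne' (partZ_pos H).ne', Real.log_exp] at this
      linarith
  have h4 := Real.log_le_log (Real.exp_pos _) (h2.trans (mul_le_mul_of_nonneg_left hR hc.le))
  rw [Real.log_mul hc.ne' (Real.exp_pos _).ne', Real.log_exp, Real.log_exp] at h4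
  have h5 := mul_le_mul_of_nonneg_left h3 (by linarith : 0 ≤ 1 - lam)
  linarith

end NullModel

noncomputable section PlantedConcentration

variable {q : ℕ} [NeZero q] {β : ℝ}

lemma avg_exp_le_of_close {a : Fin q → ℝ} {K lam : ℝ} (hK : ∀ s t, |a s - a t| ≤ K)
    (hsmall : |lam| * K ≤ 1) :
    (q : ℝ)⁻¹ * ∑ s, Real.exp (lam * a s) ≤
      Real.exp (lam * ((q : ℝ)⁻¹ * ∑ s, a s) + (|lam| * K) ^ 2) := by
  have hq0 : (0 : ℝ) < q := q_pos
  set m := (q : ℝ)⁻¹ * ∑ s, a s with hm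
  have hdev : ∀ s, |lam * (a s - m)| ≤ |lam| * K := by
    intro s
    rw [abs_mul]
    refine mul_le_mul_of_nonneg_left ?_ (abs_nonneg _)
    have : a s - m = (q : ℝ)⁻¹ * ∑ t, (a s - a t) := by
      rw [Finset.sum_sub_distrib, hm]; simp; field_simp
    rw [this, abs_mul, abs_of_pos (inv_pos.2 hq0)]
    calc (q : ℝ)⁻¹ * |∑ t, (a s - a t)| ≤ (q : ℝ)⁻¹ * ∑ _t : Fin q, K := by
          refine mul_le_mul_of_nonneg_left ?_ (by positivity)
          exact (Finset.abs_sum_le_sum_abs _ _).trans (Finset.sum_le_sum fun t _ => hK s t)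
      _ = K := by simp; field_simp
  have hs : ∀ s, Real.exp (lam * (a s - m)) ≤ 1 + lam * (a s - m) + (|lam| * K) ^ 2 := by
    intro s
    have h1 := (abs_le.1 (Real.abs_exp_sub_one_sub_id_le ((hdev s).trans hsmall))).2
    have h2 := sq_le_sq' (by linarith [(abs_le.1 (hdev s)).1]) ((abs_le.1 (hdev s)).2)
    linarith
  have hsum : (q : ℝ)⁻¹ * ∑ s, Real.exp (lam * (a s - m)) ≤ 1 + (|lam| * K) ^ 2 := by
    calc _ ≤ (q : ℝ)⁻¹ * ∑ s, (1 + lam * (a s - m) + (|lam| * K) ^ 2) :=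
          mul_le_mul_of_nonneg_left (Finset.sum_le_sum fun s _ => hs s) (by positivity)
      _ = 1 + lam * ((q : ℝ)⁻¹ * ∑ s, a s - m) + (|lam| * K) ^ 2 := by
          rw [Finset.sum_add_distrib, Finset.sum_add_distrib, ← Finset.mul_sum,
            Finset.sum_sub_distrib]
          simp; field_simp
      _ = _ := by rw [← hm]; ring
  calc (q : ℝ)⁻¹ * ∑ s, Real.exp (lam * a s)
      = Real.exp (lam * m) * ((q : ℝ)⁻¹ * ∑ s, Real.exp (lam * (a s - m))) := by
        rw [mul_left_comm]
        congr 1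
        rw [Finset.mul_sum]
        refine Finset.sum_congr rfl fun s _ => ?_
        rw [← Real.exp_add]; congr 1; ring
    _ ≤ Real.exp (lam * m) * Real.exp ((|lam| * K) ^ 2) := by
        refine mul_le_mul_of_nonneg_left (hsum.trans ?_) (Real.exp_pos _).le
        linarith [Real.add_one_le_exp ((|lam| * K) ^ 2)]
    _ = _ := by rw [← Real.exp_add]

/-- The exponential bounded difference inequality for the uniform measure on a product. -/
lemma avg_exp_le_of_boundedDiff {K lam : ℝ} (hsmall : |lam| * K ≤ 1) (n : ℕ)
    (f : (Fin n → Fin q) → ℝ) (hf : ∀ σ v s, |f (Function.update σ v s) - f σ| ≤ K) :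
    ((q : ℝ) ^ n)⁻¹ * ∑ σ, Real.exp (lam * f σ) ≤
      Real.exp (lam * (((q : ℝ) ^ n)⁻¹ * ∑ σ, f σ) + n * (|lam| * K) ^ 2) := by
  have hq0 : (0 : ℝ) < q := q_pos
  induction n with
  | zero => simp
  | succ n ih =>
    set a : Fin q → ℝ := fun s => ((q : ℝ) ^ n)⁻¹ * ∑ τ : Fin n → Fin q, f (Fin.cons s τ) with ha
    have hstep : ∀ s, ((q : ℝ) ^ n)⁻¹ * ∑ τ : Fin n → Fin q, Real.exp (lam * f (Fin.cons s τ)) ≤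
        Real.exp (n * (|lam| * K) ^ 2) * Real.exp (lam * a s) := by
      intro s
      rw [← Real.exp_add, add_comm (_ * _ ^ 2)]
      refine ih (fun τ => f (Fin.cons s τ)) fun τ v t => ?_
      have := hf (Fin.cons s τ) v.succ t
      rwa [← Fin.cons_update] at this
    have hclose : ∀ s t, |a s - a t| ≤ K := by
      intro s t
      have : a s - a t = ((q : ℝ) ^ n)⁻¹ *
          ∑ τ : Fin n → Fin q, (f (Fin.cons s τ) - f (Fin.cons t τ)) := by
        rw [Finset.sum_sub_distrib, mul_sub]
      rw [this, abs_mul, abs_of_pos (by positivity)]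
      calc _ ≤ ((q : ℝ) ^ n)⁻¹ * ∑ _τ : Fin n → Fin q, K := by
            refine mul_le_mul_of_nonneg_left ?_ (by positivity)
            refine (Finset.abs_sum_le_sum_abs _ _).trans (Finset.sum_le_sum fun τ _ => ?_)
            have := hf (Fin.cons t τ) 0 s
            rwa [Fin.update_cons_zero] at this
        _ = K := by simp; field_simp
    have h1 := avg_exp_le_of_close hclose hsmall
    rw [sum_fin_cons, sum_fin_cons]
    have e1 : ∀ g : Fin q → (Fin n → Fin q) → ℝ, ((q : ℝ) ^ (n + 1))⁻¹ * ∑ s, ∑ τ, g s τ =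
        (q : ℝ)⁻¹ * ∑ s, ((q : ℝ) ^ n)⁻¹ * ∑ τ, g s τ := by
      intro g
      rw [← Finset.mul_sum, ← mul_assoc]; congr 1; rw [pow_succ]; field_simp
    rw [e1, e1]
    calc _ ≤ (q : ℝ)⁻¹ * ∑ s, Real.exp (n * (|lam| * K) ^ 2) * Real.exp (lam * a s) :=
          mul_le_mul_of_nonneg_left (Finset.sum_le_sum fun s _ => hstep s) (by positivity)
      _ = Real.exp (n * (|lam| * K) ^ 2) * ((q : ℝ)⁻¹ * ∑ s, Real.exp (lam * a s)) := by
          rw [← Finset.mul_sum]; ring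
      _ ≤ Real.exp (n * (|lam| * K) ^ 2) *
          Real.exp (lam * ((q : ℝ)⁻¹ * ∑ s, a s) + (|lam| * K) ^ 2) :=
          mul_le_mul_of_nonneg_left h1 (Real.exp_pos _).le
      _ = _ := by rw [← Real.exp_add]; congr 1; push_cast; ring

lemma tilt_rateOf {S X : Type*} [Fintype S] [Fintype X] (ψ : X → S → ℝ) (r : X → ℝ) (σ : S) :
    tilt (Pi.evalAddMonoidHom (fun _ : S => ℝ) σ) (rateOf ψ r) =
      rateOf ψ fun x => r x * Real.exp (ψ x σ) := by
  rw [tilt, rateOf, map_sum]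
  simp [rateOf]

lemma norm_edgePot_le (hβ : 0 < β) {n : ℕ} (v w : Fin n) : ‖edgePot q β v w‖ ≤ β :=
  norm_fPot_le hβ fun σ => agree_mem v w σ

lemma exp_edgePot (hβ : 0 < β) {n : ℕ} (v w : Fin n) (σ : Fin n → Fin q) :
    Real.exp (edgePot q β v w σ) = fWt q β (agree v w σ) := exp_fPot hβ (agree_mem v w σ).2

lemma sum_edgeIdx_le {n : ℕ} {f : Fin n → Fin n → ℝ} (hf : ∀ v w, 0 ≤ f v w) :
    ∑ e : EdgeIdx n, f e.1.1 e.1.2 ≤ ∑ v, ∑ w, f v w := by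
  rw [sum_edgeIdx]
  refine Finset.sum_le_sum fun v _ => Finset.sum_le_sum fun w _ => ?_
  split_ifs
  · exact le_rfl
  · exact hf v w

lemma sum_abs_agree_update_le {n : ℕ} (σ : Fin n → Fin q) (v : Fin n) (s : Fin q) :
    ∑ e : EdgeIdx n, |agree e.1.1 e.1.2 (Function.update σ v s) - agree e.1.1 e.1.2 σ| ≤ 2 * n := by
  have h : ∀ a b : Fin n, |agree a b (Function.update σ v s) - agree a b σ| ≤
      (if a = v then 1 else 0) + (if b = v then 1 else 0) := by
    intro a b
    by_cases ha : a = v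
    · have h1 := agree_mem a b (Function.update σ v s)
      have h2 := agree_mem a b σ
      rw [if_pos ha]
      have : (0 : ℝ) ≤ if b = v then 1 else 0 := by split_ifs <;> simp
      rw [abs_le]; constructor <;> linarith [h1.1, h1.2, h2.1, h2.2]
    · by_cases hb : b = v
      · have h1 := agree_mem a b (Function.update σ v s)
        have h2 := agree_mem a b σ
        rw [if_pos hb, if_neg ha, abs_le]; constructor <;> linarith [h1.1, h1.2, h2.1, h2.2]
      · simp [agree, ha, hb]
  refine (sum_edgeIdx_le (f := fun a b => |agree a b (Function.update σ v s) - agree a b σ|)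
    fun _ _ => abs_nonneg _).trans ?_
  refine (Finset.sum_le_sum fun a _ => Finset.sum_le_sum fun b _ => h a b).trans (le_of_eq ?_)
  simp [Finset.sum_add_distrib]
  ring

lemma card_edgeIdx_le (n : ℕ) : (Fintype.card (EdgeIdx n) : ℝ) ≤ n ^ 2 := by
  have := sum_edgeIdx_le (n := n) (f := fun _ _ => 1) fun _ _ => zero_le_one
  simpa [sq] using this

/-- Exponential concentration of the planted free energy. -/
lemma plantedE_exp_le (hβ : 0 < β) {d lam : ℝ} (hd : 0 ≤ d) (hlam : 0 ≤ lam)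
    (h1 : lam * β ≤ 1) (h2 : lam * (2 * d * β * Real.exp β) ≤ 1) {n : ℕ} (hn : 0 < n) :
    plantedE (edgeRate q β n (d / n)) (fun H => Real.exp (-lam * Real.log (partZ H))) ≤
      Real.exp (-lam * plantedFE (edgeRate q β n (d / n)) +
        (10 * (d * Real.exp β) * β ^ 2 + (2 * d * β * Real.exp β) ^ 2) * lam ^ 2 * n) := by
  have hn' : (0 : ℝ) < n := by exact_mod_cast hn
  set ψ : EdgeIdx n → (Fin n → Fin q) → ℝ := fun e => edgePot q β e.1.1 e.1.2 with hψ
  set ν := edgeRate q β n (d / n) with hν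
  set K := 2 * d * β * Real.exp β with hK
  have hK0 : 0 ≤ K := by positivity
  have gl := expGrowth_log_partZ (S := Fin n → Fin q)
  set r : (Fin n → Fin q) → EdgeIdx n → ℝ := fun σ e => d / n * Real.exp (ψ e σ) with hr
  have ht : ∀ σ, tilt (Pi.evalAddMonoidHom (fun _ : Fin n → Fin q => ℝ) σ) ν = rateOf ψ (r σ) :=
    fun σ => tilt_rateOf _ _ _
  have hr0 : ∀ σ e, 0 ≤ r σ e := fun σ e => by positivity
  have hψn : ∀ e, ‖ψ e‖ ≤ β := fun e => norm_edgePot_le hβ _ _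
  set m : (Fin n → Fin q) → ℝ := fun σ =>
    Pois (rateOf ψ (r σ)) (fun H => Real.log (partZ H)) (drift ν) with hm
  have hΦ : ((q : ℝ) ^ n)⁻¹ * ∑ σ, m σ = plantedFE ν := by
    rw [← plantedE_log_partZ, plantedE_eq_avg ν gl]
    simp [ht, hm]
  have hrt : ∀ σ, rateTot (rateOf ψ (r σ)) ≤ d * Real.exp β * n := by
    intro σ
    rw [rateTot_rateOf]
    calc ∑ e, r σ e ≤ ∑ _e : EdgeIdx n, d / n * Real.exp β := by
          refine Finset.sum_le_sum fun e _ => mul_le_mul_of_nonneg_left ?_ (by positivity)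
          exact Real.exp_le_exp.2 ((le_abs_self _).trans ((norm_le_pi_norm (ψ e) σ).trans (hψn e)))
      _ = Fintype.card (EdgeIdx n) * (d / n * Real.exp β) := by simp
      _ ≤ n ^ 2 * (d / n * Real.exp β) :=
          mul_le_mul_of_nonneg_right (card_edgeIdx_le n) (by positivity)
      _ = _ := by field_simp
  have hbd : ∀ σ v s, |m (Function.update σ v s) - m σ| ≤ K := by
    intro σ v s
    refine abs_pois_sub_pois_le (rateOf_nonneg _ (hr0 _)) (rateOf_nonneg _ (hr0 _)) gl ?_ _
    intro H
    have hsub : rateOf ψ (r (Function.update σ v s)) - rateOf ψ (r σ) =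
        rateOf ψ (fun e => r (Function.update σ v s) e - r σ e) := by
      simp [rateOf]
    rw [hsub, jumpOp_rateOf, rateTot_rateOf, Finset.sum_mul, ← Finset.sum_sub_distrib]
    calc _ ≤ ∑ e : EdgeIdx n, d / n * (Real.exp β *
          |agree e.1.1 e.1.2 (Function.update σ v s) - agree e.1.1 e.1.2 σ|) * β := by
          refine (Finset.abs_sum_le_sum_abs _ _).trans (Finset.sum_le_sum fun e _ => ?_)
          rw [← mul_sub, abs_mul]
          refine mul_le_mul ?_ ((lipOne_log_partZ H (ψ e)).trans (hψn e)) (abs_nonneg _)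
            (by positivity)
          simp only [hr, hψ, exp_edgePot hβ]
          rw [← mul_sub, abs_mul, abs_of_nonneg (by positivity : 0 ≤ d / (n : ℝ))]
          exact mul_le_mul_of_nonneg_left (fWt_sub_le hβ _ _) (by positivity)
      _ = d / n * Real.exp β * β * ∑ e : EdgeIdx n,
          |agree e.1.1 e.1.2 (Function.update σ v s) - agree e.1.1 e.1.2 σ| := by
          rw [Finset.mul_sum]; exact Finset.sum_congr rfl fun e _ => by ring
      _ ≤ d / n * Real.exp β * β * (2 * n) :=
          mul_le_mul_of_nonneg_left (sum_abs_agree_update_le σ v s) (by positivity)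
      _ = K := by rw [hK]; field_simp
  have habs : |-lam| = lam := by rw [abs_neg, abs_of_nonneg hlam]
  have hmc := avg_exp_le_of_boundedDiff (lam := -lam) (by rw [habs]; exact h2) n m hbd
  rw [habs, hΦ] at hmc
  have hσ : ∀ σ, Pois (rateOf ψ (r σ)) (fun H => Real.exp (-lam * Real.log (partZ H))) (drift ν) ≤
      Real.exp (10 * (d * Real.exp β) * β ^ 2 * lam ^ 2 * n) * Real.exp (-lam * m σ) := by
    intro σ
    refine (pois_exp_le (rateOf_nonneg _ (hr0 _)) hβ.le (by rw [habs]; exact h1) ?_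
      lipOne_log_partZ (drift ν)).trans ?_
    · intro y hy
      obtain ⟨e, rfl⟩ := support_rateOf ψ _ hy
      exact hψn e
    · rw [← Real.exp_add, habs]
      refine Real.exp_le_exp.2 ?_
      have := mul_le_mul_of_nonneg_right (hrt σ) (by positivity : 0 ≤ 10 * (lam * β) ^ 2)
      simp only [hm]
      nlinarith
  rw [plantedE_eq_avg ν ((lipOne_log_partZ (S := Fin n → Fin q)).expGrowth_exp (-lam))]
  simp only [ht]
  have hcard : (Fintype.card (Fin n → Fin q) : ℝ) = (q : ℝ) ^ n := by simp
  rw [hcard]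
  calc _ ≤ ((q : ℝ) ^ n)⁻¹ * ∑ σ, Real.exp (10 * (d * Real.exp β) * β ^ 2 * lam ^ 2 * n) *
        Real.exp (-lam * m σ) :=
        mul_le_mul_of_nonneg_left (Finset.sum_le_sum fun σ _ => hσ σ) (by positivity)
    _ = Real.exp (10 * (d * Real.exp β) * β ^ 2 * lam ^ 2 * n) *
        (((q : ℝ) ^ n)⁻¹ * ∑ σ, Real.exp (-lam * m σ)) := by rw [← Finset.mul_sum]; ring
    _ ≤ Real.exp (10 * (d * Real.exp β) * β ^ 2 * lam ^ 2 * n) *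
        Real.exp (-lam * plantedFE ν + n * (lam * K) ^ 2) :=
        mul_le_mul_of_nonneg_left hmc (Real.exp_pos _).le
    _ = _ := by rw [← Real.exp_add]; congr 1; ring

end PlantedConcentration

noncomputable section Bernoulli

variable {X : Type*} [Fintype X] [DecidableEq X]

lemma sum_sum_update {α M : Type*} [Fintype α] [AddCommMonoid M] (x : X) (F : (X → α) → α → M) :
    ∑ g, ∑ a, F (Function.update g x a) (g x) = ∑ g, ∑ a, F g a := by
  rw [← Fintype.sum_prod_type' (f := fun g a => F (Function.update g x a) (g x)),
    ← Fintype.sum_prod_type' (f := F)]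
  let T : (X → α) × α → (X → α) × α := fun p => (Function.update p.1 x p.2, p.1 x)
  have hT : Function.Involutive T := fun p => by simp [T]
  exact Fintype.sum_equiv hT.toPerm _ _ fun p => rfl

/-- The expectation of `f` under independent Bernoulli variables. -/
def bernE (p : ℝ) (f : (X → Bool) → ℝ) : ℝ := ∑ g, (∏ x, if g x then p else 1 - p) * f g

lemma bernE_resample (p : ℝ) (f : (X → Bool) → ℝ) (x : X) :
    bernE p f = bernE p fun g =>
      p * f (Function.update g x true) + (1 - p) * f (Function.update g x false) := by
  set w : Bool → ℝ := fun b => if b then p else 1 - p with hw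
  have hw1 : ∑ b, w b = 1 := by simp [hw]
  have hupd : ∀ (g : X → Bool) (b : Bool),
      (∏ y, w (Function.update g x b y)) * w (g x) = (∏ y, w (g y)) * w b := by
    intro g b
    rw [← Finset.mul_prod_erase _ _ (Finset.mem_univ x),
      ← Finset.mul_prod_erase _ (fun y => w (g y)) (Finset.mem_univ x)]
    rw [Finset.prod_congr (g := fun y => w (g y)) rfl fun y hy => by
      rw [Function.update_of_ne (Finset.ne_of_mem_erase hy)]]
    simp; ring
  have h := sum_sum_update x fun (g : X → Bool) b => (∏ y, w (g y)) * w b * f g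
  have h1 : ∑ g : X → Bool, ∑ b, (∏ y, w (g y)) * w b * f g = bernE p f := by
    refine Finset.sum_congr rfl fun g _ => ?_
    rw [← Finset.sum_mul, ← Finset.mul_sum, hw1, mul_one]
  rw [← h1, ← h]
  refine Finset.sum_congr rfl fun g _ => ?_
  simp only [hupd]
  simp [hw]; ring

lemma bernE_add (p : ℝ) (f f' : (X → Bool) → ℝ) :
    bernE p (fun g => f g + f' g) = bernE p f + bernE p f' := by
  simp [bernE, mul_add, Finset.sum_add_distrib]

lemma bernE_sub (p : ℝ) (f f' : (X → Bool) → ℝ) :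
    bernE p (fun g => f g - f' g) = bernE p f - bernE p f' := by
  simp [bernE, mul_sub, Finset.sum_sub_distrib]

lemma bernE_const_mul (p c : ℝ) (f : (X → Bool) → ℝ) :
    bernE p (fun g => c * f g) = c * bernE p f := by
  simp only [bernE, Finset.mul_sum]
  exact Finset.sum_congr rfl fun g _ => by ring

lemma bernE_sum {Y : Type*} (s : Finset Y) (p : ℝ) (f : Y → (X → Bool) → ℝ) :
    bernE p (fun g => ∑ y ∈ s, f y g) = ∑ y ∈ s, bernE p (f y) := by
  simp only [bernE, Finset.mul_sum]
  rw [Finset.sum_comm]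

lemma bernE_const (p c : ℝ) : bernE p (fun _ : X → Bool => c) = c := by
  have h := Finset.prod_univ_sum (fun _ : X => (Finset.univ : Finset Bool))
    (fun _ b => if b then p else 1 - p)
  rw [Fintype.piFinset_univ] at h
  rw [bernE, ← Finset.sum_mul, ← h]
  simp

lemma bernE_mono {p : ℝ} (h0 : 0 ≤ p) (h1 : p ≤ 1) {f f' : (X → Bool) → ℝ}
    (h : ∀ g, f g ≤ f' g) : bernE p f ≤ bernE p f' :=
  Finset.sum_le_sum fun g _ => mul_le_mul_of_nonneg_left (h g)
    (Finset.prod_nonneg fun x _ => by split_ifs <;> linarith)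

lemma abs_bernE_sub_le {p : ℝ} (h0 : 0 ≤ p) (h1 : p ≤ 1) {f f' : (X → Bool) → ℝ} {B : ℝ}
    (h : ∀ g, |f g - f' g| ≤ B) : |bernE p f - bernE p f'| ≤ B := by
  rw [← bernE_sub, abs_le]
  constructor
  · rw [← bernE_const (X := X) p (-B)]; exact bernE_mono h0 h1 fun g => (abs_le.1 (h g)).1
  · conv_rhs => rw [← bernE_const (X := X) p B]
    exact bernE_mono h0 h1 fun g => (abs_le.1 (h g)).2

variable {E : Type*} [NormedAddCommGroup E]

lemma abs_pois_single_sub_le {G : E → ℝ} (hG : LipOne G) {p y₀ : ℝ} (hp : 0 ≤ p) {y : E}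
    (hy : ‖y‖ ≤ y₀) (H : E) :
    |Pois (Finsupp.single y p) G H - (p * G (H + y) + (1 - p) * G H)| ≤ 2 * y₀ * p ^ 2 := by
  set D : E → ℝ := fun H => 2⁻¹ * (G (H + y) - G H) with hD
  have hDl : LipOne D := by
    intro H z
    have h1 := hG (H + y) z
    have h2 := hG H z
    have e : D (H + z) - D H = 2⁻¹ * (G (H + y + z) - G (H + y)) - 2⁻¹ * (G (H + z) - G H) := by
      simp only [hD, add_right_comm H z y]; ring
    rw [e]
    refine (abs_sub _ _).trans ?_
    rw [abs_mul, abs_mul, abs_of_pos (by norm_num : (0 : ℝ) < 2⁻¹)]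
    linarith
  set φ : ℝ → ℝ := fun t => Pois (0 + t • Finsupp.single y 1) G H - t * (2 * D H) with hφ
  have hder : ∀ t ∈ Set.Icc 0 p, HasDerivWithinAt φ
      (Pois (0 + t • Finsupp.single y 1) (fun H => jumpOp (Finsupp.single y 1) G H -
        rateTot (Finsupp.single y 1) * G H) H - 1 * (2 * D H)) (Set.Icc 0 p) t := fun t _ =>
    ((hasDerivAt_pois hG.expGrowth 0 (Finsupp.single y 1) H t).sub
      ((hasDerivAt_id t).mul_const (2 * D H))).hasDerivWithinAt
  have hbound : ∀ t ∈ Set.Icc 0 p, ‖Pois (0 + t • Finsupp.single y 1)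
      (fun H => jumpOp (Finsupp.single y 1) G H - rateTot (Finsupp.single y 1) * G H) H -
        1 * (2 * D H)‖ ≤ 2 * y₀ * p := by
    intro t ht
    have hf : (fun H => jumpOp (Finsupp.single y 1) G H - rateTot (Finsupp.single y 1) * G H) =
        fun H => 2 * D H := by
      funext H; rw [jumpOp_single, rateTot_single]; simp only [hD]; ring
    have hnn : 0 ≤ t • Finsupp.single y (1 : ℝ) := by
      rw [Finsupp.smul_single]; exact Finsupp.single_nonneg.2 (by simpa using ht.1)
    have hs := hDl.abs_pois_sub_le (ν := t • Finsupp.single y 1) hnn (y₀ := y₀) (fun z hz => by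
      have := Finsupp.support_single_subset (Finsupp.support_smul hz)
      rw [Finset.mem_singleton.1 this]; exact hy) H
    rw [rateTot_smul, rateTot_single, mul_one] at hs
    rw [hf, zero_add, pois_const_mul, one_mul, ← mul_sub, Real.norm_eq_abs, abs_mul, abs_two]
    have hy0 := (norm_nonneg y).trans hy
    have := mul_le_mul_of_nonneg_right ht.2 hy0
    linarith
  have h := (convex_Icc (0 : ℝ) p).norm_image_sub_le_of_norm_hasDerivWithin_le hder hbound
    (Set.left_mem_Icc.2 hp) (Set.right_mem_Icc.2 hp)
  simp only [hφ, zero_add, zero_mul, sub_zero, Finsupp.smul_single,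
    smul_eq_mul, mul_one, Real.norm_eq_abs, abs_of_nonneg hp] at h
  rw [Finsupp.single_zero, pois_zero] at h
  calc _ = |Pois (Finsupp.single y p) G H - p * (2 * D H) - G H| := by
        congr 1; simp only [hD]; ring
    _ ≤ 2 * y₀ * p * p := h
    _ = _ := by ring

/-- Comparison of independent Bernoulli and Poisson sums. -/
lemma abs_bernE_sub_pois_le {F : E → ℝ} (hF : LipOne F) {p y₀ : ℝ} (h0 : 0 ≤ p) (h1 : p ≤ 1)
    {ψ : X → E} (hψ : ∀ x, ‖ψ x‖ ≤ y₀) :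
    |bernE p (fun g => F (∑ x, if g x then ψ x else 0)) - Pois (rateOf ψ fun _ => p) F 0| ≤
      Fintype.card X * (2 * y₀ * p ^ 2) := by
  set ν : Finset X → E →₀ ℝ := fun s => ∑ x ∈ s, Finsupp.single (ψ x) p with hν
  have hν0 : ∀ s, 0 ≤ ν s := fun s => Finset.sum_nonneg fun x _ => Finsupp.single_nonneg.2 h0
  set h : Finset X → (X → Bool) → E := fun s g => ∑ x ∈ sᶜ, if g x then ψ x else 0 with hh
  have main : ∀ s : Finset X, |bernE p (fun g => F (∑ x, if g x then ψ x else 0)) -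
      bernE p (fun g => Pois (ν s) F (h s g))| ≤ s.card * (2 * y₀ * p ^ 2) := by
    intro s
    induction s using Finset.induction_on with
    | empty => simp [hν, hh]
    | insert a s ha ih =>
      have hcard : ((insert a s).card : ℝ) = s.card + 1 := by
        rw [Finset.card_insert_of_notMem ha]; push_cast; rfl
      have hins : ∀ g, h s g = (if g a then ψ a else 0) + h (insert a s) g := by
        intro g
        have : sᶜ = insert a (insert a s)ᶜ := by
          ext x; by_cases hx : x = a <;> simp [hx, ha]
        simp only [hh]
        rw [this, Finset.sum_insert (by simp)]
      have hupd : ∀ g b, h (insert a s) (Function.update g a b) = h (insert a s) g := by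
        intro g b
        refine Finset.sum_congr rfl fun x hx => ?_
        have : x ≠ a := fun hxa => by simp [hxa] at hx
        rw [Function.update_of_ne this]
      have hstep : |bernE p (fun g => Pois (ν s) F (h s g)) -
          bernE p (fun g => Pois (ν (insert a s)) F (h (insert a s) g))| ≤ 2 * y₀ * p ^ 2 := by
        rw [bernE_resample p _ a]
        refine abs_bernE_sub_le h0 h1 fun g => ?_
        rw [hins, hins, hupd, hupd]
        simp only [Function.update_self, if_true, Bool.false_eq_true, if_false, zero_add]
        have hνi : ν (insert a s) = Finsupp.single (ψ a) p + ν s := Finset.sum_insert ha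
        rw [hνi, pois_add_rate hF.expGrowth, abs_sub_comm, add_comm (ψ a)]
        exact abs_pois_single_sub_le (hF.pois (hν0 s)) h0 (hψ a) _
      rw [hcard]
      have := abs_sub_le (bernE p (fun g => F (∑ x, if g x then ψ x else 0)))
        (bernE p (fun g => Pois (ν s) F (h s g)))
        (bernE p (fun g => Pois (ν (insert a s)) F (h (insert a s) g)))
      linarith
  have := main Finset.univ
  simpa [hν, hh, bernE_const, rateOf] using this

end Bernoulli

noncomputable section RandomGraph

variable {q : ℕ} [NeZero q] {β : ℝ} {n : ℕ}

lemma sum_agree {v w : Fin n} (hvw : v ≠ w) :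
    ∑ σ : Fin n → Fin q, (agree v w σ - (q : ℝ)⁻¹) = 0 := by
  have h := sum_sum_update v fun (σ : Fin n → Fin q) (_ : Fin q) => agree v w σ - (q : ℝ)⁻¹
  have h1 : ∀ σ : Fin n → Fin q,
      ∑ a, (agree v w (Function.update σ v a) - (q : ℝ)⁻¹) = 0 := by
    intro σ
    have hq : (q : ℝ) ≠ 0 := q_pos.ne'
    rw [Finset.sum_sub_distrib]
    simp [agree, Function.update_of_ne hvw.symm, hq]
  simp only [h1, Finset.sum_const_zero, Finset.sum_const, Finset.card_univ, Fintype.card_fin,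
    nsmul_eq_mul, ← Finset.mul_sum] at h
  exact (mul_eq_zero.1 h.symm).resolve_left q_pos.ne'

lemma sum_sum_agree_ge (σ : Fin n → Fin q) :
    (n : ℝ) ^ 2 * (q : ℝ)⁻¹ ≤ ∑ v, ∑ w, agree v w σ := by
  have e : ∑ v, ∑ w, agree v w σ = ∑ s : Fin q, (∑ v, if σ v = s then (1 : ℝ) else 0) ^ 2 := by
    simp only [sq, Finset.sum_mul_sum]
    rw [Finset.sum_comm' (t' := Finset.univ) (s' := fun _ => Finset.univ) (by simp)]
    rw [Finset.sum_comm]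
    conv_rhs => rw [Finset.sum_comm]
    refine Finset.sum_congr rfl fun v _ => ?_
    rw [Finset.sum_comm]
    refine Finset.sum_congr rfl fun w _ => ?_
    simp [agree, eq_comm]
  have h := sq_sum_le_card_mul_sum_sq (s := (Finset.univ : Finset (Fin q)))
    (f := fun s => ∑ v, if σ v = s then (1 : ℝ) else 0)
  have e2 : ∑ s : Fin q, ∑ v, (if σ v = s then (1 : ℝ) else 0) = n := by
    rw [Finset.sum_comm]; simp
  rw [e2, ← e, Finset.card_univ, Fintype.card_fin] at h
  rw [mul_inv_le_iff₀ q_pos]; linarith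

lemma drift_edgeRate (hβ : 0 < β) (lam : ℝ) (σ : Fin n → Fin q) :
    drift (edgeRate q β n lam) σ =
      lam * (cP β / xiP q β) * ∑ e : EdgeIdx n, (agree e.1.1 e.1.2 σ - (q : ℝ)⁻¹) := by
  rw [edgeRate, drift_rateOf, Finset.mul_sum, ← Finset.sum_neg_distrib]
  refine Finset.sum_congr rfl fun e _ => ?_
  rw [exp_edgePot hβ, fWt_eq hβ]; ring

lemma sum_drift_edgeRate (hβ : 0 < β) (lam : ℝ) :
    ∑ σ, drift (edgeRate q β n lam) σ = 0 := by
  simp only [drift_edgeRate hβ, ← Finset.mul_sum]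
  rw [Finset.sum_comm, Finset.sum_eq_zero (fun e _ => sum_agree e.2.ne), mul_zero]

lemma sum_agree_sub_ge (σ : Fin n → Fin q) :
    -(n : ℝ) ≤ ∑ e : EdgeIdx n, (agree e.1.1 e.1.2 σ - (q : ℝ)⁻¹) := by
  have h := two_mul_sum_edgeIdx (fun v w => agree v w σ - (q : ℝ)⁻¹)
    fun v w => by rw [agree_comm]
  have h1 := sum_sum_agree_ge σ
  have h2 : ∑ v : Fin n, (agree v v σ - (q : ℝ)⁻¹) ≤ n := by
    have hq : 0 ≤ (q : ℝ)⁻¹ := inv_nonneg.2 q_pos.le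
    refine (Finset.sum_le_card_nsmul _ _ 1 fun v _ => ?_).trans (by simp)
    linarith [(agree_mem v v σ).2]
  simp only [Finset.sum_sub_distrib, Finset.sum_const, Finset.card_univ, Fintype.card_fin,
    nsmul_eq_mul] at h h2 ⊢
  have hn : (0 : ℝ) ≤ n := n.cast_nonneg
  nlinarith

lemma neg_le_drift_edgeRate (hβ : 0 < β) {d : ℝ} (hd : 0 ≤ d) (hn : 0 < n)
    (σ : Fin n → Fin q) : -(d * Real.exp β) ≤ drift (edgeRate q β n (d / n)) σ := by
  have hn' : (0 : ℝ) < n := by exact_mod_cast hn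
  have h0 : 0 ≤ cP β / xiP q β := div_nonneg (cP_pos hβ).le (xiP_pos hβ).le
  rw [drift_edgeRate hβ]
  have h1 := mul_le_mul_of_nonneg_left (sum_agree_sub_ge σ)
    (mul_nonneg (div_nonneg hd hn'.le) h0)
  have h2 : d / n * (cP β / xiP q β) * -(n : ℝ) = -(d * (cP β / xiP q β)) := by field_simp
  have h3 := mul_le_mul_of_nonneg_left (cP_div_xiP_le (q := q) hβ) hd
  linarith

lemma rateTot_edgeRate_le {d : ℝ} (hd : 0 ≤ d) (hn : 0 < n) :
    rateTot (edgeRate q β n (d / n)) ≤ d * n := by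
  have hn' : (0 : ℝ) < n := by exact_mod_cast hn
  rw [edgeRate, rateTot_rateOf, Finset.sum_const, Finset.card_univ, nsmul_eq_mul]
  calc _ ≤ (n : ℝ) ^ 2 * (d / n) :=
        mul_le_mul_of_nonneg_right (card_edgeIdx_le n) (div_nonneg hd hn'.le)
    _ = d * n := by field_simp

/-- The normalised potential of a graph. -/
def graphPot (q : ℕ) (β : ℝ) {n : ℕ} (g : EdgeIdx n → Bool) : (Fin n → Fin q) → ℝ :=
  ∑ e, if g e then edgePot q β e.1.1 e.1.2 else 0

/-- The expected normalised free energy of the random graph. -/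
def erFE (q : ℕ) (β d : ℝ) (n : ℕ) : ℝ :=
  bernE (d / n) fun g : EdgeIdx n → Bool => Real.log (partZ (graphPot q β g))

lemma abs_erFE_sub_pois_le (hβ : 0 < β) {d : ℝ} (hd : 0 ≤ d) (hn : 0 < n) (hdn : d ≤ n) :
    |erFE q β d n - Pois (edgeRate q β n (d / n)) (fun H => Real.log (partZ H)) 0| ≤
      2 * β * d ^ 2 := by
  have hn' : (0 : ℝ) < n := by exact_mod_cast hn
  refine (abs_bernE_sub_pois_le lipOne_log_partZ (div_nonneg hd hn'.le) ((div_le_one hn').2 hdn)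
    fun e : EdgeIdx n => norm_edgePot_le (q := q) hβ e.1.1 e.1.2).trans ?_
  refine (mul_le_mul_of_nonneg_right (card_edgeIdx_le n) (by positivity)).trans (le_of_eq ?_)
  field_simp

/-- If the planted free energy is close to its trivial lower bound, so is the free energy of the
random graph. -/
theorem erFE_ge_of_plantedFE_le (hβ : 0 < β) {d : ℝ} (hd : 0 ≤ d)
    (h : ∀ δ > 0, ∀ᶠ N : ℕ in Filter.atTop,
      plantedFE (edgeRate q β N (d / N)) ≤ N * (Real.log q + δ)) {δ : ℝ} (hδ : 0 < δ) :
    ∀ᶠ N : ℕ in Filter.atTop, N * (Real.log q - δ) ≤ erFE q β d N := by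
  set K := 1 + 10 * d * β ^ 2 with hK
  have hK1 : 1 ≤ K := by have : 0 ≤ 10 * d * β ^ 2 := by positivity
                         linarith
  set lam := min (min 1 β⁻¹) (δ / (4 * K)) with hlam
  have hl0 : 0 < lam := by positivity
  have hl1 : lam ≤ 1 := (min_le_left _ _).trans (min_le_left _ _)
  have hlb : lam * β ≤ 1 := by
    have : lam ≤ β⁻¹ := (min_le_left _ _).trans (min_le_right _ _)
    rwa [← le_div_iff₀ hβ, one_div]
  have hlK : lam * (4 * K) ≤ δ := by
    rw [← le_div_iff₀ (by positivity)]; exact min_le_right _ _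
  filter_upwards [h (lam ^ 2) (by positivity), Filter.eventually_ge_atTop (⌈d⌉₊ + 1),
    Filter.eventually_ge_atTop ⌈4 * β * d ^ 2 / δ⌉₊] with N hN hN1 hN2
  have hNpos : 0 < N := by omega
  have hN' : (0 : ℝ) < N := by exact_mod_cast hNpos
  have hdN : d ≤ N := by
    refine (Nat.le_ceil d).trans ?_; exact_mod_cast (by omega : ⌈d⌉₊ ≤ N)
  have hN2' : 4 * β * d ^ 2 ≤ N * δ := by
    rw [← div_le_iff₀ hδ]; exact (Nat.le_ceil _).trans (by exact_mod_cast hN2)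
  have h1 := log_card_sub_plantedFE_le (edgeRate_nonneg (q := q) (β := β) N
      (div_nonneg hd hN'.le)) hβ.le hl0.le hlb
    (fun y hy => by
      obtain ⟨e, rfl⟩ := support_rateOf _ _ hy
      exact norm_edgePot_le hβ _ _) (sum_drift_edgeRate hβ _)
  have h2 := abs_le.1 (abs_erFE_sub_pois_le (q := q) hβ hd hNpos hdN)
  have h3 := rateTot_edgeRate_le (q := q) (β := β) hd hNpos
  rw [Fintype.card_fun, Fintype.card_fin, Fintype.card_fin, Nat.cast_pow, Real.log_pow] at h1
  generalize Pois (edgeRate q β N (d / N)) (fun H => Real.log (partZ H)) 0 = A at *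
  generalize plantedFE (edgeRate q β N (d / N)) = Φ at *
  generalize rateTot (edgeRate q β N (d / N)) = R at *
  generalize erFE q β d N = F at *
  generalize Real.log q = L at *
  have a1 : (1 - lam) * Φ ≤ (1 - lam) * (N * (L + lam ^ 2)) :=
    mul_le_mul_of_nonneg_left hN (by linarith)
  have a2 : 10 * R * (lam * β) ^ 2 ≤ 10 * (d * N) * (lam * β) ^ 2 := by gcongr
  have a3 : N * L - (1 - lam) * (N * (L + lam ^ 2)) - 10 * (d * N) * (lam * β) ^ 2 =
      lam * (N * L - N * lam * K) + N * lam ^ 3 := by rw [hK]; ring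
  have a4 : 0 ≤ N * lam ^ 3 := by positivity
  have a5 : N * L - N * lam * K ≤ A := by
    refine le_of_mul_le_mul_left ?_ hl0
    linarith
  have a6 : N * lam * K ≤ N * (δ / 4) := by
    have := mul_le_mul_of_nonneg_left hlK hN'.le
    linarith
  have a7 : N * (L - δ) = N * L - N * δ := by ring
  linarith

/-- If the free energy of the random graph is close to its trivial upper bound, then the planted
free energy is close to its trivial lower bound. -/
theorem plantedFE_le_of_erFE_ge (hβ : 0 < β) {d : ℝ} (hd : 0 ≤ d)
    (h : ∀ δ > 0, ∀ᶠ N : ℕ in Filter.atTop, N * (Real.log q - δ) ≤ erFE q β d N)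
    {δ : ℝ} (hδ : 0 < δ) :
    ∀ᶠ N : ℕ in Filter.atTop, plantedFE (edgeRate q β N (d / N)) ≤ N * (Real.log q + δ) := by
  set M := 10 * (d * Real.exp β) * β ^ 2 + (2 * d * β * Real.exp β) ^ 2 with hM
  have hM0 : 0 ≤ M := by positivity
  set D := 2 * d * β * Real.exp β + 1 with hD
  have hD1 : 0 < D := by positivity
  set lam := min (min 1 β⁻¹) (min D⁻¹ (δ / (4 * (M + 1)))) with hlam
  have hl0 : 0 < lam := by positivity
  have hl1 : lam ≤ 1 := (min_le_left _ _).trans (min_le_left _ _)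
  have hlb : lam * β ≤ 1 := by
    have : lam ≤ β⁻¹ := (min_le_left _ _).trans (min_le_right _ _)
    rwa [← le_div_iff₀ hβ, one_div]
  have hlD : lam * (2 * d * β * Real.exp β) ≤ 1 := by
    have : lam ≤ D⁻¹ := (min_le_right _ _).trans (min_le_left _ _)
    have h' : lam * D ≤ 1 := by rwa [← le_div_iff₀ hD1, one_div]
    rw [hD, mul_add] at h'; linarith
  have hlK : lam * (4 * (M + 1)) ≤ δ := by
    rw [← le_div_iff₀ (by positivity)]; exact (min_le_right _ _).trans (min_le_right _ _)
  set C := 2 * β * d ^ 2 + d * Real.exp β with hC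
  have hC0 : 0 ≤ C := by positivity
  filter_upwards [h (lam ^ 2) (by positivity), Filter.eventually_ge_atTop (⌈d⌉₊ + 1),
    Filter.eventually_ge_atTop ⌈C / lam ^ 2⌉₊] with N hN hN1 hN2
  have hNpos : 0 < N := by omega
  have hN' : (0 : ℝ) < N := by exact_mod_cast hNpos
  have hdN : d ≤ N := by
    refine (Nat.le_ceil d).trans ?_; exact_mod_cast (by omega : ⌈d⌉₊ ≤ N)
  have hN2' : C ≤ N * lam ^ 2 := by
    rw [← div_le_iff₀ (by positivity)]; exact (Nat.le_ceil _).trans (by exact_mod_cast hN2)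
  have h1 := mul_plantedFE_le (edgeRate_nonneg (q := q) (β := β) N (div_nonneg hd hN'.le)) hl1
    (neg_le_drift_edgeRate hβ hd hNpos) (plantedE_exp_le hβ hd hl0.le hlb hlD hNpos)
  have h2 := abs_le.1 (abs_erFE_sub_pois_le (q := q) hβ hd hNpos hdN)
  rw [Fintype.card_fun, Fintype.card_fin, Fintype.card_fin, Nat.cast_pow, Real.log_pow,
    ← hM] at h1
  generalize Pois (edgeRate q β N (d / N)) (fun H => Real.log (partZ H)) 0 = A at *
  generalize plantedFE (edgeRate q β N (d / N)) = Φ at *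
  generalize erFE q β d N = F at *
  generalize Real.log q = L at *
  have b1 : N * (L - 2 * lam ^ 2) ≤ A - d * Real.exp β := by
    have : N * (L - 2 * lam ^ 2) = N * (L - lam ^ 2) - N * lam ^ 2 := by ring
    linarith
  have b2 := mul_le_mul_of_nonneg_left b1 (by linarith : 0 ≤ 1 - lam)
  have b3 : N * L - (1 - lam) * (N * (L - 2 * lam ^ 2)) + M * lam ^ 2 * N =
      lam * (N * (L + 2 * lam + M * lam) - N * (2 * lam ^ 2)) := by ring
  have b4 : Φ ≤ N * (L + 2 * lam + M * lam) - N * (2 * lam ^ 2) := by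
    refine le_of_mul_le_mul_left ?_ hl0
    linarith
  have b5 : 0 ≤ N * (2 * lam ^ 2) := by positivity
  have b6 : N * (L + 2 * lam + M * lam) ≤ N * (L + δ) := by
    refine mul_le_mul_of_nonneg_left ?_ hN'.le
    have : 0 ≤ M * lam := by positivity
    linarith
  linarith

end RandomGraph

noncomputable section Overlap

variable {q : ℕ} [NeZero q] {β : ℝ} {n : ℕ}

lemma fWt_agree (v w : Fin n) (σ : Fin n → Fin q) :
    fWt q β (agree v w σ) =
      Real.exp (-(β * if σ v = σ w then 1 else 0)) * (xiP q β)⁻¹ := by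
  rw [fWt, agree, cP]; split_ifs <;> simp [div_eq_mul_inv]

lemma pottsWeight_div_pottsZ (hβ : 0 < β) (g : GraphCfg n) (σ : Fin n → Fin q) :
    pottsWeight q n β g σ / pottsZ q n β g =
      Real.exp (graphPot q β g σ) / partZ (graphPot q β g) := by
  set k : ℝ := ∏ e : EdgeIdx n, if g e then (xiP q β)⁻¹ else 1 with hk
  have hk0 : k ≠ 0 := Finset.prod_ne_zero_iff.2 fun e _ => by
    split_ifs
    · exact inv_ne_zero (xiP_pos hβ).ne'
    · exact one_ne_zero
  have h : ∀ τ, Real.exp (graphPot q β g τ) = pottsWeight q n β g τ * k := by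
    intro τ
    rw [graphPot, Finset.sum_apply, Real.exp_sum, pottsWeight, hk, ← Finset.prod_mul_distrib]
    refine Finset.prod_congr rfl fun e _ => ?_
    split_ifs
    · rw [exp_edgePot hβ, fWt_agree]; simp [*]
    · rw [exp_edgePot hβ, fWt_agree]; simp [*]
    · simp
  rw [partZ]
  simp only [h]
  rw [← Finset.sum_mul, mul_div_mul_right _ _ hk0, pottsZ]

lemma expOverlap_eq_bernE (hβ : 0 < β) (d : ℝ) (n : ℕ) :
    expOverlap q β d n = bernE (d / n) fun g : EdgeIdx n → Bool =>
      gibbs (graphPot q β g) fun σ => gibbs (graphPot q β g) fun τ => overlapTV q n σ τ := by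
  refine Finset.sum_congr rfl fun g _ => ?_
  rw [erProb]
  congr 1
  simp only [gibbs, Finset.sum_div, Finset.sum_mul]
  refine Finset.sum_congr rfl fun σ _ => ?_
  refine Finset.sum_congr rfl fun τ _ => ?_
  rw [pottsWeight_div_pottsZ hβ, pottsWeight_div_pottsZ hβ]
  ring

/-- The squared Euclidean distance of the overlap from the uniform distribution. -/
def overlapSq (q n : ℕ) (σ τ : Fin n → Fin q) : ℝ :=
  ∑ s : Fin q, ∑ t : Fin q,
    (((Finset.univ.filter fun v => σ v = s ∧ τ v = t).card : ℝ) / n - ((q : ℝ) ^ 2)⁻¹) ^ 2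

lemma sum_sq_card_fiber {P : Type*} [Fintype P] [DecidableEq P] (f : Fin n → P) :
    ∑ p, (∑ v, if f v = p then (1 : ℝ) else 0) ^ 2 =
      ∑ v, ∑ w, if f v = f w then (1 : ℝ) else 0 := by
  simp only [sq, Finset.sum_mul_sum]
  rw [Finset.sum_comm]
  refine Finset.sum_congr rfl fun v _ => ?_
  rw [Finset.sum_comm]
  refine Finset.sum_congr rfl fun w _ => ?_
  simp [eq_comm]

lemma overlapSq_eq (hn : 0 < n) (σ τ : Fin n → Fin q) :
    overlapSq q n σ τ =
      ((n : ℝ) ^ 2)⁻¹ * (∑ v, ∑ w, agree v w σ * agree v w τ) - ((q : ℝ) ^ 2)⁻¹ := by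
  have hn' : (n : ℝ) ≠ 0 := by exact_mod_cast hn.ne'
  have hq : (q : ℝ) ≠ 0 := q_pos.ne'
  set N : Fin q × Fin q → ℝ := fun p => ∑ v, if (σ v, τ v) = p then (1 : ℝ) else 0 with hN
  have h1 : ∑ p, N p = n := by rw [hN, Finset.sum_comm]; simp
  have h2 : ∑ p, N p ^ 2 = ∑ v, ∑ w, agree v w σ * agree v w τ := by
    rw [sum_sq_card_fiber fun v => (σ v, τ v)]
    refine Finset.sum_congr rfl fun v _ => Finset.sum_congr rfl fun w _ => ?_
    simp only [agree, Prod.mk.injEq, ite_and, mul_ite, mul_one, mul_zero]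
    split_ifs <;> rfl
  have h3 : overlapSq q n σ τ = ∑ p, (N p / n - ((q : ℝ) ^ 2)⁻¹) ^ 2 := by
    rw [overlapSq, Fintype.sum_prod_type]
    refine Finset.sum_congr rfl fun s _ => Finset.sum_congr rfl fun t _ => ?_
    simp [hN, Finset.sum_boole]
  have h4 : ∀ p, (N p / n - ((q : ℝ) ^ 2)⁻¹) ^ 2 = ((n : ℝ) ^ 2)⁻¹ * N p ^ 2 -
      (2 * (n : ℝ)⁻¹ * ((q : ℝ) ^ 2)⁻¹) * N p + (((q : ℝ) ^ 2)⁻¹) ^ 2 := fun p => by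
    field_simp; ring
  rw [h3]
  simp only [h4]
  rw [Finset.sum_add_distrib, Finset.sum_sub_distrib, ← Finset.mul_sum, ← Finset.mul_sum, h1, h2]
  simp only [Finset.sum_const, Finset.card_univ, Fintype.card_prod, Fintype.card_fin,
    nsmul_eq_mul, Nat.cast_mul]
  field_simp; ring

lemma overlapTV_le {η : ℝ} (hη : 0 < η) (σ τ : Fin n → Fin q) :
    overlapTV q n σ τ ≤ q ^ 2 * η + overlapSq q n σ τ / η := by
  have h0 : ∀ a : ℝ, 0 ≤ a → (1 / 2 : ℝ) * a ≤ a := fun a ha => by linarith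
  refine (h0 _ (Finset.sum_nonneg fun s _ => Finset.sum_nonneg fun t _ => abs_nonneg _)).trans ?_
  refine (Finset.sum_le_sum fun s _ => Finset.sum_le_sum fun t _ => abs_le_add_sq_div hη).trans (le_of_eq ?_)
  simp only [Finset.sum_add_distrib, overlapSq, Finset.sum_div, Finset.sum_const,
    Finset.card_univ, Fintype.card_fin, nsmul_eq_mul]
  ring

lemma abs_overlap_entry_le (σ τ : Fin n → Fin q) (s t : Fin q) :
    |((Finset.univ.filter fun v => σ v = s ∧ τ v = t).card : ℝ) / n - ((q : ℝ) ^ 2)⁻¹| ≤ 1 := by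
  have h1 : ((Finset.univ.filter fun v => σ v = s ∧ τ v = t).card : ℝ) / n ≤ 1 := by
    refine div_le_one_of_le₀ ?_ n.cast_nonneg
    exact_mod_cast (Finset.card_filter_le _ _).trans (by simp)
  have h2 : (0 : ℝ) ≤ ((Finset.univ.filter fun v => σ v = s ∧ τ v = t).card : ℝ) / n := by
    positivity
  have h3 : ((q : ℝ) ^ 2)⁻¹ ≤ 1 := inv_le_one_of_one_le₀ (one_le_pow₀ one_le_q)
  have h4 : (0 : ℝ) ≤ ((q : ℝ) ^ 2)⁻¹ := by positivity
  rw [abs_le]; constructor <;> linarith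

lemma overlapSq_le (σ τ : Fin n → Fin q) : overlapSq q n σ τ ≤ 2 * overlapTV q n σ τ := by
  rw [overlapTV, ← mul_assoc, mul_one_div_cancel two_ne_zero, one_mul]
  refine Finset.sum_le_sum fun s _ => Finset.sum_le_sum fun t _ => ?_
  rw [← sq_abs, sq]
  exact mul_le_of_le_one_left (abs_nonneg _) (abs_overlap_entry_le σ τ s t)

lemma overlapTV_mem (σ τ : Fin n → Fin q) : overlapTV q n σ τ ∈ Set.Icc (0 : ℝ) (q ^ 2) := by
  constructor
  · exact mul_nonneg (by norm_num)
      (Finset.sum_nonneg fun s _ => Finset.sum_nonneg fun t _ => abs_nonneg _)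
  · have : ∑ s : Fin q, ∑ t : Fin q,
        |((Finset.univ.filter fun v => σ v = s ∧ τ v = t).card : ℝ) / n - ((q : ℝ) ^ 2)⁻¹| ≤
        ∑ s : Fin q, ∑ t : Fin q, 1 :=
      Finset.sum_le_sum fun s _ => Finset.sum_le_sum fun t _ => abs_overlap_entry_le σ τ s t
    simp only [Finset.sum_const, Finset.card_univ, Fintype.card_fin, nsmul_eq_mul, mul_one] at this
    rw [overlapTV]
    nlinarith [one_le_q (q := q)]

/-- The probability that two vertices receive the same colour. -/
def corr (q : ℕ) (β : ℝ) (g : EdgeIdx n → Bool) (v w : Fin n) : ℝ :=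
  gibbs (graphPot q β g) (agree v w)

lemma corr_mem (g : EdgeIdx n → Bool) (v w : Fin n) :
    corr q β g v w ∈ Set.Icc (0 : ℝ) 1 := gibbs_mem_Icc _ (agree_mem v w)

lemma corr_comm (g : EdgeIdx n → Bool) (v w : Fin n) : corr q β g v w = corr q β g w v :=
  congrArg _ (funext fun σ => agree_comm v w σ)

lemma gibbs_overlapSq (hn : 0 < n) (g : EdgeIdx n → Bool) :
    gibbs (graphPot q β g) (fun σ => gibbs (graphPot q β g) fun τ => overlapSq q n σ τ) =
      ((n : ℝ) ^ 2)⁻¹ * (∑ v, ∑ w, corr q β g v w ^ 2) - ((q : ℝ) ^ 2)⁻¹ := by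
  simp only [overlapSq_eq hn, gibbs_sub, gibbs_const_mul, gibbs_sum, gibbs_const]
  congr 2
  refine Finset.sum_congr rfl fun v _ => Finset.sum_congr rfl fun w _ => ?_
  have : (fun σ : Fin n → Fin q => agree v w σ * gibbs (graphPot q β g) fun τ => agree v w τ) =
      fun σ => corr q β g v w * agree v w σ := funext fun σ => mul_comm _ _
  rw [this, gibbs_const_mul, sq]; rfl

lemma sum_corr_sub_ge (g : EdgeIdx n → Bool) :
    -(n : ℝ) ≤ ∑ e : EdgeIdx n, (corr q β g e.1.1 e.1.2 - (q : ℝ)⁻¹) := by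
  have h := gibbs_mono (graphPot q β g) (f := fun _ => -(n : ℝ)) fun σ => sum_agree_sub_ge (q := q) σ
  simpa only [gibbs_const, gibbs_sum, gibbs_sub, corr] using h

lemma sum_sum_corr_ge (g : EdgeIdx n → Bool) :
    (n : ℝ) ^ 2 * (q : ℝ)⁻¹ ≤ ∑ v, ∑ w, corr q β g v w := by
  have h := gibbs_mono (graphPot q β g) (f := fun _ => (n : ℝ) ^ 2 * (q : ℝ)⁻¹)
    fun σ => sum_sum_agree_ge (q := q) σ
  simpa only [gibbs_const, gibbs_sum, corr] using h

/-- The mean square deviation of edge correlations from their trivial value. -/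
def corrDev (q : ℕ) (β d : ℝ) (n : ℕ) : ℝ :=
  bernE (d / n) fun g : EdgeIdx n → Bool =>
    ∑ e : EdgeIdx n, (corr q β g e.1.1 e.1.2 - (q : ℝ)⁻¹) ^ 2

lemma sum_sq_corr_sub (g : EdgeIdx n → Bool) :
    ∑ v, ∑ w, (corr q β g v w - (q : ℝ)⁻¹) ^ 2 =
      (∑ v, ∑ w, corr q β g v w ^ 2) - 2 * (q : ℝ)⁻¹ * (∑ v, ∑ w, corr q β g v w) +
        (n : ℝ) ^ 2 * ((q : ℝ) ^ 2)⁻¹ := by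
  have : ∀ v w, (corr q β g v w - (q : ℝ)⁻¹) ^ 2 =
      corr q β g v w ^ 2 - 2 * (q : ℝ)⁻¹ * corr q β g v w + ((q : ℝ) ^ 2)⁻¹ := fun v w => by
    rw [← inv_pow]; ring
  simp only [this, Finset.sum_add_distrib, Finset.sum_sub_distrib, ← Finset.mul_sum,
    Finset.sum_const, Finset.card_univ, Fintype.card_fin, nsmul_eq_mul]
  ring

lemma inv_q_mem : (q : ℝ)⁻¹ ∈ Set.Icc (0 : ℝ) 1 :=
  ⟨inv_nonneg.2 q_pos.le, inv_le_one_of_one_le₀ one_le_q⟩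

lemma abs_corr_sub_le (g : EdgeIdx n → Bool) (v w : Fin n) :
    |corr q β g v w - (q : ℝ)⁻¹| ≤ 1 := by
  have h1 := corr_mem (q := q) (β := β) g v w
  have h2 := inv_q_mem (q := q)
  rw [abs_le]; constructor <;> linarith [h1.1, h1.2, h2.1, h2.2]

lemma corrDev_le_expOverlap (hβ : 0 < β) {d : ℝ} (hd : 0 ≤ d) (hn : 0 < n) (hdn : d ≤ n) :
    corrDev q β d n ≤ (n : ℝ) ^ 2 * expOverlap q β d n := by
  have hn' : (0 : ℝ) < n := by exact_mod_cast hn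
  rw [expOverlap_eq_bernE hβ, ← bernE_const_mul]
  refine bernE_mono (div_nonneg hd hn'.le) ((div_le_one hn').2 hdn) fun g => ?_
  have h1 := gibbs_mono (graphPot q β g) fun σ =>
    gibbs_mono (graphPot q β g) fun τ => overlapSq_le (q := q) (n := n) σ τ
  simp only [gibbs_const_mul] at h1
  rw [gibbs_overlapSq hn] at h1
  have h2 := sum_sum_corr_ge (q := q) (β := β) g
  have h3 := sum_sq_corr_sub (q := q) (β := β) g
  have h4 := two_mul_sum_edgeIdx (fun v w => (corr q β g v w - (q : ℝ)⁻¹) ^ 2)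
    fun v w => by rw [corr_comm]
  have h5 : 0 ≤ ∑ v, (corr q β g v v - (q : ℝ)⁻¹) ^ 2 := Finset.sum_nonneg fun v _ => sq_nonneg _
  have h6 := mul_le_mul_of_nonneg_left h2 (mul_nonneg zero_le_two (inv_q_mem (q := q)).1)
  have h7 := mul_le_mul_of_nonneg_left h1 (sq_nonneg (n : ℝ))
  rw [mul_sub, ← mul_assoc, mul_inv_cancel₀ (by positivity), one_mul] at h7
  have h8 : 2 * (q : ℝ)⁻¹ * ((n : ℝ) ^ 2 * (q : ℝ)⁻¹) = 2 * ((n : ℝ) ^ 2 * ((q : ℝ) ^ 2)⁻¹) := by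
    rw [← inv_pow]; ring
  linarith

lemma expOverlap_le_corrDev (hβ : 0 < β) {d η : ℝ} (hd : 0 ≤ d) (hn : 0 < n) (hdn : d ≤ n)
    (hη : 0 < η) : expOverlap q β d n ≤ q ^ 2 * η +
      (2 * η ^ 2 + (1 + 2 / η ^ 2) * ((n : ℝ)⁻¹ + ((n : ℝ) ^ 2)⁻¹ * (2 * corrDev q β d n))) / η := by
  have hn' : (0 : ℝ) < n := by exact_mod_cast hn
  have hp0 := div_nonneg hd hn'.le
  have hp1 := (div_le_one hn').2 hdn
  set A : (EdgeIdx n → Bool) → ℝ := fun g =>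
    ((n : ℝ) ^ 2)⁻¹ * ∑ v, ∑ w, (corr q β g v w - (q : ℝ)⁻¹) ^ 2 with hA
  have hpt : ∀ g, A g ≤ (n : ℝ)⁻¹ + ((n : ℝ) ^ 2)⁻¹ *
      (2 * ∑ e : EdgeIdx n, (corr q β g e.1.1 e.1.2 - (q : ℝ)⁻¹) ^ 2) := by
    intro g
    rw [two_mul_sum_edgeIdx (fun v w => (corr q β g v w - (q : ℝ)⁻¹) ^ 2)
      fun v w => by rw [corr_comm]]
    have h5 : ∑ v, (corr q β g v v - (q : ℝ)⁻¹) ^ 2 ≤ n := by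
      refine (Finset.sum_le_card_nsmul _ _ 1 fun v _ => ?_).trans (by simp)
      exact (sq_le_one_iff_abs_le_one _).2 (abs_corr_sub_le g v v)
    have h6 := mul_le_mul_of_nonneg_left h5 (by positivity : 0 ≤ ((n : ℝ) ^ 2)⁻¹)
    have h7 : ((n : ℝ) ^ 2)⁻¹ * n = (n : ℝ)⁻¹ := by field_simp
    rw [mul_sub]
    simp only [hA]
    linarith
  have hQ : ∀ g, ((n : ℝ) ^ 2)⁻¹ * (∑ v, ∑ w, corr q β g v w ^ 2) - ((q : ℝ) ^ 2)⁻¹ ≤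
      2 * η ^ 2 + (1 + 2 / η ^ 2) * A g := by
    intro g
    have h1 : ∑ v, ∑ w, (corr q β g v w - (q : ℝ)⁻¹) ≤
        ∑ v : Fin n, ∑ w : Fin n, (η ^ 2 + (corr q β g v w - (q : ℝ)⁻¹) ^ 2 / η ^ 2) :=
      Finset.sum_le_sum fun v _ => Finset.sum_le_sum fun w _ =>
        (le_abs_self _).trans (abs_le_add_sq_div (by positivity))
    simp only [Finset.sum_sub_distrib, Finset.sum_add_distrib, ← Finset.sum_div,
      Finset.sum_const, Finset.card_univ, Fintype.card_fin, nsmul_eq_mul] at h1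
    have h2 := sum_sq_corr_sub (q := q) (β := β) g
    have h3 := mul_le_mul_of_nonneg_left h1
      (by positivity : 0 ≤ ((n : ℝ) ^ 2)⁻¹)
    have h4 := congrArg (fun x => ((n : ℝ) ^ 2)⁻¹ * x) h2
    simp only [hA]
    have hW0 : 0 ≤ ∑ v, ∑ w, (corr q β g v w - (q : ℝ)⁻¹) ^ 2 :=
      Finset.sum_nonneg fun v _ => Finset.sum_nonneg fun w _ => sq_nonneg _
    generalize (∑ v, ∑ w, corr q β g v w ^ 2) = X at *
    generalize (∑ v, ∑ w, corr q β g v w) = Y at *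
    generalize (∑ v, ∑ w, (corr q β g v w - (q : ℝ)⁻¹) ^ 2) = W at *
    have e1 : ((n : ℝ) ^ 2)⁻¹ * (Y - n * (n * (q : ℝ)⁻¹)) = ((n : ℝ) ^ 2)⁻¹ * Y - (q : ℝ)⁻¹ := by
      field_simp
    have e2 : ((n : ℝ) ^ 2)⁻¹ * (n * (n * η ^ 2) + W / η ^ 2) =
        η ^ 2 + ((n : ℝ) ^ 2)⁻¹ * W / η ^ 2 := by field_simp
    have e3 : ((n : ℝ) ^ 2)⁻¹ * (X - 2 * (q : ℝ)⁻¹ * Y + (n : ℝ) ^ 2 * ((q : ℝ) ^ 2)⁻¹) =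
        ((n : ℝ) ^ 2)⁻¹ * X - ((q : ℝ) ^ 2)⁻¹ - 2 * (q : ℝ)⁻¹ * (((n : ℝ) ^ 2)⁻¹ * Y - (q : ℝ)⁻¹) := by
      have : ((n : ℝ) ^ 2)⁻¹ * ((n : ℝ) ^ 2 * ((q : ℝ) ^ 2)⁻¹) = ((q : ℝ) ^ 2)⁻¹ := by field_simp
      rw [mul_add, this, ← inv_pow]; ring
    rw [e1, e2] at h3
    rw [e3] at h4
    have hW : 0 ≤ ((n : ℝ) ^ 2)⁻¹ * W := by positivity
    have h5 := mul_le_mul_of_nonneg_left h3 (mul_nonneg zero_le_two (inv_q_mem (q := q)).1)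
    have h6 : 2 * (q : ℝ)⁻¹ * (η ^ 2 + ((n : ℝ) ^ 2)⁻¹ * W / η ^ 2) ≤
        2 * 1 * (η ^ 2 + ((n : ℝ) ^ 2)⁻¹ * W / η ^ 2) := by
      have := (inv_q_mem (q := q)).2
      gcongr
    have e4 : (1 + 2 / η ^ 2) * (((n : ℝ) ^ 2)⁻¹ * W) =
        ((n : ℝ) ^ 2)⁻¹ * W + 2 * (((n : ℝ) ^ 2)⁻¹ * W / η ^ 2) := by ring
    rw [e4]
    linarith
  rw [expOverlap_eq_bernE hβ]
  have hbd : ∀ g : EdgeIdx n → Bool,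
      gibbs (graphPot q β g) (fun σ => gibbs (graphPot q β g) fun τ => overlapTV q n σ τ) ≤
      (q ^ 2 * η + (2 * η ^ 2 + (1 + 2 / η ^ 2) * (n : ℝ)⁻¹) / η) +
        ((1 + 2 / η ^ 2) * (((n : ℝ) ^ 2)⁻¹ * 2) / η) *
          ∑ e : EdgeIdx n, (corr q β g e.1.1 e.1.2 - (q : ℝ)⁻¹) ^ 2 := by
    intro g
    have h1 := gibbs_mono (graphPot q β g) fun σ =>
      gibbs_mono (graphPot q β g) fun τ => overlapTV_le (q := q) (n := n) hη σ τ
    simp only [gibbs_add, gibbs_const, div_eq_inv_mul, gibbs_const_mul] at h1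
    rw [gibbs_overlapSq hn] at h1
    refine h1.trans ?_
    have h2 := (hQ g).trans (add_le_add_right (mul_le_mul_of_nonneg_left (hpt g)
      (by positivity : 0 ≤ 1 + 2 / η ^ 2)) (2 * η ^ 2))
    have h3 := mul_le_mul_of_nonneg_left h2 (inv_nonneg.2 hη.le)
    refine (add_le_add_right h3 _).trans (le_of_eq ?_)
    ring
  refine (bernE_mono hp0 hp1 hbd).trans (le_of_eq ?_)
  rw [bernE_add, bernE_const, bernE_const_mul, corrDev]
  ring

end Overlap

noncomputable section BernoulliResample

variable {X : Type*} [Fintype X] [DecidableEq X] {p : ℝ}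

lemma bernE_prod (p : ℝ) (a : X → ℝ) :
    bernE p (fun g => ∏ x, if g x then a x else 1) = ∏ x, (p * a x + (1 - p)) := by
  have h := Finset.prod_univ_sum (fun _ : X => (Finset.univ : Finset Bool))
    (fun x b => (if b then p else 1 - p) * if b then a x else 1)
  rw [Fintype.piFinset_univ] at h
  simp only [bernE, ← Finset.prod_mul_distrib]
  rw [← h]
  simp

lemma bernE_ite (p : ℝ) (f : (X → Bool) → ℝ) (x : X) :
    bernE p (fun g => if g x then f g else 0) =
      p * bernE p fun g => f (Function.update g x true) := by
  rw [bernE_resample p _ x, ← bernE_const_mul]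
  simp

lemma abs_bernE_sub_update_le (h0 : 0 ≤ p) (h1 : p ≤ 1) {f : (X → Bool) → ℝ} {K : ℝ}
    (hf : ∀ g g', |f g - f g'| ≤ K) (x : X) :
    |bernE p f - bernE p (fun g => f (Function.update g x false))| ≤ p * K := by
  rw [bernE_resample p f x]
  refine abs_bernE_sub_le h0 h1 fun g => ?_
  have : p * f (Function.update g x true) + (1 - p) * f (Function.update g x false) -
      f (Function.update g x false) =
      p * (f (Function.update g x true) - f (Function.update g x false)) := by ring
  rw [this, abs_mul, abs_of_nonneg h0]
  exact mul_le_mul_of_nonneg_left (hf _ _) h0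

end BernoulliResample

noncomputable section EdgeInsertion

variable {q : ℕ} [NeZero q] {β : ℝ} {n : ℕ}

lemma exp_graphPot (hβ : 0 < β) (g : EdgeIdx n → Bool) (σ : Fin n → Fin q) :
    Real.exp (graphPot q β g σ) = ∏ e, if g e then fWt q β (agree e.1.1 e.1.2 σ) else 1 := by
  rw [graphPot, Finset.sum_apply, Real.exp_sum]
  refine Finset.prod_congr rfl fun e _ => ?_
  split_ifs
  · rw [exp_edgePot hβ]
  · simp

/-- The annealed upper bound on the free energy. -/
lemma erFE_le (hβ : 0 < β) {d : ℝ} (hd : 0 ≤ d) (hn : 0 < n) (hdn : d ≤ n) :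
    erFE q β d n ≤ n * Real.log q + d * Real.exp β := by
  have hn' : (0 : ℝ) < n := by exact_mod_cast hn
  have hp0 := div_nonneg hd hn'.le
  have hp1 := (div_le_one hn').2 hdn
  set m : ℝ := (q : ℝ) ^ n * Real.exp (d * Real.exp β) with hm
  have hm0 : 0 < m := mul_pos (pow_pos q_pos _) (Real.exp_pos _)
  have hlogm : Real.log m = n * Real.log q + d * Real.exp β := by
    rw [hm, Real.log_mul (pow_pos q_pos _).ne' (Real.exp_pos _).ne', Real.log_exp, Real.log_pow]
  have hZ : bernE (d / n) (fun g : EdgeIdx n → Bool => partZ (graphPot q β g)) ≤ m := by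
    simp only [partZ, bernE_sum, exp_graphPot hβ, bernE_prod]
    have : ∀ σ : Fin n → Fin q, ∏ e : EdgeIdx n,
        (d / n * fWt q β (agree e.1.1 e.1.2 σ) + (1 - d / n)) ≤ Real.exp (d * Real.exp β) := by
      intro σ
      refine (Finset.prod_le_prod
        (g := fun e : EdgeIdx n => Real.exp (d / n * (fWt q β (agree e.1.1 e.1.2 σ) - 1)))
        (fun e _ => ?_) fun e _ => ?_).trans ?_
      · exact add_nonneg (mul_nonneg hp0 (fWt_pos hβ (agree_mem _ _ _).2).le) (by linarith)
      · have := Real.add_one_le_exp (d / n * (fWt q β (agree e.1.1 e.1.2 σ) - 1))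
        linarith
      · rw [← Real.exp_sum]
        refine Real.exp_le_exp.2 ?_
        have h := neg_le_drift_edgeRate hβ hd hn σ
        rw [edgeRate, drift_rateOf] at h
        simp only [exp_edgePot hβ] at h
        linarith
    refine (Finset.sum_le_sum fun σ _ => this σ).trans (le_of_eq ?_)
    simp [hm]
  have hpt : ∀ g : EdgeIdx n → Bool, Real.log (partZ (graphPot q β g)) ≤
      (Real.log m - 1) + m⁻¹ * partZ (graphPot q β g) := by
    intro g
    have hz := partZ_pos (graphPot q β g)
    have h := Real.log_le_sub_one_of_pos (div_pos hz hm0)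
    rw [Real.log_div hz.ne' hm0.ne', div_eq_inv_mul] at h
    linarith
  have h := bernE_mono hp0 hp1 hpt
  rw [bernE_add, bernE_const, bernE_const_mul] at h
  have h2 := mul_le_mul_of_nonneg_left hZ (inv_nonneg.2 hm0.le)
  rw [inv_mul_cancel₀ hm0.ne'] at h2
  rw [erFE, ← hlogm]; linarith

lemma graphPot_update_true (g : EdgeIdx n → Bool) (e : EdgeIdx n) :
    graphPot q β (Function.update g e true) =
      graphPot q β (Function.update g e false) + edgePot q β e.1.1 e.1.2 := by
  rw [graphPot, graphPot, ← Finset.add_sum_erase _ _ (Finset.mem_univ e),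
    ← Finset.add_sum_erase _ (fun x => if Function.update g e false x then _ else _)
      (Finset.mem_univ e)]
  rw [Finset.sum_congr (g := fun x => if Function.update g e false x = true then
    edgePot q β x.1.1 x.1.2 else 0) rfl fun x hx => by
      rw [Function.update_of_ne (Finset.ne_of_mem_erase hx),
        Function.update_of_ne (Finset.ne_of_mem_erase hx)]]
  simp [add_comm]

/-- The agreement probability along an inserted edge. -/
def insertCorr (q : ℕ) (β x : ℝ) : ℝ := Real.exp (-β) / xiP q β * x / fWt q β x

lemma corr_update_true (hβ : 0 < β) (g : EdgeIdx n → Bool) (e : EdgeIdx n) :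
    corr q β (Function.update g e true) e.1.1 e.1.2 =
      insertCorr q β (corr q β (Function.update g e false) e.1.1 e.1.2) := by
  set H := graphPot q β (Function.update g e false) with hH
  have hZ : partZ (H + edgePot q β e.1.1 e.1.2) =
      fWt q β (gibbs H (agree e.1.1 e.1.2)) * partZ H := by
    rw [← zRatio_fPot hβ H fun σ => (agree_mem e.1.1 e.1.2 σ).2, zRatio,
      div_mul_cancel₀ _ (partZ_pos H).ne']; rfl
  have hN : ∑ σ, agree e.1.1 e.1.2 σ * Real.exp ((H + edgePot q β e.1.1 e.1.2) σ) =
      Real.exp (-β) / xiP q β * gibbs H (agree e.1.1 e.1.2) * partZ H := by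
    rw [gibbs, mul_assoc, div_mul_cancel₀ _ (partZ_pos H).ne', Finset.mul_sum]
    refine Finset.sum_congr rfl fun σ _ => ?_
    rw [Pi.add_apply, Real.exp_add, exp_edgePot hβ, fWt_agree, agree]
    split_ifs
    · simp; ring
    · simp
  rw [corr, graphPot_update_true, gibbs, hN, hZ, insertCorr, corr,
    mul_div_mul_right _ _ (partZ_pos H).ne']

lemma fWt_inv_q (hβ : 0 < β) : fWt q β (q : ℝ)⁻¹ = 1 := by rw [fWt_eq hβ]; simp

lemma insertCorr_convex (hβ : 0 < β) : ∃ a b : ℝ, 0 < a ∧ 0 < b ∧ ∀ x ∈ Set.Icc (0 : ℝ) 1,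
    insertCorr q β (q : ℝ)⁻¹ + a * (x - (q : ℝ)⁻¹) + b * (x - (q : ℝ)⁻¹) ^ 2 ≤
      insertCorr q β x := by
  set A := Real.exp (-β) / xiP q β with hA
  set r := cP β / xiP q β with hr
  set y := (q : ℝ)⁻¹ with hy
  have hA0 : 0 < A := div_pos (Real.exp_pos _) (xiP_pos hβ)
  have hr0 : 0 < r := div_pos (cP_pos hβ) (xiP_pos hβ)
  have hy0 : 0 < y := inv_pos.2 q_pos
  refine ⟨A * (1 + r * y), A * (1 + r * y) * (r * Real.exp (-β)), by positivity, by positivity,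
    fun x hx => ?_⟩
  have hf := fWt_eq (q := q) hβ x
  have hfp := fWt_pos (q := q) hβ hx.2
  have hfe := fWt_le_exp (q := q) hβ hx.1
  rw [← hr, ← hy] at hf
  rw [insertCorr, insertCorr, fWt_inv_q hβ, div_one, ← hA]
  have e : A * x / fWt q β x = A * y + A * (1 + r * y) * (x - y) +
      A * (1 + r * y) * (r * (fWt q β x)⁻¹) * (x - y) ^ 2 := by
    rw [div_eq_iff hfp.ne', add_mul _ _ (fWt q β x)]
    have : A * (1 + r * y) * (r * (fWt q β x)⁻¹) * (x - y) ^ 2 * fWt q β x =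
      A * (1 + r * y) * r * (x - y) ^ 2 := by field_simp
    rw [this, hf]; ring
  rw [e]
  have : Real.exp (-β) ≤ (fWt q β x)⁻¹ := by
    rw [Real.exp_neg]; exact inv_anti₀ hfp hfe
  gcongr

lemma edgePot_eq (hβ : 0 < β) (v w : Fin n) (σ : Fin n → Fin q) :
    edgePot q β v w σ = -(β * agree v w σ) - Real.log (xiP q β) := by
  rw [edgePot, fPot, fWt_agree, Real.log_mul (Real.exp_pos _).ne' (inv_ne_zero (xiP_pos hβ).ne'),
    Real.log_exp, Real.log_inv]; rfl

lemma log_xiP_sub_le (hβ : 0 < β) {h : ℝ} (h0 : 0 ≤ h) (h1 : h ≤ 1) (hh : h < β) :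
    Real.log (xiP q (β - h)) - Real.log (xiP q β) ≤
      h * insertCorr q β (q : ℝ)⁻¹ + h ^ 2 := by
  have hx := xiP_pos (q := q) hβ
  have hx' := xiP_pos (q := q) (sub_pos.2 hh)
  rw [← Real.log_div hx'.ne' hx.ne']
  refine (Real.log_le_sub_one_of_pos (div_pos hx' hx)).trans ?_
  set A := insertCorr q β (q : ℝ)⁻¹ with hA
  have hA' : A = Real.exp (-β) / xiP q β * (q : ℝ)⁻¹ := by
    rw [hA, insertCorr, fWt_inv_q hβ, div_one]
  have e : xiP q (β - h) / xiP q β - 1 = A * (Real.exp h - 1) := by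
    have : Real.exp (-(β - h)) = Real.exp (-β) * Real.exp h := by rw [← Real.exp_add]; ring_nf
    have h2 : xiP q (β - h) - xiP q β = Real.exp (-β) * (q : ℝ)⁻¹ * (Real.exp h - 1) := by
      rw [xiP, xiP, cP, cP, this]; ring
    rw [hA', div_sub_one hx.ne', h2]; ring
  have hA0 : 0 ≤ A := by
    rw [hA']; exact mul_nonneg (div_nonneg (Real.exp_pos _).le hx.le) (inv_q_mem).1
  have hA1 : A ≤ 1 := by
    rw [hA']
    exact mul_le_one₀ ((div_le_one hx).2 (exp_neg_le_xiP hβ)) (inv_q_mem (q := q)).1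
      (inv_q_mem (q := q)).2
  have h2 := (abs_le.1 (Real.abs_exp_sub_one_sub_id_le (abs_le.2 ⟨by linarith, h1⟩))).2
  rw [e]
  have h3 := mul_le_mul_of_nonneg_left h2 hA0
  have h4 := mul_le_of_le_one_left (sq_nonneg h) hA1
  nlinarith

end EdgeInsertion

noncomputable section OverlapConcentration

variable {q : ℕ} [NeZero q] {β : ℝ} {n : ℕ}

lemma graphPot_sub (hβ : 0 < β) {h : ℝ} (hh : h < β) (g : EdgeIdx n → Bool) :
    graphPot q (β - h) g = graphPot q β g + fun σ => ∑ e : EdgeIdx n,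
      if g e then h * agree e.1.1 e.1.2 σ -
        (Real.log (xiP q (β - h)) - Real.log (xiP q β)) else 0 := by
  funext σ
  simp only [graphPot, Pi.add_apply, Finset.sum_apply]
  rw [← Finset.sum_add_distrib]
  refine Finset.sum_congr rfl fun e _ => ?_
  split_ifs
  · rw [edgePot_eq hβ, edgePot_eq (sub_pos.2 hh)]; ring
  · simp

lemma erFE_add_le_erFE_sub (hβ : 0 < β) {d h : ℝ} (hd : 0 ≤ d) (hn : 0 < n) (hdn : d ≤ n)
    (hh : h < β) : erFE q β d n + ∑ e : EdgeIdx n, d / n *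
      (h * bernE (d / n) (fun g =>
          insertCorr q β (corr q β (Function.update g e false) e.1.1 e.1.2)) -
        (Real.log (xiP q (β - h)) - Real.log (xiP q β))) ≤ erFE q (β - h) d n := by
  have hn' : (0 : ℝ) < n := by exact_mod_cast hn
  set L := Real.log (xiP q (β - h)) - Real.log (xiP q β) with hL
  have hpt : ∀ g : EdgeIdx n → Bool, Real.log (partZ (graphPot q β g)) +
      ∑ e : EdgeIdx n, (if g e then h * corr q β g e.1.1 e.1.2 - L else 0) ≤
      Real.log (partZ (graphPot q (β - h) g)) := by
    intro g
    rw [graphPot_sub hβ hh]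
    refine le_trans (le_of_eq ?_) (gibbs_le_log_partZ_add _ _)
    rw [gibbs_sum]
    congr 1
    refine Finset.sum_congr rfl fun e _ => ?_
    split_ifs
    · rw [gibbs_sub, gibbs_const_mul, gibbs_const]; rfl
    · rw [gibbs_const]
  have H := bernE_mono (div_nonneg hd hn'.le) ((div_le_one hn').2 hdn) hpt
  rw [bernE_add, bernE_sum] at H
  refine le_trans (le_of_eq ?_) H
  rw [erFE]
  congr 1
  refine Finset.sum_congr rfl fun e _ => ?_
  rw [bernE_ite _ (fun g => h * corr q β g e.1.1 e.1.2 - L), bernE_sub, bernE_const_mul,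
    bernE_const]
  simp only [corr_update_true hβ]

lemma card_edgeIdx_mul_le {d : ℝ} (hd : 0 ≤ d) (hn : 0 < n) :
    (Fintype.card (EdgeIdx n) : ℝ) * (d / n) ≤ d * n := by
  have hn' : (0 : ℝ) < n := by exact_mod_cast hn
  calc _ ≤ (n : ℝ) ^ 2 * (d / n) :=
        mul_le_mul_of_nonneg_right (card_edgeIdx_le n) (div_nonneg hd hn'.le)
    _ = d * n := by field_simp

lemma corrDev_bound (q : ℕ) [NeZero q] (hβ : 0 < β) {d : ℝ} (hd : 0 ≤ d) :
    ∃ b K : ℝ, 0 < b ∧ 0 ≤ K ∧ ∀ (n : ℕ) (h : ℝ), 0 < n → d ≤ n → 0 ≤ h → h ≤ 1 → h < β →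
      h * b * (d / n * corrDev q β d n) ≤
        (n * Real.log q - erFE q β d n) + K + d * n * h ^ 2 := by
  obtain ⟨a, b, ha, hb, hab⟩ := insertCorr_convex (q := q) hβ
  refine ⟨b, d * Real.exp β + (a * (d * (1 + d)) + b * d ^ 2), hb, by positivity,
    fun n h hn hdn h0 h1 hh => ?_⟩
  have hn' : (0 : ℝ) < n := by exact_mod_cast hn
  have hp0 := div_nonneg hd hn'.le
  have hp1 := (div_le_one hn').2 hdn
  set p := d / n with hp
  set y := (q : ℝ)⁻¹ with hy
  set u : EdgeIdx n → (EdgeIdx n → Bool) → ℝ := fun e g => corr q β g e.1.1 e.1.2 - y with hu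
  have hy' := inv_q_mem (q := q)
  have hu1 : ∀ e g g', |u e g - u e g'| ≤ 1 := fun e g g' => by
    have h1 := corr_mem (q := q) (β := β) g e.1.1 e.1.2
    have h2 := corr_mem (q := q) (β := β) g' e.1.1 e.1.2
    simp only [hu]
    rw [abs_le]; constructor <;> linarith [h1.1, h1.2, h2.1, h2.2]
  have hu2 : ∀ e g g', |u e g ^ 2 - u e g' ^ 2| ≤ 1 := fun e g g' => by
    have h1 := (sq_le_one_iff_abs_le_one _).2 (abs_corr_sub_le (q := q) (β := β) g e.1.1 e.1.2)
    have h2 := (sq_le_one_iff_abs_le_one _).2 (abs_corr_sub_le (q := q) (β := β) g' e.1.1 e.1.2)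
    simp only [hu]
    rw [abs_le]; constructor <;> nlinarith [sq_nonneg (u e g), sq_nonneg (u e g')]
  have hmain := (erFE_add_le_erFE_sub hβ hd hn hdn hh).trans
    (erFE_le (q := q) (sub_pos.2 hh) hd hn hdn)
  have hterm : ∀ e : EdgeIdx n,
      p * (h * (a * (bernE p (u e) - p) + b * (bernE p (fun g => u e g ^ 2) - p)) - h ^ 2) ≤
      p * (h * bernE p (fun g =>
          insertCorr q β (corr q β (Function.update g e false) e.1.1 e.1.2)) -
        (Real.log (xiP q (β - h)) - Real.log (xiP q β))) := by
    intro e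
    refine mul_le_mul_of_nonneg_left ?_ hp0
    have e1 := (abs_le.1 (abs_bernE_sub_update_le hp0 hp1 (hu1 e) e)).2
    have e2 := (abs_le.1 (abs_bernE_sub_update_le hp0 hp1 (hu2 e) e)).2
    have e3 := bernE_mono hp0 hp1 fun g : EdgeIdx n → Bool =>
      hab _ (corr_mem (q := q) (β := β) (Function.update g e false) e.1.1 e.1.2)
    have e4 := log_xiP_sub_le (q := q) hβ h0 h1 hh
    rw [bernE_add, bernE_add, bernE_const, bernE_const_mul, bernE_const_mul] at e3
    have e5 : a * (bernE p (u e) - p) ≤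
        a * bernE p (fun g => u e (Function.update g e false)) :=
      mul_le_mul_of_nonneg_left (by linarith) ha.le
    have e6 : b * (bernE p (fun g => u e g ^ 2) - p) ≤
        b * bernE p (fun g => u e (Function.update g e false) ^ 2) :=
      mul_le_mul_of_nonneg_left (by linarith) hb.le
    simp only [hu] at e5 e6
    have e7 := mul_le_mul_of_nonneg_left (add_le_add e5 e6) h0
    have e8 := mul_le_mul_of_nonneg_left e3 h0
    simp only [mul_add] at e7 e8
    simp only [hu, mul_add]
    linarith
  have hsum := Finset.sum_le_sum fun e (_ : e ∈ Finset.univ) => hterm e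
  have hsumu : -(n : ℝ) ≤ ∑ e, bernE p (u e) := by
    have := bernE_mono hp0 hp1 (f := fun _ => -(n : ℝ)) fun g => sum_corr_sub_ge (q := q) (β := β) g
    rwa [bernE_const, bernE_sum] at this
  have hcorr : corrDev q β d n = ∑ e, bernE p (fun g => u e g ^ 2) := by
    rw [corrDev, bernE_sum]
  have hexp : Real.exp (β - h) ≤ Real.exp β := Real.exp_le_exp.2 (by linarith)
  have hexp' := mul_le_mul_of_nonneg_left hexp hd
  have hcard := card_edgeIdx_mul_le (n := n) hd hn
  have hexpand : ∑ e : EdgeIdx n, p * (h * (a * (bernE p (u e) - p) +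
        b * (bernE p (fun g => u e g ^ 2) - p)) - h ^ 2) =
      p * h * a * (∑ e, bernE p (u e)) + h * b * (p * corrDev q β d n) -
        (Fintype.card (EdgeIdx n) * p) * (h * (a * p + b * p) + h ^ 2) := by
    rw [hcorr]
    have : ∀ e : EdgeIdx n, p * (h * (a * (bernE p (u e) - p) +
        b * (bernE p (fun g => u e g ^ 2) - p)) - h ^ 2) = p * h * a * bernE p (u e) +
        (h * b * p) * bernE p (fun g => u e g ^ 2) - p * (h * (a * p + b * p) + h ^ 2) :=
      fun e => by ring
    simp only [this, Finset.sum_add_distrib, Finset.sum_sub_distrib, ← Finset.mul_sum,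
      Finset.sum_const, Finset.card_univ, nsmul_eq_mul]
    ring
  rw [hexpand] at hsum
  have g1 := mul_le_mul_of_nonneg_left hsumu (by positivity : 0 ≤ p * h * a)
  have hpn : p * n = d := by rw [hp]; field_simp
  have g2 : p * h * a * -(n : ℝ) = -(h * (a * d)) := by rw [← hpn]; ring
  have g3 := mul_le_mul_of_nonneg_right hcard (by positivity : 0 ≤ h * (a * p + b * p) + h ^ 2)
  have g4 : d * n * (h * (a * p + b * p) + h ^ 2) = h * (a * d ^ 2 + b * d ^ 2) + d * n * h ^ 2 := by
    have : d * n * (h * (a * p + b * p) + h ^ 2) =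
      d * h * (a * (p * n) + b * (p * n)) + d * n * h ^ 2 := by ring
    rw [this, hpn]; ring
  have g5 : h * (a * d + a * d ^ 2 + b * d ^ 2) ≤ 1 * (a * d + a * d ^ 2 + b * d ^ 2) :=
    mul_le_mul_of_nonneg_right h1 (by positivity)
  have g6 : h * (a * d + a * d ^ 2 + b * d ^ 2) =
    h * (a * d) + h * (a * d ^ 2 + b * d ^ 2) := by ring
  linarith

lemma expOverlap_mem (hβ : 0 < β) {d : ℝ} (hd : 0 ≤ d) (hn : 0 < n) (hdn : d ≤ n) :
    expOverlap q β d n ∈ Set.Icc (0 : ℝ) (q ^ 2) := by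
  have hn' : (0 : ℝ) < n := by exact_mod_cast hn
  have hp0 := div_nonneg hd hn'.le
  have hp1 := (div_le_one hn').2 hdn
  have h : ∀ g : EdgeIdx n → Bool, gibbs (graphPot q β g) (fun σ =>
      gibbs (graphPot q β g) fun τ => overlapTV q n σ τ) ∈ Set.Icc (0 : ℝ) (q ^ 2) :=
    fun g => gibbs_mem_Icc _ fun σ => gibbs_mem_Icc _ fun τ => overlapTV_mem σ τ
  rw [expOverlap_eq_bernE hβ]
  constructor
  · rw [← bernE_const (X := EdgeIdx n) (d / n) 0]; exact bernE_mono hp0 hp1 fun g => (h g).1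
  · conv_rhs => rw [← bernE_const (X := EdgeIdx n) (d / n) ((q : ℝ) ^ 2)]
    exact bernE_mono hp0 hp1 fun g => (h g).2

lemma eventually_pos_le (d : ℝ) : ∀ᶠ n : ℕ in Filter.atTop, 0 < n ∧ d ≤ n := by
  filter_upwards [Filter.eventually_ge_atTop (⌈d⌉₊ + 1)] with n hn
  exact ⟨by omega, (Nat.le_ceil d).trans (by exact_mod_cast (by omega : ⌈d⌉₊ ≤ n))⟩

lemma corrDev_tendsto_of_erFE_ge (hβ : 0 < β) {d : ℝ} (hd : 0 < d)
    (h : ∀ δ > 0, ∀ᶠ N : ℕ in Filter.atTop, N * (Real.log q - δ) ≤ erFE q β d N)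
    {ε : ℝ} (hε : 0 < ε) :
    ∀ᶠ n : ℕ in Filter.atTop, ((n : ℝ) ^ 2)⁻¹ * corrDev q β d n ≤ ε := by
  obtain ⟨b, K, hb, hK, hbound⟩ := corrDev_bound q hβ hd.le
  set η := min (min 1 (β / 2)) (ε * (b * d) / (2 + d)) with hη
  have hη0 : 0 < η := by positivity
  have hη1 : η ≤ 1 := (min_le_left _ _).trans (min_le_left _ _)
  have hηβ : η < β := ((min_le_left _ _).trans (min_le_right _ _)).trans_lt (by linarith)
  have hηε : η * (2 + d) ≤ ε * (b * d) := by
    rw [← le_div_iff₀ (by positivity)]; exact min_le_right _ _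
  filter_upwards [h (η ^ 2) (by positivity), eventually_pos_le d,
    Filter.eventually_ge_atTop ⌈K / η ^ 2⌉₊] with n h1 ⟨hn, hdn⟩ h2
  have hn' : (0 : ℝ) < n := by exact_mod_cast hn
  have h3 : K ≤ n * η ^ 2 := by
    rw [← div_le_iff₀ (by positivity)]; exact (Nat.le_ceil _).trans (by exact_mod_cast h2)
  have h4 := hbound n η hn hdn hη0.le hη1 hηβ
  have h5 : η * b * (d / n * corrDev q β d n) =
      (η * n) * (b * d * (((n : ℝ) ^ 2)⁻¹ * corrDev q β d n)) := by
    field_simp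
  rw [h5] at h4
  have h6 : (η * n) * (b * d * (((n : ℝ) ^ 2)⁻¹ * corrDev q β d n)) ≤ (η * n) * (η * (2 + d)) := by
    linarith
  have h7 := le_of_mul_le_mul_left h6 (by positivity)
  have h8 : b * d * (((n : ℝ) ^ 2)⁻¹ * corrDev q β d n) ≤ b * d * ε := by linarith
  exact le_of_mul_le_mul_left h8 (by positivity)

/-- Trivial free energy implies overlap concentration. -/
theorem expOverlap_tendsto_of_erFE_ge (hβ : 0 < β) {d : ℝ} (hd : 0 < d)
    (h : ∀ δ > 0, ∀ᶠ N : ℕ in Filter.atTop, N * (Real.log q - δ) ≤ erFE q β d N) :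
    Filter.Tendsto (fun n => expOverlap q β d n) Filter.atTop (nhds 0) := by
  rw [Metric.tendsto_atTop']
  intro ε hε
  have hq := q_pos (q := q)
  set η := ε / (2 * (q ^ 2 + 2)) with hη
  have hη0 : 0 < η := by positivity
  set c := (1 + 2 / η ^ 2) / η with hc
  have hc0 : 0 < c := by positivity
  have hε' : 0 < ε / (8 * c) := by positivity
  suffices hs : ∀ᶠ n : ℕ in Filter.atTop, dist (expOverlap q β d n) 0 < ε by
    obtain ⟨N, hN⟩ := Filter.eventually_atTop.1 hs
    exact ⟨N, fun n hn => hN n hn.le⟩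
  filter_upwards [corrDev_tendsto_of_erFE_ge hβ hd h hε', eventually_pos_le d,
    Filter.eventually_ge_atTop ⌈8 * c / ε⌉₊] with n h1 ⟨hn, hdn⟩ h2
  have hn' : (0 : ℝ) < n := by exact_mod_cast hn
  have h3 : (n : ℝ)⁻¹ ≤ ε / (8 * c) := by
    rw [← inv_div (8 * c)]
    exact inv_anti₀ (by positivity) ((Nat.le_ceil _).trans (by exact_mod_cast h2))
  have h4 := expOverlap_le_corrDev (q := q) hβ hd.le hn hdn hη0
  have h5 : (2 * η ^ 2 + (1 + 2 / η ^ 2) *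
      ((n : ℝ)⁻¹ + ((n : ℝ) ^ 2)⁻¹ * (2 * corrDev q β d n))) / η =
      2 * η + c * ((n : ℝ)⁻¹ + 2 * (((n : ℝ) ^ 2)⁻¹ * corrDev q β d n)) := by
    rw [hc]; field_simp
  have h6 : c * ((n : ℝ)⁻¹ + 2 * (((n : ℝ) ^ 2)⁻¹ * corrDev q β d n)) ≤
      c * (3 * (ε / (8 * c))) := mul_le_mul_of_nonneg_left (by linarith) hc0.le
  have h7 : c * (3 * (ε / (8 * c))) = 3 / 8 * ε := by field_simp
  have h8 : (q : ℝ) ^ 2 * η + 2 * η = ε / 2 := by rw [hη]; field_simp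
  rw [Real.dist_eq, sub_zero, abs_of_nonneg (expOverlap_mem hβ hd.le hn hdn).1]
  linarith

end OverlapConcentration

noncomputable section BernoulliDerivative

variable {X : Type*} [Fintype X] [DecidableEq X]

lemma hasDerivAt_bernE (f : (X → Bool) → ℝ) (p : ℝ) :
    HasDerivAt (fun p => bernE p f) (∑ x, bernE p fun g =>
      f (Function.update g x true) - f (Function.update g x false)) p := by
  set w : Bool → ℝ := fun b => if b then p else 1 - p with hw
  set s : Bool → ℝ := fun b => if b then 1 else -1 with hs
  have hder : ∀ b : Bool, HasDerivAt (fun p : ℝ => if b then p else 1 - p) (s b) p := by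
    intro b
    cases b
    · simpa [hs] using (hasDerivAt_id p).const_sub 1
    · simpa [hs] using hasDerivAt_id' p
  have h1 : HasDerivAt (fun p => bernE p f)
      (∑ g : X → Bool, (∑ x, (∏ y ∈ Finset.univ.erase x, w (g y)) • s (g x)) * f g) p :=
    HasDerivAt.fun_sum fun g _ => (HasDerivAt.fun_finsetProd fun x _ => hder (g x)).mul_const _
  refine h1.congr_deriv ?_
  simp only [Finset.sum_mul]
  rw [Finset.sum_comm]
  refine Finset.sum_congr rfl fun x _ => ?_
  have h := sum_sum_update x fun (g : X → Bool) b =>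
    (∏ y ∈ Finset.univ.erase x, w (g y)) * w b * (s (g x) * f g)
  have hw1 : ∑ b, w b = 1 := by simp [hw]
  have h2 : ∀ g : X → Bool, ∑ b, (∏ y ∈ Finset.univ.erase x, w (g y)) * w b * (s (g x) * f g) =
      (∏ y ∈ Finset.univ.erase x, w (g y)) • s (g x) * f g := fun g => by
    rw [← Finset.sum_mul, ← Finset.mul_sum, hw1, smul_eq_mul]; ring
  simp only [h2] at h
  rw [← h, bernE]
  refine Finset.sum_congr rfl fun g _ => ?_
  have h3 : ∀ b, ∏ y ∈ Finset.univ.erase x, w (Function.update g x b y) =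
      ∏ y ∈ Finset.univ.erase x, w (g y) := fun b =>
    Finset.prod_congr rfl fun y hy => by rw [Function.update_of_ne (Finset.ne_of_mem_erase hy)]
  have h4 : (∏ y, if g y then p else 1 - p) = (∏ y ∈ Finset.univ.erase x, w (g y)) * w (g x) :=
    (Finset.prod_erase_mul _ _ (Finset.mem_univ x)).symm
  simp only [h3, h4]
  simp [hs]; ring

lemma continuous_bernE (f : (X → Bool) → ℝ) : Continuous fun p => bernE p f :=
  continuous_iff_continuousAt.2 fun p => (hasDerivAt_bernE f p).continuousAt

lemma bernE_zero (f : (X → Bool) → ℝ) : bernE 0 f = f fun _ => false := by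
  rw [bernE, Finset.sum_eq_single fun _ => false]
  · simp
  · intro g _ hg
    obtain ⟨x, hx⟩ := Function.ne_iff.1 hg
    rw [Finset.prod_eq_zero (Finset.mem_univ x) (by simpa using hx), zero_mul]
  · simp

end BernoulliDerivative

noncomputable section FreeEnergyIntegral

variable {q : ℕ} [NeZero q] {β : ℝ} {n : ℕ}

lemma erFE_zero (n : ℕ) : erFE q β 0 n = n * Real.log q := by
  rw [erFE, zero_div, bernE_zero]
  simp [graphPot, partZ]

lemma log_partZ_update_sub (hβ : 0 < β) (g : EdgeIdx n → Bool) (e : EdgeIdx n) :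
    Real.log (partZ (graphPot q β (Function.update g e true))) -
      Real.log (partZ (graphPot q β (Function.update g e false))) =
      fPot q β (corr q β (Function.update g e false) e.1.1 e.1.2) := by
  rw [graphPot_update_true, ← Real.log_div (partZ_pos _).ne' (partZ_pos _).ne', fPot, corr,
    ← zRatio_fPot hβ _ fun σ => (agree_mem e.1.1 e.1.2 σ).2]
  rfl

/-- The derivative of the free energy density in the mean degree. -/
def erSlope (q : ℕ) (β : ℝ) (n : ℕ) (t : ℝ) : ℝ :=
  ((n : ℝ) ^ 2)⁻¹ * ∑ e : EdgeIdx n, bernE (t / n) fun g =>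
    fPot q β (corr q β (Function.update g e false) e.1.1 e.1.2)

lemma hasDerivAt_erFE (hβ : 0 < β) (n : ℕ) (t : ℝ) :
    HasDerivAt (fun t => (n : ℝ)⁻¹ * erFE q β t n) (erSlope q β n t) t := by
  have h1 := (hasDerivAt_bernE (fun g : EdgeIdx n → Bool =>
    Real.log (partZ (graphPot q β g))) (t / n)).comp t ((hasDerivAt_id t).div_const (n : ℝ))
  refine (h1.const_mul (n : ℝ)⁻¹).congr_deriv ?_
  simp only [log_partZ_update_sub hβ]
  rw [erSlope, sq, mul_inv]; ring

lemma continuous_erSlope (n : ℕ) : Continuous (erSlope q β n) :=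
  continuous_const.mul (continuous_finsetSum _ fun _ _ =>
    (continuous_bernE _).comp (continuous_id.div_const _))

lemma erFE_sub_eq_integral (hβ : 0 < β) (hn : 0 < n) (d : ℝ) :
    (n : ℝ)⁻¹ * erFE q β d n - Real.log q = ∫ t in (0 : ℝ)..d, erSlope q β n t := by
  have hn' : (n : ℝ) ≠ 0 := by exact_mod_cast hn.ne'
  rw [intervalIntegral.integral_eq_sub_of_hasDerivAt (fun t _ => hasDerivAt_erFE hβ n t)
    ((continuous_erSlope n).intervalIntegrable _ _), erFE_zero, inv_mul_cancel_left₀ hn']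

lemma abs_fPot_le_mul (hβ : 0 < β) {x : ℝ} (hx : x ∈ Set.Icc (0 : ℝ) 1) :
    |fPot q β x| ≤ Real.exp (2 * β) * |x - (q : ℝ)⁻¹| := by
  have hf := fWt_pos (q := q) hβ hx.2
  have h1 : |fWt q β x - 1| ≤ Real.exp β * |x - (q : ℝ)⁻¹| := by
    rw [fWt_eq hβ, sub_sub_cancel_left, abs_neg, abs_mul,
      abs_of_nonneg (div_nonneg (cP_pos hβ).le (xiP_pos hβ).le)]
    exact mul_le_mul_of_nonneg_right (cP_div_xiP_le hβ) (abs_nonneg _)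
  have h2 : Real.exp (2 * β) = Real.exp β * Real.exp β := by rw [← Real.exp_add]; ring_nf
  have h3 : 1 ≤ Real.exp β := Real.one_le_exp hβ.le
  have h4 := abs_nonneg (fWt q β x - 1)
  have h5 : Real.exp β * |fWt q β x - 1| ≤ Real.exp (2 * β) * |x - (q : ℝ)⁻¹| := by
    rw [h2, mul_assoc]; exact mul_le_mul_of_nonneg_left h1 (Real.exp_pos _).le
  refine le_trans ?_ h5
  rw [fPot, abs_le]
  constructor
  · have h6 := Real.log_le_sub_one_of_pos (inv_pos.2 hf)
    rw [Real.log_inv] at h6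
    have h7 : (fWt q β x)⁻¹ ≤ Real.exp β := by
      rw [inv_le_comm₀ hf (Real.exp_pos _), ← Real.exp_neg]; exact exp_neg_le_fWt hβ hx.2
    have h8 : (fWt q β x)⁻¹ - 1 = (fWt q β x)⁻¹ * (1 - fWt q β x) := by field_simp
    have h9 : (fWt q β x)⁻¹ * (1 - fWt q β x) ≤ Real.exp β * |fWt q β x - 1| := by
      rw [abs_sub_comm]
      exact (mul_le_mul_of_nonneg_left (le_abs_self _) (inv_nonneg.2 hf.le)).trans
        (mul_le_mul_of_nonneg_right h7 (abs_nonneg _))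
    linarith
  · have h6 := Real.log_le_sub_one_of_pos hf
    have h7 := le_abs_self (fWt q β x - 1)
    nlinarith

lemma abs_erSlope_le (hβ : 0 < β) {t : ℝ} (ht : 0 ≤ t) (hn : 0 < n) (htn : t ≤ n) :
    |erSlope q β n t| ≤ β := by
  have hn' : (0 : ℝ) < n := by exact_mod_cast hn
  have h : ∀ e : EdgeIdx n, |bernE (t / n) fun g =>
      fPot q β (corr q β (Function.update g e false) e.1.1 e.1.2)| ≤ β := fun e => by
    have := abs_bernE_sub_le (div_nonneg ht hn'.le) ((div_le_one hn').2 htn)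
      (f := fun g => fPot q β (corr q β (Function.update g e false) e.1.1 e.1.2))
      (f' := fun _ => 0) (B := β) fun g => by
        have hc := corr_mem (q := q) (β := β) (Function.update g e false) e.1.1 e.1.2
        rw [sub_zero]; exact abs_fPot_le hβ hc.1 hc.2
    rwa [bernE_const, sub_zero] at this
  rw [erSlope, abs_mul, abs_of_nonneg (by positivity), inv_mul_le_iff₀ (by positivity)]
  refine (Finset.abs_sum_le_sum_abs _ _).trans ((Finset.sum_le_sum fun e _ => h e).trans ?_)
  rw [Finset.sum_const, Finset.card_univ, nsmul_eq_mul]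
  exact mul_le_mul_of_nonneg_right (card_edgeIdx_le n) hβ.le

lemma abs_erSlope_le_expOverlap (hβ : 0 < β) {t η : ℝ} (ht : 0 ≤ t) (hn : 0 < n) (htn : t ≤ n)
    (hη : 0 < η) :
    |erSlope q β n t| ≤ Real.exp (2 * β) * (η + (expOverlap q β t n + t / n) / η) := by
  have hn' : (0 : ℝ) < n := by exact_mod_cast hn
  have hp0 := div_nonneg ht hn'.le
  have hp1 := (div_le_one hn').2 htn
  set E := Real.exp (2 * β) with hE
  have hE0 : 0 ≤ E := (Real.exp_pos _).le
  set u : EdgeIdx n → (EdgeIdx n → Bool) → ℝ :=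
    fun e g => corr q β g e.1.1 e.1.2 - (q : ℝ)⁻¹ with hu
  have h : ∀ e : EdgeIdx n, |bernE (t / n) fun g =>
      fPot q β (corr q β (Function.update g e false) e.1.1 e.1.2)| ≤
      E * (η + (bernE (t / n) (fun g => u e g ^ 2) + t / n) / η) := by
    intro e
    have hpt : ∀ g : EdgeIdx n → Bool,
        |fPot q β (corr q β (Function.update g e false) e.1.1 e.1.2)| ≤
        E * η + E / η * u e (Function.update g e false) ^ 2 := fun g => by
      refine (abs_fPot_le_mul hβ (corr_mem _ _ _)).trans ?_
      refine (mul_le_mul_of_nonneg_left (abs_le_add_sq_div hη) hE0).trans (le_of_eq ?_)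
      simp only [hu]; ring
    have hup := bernE_mono hp0 hp1 fun g => (le_abs_self _).trans (hpt g)
    have hlo := bernE_mono hp0 hp1 fun g =>
      (neg_le.1 ((neg_le_abs _).trans (hpt g)))
    have hneg : bernE (t / n) (fun g : EdgeIdx n → Bool =>
        -(E * η + E / η * u e (Function.update g e false) ^ 2)) =
        -bernE (t / n) (fun g : EdgeIdx n → Bool =>
          E * η + E / η * u e (Function.update g e false) ^ 2) := by
      simp only [neg_eq_neg_one_mul (E * η + _), bernE_const_mul]; ring
    rw [hneg] at hlo
    refine (abs_le.2 ⟨hlo, hup⟩).trans ?_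
    rw [bernE_add, bernE_const, bernE_const_mul]
    have h1 := (abs_le.1 (abs_bernE_sub_update_le hp0 hp1 (K := 1)
      (f := fun g => u e g ^ 2) (fun g g' => by
        have h1 := (sq_le_one_iff_abs_le_one _).2
          (abs_corr_sub_le (q := q) (β := β) g e.1.1 e.1.2)
        have h2 := (sq_le_one_iff_abs_le_one _).2
          (abs_corr_sub_le (q := q) (β := β) g' e.1.1 e.1.2)
        simp only [hu]
        rw [abs_le]; constructor <;> nlinarith [sq_nonneg (u e g), sq_nonneg (u e g')]) e)).1
    have h2 := mul_le_mul_of_nonneg_left (by linarith : bernE (t / n)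
      (fun g => u e (Function.update g e false) ^ 2) ≤
      bernE (t / n) (fun g => u e g ^ 2) + t / n) (div_nonneg hE0 hη.le)
    refine (add_le_add_right h2 _).trans (le_of_eq ?_)
    ring
  rw [erSlope, abs_mul, abs_of_nonneg (by positivity), inv_mul_le_iff₀ (by positivity)]
  refine (Finset.abs_sum_le_sum_abs _ _).trans ((Finset.sum_le_sum fun e _ => h e).trans ?_)
  have hcd : ∑ e, bernE (t / n) (fun g => u e g ^ 2) ≤ (n : ℝ) ^ 2 * expOverlap q β t n := by
    refine le_trans (le_of_eq ?_) (corrDev_le_expOverlap hβ ht hn htn)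
    rw [corrDev, bernE_sum]
  rw [← Finset.mul_sum, Finset.sum_add_distrib, ← Finset.sum_div, Finset.sum_add_distrib,
    Finset.sum_const, Finset.sum_const, Finset.card_univ, nsmul_eq_mul, nsmul_eq_mul,
    mul_left_comm]
  refine mul_le_mul_of_nonneg_left ?_ hE0
  have hc := card_edgeIdx_le n
  have h3 : (Fintype.card (EdgeIdx n) : ℝ) * (t / n) ≤ (n : ℝ) ^ 2 * (t / n) :=
    mul_le_mul_of_nonneg_right hc hp0
  have h4 : (Fintype.card (EdgeIdx n) : ℝ) * η ≤ (n : ℝ) ^ 2 * η :=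
    mul_le_mul_of_nonneg_right hc hη.le
  have h5 := div_le_div_of_nonneg_right (add_le_add hcd h3) hη.le
  refine (add_le_add h4 h5).trans (le_of_eq ?_)
  ring

lemma erSlope_tendsto (hβ : 0 < β) {t : ℝ} (ht : 0 ≤ t)
    (h : Filter.Tendsto (fun n => expOverlap q β t n) Filter.atTop (nhds 0)) :
    Filter.Tendsto (fun n => erSlope q β n t) Filter.atTop (nhds 0) := by
  have hE : 0 < Real.exp (2 * β) := Real.exp_pos _
  have h0 : Filter.Tendsto (fun n : ℕ => expOverlap q β t n + t / n) Filter.atTop (nhds 0) := by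
    simpa using h.add (tendsto_const_div_atTop_nhds_zero_nat t)
  refine Metric.tendsto_nhds.2 fun ε hε => ?_
  set η := ε / (4 * Real.exp (2 * β)) with hη
  have hη0 : 0 < η := by positivity
  filter_upwards [eventually_pos_le t, h0.eventually_lt_const (by positivity : 0 < η ^ 2)]
    with n ⟨hn, htn⟩ h1
  rw [Real.dist_eq, sub_zero]
  refine (abs_erSlope_le_expOverlap hβ ht hn htn hη0).trans_lt ?_
  have h2 : (expOverlap q β t n + t / n) / η ≤ η := by
    rw [div_le_iff₀ hη0, ← sq]; exact h1.le
  calc _ ≤ Real.exp (2 * β) * (η + η) := mul_le_mul_of_nonneg_left (by linarith) hE.le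
    _ = ε / 2 := by rw [hη]; field_simp; ring
    _ < ε := by linarith

/-- Overlap concentration up to mean degree `d` implies a trivial free energy at `d`. -/
theorem erFE_ge_of_expOverlap_tendsto (hβ : 0 < β) {d : ℝ} (hd : 0 ≤ d)
    (h : ∀ t ∈ Set.Ioc 0 d, Filter.Tendsto (fun n => expOverlap q β t n) Filter.atTop (nhds 0))
    {δ : ℝ} (hδ : 0 < δ) :
    ∀ᶠ N : ℕ in Filter.atTop, N * (Real.log q - δ) ≤ erFE q β d N := by
  have hlim_int : Filter.Tendsto (fun n : ℕ => ∫ t in (0 : ℝ)..d, erSlope q β n t) Filter.atTop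
      (nhds (∫ _ in (0 : ℝ)..d, (0 : ℝ))) := by
    refine intervalIntegral.tendsto_integral_filter_of_dominated_convergence (fun _ => β)
      (Filter.Eventually.of_forall fun n => (continuous_erSlope n).aestronglyMeasurable) ?_
      (intervalIntegrable_const) ?_
    · filter_upwards [eventually_pos_le d] with n ⟨hn, hdn⟩
      refine Filter.Eventually.of_forall fun t ht => ?_
      rw [Set.uIoc_of_le hd] at ht
      exact abs_erSlope_le hβ ht.1.le hn (ht.2.trans hdn)
    · refine Filter.Eventually.of_forall fun t ht => ?_
      rw [Set.uIoc_of_le hd] at ht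
      exact erSlope_tendsto hβ ht.1.le (h t ht)
  rw [intervalIntegral.integral_zero] at hlim_int
  filter_upwards [hlim_int.eventually_const_lt (neg_lt_zero.2 hδ), eventually_pos_le d]
    with n h1 ⟨hn, _⟩
  have hn' : (0 : ℝ) < n := by exact_mod_cast hn
  rw [← erFE_sub_eq_integral hβ hn] at h1
  have h2 := mul_le_mul_of_nonneg_left (by linarith : Real.log q - δ ≤ (n : ℝ)⁻¹ * erFE q β d n)
    hn'.le
  rwa [mul_inv_cancel_left₀ hn'.ne'] at h2

end FreeEnergyIntegral

noncomputable section BetheMeasure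

variable {q : ℕ} [NeZero q] {β : ℝ}

/-- Integrand of the vertex part of the normalized Bethe functional. -/
def vertexTerm (q : ℕ) (β : ℝ) {γ : ℕ} (x : Fin γ → Fin q → ℝ) : ℝ :=
  (q : ℝ)⁻¹ * LamFn (∑ s, ∏ i, fWt q β (x i s))

/-- Integrand of the edge part of the normalized Bethe functional. -/
def edgeTerm (q : ℕ) (β : ℝ) (x : Fin 2 → Fin q → ℝ) : ℝ :=
  lamZ (fWt q β (∑ s, x 0 s * x 1 s))

/-- The normalized Bethe functional of the law of `f` under `m`. -/
def betheOf {A : Type*} [MeasurableSpace A] (β d : ℝ) (m : Measure A) (f : A → Fin q → ℝ) : ℝ :=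
  (∑' γ : ℕ, (Real.exp (-d) * d ^ γ / γ.factorial) *
      ∫ a : Fin γ → A, vertexTerm q β (fun i => f (a i)) ∂(Measure.pi fun _ : Fin γ => m)) -
    d / 2 * ∫ a : Fin 2 → A, edgeTerm q β (fun i => f (a i)) ∂(Measure.pi fun _ : Fin 2 => m)

lemma continuous_fWt : Continuous (fWt q β) := by
  unfold fWt; fun_prop

lemma continuous_LamFn : Continuous LamFn := Real.continuous_mul_log

lemma continuous_vertexTerm {γ : ℕ} :
    Continuous fun x : Fin γ → Fin q → ℝ => vertexTerm q β x := by
  refine continuous_const.mul (continuous_LamFn.comp ?_)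
  exact continuous_finsetSum _ fun s _ => continuous_finsetProd _ fun i _ =>
    continuous_fWt.comp (by fun_prop)

lemma continuous_edgeTerm : Continuous fun x : Fin 2 → Fin q → ℝ => edgeTerm q β x := by
  have h : Continuous lamZ := (continuous_LamFn.sub continuous_id).add continuous_const
  exact h.comp (continuous_fWt.comp (by fun_prop))

lemma prod_fWt_mem (hβ : 0 < β) {γ : ℕ} {x : Fin γ → Fin q → ℝ}
    (hx : ∀ i, x i ∈ stdSimplex ℝ (Fin q)) (s : Fin q) :
    ∏ i, fWt q β (x i s) ∈ Set.Icc (Real.exp (-(β * γ))) (Real.exp (β * γ)) := by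
  have h : ∀ i, x i s ∈ Set.Icc (0 : ℝ) 1 := fun i => mem_Icc_of_mem_stdSimplex (hx i) s
  constructor
  · calc Real.exp (-(β * γ)) = ∏ _i : Fin γ, Real.exp (-β) := by
          rw [Finset.prod_const, Finset.card_univ, Fintype.card_fin, ← Real.exp_nat_mul]; ring_nf
      _ ≤ _ := Finset.prod_le_prod (fun _ _ => (Real.exp_pos _).le) fun i _ =>
          exp_neg_le_fWt hβ (h i).2
  · calc _ ≤ ∏ _i : Fin γ, Real.exp β :=
          Finset.prod_le_prod (fun i _ => (fWt_pos hβ (h i).2).le) fun i _ =>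
          fWt_le_exp hβ (h i).1
      _ = Real.exp (β * γ) := by
          rw [Finset.prod_const, Finset.card_univ, Fintype.card_fin, ← Real.exp_nat_mul]; ring_nf

lemma abs_vertexTerm_le (hβ : 0 < β) {γ : ℕ} {x : Fin γ → Fin q → ℝ}
    (hx : ∀ i, x i ∈ stdSimplex ℝ (Fin q)) :
    |vertexTerm q β x| ≤ Real.exp (2 * q) * Real.exp (2 * β) ^ γ := by
  set W := ∑ s, ∏ i, fWt q β (x i s) with hW
  have hq1 : (1 : ℝ) ≤ q := one_le_q
  have hlo : Real.exp (-(β * γ)) ≤ W := by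
    refine (prod_fWt_mem hβ hx 0).1.trans ?_
    exact Finset.single_le_sum (f := fun s => ∏ i, fWt q β (x i s))
      (fun s _ => (Real.exp_pos _).le.trans (prod_fWt_mem hβ hx s).1) (Finset.mem_univ _)
  have hW0 : 0 < W := (Real.exp_pos _).trans_le hlo
  have hup : W ≤ Real.exp (q + β * γ) := by
    calc W ≤ ∑ _s : Fin q, Real.exp (β * γ) :=
          Finset.sum_le_sum fun s _ => (prod_fWt_mem hβ hx s).2
      _ = q * Real.exp (β * γ) := by simp
      _ ≤ Real.exp q * Real.exp (β * γ) := by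
          gcongr; linarith [Real.add_one_le_exp (q : ℝ)]
      _ = _ := (Real.exp_add _ _).symm
  have hlog : -(q + β * γ) ≤ Real.log W := by
    have := Real.log_le_log (Real.exp_pos _) hlo
    rw [Real.log_exp] at this
    linarith
  have h := LamFn_le_of_le hW0 hup hlog
  rw [vertexTerm, ← hW, abs_mul, abs_of_nonneg (inv_nonneg.2 (zero_le_one.trans hq1))]
  have hb : (q : ℝ) + β * γ ≤ Real.exp (q + β * γ) := by
    linarith [Real.add_one_le_exp ((q : ℝ) + β * γ)]
  calc (q : ℝ)⁻¹ * |LamFn W| ≤ 1 * |LamFn W| :=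
        mul_le_mul_of_nonneg_right (inv_le_one_of_one_le₀ hq1) (abs_nonneg _)
    _ ≤ Real.exp (q + β * γ) * (q + β * γ) := by rw [one_mul]; exact h
    _ ≤ Real.exp (q + β * γ) * Real.exp (q + β * γ) :=
        mul_le_mul_of_nonneg_left hb (Real.exp_pos _).le
    _ = _ := by rw [← Real.exp_add, ← Real.exp_nat_mul, ← Real.exp_add]; ring_nf

lemma abs_edgeTerm_le (hβ : 0 < β) {x : Fin 2 → Fin q → ℝ}
    (hx : ∀ i, x i ∈ stdSimplex ℝ (Fin q)) : |edgeTerm q β x| ≤ Real.exp (2 * β) := by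
  have h := sum_mul_mem_Icc (hx 0) (hx 1)
  rw [edgeTerm, abs_of_nonneg (lamZ_nonneg (fWt_pos hβ h.2).le)]
  exact lamZ_fWt_le hβ h.1 h.2

lemma summable_poisson_bound (d C K : ℝ) :
    Summable fun γ : ℕ => Real.exp (-d) * d ^ γ / γ.factorial * (C * K ^ γ) := by
  have h := ((hasSum_exp (d * K)).summable.mul_left (Real.exp (-d) * C))
  refine h.congr fun γ => ?_
  rw [mul_pow]; ring

lemma hasSum_poisson (d : ℝ) :
    HasSum (fun γ : ℕ => Real.exp (-d) * d ^ γ / γ.factorial * (γ : ℝ)) d := by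
  refine (hasSum_nat_add_iff' 1).1 ?_
  have h := (hasSum_exp d).mul_left (Real.exp (-d) * d)
  have h2 : Real.exp (-d) * d * Real.exp d = d := by
    rw [mul_right_comm, ← Real.exp_add]; simp
  rw [h2] at h
  simp only [Finset.range_one, Finset.sum_singleton, Nat.cast_zero, mul_zero, sub_zero]
  refine h.congr_fun fun γ => ?_
  rw [Nat.factorial_succ, pow_succ]
  push_cast
  field_simp

section Map

variable {A A' : Type*} [MeasurableSpace A] [MeasurableSpace A']

lemma integral_pi_map {γ : ℕ} (m : Measure A) [IsProbabilityMeasure m] {g : A → A'}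
    (hg : Measurable g) {F : (Fin γ → A') → ℝ} (hF : Measurable F) :
    ∫ b, F b ∂(Measure.pi fun _ : Fin γ => m.map g) =
      ∫ a, F (fun i => g (a i)) ∂(Measure.pi fun _ : Fin γ => m) := by
  have : IsProbabilityMeasure (m.map g) := Measure.isProbabilityMeasure_map hg.aemeasurable
  rw [← Measure.pi_map_pi (fun _ => hg.aemeasurable), integral_map]
  · exact (measurable_pi_lambda _ fun i => hg.comp (measurable_pi_apply i)).aemeasurable
  · exact hF.aestronglyMeasurable

lemma betheOf_map (d : ℝ) (m : Measure A) [IsProbabilityMeasure m] {g : A → A'}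
    (hg : Measurable g) {f : A' → Fin q → ℝ} (hf : Measurable f) :
    betheOf β d (m.map g) f = betheOf β d m fun a => f (g a) := by
  have hm : ∀ γ : ℕ, Measurable fun (a : Fin γ → A') (i : Fin γ) => f (a i) := fun γ =>
    measurable_pi_lambda _ fun i => hf.comp (measurable_pi_apply i)
  have he : Measurable fun x : Fin 2 → Fin q → ℝ => edgeTerm q β x :=
    (continuous_edgeTerm (q := q) (β := β)).measurable
  rw [betheOf, betheOf]
  congr 1
  · refine tsum_congr fun γ => ?_
    rw [integral_pi_map m hg (F := fun a => vertexTerm q β fun i => f (a i))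
      (continuous_vertexTerm.measurable.comp (hm γ))]
  · rw [integral_pi_map m hg (F := fun a => edgeTerm q β fun i => f (a i))
      (he.comp (hm 2) :)]

end Map

lemma ae_pi_mem {A : Type*} [MeasurableSpace A] {m : Measure A} [IsProbabilityMeasure m] {s : Set A}
    (h : ∀ᵐ a ∂m, a ∈ s) (γ : ℕ) :
    ∀ᵐ a ∂(Measure.pi fun _ : Fin γ => m), ∀ i, a i ∈ s :=
  ae_all_iff.2 fun i => (measurePreserving_eval (fun _ => m) i).quasiMeasurePreserving.ae h

lemma integral_pi_fintype {J : Type*} [Fintype J] [MeasurableSpace J] [MeasurableSingletonClass J]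
    (m : Measure J) [IsProbabilityMeasure m] {γ : ℕ} (F : (Fin γ → J) → ℝ) :
    ∫ a, F a ∂(Measure.pi fun _ : Fin γ => m) =
      ∑ l : Fin γ → J, (∏ i, m.real {l i}) * F l := by
  rw [integral_fintype .of_finite]
  refine Finset.sum_congr rfl fun l _ => ?_
  rw [smul_eq_mul, measureReal_def, Measure.pi_singleton, ENNReal.toReal_prod]
  rfl

/-- The finitely supported law of `ρ` under a probability measure on a finite set. -/
def FinLaw.ofMeasure {J : Type} [Fintype J] [MeasurableSpace J] [MeasurableSingletonClass J]
    (m : Measure J) [IsProbabilityMeasure m] (ρ : J → Fin q → ℝ)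
    (hρ : ∀ j, ρ j ∈ stdSimplex ℝ (Fin q)) : FinLaw q J where
  p j := m.real {j}
  ρ := ρ
  p_nonneg _ := measureReal_nonneg
  p_sum := by rw [sum_measureReal_singleton]; simp
  ρ_mem := hρ

lemma betheOf_finLaw (hβ : 0 < β) {J : Type} [Fintype J] [MeasurableSpace J]
    [MeasurableSingletonClass J] (m : Measure J) [IsProbabilityMeasure m] (P : FinLaw q J)
    (hP : ∀ j, m.real {j} = P.p j) (d : ℝ) :
    betheOf β d m P.ρ = betheV β d P - betheE β d P := by
  rw [betheOf, betheV, betheE]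
  congr 1
  · rw [Pois, rateTot_rateOf, ← Finset.mul_sum, P.p_sum, mul_one, ← mul_assoc, ← tsum_mul_left]
    refine tsum_congr fun γ => ?_
    rw [integral_pi_fintype, jumpOp_pow_rateOf, Finset.mul_sum, Finset.sum_div, Finset.mul_sum]
    refine Finset.sum_congr rfl fun l _ => ?_
    have h1 : partZ (0 + ∑ i, fun s => fPot q β (P.ρ (l i) s)) =
        ∑ s, ∏ i, fWt q β (P.ρ (l i) s) := by
      refine Finset.sum_congr rfl fun s _ => ?_
      rw [zero_add, Finset.sum_apply, Real.exp_sum]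
      exact Finset.prod_congr rfl fun i _ => exp_fPot hβ (P.ρ_mem_Icc _ _).2
    rw [h1, Finset.prod_mul_distrib, Finset.prod_const, Finset.card_univ, Fintype.card_fin,
      vertexTerm]
    simp only [hP]
    ring
  · rw [integral_pi_fintype, ← (finTwoArrowEquiv J).symm.sum_comp, Fintype.sum_prod_type]
    simp [hP, edgeTerm, Fin.prod_univ_two]

lemma integral_fWt_eq_one (hβ : 0 < β) {π : ProbabilityMeasure (Fin q → ℝ)} (hπ : memP2star q π)
    (s : Fin q) : ∫ μ, fWt q β (μ s) ∂(π : Measure (Fin q → ℝ)) = 1 := by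
  have hi : Integrable (fun μ : Fin q → ℝ => μ s) (π : Measure (Fin q → ℝ)) :=
    Integrable.of_bound (measurable_pi_apply s).aestronglyMeasurable 1 (hπ.1.mono fun μ hμ => by
      have := mem_Icc_of_mem_stdSimplex hμ s
      rw [Real.norm_eq_abs, abs_of_nonneg this.1]; exact this.2)
  have hξ := xiP_pos (q := q) hβ
  simp only [fWt]
  rw [integral_div, integral_sub (integrable_const _) (hi.const_mul _), integral_const_mul, hπ.2 s]
  simp only [integral_const, probReal_univ, smul_eq_mul, mul_one]
  rw [← div_eq_mul_inv]
  exact div_self hξ.ne'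

lemma integrable_pi_of_continuous {π : ProbabilityMeasure (Fin q → ℝ)} (hπ : memP2star q π) {γ : ℕ}
    {F : (Fin γ → Fin q → ℝ) → ℝ} (hF : Continuous F) {C : ℝ}
    (hC : ∀ x : Fin γ → Fin q → ℝ, (∀ i, x i ∈ stdSimplex ℝ (Fin q)) → |F x| ≤ C) :
    Integrable F (Measure.pi fun _ : Fin γ => (π : Measure (Fin q → ℝ))) :=
  Integrable.of_bound hF.aestronglyMeasurable C ((ae_pi_mem hπ.1 γ).mono fun x hx => hC x hx)

lemma BPotts_eq (hβ : 0 < β) (d : ℝ) {π : ProbabilityMeasure (Fin q → ℝ)} (hπ : memP2star q π) :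
    BPotts q β d π = betheOf β d (π : Measure (Fin q → ℝ)) (fun μ => μ) +
      d / 2 * Real.log (xiP q β) := by
  have hξ := xiP_pos (q := q) hβ
  have hq0 : (q : ℝ) ≠ 0 := q_pos.ne'
  have hf : ∀ x, 1 - (1 - Real.exp (-β)) * x = xiP q β * fWt q β x := fun x => by
    rw [fWt, mul_div_cancel₀ _ hξ.ne', cP]
  have hV : ∀ γ : ℕ, ∫ ρ : Fin γ → Fin q → ℝ,
        LamFn (∑ σ : Fin q, ∏ i, (1 - (1 - Real.exp (-β)) * ρ i σ)) /
          ((q : ℝ) * (1 - (1 - Real.exp (-β)) / q) ^ γ)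
        ∂(Measure.pi fun _ : Fin γ => (π : Measure (Fin q → ℝ))) =
      (∫ ρ : Fin γ → Fin q → ℝ, vertexTerm q β ρ
        ∂(Measure.pi fun _ : Fin γ => (π : Measure (Fin q → ℝ)))) + γ * Real.log (xiP q β) := by
    intro γ
    have hW : Continuous fun ρ : Fin γ → Fin q → ℝ => ∑ s, ∏ i, fWt q β (ρ i s) :=
      continuous_finsetSum _ fun s _ => continuous_finsetProd _ fun i _ =>
        continuous_fWt.comp (by fun_prop)
    have hP : ∀ s : Fin q, Integrable (fun ρ : Fin γ → Fin q → ℝ => ∏ i, fWt q β (ρ i s))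
        (Measure.pi fun _ : Fin γ => (π : Measure (Fin q → ℝ))) := fun s =>
      integrable_pi_of_continuous hπ (continuous_finsetProd _ fun i _ =>
        continuous_fWt.comp (by fun_prop)) fun x hx => by
          have h := prod_fWt_mem hβ hx s
          rw [abs_of_nonneg ((Real.exp_pos _).le.trans h.1)]
          exact h.2
    have hE : ∫ ρ : Fin γ → Fin q → ℝ, ∑ s, ∏ i, fWt q β (ρ i s)
        ∂(Measure.pi fun _ : Fin γ => (π : Measure (Fin q → ℝ))) = q := by
      rw [integral_finsetSum _ fun s _ => hP s]
      have : ∀ s : Fin q, ∫ ρ : Fin γ → Fin q → ℝ, ∏ i, fWt q β (ρ i s)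
          ∂(Measure.pi fun _ : Fin γ => (π : Measure (Fin q → ℝ))) = 1 := fun s => by
        rw [integral_fintype_prod_eq_prod fun (_ : Fin γ) (μ : Fin q → ℝ) => fWt q β (μ s)]
        simp [integral_fWt_eq_one hβ hπ]
      simp [this]
    have hi := integrable_pi_of_continuous hπ (γ := γ) (continuous_vertexTerm (q := q) (β := β))
      fun x hx => abs_vertexTerm_le hβ hx
    have hlast : (γ : ℝ) * Real.log (xiP q β) = ∫ ρ : Fin γ → Fin q → ℝ,
        (q : ℝ)⁻¹ * (γ * Real.log (xiP q β)) * ∑ s, ∏ i, fWt q β (ρ i s)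
        ∂(Measure.pi fun _ : Fin γ => (π : Measure (Fin q → ℝ))) := by
      rw [integral_const_mul, hE]; field_simp
    rw [hlast, ← integral_add hi ((integrable_finsetSum _ fun s _ => hP s).const_mul _)]
    refine integral_congr_ae ((ae_pi_mem hπ.1 γ).mono fun x hx => ?_)
    have hW0 : 0 < ∑ s, ∏ i, fWt q β (x i s) :=
      Finset.sum_pos (fun s _ => (Real.exp_pos _).trans_le (prod_fWt_mem hβ hx s).1) ⟨0, mem_univ _⟩
    have hx1 : ∑ σ : Fin q, ∏ i, (1 - (1 - Real.exp (-β)) * x i σ) =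
        xiP q β ^ γ * ∑ s, ∏ i, fWt q β (x i s) := by
      simp only [hf, Finset.prod_mul_distrib, Finset.prod_const, Finset.card_univ,
        Fintype.card_fin, Finset.mul_sum]
    have hx2 : (1 : ℝ) - (1 - Real.exp (-β)) / q = xiP q β := rfl
    have hξγ : xiP q β ^ γ ≠ 0 := (pow_pos hξ γ).ne'
    simp only [vertexTerm]
    rw [hx1, hx2, LamFn_mul (pow_pos hξ γ) hW0, Real.log_pow]
    field_simp
  have hEd : ∫ ρ : Fin 2 → Fin q → ℝ,
        LamFn (1 - (1 - Real.exp (-β)) * ∑ τ : Fin q, ρ 0 τ * ρ 1 τ) /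
          (1 - (1 - Real.exp (-β)) / q)
        ∂(Measure.pi fun _ : Fin 2 => (π : Measure (Fin q → ℝ))) =
      (∫ ρ : Fin 2 → Fin q → ℝ, edgeTerm q β ρ
        ∂(Measure.pi fun _ : Fin 2 => (π : Measure (Fin q → ℝ)))) + Real.log (xiP q β) := by
    have hP : ∀ s : Fin q, Integrable (fun ρ : Fin 2 → Fin q → ℝ => ρ 0 s * ρ 1 s)
        (Measure.pi fun _ : Fin 2 => (π : Measure (Fin q → ℝ))) := fun s =>
      integrable_pi_of_continuous hπ (C := 1) (by fun_prop) fun x hx => by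
        have h0 := mem_Icc_of_mem_stdSimplex (hx 0) s
        have h1 := mem_Icc_of_mem_stdSimplex (hx 1) s
        rw [abs_of_nonneg (mul_nonneg h0.1 h1.1)]
        exact mul_le_one₀ h0.2 h1.1 h1.2
    have hS : ∫ ρ : Fin 2 → Fin q → ℝ, ∑ s, ρ 0 s * ρ 1 s
        ∂(Measure.pi fun _ : Fin 2 => (π : Measure (Fin q → ℝ))) = (q : ℝ)⁻¹ := by
      rw [integral_finsetSum _ fun s _ => hP s]
      have : ∀ s : Fin q, ∫ ρ : Fin 2 → Fin q → ℝ, ρ 0 s * ρ 1 s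
          ∂(Measure.pi fun _ : Fin 2 => (π : Measure (Fin q → ℝ))) = (q : ℝ)⁻¹ * (q : ℝ)⁻¹ := by
        intro s
        have := integral_fintype_prod_eq_prod (μ := fun _ : Fin 2 => (π : Measure (Fin q → ℝ)))
          fun (_ : Fin 2) (μ : Fin q → ℝ) => μ s
        simpa only [Fin.prod_univ_two, hπ.2 s] using this
      simp only [this, Finset.sum_const, Finset.card_univ, Fintype.card_fin, nsmul_eq_mul]
      field_simp
    have hSi := integrable_finsetSum Finset.univ fun s _ => hP s
    have hF : ∫ ρ : Fin 2 → Fin q → ℝ, fWt q β (∑ s, ρ 0 s * ρ 1 s)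
        ∂(Measure.pi fun _ : Fin 2 => (π : Measure (Fin q → ℝ))) = 1 := by
      simp only [fWt]
      rw [integral_div, integral_sub (integrable_const _) (hSi.const_mul _), integral_const_mul, hS]
      simp only [integral_const, probReal_univ, smul_eq_mul, mul_one]
      rw [← div_eq_mul_inv]
      exact div_self hξ.ne'
    have hFi : Integrable (fun ρ : Fin 2 → Fin q → ℝ => fWt q β (∑ s, ρ 0 s * ρ 1 s))
        (Measure.pi fun _ : Fin 2 => (π : Measure (Fin q → ℝ))) :=
      ((integrable_const _).sub (hSi.const_mul _)).div_const _
    have hi := integrable_pi_of_continuous hπ (continuous_edgeTerm (q := q) (β := β))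
      fun x hx => abs_edgeTerm_le hβ hx
    have hlast : Real.log (xiP q β) = ∫ ρ : Fin 2 → Fin q → ℝ,
        ((1 + Real.log (xiP q β)) * fWt q β (∑ s, ρ 0 s * ρ 1 s) - 1)
        ∂(Measure.pi fun _ : Fin 2 => (π : Measure (Fin q → ℝ))) := by
      rw [integral_sub (hFi.const_mul _) (integrable_const _), integral_const_mul, hF]
      simp
    have hGi : Integrable (fun ρ : Fin 2 → Fin q → ℝ =>
        (1 + Real.log (xiP q β)) * fWt q β (∑ s, ρ 0 s * ρ 1 s) - 1)
        (Measure.pi fun _ : Fin 2 => (π : Measure (Fin q → ℝ))) :=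
      (hFi.const_mul _).sub (integrable_const _)
    rw [hlast, ← integral_add hi hGi]
    refine integral_congr_ae ((ae_pi_mem hπ.1 2).mono fun x hx => ?_)
    have hx1 := sum_mul_mem_Icc (hx 0) (hx 1)
    have hx2 : (1 : ℝ) - (1 - Real.exp (-β)) / q = xiP q β := rfl
    simp only [edgeTerm, lamZ]
    rw [hf, hx2, LamFn_mul hξ (fWt_pos hβ hx1.2)]
    field_simp
    ring
  have hsum1 : Summable fun γ : ℕ => Real.exp (-d) * d ^ γ / γ.factorial *
      ∫ ρ : Fin γ → Fin q → ℝ, vertexTerm q β ρ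
        ∂(Measure.pi fun _ : Fin γ => (π : Measure (Fin q → ℝ))) := by
    refine (summable_poisson_bound |d| (Real.exp (2 * q) * Real.exp (|d| - d)) (Real.exp (2 * β))).of_norm_bounded
      fun γ => ?_
    have h := norm_integral_le_of_norm_le_const (f := vertexTerm q β)
      ((ae_pi_mem hπ.1 γ).mono fun x hx => abs_vertexTerm_le hβ hx)
    rw [probReal_univ, mul_one] at h
    have h2 : Real.exp (-d) = Real.exp (-|d|) * Real.exp (|d| - d) := by
      rw [← Real.exp_add]; ring_nf
    rw [norm_mul, norm_div, norm_mul, norm_pow, Real.norm_eq_abs d,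
      Real.norm_of_nonneg (Real.exp_pos _).le, Real.norm_natCast, h2]
    refine (mul_le_mul_of_nonneg_left h (by positivity)).trans (le_of_eq ?_)
    ring
  rw [BPotts, betheOf, hEd]
  simp only [hV, mul_add, ← mul_assoc]
  have hp := (hasSum_poisson d).mul_right (Real.log (xiP q β))
  rw [(hsum1.hasSum.add hp).tsum_eq]
  ring

end BetheMeasure

noncomputable section Threshold

variable {q : ℕ} [NeZero q] {β : ℝ}

lemma exists_memP2star_of_finLaw (hβ : 0 < β) (d : ℝ) {J : Type} [Fintype J] {P : FinLaw q J}
    (hP : P.Balanced) : ∃ π : ProbabilityMeasure (Fin q → ℝ), memP2star q π ∧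
      BPotts q β d π = betheV β d P - betheE β d P + d / 2 * Real.log (xiP q β) := by
  let _ : MeasurableSpace J := ⊤
  have hsum : ∑ j, ENNReal.ofReal (P.p j) = 1 := by
    rw [← ENNReal.ofReal_sum_of_nonneg fun j _ => P.p_nonneg j, P.p_sum, ENNReal.ofReal_one]
  set m : Measure J := (PMF.ofFintype (fun j => ENNReal.ofReal (P.p j)) hsum).toMeasure with hm
  have hmp : ∀ j, m.real {j} = P.p j := fun j => by
    rw [measureReal_def, hm, PMF.toMeasure_apply_singleton _ _ (measurableSet_singleton j),
      PMF.ofFintype_apply, ENNReal.toReal_ofReal (P.p_nonneg j)]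
  have hρ : Measurable P.ρ := measurable_from_top
  have hprob : IsProbabilityMeasure (m.map P.ρ) := Measure.isProbabilityMeasure_map hρ.aemeasurable
  have hmem : memP2star q ⟨m.map P.ρ, hprob⟩ := by
    constructor
    · exact (ae_map_iff hρ.aemeasurable (isClosed_stdSimplex ℝ (Fin q)).measurableSet).2
        (Filter.Eventually.of_forall P.ρ_mem)
    · intro s
      change ∫ μ, μ s ∂(m.map P.ρ) = _
      rw [integral_map hρ.aemeasurable (measurable_pi_apply s).aestronglyMeasurable,
        integral_fintype .of_finite]
      simp only [hmp, smul_eq_mul]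
      exact hP s
  refine ⟨_, hmem, ?_⟩
  rw [BPotts_eq hβ d hmem]
  change betheOf β d (m.map P.ρ) (fun μ => μ) + _ = _
  rw [betheOf_map d m hρ measurable_id', betheOf_finLaw hβ m P hmp]

lemma tendsto_betheOf_simpleFunc (hβ : 0 < β) {d : ℝ} (hd : 0 ≤ d)
    {π : ProbabilityMeasure (Fin q → ℝ)} (hπ : memP2star q π)
    {f : ℕ → SimpleFunc (Fin q → ℝ) (Fin q → ℝ)} (hf : ∀ k x, f k x ∈ stdSimplex ℝ (Fin q))
    (hlim : ∀ x ∈ stdSimplex ℝ (Fin q), Filter.Tendsto (fun k => f k x) Filter.atTop (nhds x)) :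
    Filter.Tendsto (fun k => betheOf β d (π : Measure (Fin q → ℝ)) (f k)) Filter.atTop
      (nhds (betheOf β d (π : Measure (Fin q → ℝ)) fun μ => μ)) := by
  have hconv : ∀ (γ : ℕ) (F : (Fin γ → Fin q → ℝ) → ℝ) (C : ℝ), Continuous F →
      (∀ x : Fin γ → Fin q → ℝ, (∀ i, x i ∈ stdSimplex ℝ (Fin q)) → |F x| ≤ C) →
      Filter.Tendsto (fun k => ∫ a : Fin γ → Fin q → ℝ, F (fun i => f k (a i))
        ∂(Measure.pi fun _ : Fin γ => (π : Measure (Fin q → ℝ)))) Filter.atTop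
        (nhds (∫ a : Fin γ → Fin q → ℝ, F a
          ∂(Measure.pi fun _ : Fin γ => (π : Measure (Fin q → ℝ))))) := by
    intro γ F C hF hC
    refine tendsto_integral_of_dominated_convergence (fun _ => C) (fun k => ?_)
      (integrable_const _) (fun k => Filter.Eventually.of_forall fun a => hC _ fun i => hf k _) ?_
    · exact (hF.measurable.comp (measurable_pi_lambda _ fun i =>
        (f k).measurable.comp (measurable_pi_apply i)) :).aestronglyMeasurable
    · refine (ae_pi_mem hπ.1 γ).mono fun a ha => ?_
      exact (hF.tendsto a).comp (tendsto_pi_nhds.2 fun i => hlim _ (ha i))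
  refine Filter.Tendsto.sub ?_ ((hconv 2 _ _ continuous_edgeTerm fun x hx =>
    abs_edgeTerm_le hβ hx).const_mul _)
  refine tendsto_tsum_of_dominated_convergence
    (summable_poisson_bound d (Real.exp (2 * q)) (Real.exp (2 * β)))
    (fun γ => (hconv γ _ _ continuous_vertexTerm fun x hx => abs_vertexTerm_le hβ hx).const_mul _)
    (Filter.Eventually.of_forall fun k γ => ?_)
  have h := norm_integral_le_of_norm_le_const
    (μ := Measure.pi fun _ : Fin γ => (π : Measure (Fin q → ℝ)))
    (f := fun a => vertexTerm q β fun i => f k (a i))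
    (Filter.Eventually.of_forall fun a => abs_vertexTerm_le hβ fun i => hf k (a i))
  rw [probReal_univ, mul_one] at h
  rw [norm_mul, Real.norm_of_nonneg (by positivity)]
  exact mul_le_mul_of_nonneg_left h (by positivity)

lemma exists_finLaw_simpleFunc (hβ : 0 < β) (d : ℝ) (π : ProbabilityMeasure (Fin q → ℝ))
    (f : SimpleFunc (Fin q → ℝ) (Fin q → ℝ)) (hf : ∀ x, f x ∈ stdSimplex ℝ (Fin q)) :
    ∃ (J : Type) (_ : Fintype J) (P : FinLaw q J),
      betheV β d P - betheE β d P = betheOf β d (π : Measure (Fin q → ℝ)) f ∧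
      ∀ s, P.bary s = ∫ μ, f μ s ∂(π : Measure (Fin q → ℝ)) := by
  let _ : MeasurableSpace f.range := ⊤
  set g : (Fin q → ℝ) → f.range := fun x => ⟨f x, f.mem_range_self x⟩ with hg
  have hgm : Measurable g := by
    refine measurable_to_countable' fun y => ?_
    have : g ⁻¹' {y} = f ⁻¹' {y.1} := by ext x; simp [hg, Subtype.ext_iff]
    rw [this]
    exact f.measurableSet_fiber _
  have hprob : IsProbabilityMeasure ((π : Measure (Fin q → ℝ)).map g) :=
    Measure.isProbabilityMeasure_map hgm.aemeasurable
  have hρ : ∀ j : f.range, (j : Fin q → ℝ) ∈ stdSimplex ℝ (Fin q) := fun j => by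
    obtain ⟨x, hx⟩ := SimpleFunc.mem_range.1 j.2
    rw [← hx]; exact hf x
  refine ⟨f.range, inferInstance,
    FinLaw.ofMeasure ((π : Measure (Fin q → ℝ)).map g) (fun j => j.1) hρ, ?_, fun s => ?_⟩
  · rw [← betheOf_finLaw hβ ((π : Measure (Fin q → ℝ)).map g) _ fun _ => rfl]
    exact betheOf_map d (π : Measure (Fin q → ℝ)) hgm measurable_from_top
  · have h := integral_map (μ := (π : Measure (Fin q → ℝ))) hgm.aemeasurable
      (f := fun j : f.range => j.1 s) measurable_from_top.aestronglyMeasurable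
    rw [integral_fintype .of_finite] at h
    exact h

lemma exists_balanced_of_BPotts_gt (hβ : 0 < β) {d : ℝ} (hd : 0 ≤ d)
    {π : ProbabilityMeasure (Fin q → ℝ)} (hπ : memP2star q π)
    (h : Real.log q + d / 2 * Real.log (xiP q β) < BPotts q β d π) :
    ∃ (J : Type) (_ : Fintype J) (P : FinLaw q J), P.Balanced ∧
      Real.log q < betheV β d P - betheE β d P := by
  rw [BPotts_eq hβ d hπ, add_lt_add_iff_right] at h
  have hne : (stdSimplex ℝ (Fin q)).Nonempty := hπ.1.exists
  obtain ⟨y, hy⟩ := hne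
  set f := SimpleFunc.approxOn (fun x : Fin q → ℝ => x) measurable_id' (stdSimplex ℝ (Fin q)) y hy
  have hf : ∀ k x, f k x ∈ stdSimplex ℝ (Fin q) := SimpleFunc.approxOn_mem _ hy
  have hlim : ∀ x ∈ stdSimplex ℝ (Fin q), Filter.Tendsto (fun k => f k x) Filter.atTop (nhds x) :=
    fun x hx => SimpleFunc.tendsto_approxOn measurable_id' hy (subset_closure hx)
  obtain ⟨C, -, hbal⟩ := exists_balanced_bethe_ge q hβ hd
  have h1 := tendsto_betheOf_simpleFunc hβ hd hπ hf hlim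
  have h2 : Filter.Tendsto (fun k => ∑ s : Fin q,
      |(∫ μ, f k μ s ∂(π : Measure (Fin q → ℝ))) - (q : ℝ)⁻¹|) Filter.atTop (nhds 0) := by
    have : ∀ s : Fin q, Filter.Tendsto (fun k =>
        |(∫ μ, f k μ s ∂(π : Measure (Fin q → ℝ))) - (q : ℝ)⁻¹|) Filter.atTop (nhds 0) := by
      intro s
      have h3 : Filter.Tendsto (fun k => ∫ μ, f k μ s ∂(π : Measure (Fin q → ℝ))) Filter.atTop
          (nhds (∫ μ, μ s ∂(π : Measure (Fin q → ℝ)))) := by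
        refine tendsto_integral_of_dominated_convergence (fun _ => 1) (fun k => ?_)
          (integrable_const _) (fun k => Filter.Eventually.of_forall fun μ => ?_) ?_
        · exact ((measurable_pi_apply s).comp (f k).measurable).aestronglyMeasurable
        · have := mem_Icc_of_mem_stdSimplex (hf k μ) s
          rw [Real.norm_of_nonneg this.1]
          exact this.2
        · exact hπ.1.mono fun μ hμ => (tendsto_pi_nhds.1 (hlim μ hμ)) s
      rw [hπ.2 s] at h3
      simpa using (h3.sub_const (q : ℝ)⁻¹).abs
    simpa using tendsto_finsetSum Finset.univ fun s _ => this s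
  have h4 := (h1.sub (h2.const_mul C)).eventually (lt_mem_nhds (a := Real.log q) (by simpa using h))
  obtain ⟨k, hk⟩ := h4.exists
  obtain ⟨J, _, P, hP, hb⟩ := exists_finLaw_simpleFunc hβ d π (f k) (hf k)
  obtain ⟨P', hP', hle⟩ := hbal J P
  refine ⟨_, inferInstance, P', hP', lt_of_lt_of_le ?_ hle⟩
  rw [hP, FinLaw.imbalance]
  simpa only [hb] using hk

/-- The replica overlap condition forces the Bethe functional to stay below `log q`. -/
lemma bethe_le_log_of_expOverlap_tendsto (hq : 2 ≤ q) (hβ : 0 < β) {d : ℝ} (hd : 0 ≤ d)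
    (h : ∀ t ∈ Set.Ioc 0 d, Filter.Tendsto (fun n => expOverlap q β t n) Filter.atTop (nhds 0))
    {J : Type} [Fintype J] {P : FinLaw q J} (hP : P.Balanced) :
    betheV β d P - betheE β d P ≤ Real.log q := by
  refine le_of_forall_pos_le_add fun ε hε => ?_
  have h1 := plantedFE_le_of_erFE_ge hβ hd
    (fun δ hδ => erFE_ge_of_expOverlap_tendsto hβ hd h hδ) (half_pos hε)
  set K := d / 2 * lamZ (fWt q β 1) with hK
  obtain ⟨n, hn, hn0, hnK⟩ := (h1.and (eventually_pos_le (2 * K / ε))).exists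
  have hn' : (0 : ℝ) < n := by exact_mod_cast hn0
  have h2 := (bethe_le_plantedFE hq hβ hd hP hn0).trans hn
  rw [div_le_iff₀ hε] at hnK
  refine le_of_mul_le_mul_left ?_ hn'
  nlinarith

lemma limsup_expOverlap_le_zero (hβ : 0 < β) {d : ℝ} (hd : 0 ≤ d)
    (h : Filter.limsup (fun n => expOverlap q β d n) Filter.atTop ≤ 0) :
    Filter.Tendsto (fun n => expOverlap q β d n) Filter.atTop (nhds 0) := by
  have hmem : ∀ᶠ n : ℕ in Filter.atTop, expOverlap q β d n ∈ Set.Icc (0 : ℝ) (q ^ 2) :=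
    (eventually_pos_le d).mono fun n hn => expOverlap_mem hβ hd hn.1 hn.2
  have hup : Filter.IsBoundedUnder (· ≤ ·) Filter.atTop fun n => expOverlap q β d n :=
    ⟨q ^ 2, hmem.mono fun n hn => hn.2⟩
  have hlo : Filter.IsBoundedUnder (· ≥ ·) Filter.atTop fun n => expOverlap q β d n :=
    ⟨0, hmem.mono fun n hn => hn.1⟩
  exact tendsto_of_le_liminf_of_limsup_le
    (Filter.le_liminf_of_le hup.isCoboundedUnder_ge (hmem.mono fun n hn => hn.1)) h hup hlo

lemma limsup_expOverlap_eq_zero (hβ : 0 < β) {d : ℝ} (hd : 0 < d)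
    (h : ∀ (J : Type) [Fintype J] (P : FinLaw q J), P.Balanced →
      betheV β d P - betheE β d P ≤ Real.log q) :
    Filter.limsup (fun n => expOverlap q β d n) Filter.atTop = 0 :=
  (expOverlap_tendsto_of_erFE_ge hβ hd fun _ hδ => erFE_ge_of_plantedFE_le hβ hd.le
    (fun _ hδ' => plantedFE_le_of_bethe_le hβ hd.le h hδ') hδ).limsup_eq

end Threshold

lemma sInf_eq_of_subset_of_exists_le {s t : Set ℝ} (h : t ⊆ s) (hs : BddBelow s)
    (h' : ∀ d ∈ s, ∃ d' ∈ t, d' ≤ d) : sInf s = sInf t := by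
  rcases s.eq_empty_or_nonempty with rfl | ⟨d, hd⟩
  · rw [Set.subset_empty_iff.1 h]
  · obtain ⟨e, he, -⟩ := h' d hd
    refine le_antisymm (csInf_le_csInf hs ⟨e, he⟩ h) (le_csInf ⟨d, hd⟩ fun x hx => ?_)
    obtain ⟨y, hy, hyx⟩ := h' x hx
    exact (csInf_le (hs.mono h) hy).trans hyx

/-- Theorem "Thm_PottsOverlap": for all `q ≥ 2` and `β > 0`, the
condensation threshold of the Potts antiferromagnet equals the threshold for overlap
concentration:
`d_cond(q,β) = inf{d > 0 : limsup_n E⟨‖ρ_{σ_1,σ_2} - ρ̄‖_TV⟩_{𝔾(n,d/n),q,β} > 0}`. -/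
theorem stmt18 (q : ℕ) (hq : 2 ≤ q) (β : ℝ) (hβ : 0 < β) :
    dcond q β =
      sInf {d : ℝ | 0 < d ∧
        0 < Filter.limsup (fun n : ℕ => expOverlap q β d n) Filter.atTop} := by
  have : NeZero q := ⟨by omega⟩
  refine sInf_eq_of_subset_of_exists_le ?_ ⟨0, fun d hd => hd.1.le⟩ ?_
  · rintro d ⟨hd, hlim⟩
    refine ⟨hd, ?_⟩
    by_contra hcon
    push Not at hcon
    refine hlim.ne' (limsup_expOverlap_eq_zero hβ hd fun J _ P hP => ?_)
    obtain ⟨π, hπ, hB⟩ := exists_memP2star_of_finLaw hβ d hP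
    have := hcon π hπ
    rw [hB] at this
    exact le_of_add_le_add_right this
  · rintro d ⟨hd, π, hπ, hB⟩
    by_contra hcon
    push Not at hcon
    obtain ⟨J, _, P, hP, hlt⟩ := exists_balanced_of_BPotts_gt hβ hd.le hπ hB
    refine hlt.not_ge (bethe_le_log_of_expOverlap_tendsto hq hβ hd.le (fun t ht => ?_) hP)
    refine limsup_expOverlap_le_zero hβ ht.1.le (not_lt.1 fun hpos => ?_)
    exact (hcon t ⟨ht.1, hpos⟩).not_ge ht.2
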